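/- Let b > 0 be an odd integer, let 0 < δ < 1/3 be a constant, and let k : ℕ → ℕ be any function. Set N' = N / 2^{k(N)}, y = N'^{1/3}, z = N'^δ, and C_δ = ∫_δ^{1/3} log(2 − 3β) / (β(1 − β)) dβ. Then there exist constants C > 0 and M₀ such that for all N with N' ≥ M₀, S(B, 𝒫, y) ≤ (4δ·e^γ·C_δ + C·(log N')^{−1/6}) · N' · V(z) / log N', where S(B, 𝒫, y) is the number of triples of primes (p₁, p₂, p₃) with z ≤ p₁ < y ≤ p₂ ≤ p₃ and p₁p₂p₃ ≤ N' such that no odd prime q < y with q ∤ b divides 2^{k(N)}·p₁p₂p₃ + b. -/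

import Mathlib

open scoped Classical in
/-- `V b z = ∏_{q < z, q prime, q ∤ 2b} (1 - 1/(q-1))`. -/
noncomputable def V (b : ℕ) (z : ℝ) : ℝ :=
  ∏ q ∈ (Finset.range (Nat.ceil z + 1)).filter
      (fun q : ℕ => q.Prime ∧ (q : ℝ) < z ∧ ¬ q ∣ 2 * b),
    (1 - 1 / ((q : ℝ) - 1))

/-- `SB b kN N' y z` counts triples of primes `(p₁, p₂, p₃)` with
`z ≤ p₁ < y ≤ p₂ ≤ p₃` and `p₁p₂p₃ ≤ N'` such that no odd prime `q < y` with `q ∤ b`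
divides `2^kN * p₁p₂p₃ + b`. -/
noncomputable def SB (b kN : ℕ) (N' y z : ℝ) : ℕ :=
  {t : ℕ × ℕ × ℕ | t.1.Prime ∧ t.2.1.Prime ∧ t.2.2.Prime ∧
    z ≤ (t.1 : ℝ) ∧ (t.1 : ℝ) < y ∧ y ≤ (t.2.1 : ℝ) ∧ t.2.1 ≤ t.2.2 ∧
    ((t.1 * t.2.1 * t.2.2 : ℕ) : ℝ) ≤ N' ∧
    ∀ q : ℕ, q.Prime → Odd q → (q : ℝ) < y → ¬ q ∣ b →
      ¬ q ∣ (2 ^ kN * (t.1 * t.2.1 * t.2.2) + b)}.ncard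

namespace Chen
noncomputable section
open Finset
open Real (log exp norm_eq_abs hasDerivAt_log continuousAt_log log_pos log_exp log_le_log exp_pos rpow_def_of_pos exp_add add_one_le_exp exp_nat_mul exp_le_exp log_nonneg rpow_add rpow_neg_one le_log_iff_exp_le log_natCast_nonneg rpow_natCast one_le_exp exp_one_lt_d9 log_mul log_pow rpow_mul norm_of_nonneg sqrt_nonneg log_le_sub_one_of_pos le_sqrt_of_sq_le sqrt_le_iff mul_self_sqrt one_le_sqrt sqrt_mul sqrt_sq log_le_iff_le_exp eulerMascheroniConstant exp_log log_div)

def cf (g : ℕ → ℝ) (D : Finset (Finset ℕ)) (r : Finset ℕ) : ℝ :=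
  ∑ A ∈ D, ∑ B ∈ D, ∑ v ∈ (A ∩ B).powerset,
    if symmDiff A B ∪ v = r then (∏ p ∈ (A ∩ B) \ v, g p) * ∏ p ∈ v, (g p - 1) else 0

lemma prod_mul_prod_expand (g e : ℕ → ℝ) (A B : Finset ℕ)
    (he : ∀ p ∈ A, e p ^ 2 = g p + (g p - 1) * e p) :
    (∏ p ∈ A, e p) * ∏ p ∈ B, e p =
      ∑ v ∈ (A ∩ B).powerset,
        ((∏ p ∈ (A ∩ B) \ v, g p) * ∏ p ∈ v, (g p - 1)) * ∏ p ∈ symmDiff A B ∪ v, e p := by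
  have h1 : (∏ p ∈ A, e p) * ∏ p ∈ B, e p
      = (∏ p ∈ symmDiff A B, e p) * ∏ p ∈ A ∩ B, (g p + (g p - 1) * e p) := by
    have ha : (∏ p ∈ A, e p) = (∏ p ∈ A \ B, e p) * ∏ p ∈ A ∩ B, e p := by rw [mul_comm, prod_inter_mul_prod_sdiff]
    have hb : (∏ p ∈ B, e p) = (∏ p ∈ B \ A, e p) * ∏ p ∈ A ∩ B, e p := by
      rw [mul_comm, inter_comm, prod_inter_mul_prod_sdiff]
    have hs : (∏ p ∈ symmDiff A B, e p) = (∏ p ∈ A \ B, e p) * ∏ p ∈ B \ A, e p := by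
      have : symmDiff A B = (A \ B) ∪ (B \ A) := by ext; simp [mem_symmDiff]
      rw [this, prod_union]
      exact disjoint_sdiff_sdiff
    have hc : ∏ p ∈ A ∩ B, (g p + (g p - 1) * e p) = (∏ p ∈ A ∩ B, e p) * ∏ p ∈ A ∩ B, e p := by
      rw [← prod_mul_distrib]
      refine prod_congr rfl fun p hp => ?_
      rw [← he p (mem_inter.1 hp).1]; ring
    rw [ha, hb, hs, hc]; ring
  rw [h1]
  have h2 : ∏ p ∈ A ∩ B, (g p + (g p - 1) * e p)
      = ∑ v ∈ (A ∩ B).powerset, (∏ p ∈ v, ((g p - 1) * e p)) * ∏ p ∈ (A ∩ B) \ v, g p := by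
    rw [← prod_add]
    exact prod_congr rfl fun p _ => by ring
  rw [h2, mul_sum]
  refine sum_congr rfl fun v hv => ?_
  have hd : Disjoint (symmDiff A B) v := by
    rw [disjoint_left]
    intro p hp hpv
    have := mem_powerset.1 hv hpv
    simp [mem_symmDiff] at hp this
    tauto
  rw [prod_union hd, prod_mul_distrib]; ring

lemma sq_expand (g : ℕ → ℝ) (P : Finset ℕ) (D : Finset (Finset ℕ)) (hD : ∀ A ∈ D, A ⊆ P)
    (e : ℕ → ℝ) (he : ∀ p ∈ P, e p ^ 2 = g p + (g p - 1) * e p) :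
    (∑ A ∈ D, ∏ p ∈ A, e p) ^ 2 = ∑ r ∈ P.powerset, cf g D r * ∏ p ∈ r, e p := by
  have : ∀ r ∈ P.powerset, cf g D r * ∏ p ∈ r, e p =
     ∑ A ∈ D, ∑ B ∈ D, ∑ v ∈ (A ∩ B).powerset,
      if symmDiff A B ∪ v = r then
      ((∏ p ∈ (A ∩ B) \ v, g p) * ∏ p ∈ v, (g p - 1)) * ∏ p ∈ symmDiff A B ∪ v, e p else 0 := by
    intro r _
    unfold cf
    simp only [sum_mul]
    refine sum_congr rfl fun A _ => sum_congr rfl fun B _ => sum_congr rfl fun v _ => ?_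
    split_ifs with h
    · rw [h]
    · simp
  rw [sum_congr rfl this, sum_comm, sq, sum_mul_sum]
  refine sum_congr rfl fun A hA => ?_
  rw [sum_comm]
  refine sum_congr rfl fun B hB => ?_
  rw [sum_comm, prod_mul_prod_expand g e A B (fun p hp => he p (hD A hA hp))]
  refine sum_congr rfl fun v hv => ?_
  rw [sum_ite_eq, if_pos]
  rw [mem_powerset]
  intro p hp
  have h1 := hD A hA
  have h2 := hD B hB
  have h3 := mem_powerset.1 hv
  rw [mem_union, mem_symmDiff] at hp
  rcases hp with (hp | hp) | hp
  · exact h1 hp.1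
  · exact h2 hp.1
  · exact h1 (mem_inter.1 (h3 hp)).1

lemma cf_empty (g : ℕ → ℝ) (D : Finset (Finset ℕ)) :
    cf g D ∅ = ∑ A ∈ D, ∏ p ∈ A, g p := by
  unfold cf
  refine sum_congr rfl fun A hA => ?_
  rw [sum_eq_single A]
  · rw [sum_eq_single ∅]
    · simp
    · intro v _ hv
      rw [if_neg]
      simpa using hv
    · simp
  · intro B _ hB
    refine sum_eq_zero fun v _ => ?_
    rw [if_neg]
    intro h
    rw [union_eq_empty] at h
    exact hB (symmDiff_eq_bot.1 h.1).symm
  · intro h; exact absurd hA h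

lemma cf_ne_zero (g : ℕ → ℝ) (D : Finset (Finset ℕ)) (r : Finset ℕ) (h : cf g D r ≠ 0) :
    ∃ A ∈ D, ∃ B ∈ D, r ⊆ A ∪ B := by
  unfold cf at h
  obtain ⟨A, hA, h⟩ := exists_ne_zero_of_sum_ne_zero h
  obtain ⟨B, hB, h⟩ := exists_ne_zero_of_sum_ne_zero h
  obtain ⟨v, hv, h⟩ := exists_ne_zero_of_sum_ne_zero h
  refine ⟨A, hA, B, hB, ?_⟩
  by_cases h1 : symmDiff A B ∪ v = r
  · rw [← h1]
    intro p hp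
    have h3 := mem_powerset.1 hv
    rw [mem_union, mem_symmDiff] at hp
    rw [mem_union]
    rcases hp with (hp | hp) | hp
    · exact Or.inl hp.1
    · exact Or.inr hp.1
    · exact Or.inl (mem_inter.1 (h3 hp)).1
  · rw [if_neg h1] at h; exact absurd rfl h

set_option maxHeartbeats 800000 in
lemma cf_abs_le (g : ℕ → ℝ) (P : Finset ℕ) (D : Finset (Finset ℕ)) (hD : ∀ A ∈ D, A ⊆ P)
    (hdown : ∀ A ∈ D, ∀ B ⊆ A, B ∈ D) (hg : ∀ p ∈ P, 0 ≤ g p ∧ g p ≤ 1) (r : Finset ℕ) :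
    |cf g D r| ≤ 3 ^ r.card * ∑ A ∈ D, ∏ p ∈ A, g p := by
  classical
  have hgn : ∀ A ∈ D, 0 ≤ ∏ p ∈ A, g p := fun A hA =>
    prod_nonneg fun p hp => (hg p (hD A hA hp)).1
  set S := ((D ×ˢ D) ×ˢ P.powerset).filter
    (fun t => t.2 ⊆ t.1.1 ∩ t.1.2 ∧ symmDiff t.1.1 t.1.2 ∪ t.2 = r) with hS
  have h1 : |cf g D r| ≤ ∑ t ∈ S, ∏ p ∈ (t.1.1 ∩ t.1.2) \ t.2, g p := by
    rw [hS, sum_filter, sum_product, sum_product]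
    unfold cf
    refine (abs_sum_le_sum_abs _ _).trans (sum_le_sum fun A hA => ?_)
    refine (abs_sum_le_sum_abs _ _).trans (sum_le_sum fun B hB => ?_)
    refine (abs_sum_le_sum_abs _ _).trans ?_
    have hsub : (A ∩ B).powerset ⊆ P.powerset := by
      intro v hv
      rw [mem_powerset] at *
      exact hv.trans (inter_subset_left.trans (hD A hA))
    have hnn : ∀ v : Finset ℕ, 0 ≤ ∏ p ∈ (A ∩ B) \ v, g p := fun v =>
      prod_nonneg fun p hp => (hg p (hD A hA (mem_inter.1 (mem_sdiff.1 hp).1).1)).1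
    refine le_trans ?_ (sum_le_sum_of_subset_of_nonneg hsub ?_)
    · refine sum_le_sum fun v hv => ?_
      have hv' := mem_powerset.1 hv
      simp only [hv', true_and]
      split_ifs with h
      · rw [abs_mul, abs_of_nonneg (hnn v)]
        refine mul_le_of_le_one_right (hnn v) ?_
        rw [abs_prod]
        refine prod_le_one (fun _ _ => abs_nonneg _) fun p hp => ?_
        have := hg p (hD A hA (mem_inter.1 (hv' hp)).1)
        rw [abs_le]; constructor <;> linarith
      · simp
    · intro v _ _
      dsimp only
      split_ifs
      · exact hnn v
      · exact le_rfl
  set ι : (Finset ℕ × Finset ℕ) × Finset ℕ → (Finset ℕ × Finset ℕ) × Finset ℕ :=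
    fun t => ((t.2, t.1.1 \ t.1.2), (t.1.1 ∩ t.1.2) \ t.2) with hι
  set U := (r.powerset ×ˢ r.powerset).filter (fun t => t.2 ⊆ r \ t.1) with hU
  have hmaps : ∀ t ∈ S, ι t ∈ U ×ˢ D := by
    rintro ⟨⟨A, B⟩, v⟩ ht
    simp only [hS, mem_filter, mem_product, mem_powerset] at ht
    obtain ⟨⟨⟨hA, hB⟩, -⟩, hv, hr⟩ := ht
    simp only [hι, hU, mem_filter, mem_product, mem_powerset]
    refine ⟨⟨⟨?_, ?_⟩, ?_⟩, ?_⟩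
    · rw [← hr]; exact subset_union_right
    · rw [← hr]; intro p hp; rw [mem_union, mem_symmDiff]; rw [mem_sdiff] at hp; tauto
    · rw [← hr]; intro p hp
      rw [mem_sdiff, mem_union, mem_symmDiff]; rw [mem_sdiff] at hp
      refine ⟨by tauto, fun h => hp.2 (mem_inter.1 (hv h)).2⟩
    · exact hdown A hA _ (sdiff_subset.trans inter_subset_left)
  have hinj : Set.InjOn ι S := by
    rintro ⟨⟨A, B⟩, v⟩ ht ⟨⟨A', B'⟩, v'⟩ ht' h
    simp only [hS, coe_filter, Set.mem_ofPred_eq, mem_product, mem_powerset] at ht ht'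
    simp only [hι, Prod.mk.injEq] at h
    obtain ⟨-, hv, hr⟩ := ht
    obtain ⟨-, hv', hr'⟩ := ht'
    obtain ⟨⟨rfl, h2⟩, h3⟩ := h
    rw [← hr'] at hr
    have key : ∀ p, (p ∈ A ↔ p ∈ A') ∧ (p ∈ B ↔ p ∈ B') := by
      intro p
      have e1 : p ∈ A \ B ↔ p ∈ A' \ B' := by rw [h2]
      have e2 : p ∈ (A ∩ B) \ v ↔ p ∈ (A' ∩ B') \ v := by rw [h3]
      have e3 : p ∈ symmDiff A B ∪ v ↔ p ∈ symmDiff A' B' ∪ v := by rw [hr]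
      have e4 := @hv p
      have e5 := @hv' p
      simp only [mem_sdiff, mem_inter, mem_union, mem_symmDiff] at e1 e2 e3 e4 e5
      clear * - e1 e2 e3 e4 e5
      grind
    simp only [Prod.mk.injEq, and_true]
    exact ⟨by ext p; exact (key p).1, by ext p; exact (key p).2⟩
  have h2 : ∑ t ∈ S, ∏ p ∈ (t.1.1 ∩ t.1.2) \ t.2, g p ≤ ∑ t ∈ U ×ˢ D, ∏ p ∈ t.2, g p := by
    have : ∑ t ∈ S, ∏ p ∈ (t.1.1 ∩ t.1.2) \ t.2, g p = ∑ t ∈ S.image ι, ∏ p ∈ t.2, g p := by rw [sum_image hinj]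
    rw [this]
    refine sum_le_sum_of_subset_of_nonneg ?_ ?_
    · intro t ht
      obtain ⟨s, hs, rfl⟩ := mem_image.1 ht
      exact hmaps s hs
    · intro t ht _
      exact hgn _ (mem_product.1 ht).2
  have h3 : (U.card : ℝ) = 3 ^ r.card := by
    have : U.card = ∑ v ∈ r.powerset, 2 ^ (r.card - v.card) := by
      rw [hU, card_filter, sum_product]
      refine sum_congr rfl fun v hv => ?_
      rw [← card_filter]
      have : (r.powerset).filter (fun x => x ⊆ r \ v) = (r \ v).powerset := by
        ext s; simp only [mem_filter, mem_powerset]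
        exact ⟨fun h => h.2, fun h => ⟨h.trans sdiff_subset, h⟩⟩
      rw [this, card_powerset, card_sdiff_of_subset (mem_powerset.1 hv)]
    rw [this]
    have h4 := sum_pow_mul_eq_add_pow (1 : ℕ) 2 r
    simp only [one_pow, one_mul] at h4
    rw [h4]; norm_num
  calc |cf g D r| ≤ _ := h1.trans h2
    _ = _ := by rw [sum_product]; dsimp only; rw [sum_const, nsmul_eq_mul, h3]

/-- primitive characters mod `r` -/
def prims (r : ℕ) : Finset (DirichletCharacter ℂ r) :=
  (Set.toFinite {χ : DirichletCharacter ℂ r | χ.IsPrimitive}).toFinset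

lemma mem_prims {r : ℕ} {χ : DirichletCharacter ℂ r} : χ ∈ prims r ↔ χ.IsPrimitive := by simp [prims]

lemma sum_all_eq (d : ℕ) [NeZero d] (a c : ℤ) (hc : IsCoprime c (d : ℤ)) :
    ∑ χ : DirichletCharacter ℂ d, χ (a : ZMod d) * star (χ (c : ZMod d)) =
      if (d : ℤ) ∣ a - c then (d.totient : ℂ) else 0 := by
  have hu : IsUnit (c : ZMod d) := by
    have := (ZMod.isUnit_iff_coprime c.natAbs d).2 (by
      have := Int.isCoprime_iff_gcd_eq_one.1 hc
      simpa [Nat.Coprime, Int.gcd] using this)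
    rcases Int.natAbs_eq c with h | h
    · rw [h]; push_cast; simpa using this
    · rw [h]; push_cast; simpa using this
  have h1 := DirichletCharacter.sum_char_inv_mul_char_eq ℂ hu (a : ZMod d)
  have h2 : (((c : ZMod d) = (a : ZMod d)) ↔ (d : ℤ) ∣ a - c) := by rw [ZMod.intCast_eq_intCast_iff, Int.modEq_iff_dvd]
  simp only [h2] at h1
  rw [← h1]
  refine sum_congr rfl fun χ _ => ?_
  have h3 : star (χ (c : ZMod d)) = χ (c : ZMod d)⁻¹ := by
    obtain ⟨u, hu'⟩ := hu
    rw [MulChar.star_apply', MulChar.inv_apply, ← hu', Ring.inverse_unit, ZMod.inv_coe_unit]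
  rw [h3, mul_comm]

lemma sum_all_fiber (r : Finset ℕ) (hr : ∀ p ∈ r, p.Prime) (a c : ℤ)
    (ha : ∀ p ∈ r, IsCoprime a (p : ℤ)) (hc : ∀ p ∈ r, IsCoprime c (p : ℤ))
    [NeZero (∏ p ∈ r, p)] :
    ∑ χ : DirichletCharacter ℂ (∏ p ∈ r, p), χ (a : ZMod _) * star (χ (c : ZMod _)) =
      ∑ t ∈ r.powerset, ∑ χ ∈ prims (∏ p ∈ t, p), χ (a : ZMod _) * star (χ (c : ZMod _)) := by
  classical
  have hsq : Squarefree (∏ p ∈ r, p) := by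
    refine squarefree_prod_of_pairwise_isCoprime ?_ ?_
    · intro p hp q hq hpq
      exact Nat.coprime_iff_isRelPrime.1 ((Nat.coprime_primes (hr p hp) (hr q hq)).2 hpq)
    · intro p hp; exact (hr p hp).prime.squarefree
  have hac : IsCoprime a ((∏ p ∈ r, p : ℕ) : ℤ) := by push_cast; exact IsCoprime.prod_right ha
  have hcc : IsCoprime c ((∏ p ∈ r, p : ℕ) : ℤ) := by push_cast; exact IsCoprime.prod_right hc
  have hmap : ∀ χ ∈ (univ : Finset (DirichletCharacter ℂ (∏ p ∈ r, p))),
      χ.conductor.primeFactors ∈ r.powerset := by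
    intro χ _
    rw [mem_powerset]
    calc χ.conductor.primeFactors ⊆ (∏ p ∈ r, p).primeFactors :=
          Nat.primeFactors_mono χ.conductor_dvd_level hsq.ne_zero
      _ = r := Nat.primeFactors_prod hr
  rw [← sum_fiberwise_of_maps_to hmap]
  refine sum_congr rfl fun t ht => ?_
  have htr := mem_powerset.1 ht
  have hdvd : (∏ p ∈ t, p) ∣ (∏ p ∈ r, p) := prod_dvd_prod_of_subset _ _ _ htr
  symm
  refine sum_bij (fun χ _ => DirichletCharacter.changeLevel hdvd χ) ?_ ?_ ?_ ?_
  · intro χ hχ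
    rw [mem_prims] at hχ
    simp only [mem_filter, mem_univ, true_and]
    rw [DirichletCharacter.conductor_changeLevel, (DirichletCharacter.isPrimitive_def _).1 hχ,
      Nat.primeFactors_prod fun p hp => hr p (htr hp)]
  · intro χ _ ψ _ h
    exact DirichletCharacter.changeLevel_injective hdvd h
  · intro χ hχ
    simp only [mem_filter, mem_univ, true_and] at hχ
    have h1 : χ.conductor = ∏ p ∈ t, p := by
      rw [← hχ, Nat.prod_primeFactors_of_squarefree]
      exact hsq.squarefree_of_dvd χ.conductor_dvd_level
    have h2 := χ.factorsThrough_conductor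
    rw [h1] at h2
    refine ⟨h2.χ₀, ?_, h2.eq_changeLevel.symm⟩
    rw [mem_prims, DirichletCharacter.isPrimitive_def]
    have h3 := DirichletCharacter.conductor_changeLevel h2.χ₀ hdvd
    rw [← h2.eq_changeLevel, h1] at h3
    exact h3.symm
  · intro χ _
    rw [DirichletCharacter.changeLevel_eq_cast_of_dvd' χ hdvd hac,
      DirichletCharacter.changeLevel_eq_cast_of_dvd' χ hdvd hcc]

lemma prim_sum_eq (r : Finset ℕ) (hr : ∀ p ∈ r, p.Prime) (a c : ℤ)
    (ha : ∀ p ∈ r, IsCoprime a (p : ℤ)) (hc : ∀ p ∈ r, IsCoprime c (p : ℤ)) :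
    ∑ χ ∈ prims (∏ p ∈ r, p), χ (a : ZMod _) * star (χ (c : ZMod _)) =
      ∏ p ∈ r, ((if (p : ℤ) ∣ a - c then ((p : ℂ) - 1) else 0) - 1) := by
  classical
  induction r using strongInduction with
  | H r ih =>
  have : NeZero (∏ p ∈ r, p) := ⟨prod_ne_zero_iff.2 fun p hp => (hr p hp).ne_zero⟩
  have h1 := sum_all_fiber r hr a c ha hc
  have hcc : IsCoprime c ((∏ p ∈ r, p : ℕ) : ℤ) := by push_cast; exact IsCoprime.prod_right hc
  rw [sum_all_eq _ a c hcc] at h1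
  have h2 : (if ((∏ p ∈ r, p : ℕ) : ℤ) ∣ a - c then ((∏ p ∈ r, p).totient : ℂ) else 0)
      = ∏ p ∈ r, (((if (p : ℤ) ∣ a - c then ((p : ℂ) - 1) else 0) - 1) + 1) := by
    have hcop : (r : Set ℕ).Pairwise (Function.onFun IsCoprime fun p : ℕ => (p : ℤ)) := by
      intro p hp q hq hpq
      exact Nat.isCoprime_iff_coprime.2 ((Nat.coprime_primes (hr p hp) (hr q hq)).2 hpq)
    split_ifs with h
    · have h3 : ∀ p ∈ r, (p : ℤ) ∣ a - c := fun p hp =>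
        (Int.natCast_dvd_natCast.2 (dvd_prod_of_mem (fun p => p) hp)).trans h
      have h4 : (∏ p ∈ r, p).totient = ∏ p ∈ r, (p - 1) := by
        rw [Nat.totient_eq_div_primeFactors_mul, Nat.primeFactors_prod hr, Nat.div_self, one_mul]
        exact prod_pos fun p hp => (hr p hp).pos
      rw [h4, Nat.cast_prod]
      refine prod_congr rfl fun p hp => ?_
      rw [if_pos (h3 p hp), Nat.cast_sub (hr p hp).one_lt.le]; push_cast; ring
    · have : ∃ p ∈ r, ¬ (p : ℤ) ∣ a - c := by
        by_contra! h5
        apply h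
        push_cast
        exact prod_dvd_of_coprime hcop h5
      obtain ⟨p, hp, hpd⟩ := this
      rw [prod_eq_zero hp]
      rw [if_neg hpd]; ring
  rw [h2, prod_add] at h1
  simp only [prod_const_one, mul_one] at h1
  have hmem : r ∈ r.powerset := mem_powerset_self r
  rw [← sum_erase_add _ _ hmem, ← sum_erase_add _ _ hmem] at h1
  have h3 : ∑ t ∈ r.powerset.erase r, ∏ p ∈ t, ((if (p : ℤ) ∣ a - c then ((p : ℂ) - 1) else 0) - 1)
     = ∑ t ∈ r.powerset.erase r, ∑ χ ∈ prims (∏ p ∈ t, p),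
        χ (a : ZMod _) * star (χ (c : ZMod _)) := by
    refine sum_congr rfl fun t ht => ?_
    rw [mem_erase, mem_powerset] at ht
    rw [ih t (ht.2.ssubset_of_ne ht.1) (fun p hp => hr p (ht.2 hp))
      (fun p hp => ha p (ht.2 hp)) (fun p hp => hc p (ht.2 hp))]
  rw [h3] at h1
  exact (add_left_cancel h1).symm

/-- the sieve local factor -/
def ee (p : ℕ) (m : ℤ) : ℝ := if (p : ℤ) ∣ m then -1 else 1 / ((p : ℝ) - 2)

lemma ee_sq (p : ℕ) (hp : 3 ≤ p) (m : ℤ) :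
    ee p m ^ 2 = 1 / ((p : ℝ) - 2) + (1 / ((p : ℝ) - 2) - 1) * ee p m := by
  unfold ee
  split_ifs
  · ring
  · ring

lemma prod_ee_eq (r : Finset ℕ) (hr : ∀ p ∈ r, p.Prime ∧ 3 ≤ p) (a c : ℤ)
    (ha : ∀ p ∈ r, IsCoprime a (p : ℤ)) (hc : ∀ p ∈ r, IsCoprime c (p : ℤ)) :
    ((∏ p ∈ r, ee p (a - c) : ℝ) : ℂ) = ((∏ p ∈ r, (-(1 / ((p : ℝ) - 2))) : ℝ) : ℂ) *
      ∑ χ ∈ prims (∏ p ∈ r, p), χ (a : ZMod _) * star (χ (c : ZMod _)) := by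
  rw [prim_sum_eq r (fun p hp => (hr p hp).1) a c ha hc]
  push_cast
  rw [← prod_mul_distrib]
  refine prod_congr rfl fun p hp => ?_
  have h3 := (hr p hp).2
  have h4 : (p : ℂ) - 2 ≠ 0 := by
    have : (p : ℝ) - 2 ≠ 0 := by
      have : (3 : ℝ) ≤ p := by exact_mod_cast h3
      linarith
    exact_mod_cast this
  unfold ee
  split_ifs
  · push_cast; field_simp; ring
  · push_cast; field_simp; ring

def sieveFam (P : Finset ℕ) (ξ : ℕ) : Finset (Finset ℕ) :=
  P.powerset.filter fun S => ∏ p ∈ S, p ≤ ξ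

def sieveG (P : Finset ℕ) (ξ : ℕ) : ℝ :=
  ∑ S ∈ sieveFam P ξ, ∏ p ∈ S, 1 / ((p : ℝ) - 2)

def sieveR (P : Finset ℕ) (D : ℕ) : Finset ℕ :=
  (Finset.Ioc 1 D).filter fun r => Squarefree r ∧ r.primeFactors ⊆ P

lemma sieveG_ge_one (P : Finset ℕ) (hP : ∀ p ∈ P, p.Prime ∧ 3 ≤ p) (ξ : ℕ) (hξ : 1 ≤ ξ) :
    1 ≤ sieveG P ξ := by
  have h0 : (∅ : Finset ℕ) ∈ sieveFam P ξ := by simp [sieveFam, hξ]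
  have := single_le_sum (f := fun S : Finset ℕ => ∏ p ∈ S, 1 / ((p : ℝ) - 2)) (s := sieveFam P ξ)
    (fun S hS => prod_nonneg fun p hp => ?_) h0
  · simpa [sieveG] using this
  · have := (hP p (mem_powerset.1 (mem_filter.1 hS).1 hp)).2
    have : (3 : ℝ) ≤ p := by exact_mod_cast this
    apply one_div_nonneg.2; linarith

theorem sieve_bound {ι : Type*} (T : Finset ι) (n : ι → ℕ) (P : Finset ℕ)
    (hP : ∀ p ∈ P, p.Prime ∧ 3 ≤ p) (A B : ℕ) (hA : ∀ p ∈ P, ¬ p ∣ A) (hB : ∀ p ∈ P, ¬ p ∣ B)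
    (hn : ∀ t ∈ T, ∀ p ∈ P, ¬ p ∣ n t) (ξ : ℕ) (hξ : 1 ≤ ξ) :
    ((T.filter fun t => ∀ p ∈ P, ¬ p ∣ A * n t + B).card : ℝ) ≤
      T.card / sieveG P ξ + ∑ r ∈ sieveR P (ξ ^ 2),
        (9 ^ r.primeFactors.card / (r * sieveG P ξ)) *
          ∑ χ ∈ prims r, ‖∑ t ∈ T, χ (n t : ZMod r)‖ := by
  classical
  set G := sieveG P ξ with hG
  have hG1 : 1 ≤ G := sieveG_ge_one P hP ξ hξ
  set D := sieveFam P ξ with hDdef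
  set g : ℕ → ℝ := fun p => 1 / ((p : ℝ) - 2) with hg
  have hgb : ∀ p ∈ P, 0 ≤ g p ∧ g p ≤ 1 := by
    intro p hp
    have : (3 : ℝ) ≤ p := by exact_mod_cast (hP p hp).2
    constructor
    · apply one_div_nonneg.2; linarith
    · rw [hg]; dsimp only; rw [div_le_one] <;> linarith
  have hgb3 : ∀ p ∈ P, g p ≤ 3 / p := by
    intro p hp
    have : (3 : ℝ) ≤ p := by exact_mod_cast (hP p hp).2
    rw [hg]; dsimp only; rw [div_le_div_iff₀] <;> linarith
  have hD : ∀ S ∈ D, S ⊆ P := fun S hS => mem_powerset.1 (mem_filter.1 hS).1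
  have hDle : ∀ S ∈ D, ∏ p ∈ S, p ≤ ξ := fun S hS => (mem_filter.1 hS).2
  have hdown : ∀ S ∈ D, ∀ S' ⊆ S, S' ∈ D := by
    intro S hS S' hS'
    rw [hDdef, sieveFam, mem_filter, mem_powerset]
    refine ⟨hS'.trans (hD S hS), le_trans ?_ (hDle S hS)⟩
    exact prod_le_prod_of_subset_of_one_le' hS' fun p hp _ => (hP p (hD S hS hp)).1.one_lt.le
  have hGsum : ∑ S ∈ D, ∏ p ∈ S, g p = G := rfl
  set m : ι → ℤ := fun t => (A * n t : ℤ) - (-(B : ℤ)) with hm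
  set θ : ι → ℝ := fun t => ∑ S ∈ D, ∏ p ∈ S, ee p (m t) with hθ
  have h1 : ((T.filter fun t => ∀ p ∈ P, ¬ p ∣ A * n t + B).card : ℝ) * G ^ 2 ≤
      ∑ t ∈ T, θ t ^ 2 := by
    rw [← nsmul_eq_mul, ← sum_const]
    refine (sum_le_sum (g := fun t => θ t ^ 2) ?_).trans
      (sum_le_sum_of_subset_of_nonneg (filter_subset _ _) fun t _ _ => sq_nonneg _)
    intro t ht
    apply le_of_eq
    congr 1
    rw [hθ, ← hGsum]
    refine sum_congr rfl fun S hS => prod_congr rfl fun p hp => ?_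
    unfold ee
    rw [if_neg]
    have := (mem_filter.1 ht).2 p (hD S hS hp)
    rw [hm]; intro h; apply this
    have h' : ((p : ℤ)) ∣ ((A * n t + B : ℕ) : ℤ) := by push_cast; simpa using h
    exact_mod_cast h'
  have h2 : ∑ t ∈ T, θ t ^ 2 = ∑ r ∈ P.powerset, cf g D r * ∑ t ∈ T, ∏ p ∈ r, ee p (m t) := by
    simp_rw [mul_sum]
    rw [sum_comm]
    refine sum_congr rfl fun t _ => ?_
    exact sq_expand g P D hD (fun p => ee p (m t)) fun p hp => ee_sq p (hP p hp).2 _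
  have hcop : ∀ p ∈ P, ∀ k : ℕ, ¬ p ∣ k → IsCoprime (k : ℤ) (p : ℤ) := by
    intro p hp k hk
    rw [Nat.isCoprime_iff_coprime, Nat.coprime_comm]
    exact ((hP p hp).1.coprime_iff_not_dvd).2 hk
  have h3 : ∀ r ∈ P.powerset, |∑ t ∈ T, ∏ p ∈ r, ee p (m t)| ≤
      (∏ p ∈ r, g p) * ∑ χ ∈ prims (∏ p ∈ r, p), ‖∑ t ∈ T, χ (n t : ZMod _)‖ := by
    intro r hr
    have hrP := mem_powerset.1 hr
    have h4 : ((∑ t ∈ T, ∏ p ∈ r, ee p (m t) : ℝ) : ℂ) =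
       ((∏ p ∈ r, (-(g p)) : ℝ) : ℂ) * ∑ χ ∈ prims (∏ p ∈ r, p),
        (χ (A : ZMod _) * star (χ ((-(B : ℤ) : ℤ) : ZMod _))) * ∑ t ∈ T, χ (n t : ZMod _) := by
      rw [Complex.ofReal_sum]
      have h5 : ∀ t ∈ T, ((∏ p ∈ r, ee p (m t) : ℝ) : ℂ) = ((∏ p ∈ r, (-(g p)) : ℝ) : ℂ) *
          ∑ χ ∈ prims (∏ p ∈ r, p), (χ (A : ZMod _) * star (χ ((-(B : ℤ) : ℤ) : ZMod _)))
            * χ (n t : ZMod _) := by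
        intro t ht
        rw [hm]; dsimp only
        rw [prod_ee_eq r (fun p hp => hP p (hrP hp))]
        · congr 1
          refine sum_congr rfl fun χ _ => ?_
          push_cast
          rw [map_mul]; ring
        · intro p hp
          exact (hcop p (hrP hp) A (hA p (hrP hp))).mul_left
            (hcop p (hrP hp) _ (hn t ht p (hrP hp)))
        · intro p hp
          exact (hcop p (hrP hp) B (hB p (hrP hp))).neg_left
      rw [sum_congr rfl h5, ← mul_sum, sum_comm]
      simp_rw [mul_sum]
    have h6 : |∑ t ∈ T, ∏ p ∈ r, ee p (m t)| = ‖((∑ t ∈ T, ∏ p ∈ r, ee p (m t) : ℝ) : ℂ)‖ := by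
      rw [Complex.norm_real, norm_eq_abs]
    rw [h6, h4, norm_mul]
    have h7 : ‖((∏ p ∈ r, (-(g p)) : ℝ) : ℂ)‖ = ∏ p ∈ r, g p := by
      rw [Complex.norm_real, norm_eq_abs, abs_prod]
      exact prod_congr rfl fun p hp => by rw [abs_neg, abs_of_nonneg (hgb p (hrP hp)).1]
    rw [h7]
    refine mul_le_mul_of_nonneg_left ?_ (prod_nonneg fun p hp => (hgb p (hrP hp)).1)
    refine (norm_sum_le _ _).trans (sum_le_sum fun χ _ => ?_)
    rw [norm_mul, norm_mul, norm_star]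
    refine mul_le_of_le_one_left (norm_nonneg _) ?_
    exact mul_le_one₀ (DirichletCharacter.norm_le_one _ _) (norm_nonneg _)
      (DirichletCharacter.norm_le_one _ _)
  set E : ℕ → ℝ := fun r => ∑ χ ∈ prims r, ‖∑ t ∈ T, χ (n t : ZMod r)‖ with hE
  have hE0 : ∀ r, 0 ≤ E r := fun r => sum_nonneg fun χ _ => norm_nonneg _
  have hsets : ∑ r ∈ P.powerset, cf g D r * ∑ t ∈ T, ∏ p ∈ r, ee p (m t) ≤
      G * T.card + ∑ r ∈ sieveR P (ξ ^ 2), (9 ^ r.primeFactors.card / r * G) * E r := by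
    rw [← add_sum_erase _ _ (empty_mem_powerset P), cf_empty, hGsum]
    simp only [prod_empty, sum_const, nsmul_eq_mul, mul_one]
    gcongr
    set Q := (P.powerset.erase ∅).filter fun r => cf g D r ≠ 0 with hQ
    have hQ1 : ∑ r ∈ P.powerset.erase ∅, cf g D r * ∑ t ∈ T, ∏ p ∈ r, ee p (m t) =
        ∑ r ∈ Q, cf g D r * ∑ t ∈ T, ∏ p ∈ r, ee p (m t) := by
      rw [hQ, sum_filter]
      refine sum_congr rfl fun r _ => ?_
      split_ifs with h
      · rfl
      · rw [not_not.1 h]; simp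
    rw [hQ1]
    have hQP : ∀ r ∈ Q, r ⊆ P := fun r hr =>
      mem_powerset.1 (mem_of_mem_erase (mem_filter.1 hr).1)
    have hpf : ∀ r ∈ Q, (∏ p ∈ r, p).primeFactors = r := fun r hr =>
      Nat.primeFactors_prod fun p hp => (hP p (hQP r hr hp)).1
    have hinj : Set.InjOn (fun r : Finset ℕ => ∏ p ∈ r, p) Q := by
      intro r hr s hs h
      rw [← hpf r hr, ← hpf s hs]; exact congrArg _ h
    calc ∑ r ∈ Q, cf g D r * ∑ t ∈ T, ∏ p ∈ r, ee p (m t)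
        ≤ ∑ r ∈ Q, (9 ^ (∏ p ∈ r, p).primeFactors.card / ((∏ p ∈ r, p : ℕ) : ℝ) * G)
            * E (∏ p ∈ r, p) := by
          refine sum_le_sum fun r hr => ?_
          have hrP := hQP r hr
          rw [hpf r hr]
          refine (le_abs_self _).trans ?_
          rw [abs_mul]
          have i1 := cf_abs_le g P D hD hdown hgb r
          rw [hGsum] at i1
          have i2 := h3 r (mem_powerset.2 hrP)
          have i3 : ∏ p ∈ r, g p ≤ 3 ^ r.card / ((∏ p ∈ r, p : ℕ) : ℝ) := by
            push_cast
            rw [← prod_const, ← prod_div_distrib]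
            exact prod_le_prod (fun p hp => (hgb p (hrP hp)).1) fun p hp => hgb3 p (hrP hp)
          calc |cf g D r| * |∑ t ∈ T, ∏ p ∈ r, ee p (m t)|
              ≤ (3 ^ r.card * G) * ((3 ^ r.card / ((∏ p ∈ r, p : ℕ) : ℝ)) * E (∏ p ∈ r, p)) := by
                apply mul_le_mul i1 _ (abs_nonneg _) (by positivity)
                exact i2.trans (mul_le_mul_of_nonneg_right i3 (hE0 _))
            _ = _ := by rw [show (9 : ℝ) = 3 * 3 by norm_num, mul_pow]; ring
      _ = ∑ r ∈ Q.image (fun r => ∏ p ∈ r, p), (9 ^ r.primeFactors.card / (r : ℝ) * G) * E r := by rw [sum_image hinj]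
      _ ≤ _ := by
          refine sum_le_sum_of_subset_of_nonneg ?_ fun r _ _ => by
            have := hE0 r
            positivity
          intro d hd
          obtain ⟨r, hr, rfl⟩ := mem_image.1 hd
          have hrP := hQP r hr
          have hne : r ≠ ∅ := ne_of_mem_erase (mem_filter.1 hr).1
          rw [sieveR, mem_filter, mem_Ioc]
          refine ⟨⟨?_, ?_⟩, ?_, ?_⟩
          · obtain ⟨p, hp⟩ := nonempty_iff_ne_empty.2 hne
            refine (hP p (hrP hp)).1.one_lt.trans_le ?_
            exact Nat.le_of_dvd (prod_pos fun q hq => (hP q (hrP hq)).1.pos)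
              (dvd_prod_of_mem (fun p => p) hp)
          · obtain ⟨S, hS, S', hS', hsub⟩ := cf_ne_zero g D r (mem_filter.1 hr).2
            calc ∏ p ∈ r, p ≤ ∏ p ∈ S ∪ S', p := by
                  refine prod_le_prod_of_subset_of_one_le' hsub fun p hp _ => ?_
                  rcases mem_union.1 hp with h | h
                  · exact (hP p (hD S hS h)).1.one_lt.le
                  · exact (hP p (hD S' hS' h)).1.one_lt.le
              _ ≤ (∏ p ∈ S ∪ S', p) * ∏ p ∈ S ∩ S', p := by
                  refine Nat.le_mul_of_pos_right _ (prod_pos fun p hp => ?_)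
                  exact (hP p (hD S hS (mem_inter.1 hp).1)).1.pos
              _ = (∏ p ∈ S, p) * ∏ p ∈ S', p := prod_union_inter
              _ ≤ ξ * ξ := Nat.mul_le_mul (hDle S hS) (hDle S' hS')
              _ = ξ ^ 2 := by ring
          · refine squarefree_prod_of_pairwise_isCoprime ?_ ?_
            · intro p hp q hq hpq
              exact Nat.coprime_iff_isRelPrime.1
                ((Nat.coprime_primes (hP p (hrP hp)).1 (hP q (hrP hq)).1).2 hpq)
            · intro p hp; exact (hP p (hrP hp)).1.prime.squarefree
          · rw [hpf r hr]; exact hrP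
  have hfin := h1.trans (h2.le.trans hsets)
  have hGpos : 0 < G := by linarith
  have : (T.card : ℝ) / G + ∑ r ∈ sieveR P (ξ ^ 2), (9 ^ r.primeFactors.card / (r * G)) * E r
     = (G * T.card + ∑ r ∈ sieveR P (ξ ^ 2), (9 ^ r.primeFactors.card / r * G) * E r) / G ^ 2 := by
    rw [add_div, sum_div]
    congr 1
    · field_simp
    · refine sum_congr rfl fun r _ => ?_
      rw [mul_comm (r : ℝ) G, ← div_div]
      field_simp
  rw [this, le_div_iff₀ (by positivity)]
  exact hfin

open MeasureTheory

lemma gallagher_point (g g' h : ℝ → ℝ) (hg : ∀ x, HasDerivAt g (g' x) x) (hg' : Continuous g')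
    (hh : Continuous h) (δ : ℝ) (hδ : 0 < δ) (hle : ∀ x, (1 / δ) * g x + |g' x| ≤ h x) (α : ℝ) :
    g α ≤ ∫ x in (α - δ / 2)..(α + δ / 2), h x := by
  have hgc : Continuous g := continuous_iff_continuousAt.2 fun x => (hg x).continuousAt
  set u := α - δ / 2 with hu
  set v := α + δ / 2 with hv
  have huv : u < v := by rw [hu, hv]; linarith
  -- point where g ≤ average
  obtain ⟨β, hβ, hβle⟩ : ∃ β ∈ Set.Icc u v, g β * (v - u) ≤ ∫ x in u..v, g x := by
    obtain ⟨β, hβ, hmin⟩ := isCompact_Icc.exists_isMinOn (Set.nonempty_Icc.2 huv.le)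
      hgc.continuousOn
    refine ⟨β, hβ, ?_⟩
    have := intervalIntegral.integral_mono_on (μ := volume) huv.le
      (intervalIntegrable_const (c := g β)) (hgc.intervalIntegrable u v) (fun x hx => hmin hx)
    simpa [mul_comm] using this
  have hFTC : g α - g β = ∫ x in β..α, g' x := by
    rw [intervalIntegral.integral_eq_sub_of_hasDerivAt (fun x _ => hg x)
      (hg'.intervalIntegrable _ _)]
  have h1 : g α - g β ≤ ∫ x in u..v, |g' x| := by
    rw [hFTC]
    refine (le_abs_self _).trans ?_
    rw [← norm_eq_abs]
    refine (intervalIntegral.norm_integral_le_integral_norm_uIoc).trans ?_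
    rw [intervalIntegral.integral_of_le huv.le]
    refine setIntegral_mono_set ?_ ?_ ?_
    · exact ((hg'.norm).integrableOn_Icc).mono_set Set.Ioc_subset_Icc_self
    · exact Filter.Eventually.of_forall fun x => norm_nonneg _
    · refine LE.le.eventuallyLE ?_
      intro x hx
      rw [Set.mem_uIoc] at hx
      rw [Set.mem_Icc] at hβ
      rw [Set.mem_Ioc]
      rcases hx with hx | hx <;> constructor <;> linarith [hβ.1, hβ.2, hx.1, hx.2]
  have h2 : g β ≤ (1 / δ) * ∫ x in u..v, g x := by
    rw [one_div, ← div_eq_inv_mul, le_div_iff₀ hδ]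
    have e : v - u = δ := by rw [hu, hv]; ring
    rwa [e] at hβle
  calc g α ≤ (1 / δ) * (∫ x in u..v, g x) + ∫ x in u..v, |g' x| := by linarith
    _ = ∫ x in u..v, ((1 / δ) * g x + |g' x|) := by
        rw [intervalIntegral.integral_add, intervalIntegral.integral_const_mul]
        · exact (hgc.const_mul _).intervalIntegrable _ _
        · exact hg'.abs.intervalIntegrable _ _
    _ ≤ _ := by
        refine intervalIntegral.integral_mono_on huv.le ?_ (hh.intervalIntegrable _ _)
          fun x _ => hle x
        exact ((hgc.const_mul _).add hg'.abs).intervalIntegrable _ _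

lemma sum_intervals_le {ι : Type*} (s : Finset ι) (α : ι → ℝ) (δ : ℝ) (hδ : 0 < δ)
    (hsp : ∀ i ∈ s, ∀ j ∈ s, i ≠ j → δ ≤ |α i - α j|) (h : ℝ → ℝ) (hh : Continuous h)
    (hpos : ∀ x, 0 ≤ h x) (u v : ℝ) (huv : u ≤ v)
    (hin : ∀ i ∈ s, u ≤ α i - δ / 2 ∧ α i + δ / 2 ≤ v) :
    ∑ i ∈ s, ∫ x in (α i - δ / 2)..(α i + δ / 2), h x ≤ ∫ x in u..v, h x := by
  have e : ∀ i ∈ s, ∫ x in (α i - δ / 2)..(α i + δ / 2), h x =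
      ∫ x in Set.Ioc (α i - δ / 2) (α i + δ / 2), h x := fun i _ =>
    intervalIntegral.integral_of_le (by linarith)
  have hitg : ∀ a b, IntegrableOn h (Set.Ioc a b) := fun a b =>
    (hh.integrableOn_Icc).mono_set Set.Ioc_subset_Icc_self
  rw [sum_congr rfl e, ← integral_biUnion_finset, intervalIntegral.integral_of_le huv]
  · refine setIntegral_mono_set (hitg _ _) (Filter.Eventually.of_forall hpos) ?_
    refine LE.le.eventuallyLE ?_
    intro x hx
    simp only [Set.mem_iUnion, Set.mem_Ioc] at hx
    obtain ⟨i, hi, hx⟩ := hx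
    have := hin i hi
    exact ⟨by linarith, by linarith⟩
  · exact fun i _ => measurableSet_Ioc
  · intro i hi j hj hij
    rw [Function.onFun, Set.disjoint_left]
    intro x hx hx'
    have := hsp i hi j hj hij
    rw [Set.mem_Ioc] at hx hx'
    rcases le_abs.1 this with h | h <;> linarith [hx.1, hx.2, hx'.1, hx'.2]
  · exact fun i _ => hitg _ _

/-- exponential polynomial -/
def ep (c : ℕ → ℂ) (N : ℕ) (x : ℝ) : ℂ :=
  ∑ n ∈ range (N + 1), c n * Complex.exp (2 * Real.pi * Complex.I * n * x)

lemma ep_hasDerivAt (c : ℕ → ℂ) (N : ℕ) (x : ℝ) :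
    HasDerivAt (ep c N) (ep (fun n => c n * (2 * Real.pi * Complex.I * n)) N x) x := by
  unfold ep
  refine HasDerivAt.fun_sum fun n _ => ?_
  have h1 : HasDerivAt (fun x : ℝ => (2 * Real.pi * Complex.I * n * x : ℂ))
      (2 * Real.pi * Complex.I * n) x := by
    simpa using (Complex.ofRealCLM.hasDerivAt (x := x)).const_mul (2 * Real.pi * Complex.I * n : ℂ)
  have h2 := (h1.cexp).const_mul (c n)
  refine h2.congr_deriv ?_
  ring

lemma ep_continuous (c : ℕ → ℂ) (N : ℕ) : Continuous (ep c N) :=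
  continuous_iff_continuousAt.2 fun x => (ep_hasDerivAt c N x).continuousAt

lemma ep_planch (c : ℕ → ℂ) (N : ℕ) (u : ℝ) :
    ∫ x in u..(u + 1), ‖ep c N x‖ ^ 2 = ∑ n ∈ range (N + 1), ‖c n‖ ^ 2 := by
  have h1 : ∀ x : ℝ, ((‖ep c N x‖ ^ 2 : ℝ) : ℂ) = ∑ n ∈ range (N + 1), ∑ m ∈ range (N + 1),
      c n * star (c m) * Complex.exp ((2 * Real.pi * Complex.I * ((n : ℂ) - m)) * x) := by
    intro x
    rw [Complex.ofReal_pow, ← Complex.mul_conj', ep, map_sum, sum_mul_sum]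
    refine sum_congr rfl fun n _ => sum_congr rfl fun m _ => ?_
    rw [map_mul, ← Complex.exp_conj]
    simp only [map_mul, Complex.conj_I, Complex.conj_ofReal, Complex.conj_natCast, map_ofNat]
    rw [mul_mul_mul_comm, ← Complex.exp_add]
    congr 2
    ring
  have h2 : ∀ n m : ℕ, ∫ x in u..(u + 1), c n * star (c m) *
      Complex.exp ((2 * Real.pi * Complex.I * ((n : ℂ) - m)) * x) =
      if n = m then c n * star (c n) else 0 := by
    intro n m
    rw [intervalIntegral.integral_const_mul]
    split_ifs with h
    · subst h; simp
    · have hne : (2 * Real.pi * Complex.I * ((n : ℂ) - m)) ≠ 0 := by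
        have : (n : ℂ) - m ≠ 0 := sub_ne_zero.2 (by exact_mod_cast h)
        have hp : (Real.pi : ℂ) ≠ 0 := by exact_mod_cast Real.pi_ne_zero
        simp [hp, this]
      rw [integral_exp_mul_complex hne]
      have : Complex.exp ((2 * Real.pi * Complex.I * ((n : ℂ) - m)) * ((u + 1 : ℝ) : ℂ)) =
          Complex.exp ((2 * Real.pi * Complex.I * ((n : ℂ) - m)) * (u : ℂ)) := by
        rw [Complex.exp_eq_exp_iff_exists_int]
        refine ⟨(n : ℤ) - m, ?_⟩
        push_cast; ring
      rw [this]; simp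
  have h3 : ((∫ x in u..(u + 1), ‖ep c N x‖ ^ 2 : ℝ) : ℂ) =
      ((∑ n ∈ range (N + 1), ‖c n‖ ^ 2 : ℝ) : ℂ) := by
    rw [← intervalIntegral.integral_ofReal]
    simp_rw [h1]
    have hc : ∀ n m : ℕ, IntervalIntegrable (fun x : ℝ => c n * star (c m) *
      Complex.exp ((2 * Real.pi * Complex.I * ((n : ℂ) - m)) * x)) volume u (u + 1) := fun n m =>
      Continuous.intervalIntegrable (by fun_prop) _ _
    rw [intervalIntegral.integral_finsetSum]
    · rw [Complex.ofReal_sum]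
      refine sum_congr rfl fun n hn => ?_
      rw [intervalIntegral.integral_finsetSum (fun m _ => hc n m)]
      simp_rw [h2]
      rw [sum_ite_eq, if_pos hn, Complex.ofReal_pow, ← Complex.mul_conj']
      rfl
    · intro n _
      exact Continuous.intervalIntegrable (by fun_prop) _ _
  exact_mod_cast h3

lemma additive_ls {ι : Type*} (s : Finset ι) (α : ι → ℝ) (δ : ℝ) (hδ : 0 < δ)
    (hsp : ∀ i ∈ s, ∀ j ∈ s, i ≠ j → δ ≤ |α i - α j|) (hin : ∀ i ∈ s, δ ≤ α i ∧ α i ≤ 1)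
    (N : ℕ) (c : ℕ → ℂ) :
    ∑ i ∈ s, ‖ep c N (α i)‖ ^ 2 ≤ (1 / δ + 13 * (N + 1)) * ∑ n ∈ range (N + 1), ‖c n‖ ^ 2 := by
  set c' : ℕ → ℂ := fun n => c n * (2 * Real.pi * Complex.I * n) with hc'
  set K : ℝ := 2 * Real.pi * (N + 1) with hK
  have hKpos : 0 < K := by positivity
  set h : ℝ → ℝ := fun x => (1 / δ + K) * ‖ep c N x‖ ^ 2 + (1 / K) * ‖ep c' N x‖ ^ 2 with hh
  have hc1 : Continuous fun x => ‖ep c N x‖ ^ 2 := (ep_continuous c N).norm.pow 2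
  have hc2 : Continuous fun x => ‖ep c' N x‖ ^ 2 := (ep_continuous c' N).norm.pow 2
  have hhc : Continuous h := (hc1.const_mul _).add (hc2.const_mul _)
  set g' : ℝ → ℝ := fun x => 2 * (inner ℝ (ep c N x) (ep c' N x)) with hg'
  have hder : ∀ x, HasDerivAt (fun x => ‖ep c N x‖ ^ 2) (g' x) x := fun x => by
    have := (ep_hasDerivAt c N x).norm_sq
    simpa [hg'] using this
  have hg'c : Continuous g' := by
    rw [hg']
    exact continuous_const.mul ((ep_continuous c N).inner (ep_continuous c' N))
  have hle : ∀ x, (1 / δ) * ‖ep c N x‖ ^ 2 + |g' x| ≤ h x := by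
    intro x
    have h1 : |g' x| ≤ 2 * (‖ep c N x‖ * ‖ep c' N x‖) := by
      rw [hg']; dsimp only
      rw [abs_mul, abs_two]
      exact mul_le_mul_of_nonneg_left (abs_real_inner_le_norm _ _) (by norm_num)
    have h2 : 2 * (‖ep c N x‖ * ‖ep c' N x‖) ≤ K * ‖ep c N x‖ ^ 2 + (1 / K) * ‖ep c' N x‖ ^ 2 := by
      have : 0 ≤ (1 / K) * (K * ‖ep c N x‖ - ‖ep c' N x‖) ^ 2 := by positivity
      have e : (1 / K) * (K * ‖ep c N x‖ - ‖ep c' N x‖) ^ 2 = K * ‖ep c N x‖ ^ 2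
        - 2 * (‖ep c N x‖ * ‖ep c' N x‖) + (1 / K) * ‖ep c' N x‖ ^ 2 := by
        field_simp; ring
      linarith
    rw [hh]; dsimp only
    nlinarith
  have hnn : ∀ x, 0 ≤ h x := fun x => by rw [hh]; positivity
  have step : ∑ i ∈ s, ‖ep c N (α i)‖ ^ 2 ≤ ∫ x in (δ / 2)..(δ / 2 + 1), h x := by
    refine (sum_le_sum fun i _ => gallagher_point _ g' h hder hg'c hhc δ hδ hle (α i)).trans ?_
    refine sum_intervals_le s α δ hδ hsp h hhc hnn _ _ (by linarith) fun i hi => ?_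
    have := hin i hi
    constructor <;> linarith
  refine step.trans ?_
  rw [hh]
  rw [intervalIntegral.integral_add ((hc1.const_mul _).intervalIntegrable _ _)
    ((hc2.const_mul _).intervalIntegrable _ _), intervalIntegral.integral_const_mul,
    intervalIntegral.integral_const_mul, ep_planch, ep_planch]
  have h3 : ∑ n ∈ range (N + 1), ‖c' n‖ ^ 2 ≤ K ^ 2 * ∑ n ∈ range (N + 1), ‖c n‖ ^ 2 := by
    rw [mul_sum]
    refine sum_le_sum fun n hn => ?_
    rw [hc']; dsimp only
    rw [norm_mul, mul_pow, mul_comm]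
    refine mul_le_mul_of_nonneg_right ?_ (sq_nonneg _)
    refine pow_le_pow_left₀ (norm_nonneg _) ?_ 2
    have : (n : ℝ) ≤ N + 1 := by exact_mod_cast (mem_range.1 hn).le
    simp only [norm_mul, Complex.norm_I, Complex.norm_natCast, Complex.norm_real, mul_one,
      Complex.norm_ofNat, norm_eq_abs, abs_of_pos Real.pi_pos]
    rw [hK]; gcongr
  set W := ∑ n ∈ range (N + 1), ‖c n‖ ^ 2 with hW
  have hW0 : 0 ≤ W := sum_nonneg fun _ _ => sq_nonneg _
  have h4 : (1 / K) * ∑ n ∈ range (N + 1), ‖c' n‖ ^ 2 ≤ K * W := by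
    calc _ ≤ (1 / K) * (K ^ 2 * W) := by gcongr
      _ = K * W := by field_simp
  have h5 : 2 * K ≤ 13 * (N + 1) := by
    rw [hK]
    have := Real.pi_lt_d2
    have hN : (0 : ℝ) ≤ N := Nat.cast_nonneg N
    nlinarith
  nlinarith

lemma norm_gaussSum_sq (r : ℕ) [NeZero r] (χ : DirichletCharacter ℂ r) (hχ : χ.IsPrimitive) :
    ‖gaussSum χ (ZMod.stdAddChar (N := r))‖ ^ 2 = r := by
  set ψ := ZMod.stdAddChar (N := r) with hψ
  have hprim : ψ.IsPrimitive := ZMod.isPrimitive_stdAddChar r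
  set U : ℂ := ∑ a : ZMod r, χ a * star (χ a) with hU
  have hUne : U ≠ 0 := by
    have : U = ((∑ a : ZMod r, ‖χ a‖ ^ 2 : ℝ) : ℂ) := by
      rw [hU, Complex.ofReal_sum]
      refine sum_congr rfl fun a _ => ?_
      rw [Complex.ofReal_pow, ← Complex.mul_conj']; rfl
    rw [this]
    have h1 : (1 : ℝ) ≤ ∑ a : ZMod r, ‖χ a‖ ^ 2 := by
      have := single_le_sum (f := fun a : ZMod r => ‖χ a‖ ^ 2) (s := univ)
        (fun _ _ => sq_nonneg _) (mem_univ 1)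
      simpa using this
    have h2 : (∑ a : ZMod r, ‖χ a‖ ^ 2) ≠ 0 := by linarith
    exact_mod_cast h2
  have hl : ∑ k : ZMod r, gaussSum χ (ψ.mulShift k) * star (gaussSum χ (ψ.mulShift k)) =
      U * (gaussSum χ ψ * star (gaussSum χ ψ)) := by
    rw [hU, sum_mul]
    refine sum_congr rfl fun k _ => ?_
    rw [gaussSum_mulShift_of_isPrimitive ψ hχ k, star_mul]
    have : χ⁻¹ k = star (χ k) := by rw [MulChar.star_apply']
    rw [this, star_star]; ring
  have hr : ∑ k : ZMod r, gaussSum χ (ψ.mulShift k) * star (gaussSum χ (ψ.mulShift k)) =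
      r * U := by
    have e1 : ∀ k : ZMod r, gaussSum χ (ψ.mulShift k) * star (gaussSum χ (ψ.mulShift k)) =
        ∑ a : ZMod r, ∑ b : ZMod r, χ a * star (χ b) * ψ (k * (a - b)) := by
      intro k
      rw [gaussSum, star_sum, sum_mul_sum]
      refine sum_congr rfl fun a _ => sum_congr rfl fun b _ => ?_
      rw [star_mul, AddChar.mulShift_apply, AddChar.mulShift_apply, sub_eq_add_neg, mul_add,
        mul_neg, AddChar.map_add_eq_mul, AddChar.map_neg_eq_conj]
      simp only [starRingEnd_apply]
      ring
    simp_rw [e1]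
    rw [sum_comm, hU, mul_sum]
    refine sum_congr rfl fun a _ => ?_
    rw [sum_comm]
    simp_rw [← mul_sum, AddChar.sum_mulShift _ hprim, sub_eq_zero, ZMod.card]
    simp [mul_comm]
  rw [hl, mul_comm] at hr
  have h2 := mul_right_cancel₀ hUne hr
  have h3 : gaussSum χ ψ * star (gaussSum χ ψ) = ((‖gaussSum χ ψ‖ ^ 2 : ℝ) : ℂ) := by
    rw [Complex.ofReal_pow, ← Complex.mul_conj']; rfl
  rw [h3] at h2
  exact_mod_cast h2

lemma prim_le_additive (r : ℕ) [NeZero r] (s : Finset ℕ) (c : ℕ → ℂ) :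
    ∑ χ ∈ prims r, ‖∑ n ∈ s, c n * χ (n : ZMod r)‖ ^ 2 ≤
      ∑ a : (ZMod r)ˣ, ‖∑ n ∈ s, c n * ZMod.stdAddChar ((n : ZMod r) * (a : ZMod r))‖ ^ 2 := by
  set ψ := ZMod.stdAddChar (N := r) with hψ
  set S : ZMod r → ℂ := fun a => ∑ n ∈ s, c n * ψ (n * a) with hS
  have hrpos : (0 : ℝ) < r := by exact_mod_cast NeZero.pos r
  have h1 : ∀ χ ∈ prims r, ‖∑ n ∈ s, c n * χ (n : ZMod r)‖ ^ 2 =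
      (1 / r) * ‖∑ a : ZMod r, star (χ a) * S a‖ ^ 2 := by
    intro χ hχ
    rw [mem_prims] at hχ
    have hχ' : (χ⁻¹).IsPrimitive := by
      rw [DirichletCharacter.isPrimitive_def, DirichletCharacter.conductor_inv]; exact hχ
    have e : ∑ a : ZMod r, star (χ a) * S a =
        (∑ n ∈ s, c n * χ (n : ZMod r)) * gaussSum χ⁻¹ ψ := by
      rw [sum_mul]
      simp_rw [hS, mul_sum]
      rw [sum_comm]
      refine sum_congr rfl fun n _ => ?_
      have := gaussSum_mulShift_of_isPrimitive ψ hχ' (n : ZMod r)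
      rw [inv_inv] at this
      rw [mul_assoc, ← this, gaussSum, mul_sum]
      refine sum_congr rfl fun a _ => ?_
      rw [AddChar.mulShift_apply, MulChar.star_apply']
      ring
    rw [e, norm_mul, mul_pow, norm_gaussSum_sq r _ hχ']
    field_simp
  have h2 : ∑ χ : DirichletCharacter ℂ r, ‖∑ a : ZMod r, star (χ a) * S a‖ ^ 2 =
      r.totient * ∑ a : (ZMod r)ˣ, ‖S a‖ ^ 2 := by
    have hunit : ∀ χ : DirichletCharacter ℂ r, ∑ a : ZMod r, star (χ a) * S a =
        ∑ a : (ZMod r)ˣ, star (χ a) * S a := by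
      intro χ
      symm
      refine sum_of_injOn (fun a : (ZMod r)ˣ => (a : ZMod r)) ?_ ?_ ?_ ?_
      · intro a _ b _ h; exact Units.ext h
      · intro a _; simp
      · intro a _ ha
        have : ¬ IsUnit a := by rintro ⟨u, rfl⟩; exact ha ⟨u, by simp, rfl⟩
        rw [MulChar.map_nonunit _ this]; simp
      · intro a _; rfl
    have hC : ((∑ χ : DirichletCharacter ℂ r, ‖∑ a : ZMod r, star (χ a) * S a‖ ^ 2 : ℝ) : ℂ) =
        ((r.totient * ∑ a : (ZMod r)ˣ, ‖S a‖ ^ 2 : ℝ) : ℂ) := by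
      rw [Complex.ofReal_sum]
      have e1 : ∀ χ : DirichletCharacter ℂ r, ((‖∑ a : ZMod r, star (χ a) * S a‖ ^ 2 : ℝ) : ℂ) =
          ∑ a : (ZMod r)ˣ, ∑ b : (ZMod r)ˣ, S a * star (S b) * (χ (a : ZMod r)⁻¹ * χ b) := by
        intro χ
        rw [hunit, Complex.ofReal_pow, ← Complex.mul_conj', map_sum, sum_mul_sum]
        refine sum_congr rfl fun a _ => sum_congr rfl fun b _ => ?_
        have : χ (a : ZMod r)⁻¹ = star (χ a) := by
          rw [MulChar.star_apply', MulChar.inv_apply, Ring.inverse_unit, ZMod.inv_coe_unit]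
        rw [this]
        simp only [starRingEnd_apply, star_mul, star_star]
        ring
      simp_rw [e1]
      rw [sum_comm]
      push_cast
      rw [mul_sum]
      refine sum_congr rfl fun a _ => ?_
      rw [sum_comm]
      simp_rw [← mul_sum]
      simp_rw [DirichletCharacter.sum_char_inv_mul_char_eq ℂ a.isUnit]
      simp only [Units.val_inj, mul_ite, mul_zero]
      rw [sum_ite_eq, if_pos (mem_univ _), mul_comm, ← Complex.mul_conj']
      rfl
    exact_mod_cast hC
  rw [sum_congr rfl h1, ← mul_sum]
  calc (1 / (r : ℝ)) * ∑ χ ∈ prims r, ‖∑ a : ZMod r, star (χ a) * S a‖ ^ 2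
      ≤ (1 / (r : ℝ)) * ∑ χ : DirichletCharacter ℂ r, ‖∑ a : ZMod r, star (χ a) * S a‖ ^ 2 := by
        gcongr
        exact subset_univ _
    _ = (r.totient / r : ℝ) * ∑ a : (ZMod r)ˣ, ‖S a‖ ^ 2 := by rw [h2]; ring
    _ ≤ 1 * ∑ a : (ZMod r)ˣ, ‖S a‖ ^ 2 := by
        gcongr
        rw [div_le_one hrpos]
        exact_mod_cast Nat.totient_le r
    _ = _ := by rw [one_mul]

lemma units_sum_eq (r : ℕ) [NeZero r] (N : ℕ) (c : ℕ → ℂ) :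
    ∑ a : (ZMod r)ˣ, ‖∑ n ∈ range (N + 1), c n * ZMod.stdAddChar ((n : ZMod r) * (a : ZMod r))‖ ^ 2 =
      ∑ a ∈ (Icc 1 r).filter (fun a => a.Coprime r), ‖ep c N ((a : ℝ) / r)‖ ^ 2 := by
  symm
  refine sum_bij' (fun a ha => ZMod.unitOfCoprime a (mem_filter.1 ha).2)
    (fun u _ => if (u : ZMod r).val = 0 then r else (u : ZMod r).val) ?_ ?_ ?_ ?_ ?_
  · intro a ha; exact mem_univ _
  · intro u _
    have hc : (u : ZMod r).val.Coprime r := ZMod.val_coe_unit_coprime u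
    have hlt := ZMod.val_lt (u : ZMod r)
    rw [mem_filter, mem_Icc]
    split_ifs with h
    · rw [h] at hc
      have : r = 1 := by simpa using hc
      subst this; simp
    · exact ⟨⟨Nat.one_le_iff_ne_zero.2 h, hlt.le⟩, hc⟩
  · intro a ha
    rw [mem_filter, mem_Icc] at ha
    simp only [ZMod.coe_unitOfCoprime, ZMod.val_natCast]
    rcases ha.1.2.lt_or_eq with h | h
    · rw [Nat.mod_eq_of_lt h, if_neg (by omega)]
    · rw [h]; simp
  · intro u _
    ext
    simp only [ZMod.coe_unitOfCoprime]
    split_ifs with h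
    · have := ZMod.natCast_zmod_val (u : ZMod r)
      rw [← this, h]; simp
    · exact ZMod.natCast_zmod_val _
  · intro a ha
    congr 2
    rw [ep]
    refine sum_congr rfl fun n _ => ?_
    congr 1
    rw [ZMod.coe_unitOfCoprime]
    have := ZMod.stdAddChar_coe (N := r) ((n * a : ℕ) : ℤ)
    push_cast at this
    rw [this]
    congr 1
    push_cast
    ring

theorem large_sieve (R : Finset ℕ) (δ : ℝ) (hδ : 0 < δ) (hpos : ∀ r ∈ R, 0 < r ∧ δ ≤ 1 / (r : ℝ))
    (hsp : ∀ r ∈ R, ∀ r' ∈ R, ∀ a a' : ℕ, (a : ℝ) / r ≠ a' / r' → δ ≤ |(a : ℝ) / r - a' / r'|)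
    (N : ℕ) (c : ℕ → ℂ) :
    ∑ r ∈ R, ∑ χ ∈ prims r, ‖∑ n ∈ range (N + 1), c n * χ (n : ZMod r)‖ ^ 2 ≤
      (1 / δ + 13 * (N + 1)) * ∑ n ∈ range (N + 1), ‖c n‖ ^ 2 := by
  have h1 : ∑ r ∈ R, ∑ χ ∈ prims r, ‖∑ n ∈ range (N + 1), c n * χ (n : ZMod r)‖ ^ 2 ≤
      ∑ r ∈ R, ∑ a ∈ (Icc 1 r).filter (fun a => a.Coprime r), ‖ep c N ((a : ℝ) / r)‖ ^ 2 := by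
    refine sum_le_sum fun r hr => ?_
    have : NeZero r := ⟨(hpos r hr).1.ne'⟩
    rw [← units_sum_eq]
    exact prim_le_additive r _ c
  refine h1.trans ?_
  rw [sum_sigma']
  refine additive_ls _ (fun i : (_ : ℕ) × ℕ => (i.2 : ℝ) / i.1) δ hδ ?_ ?_ N c
  · rintro ⟨r, a⟩ hi ⟨r', a'⟩ hj hij
    simp only [mem_sigma, mem_filter, mem_Icc] at hi hj
    refine hsp r hi.1 r' hj.1 a a' ?_
    intro h
    apply hij
    have hr := (hpos r hi.1).1
    have hr' := (hpos r' hj.1).1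
    have h2 : a * r' = a' * r := by
      rw [div_eq_div_iff (by positivity) (by positivity)] at h
      exact_mod_cast h
    have h3 : r ∣ r' := by
      refine (Nat.Coprime.dvd_of_dvd_mul_left (m := a) hi.2.2.symm ?_)
      rw [h2]; exact dvd_mul_left _ _
    have h4 : r' ∣ r := by
      refine (Nat.Coprime.dvd_of_dvd_mul_left (m := a') hj.2.2.symm ?_)
      rw [← h2]; exact dvd_mul_left _ _
    have h5 : r = r' := Nat.dvd_antisymm h3 h4
    subst h5
    have h6 : a = a' := Nat.eq_of_mul_eq_mul_right hr h2
    rw [h6]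
  · rintro ⟨r, a⟩ hi
    simp only [mem_sigma, mem_filter, mem_Icc] at hi
    have hr : (0 : ℝ) < r := by exact_mod_cast (hpos r hi.1).1
    have h1 : (1 : ℝ) ≤ a := by exact_mod_cast hi.2.1.1
    have h2 : (a : ℝ) ≤ r := by exact_mod_cast hi.2.1.2
    refine ⟨(hpos r hi.1).2.trans ?_, ?_⟩
    · dsimp only; gcongr
    · dsimp only; rw [div_le_one hr]; exact h2

lemma large_sieve_Q (Q : ℕ) (R : Finset ℕ) (hR : R ⊆ Icc 1 Q) (N : ℕ) (c : ℕ → ℂ) :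
    ∑ r ∈ R, ∑ χ ∈ prims r, ‖∑ n ∈ range (N + 1), c n * χ (n : ZMod r)‖ ^ 2 ≤
      ((Q : ℝ) ^ 2 + 13 * (N + 1)) * ∑ n ∈ range (N + 1), ‖c n‖ ^ 2 := by
  rcases R.eq_empty_or_nonempty with rfl | ⟨r0, hr0⟩
  · simp only [sum_empty]; positivity
  have hQ : 1 ≤ Q := by have := mem_Icc.1 (hR hr0); omega
  have hQ' : (1 : ℝ) ≤ Q := by exact_mod_cast hQ
  have := large_sieve R (1 / (Q : ℝ) ^ 2) (by positivity) ?_ ?_ N c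
  · simpa using this
  · intro r hr
    have h := mem_Icc.1 (hR hr)
    have h1 : (1 : ℝ) ≤ r := by exact_mod_cast h.1
    have h2 : (r : ℝ) ≤ Q := by exact_mod_cast h.2
    refine ⟨by omega, ?_⟩
    gcongr
    nlinarith
  · intro r hr r' hr' a a' hne
    have h := mem_Icc.1 (hR hr)
    have h' := mem_Icc.1 (hR hr')
    have h1 : (1 : ℝ) ≤ r := by exact_mod_cast h.1
    have h2 : (r : ℝ) ≤ Q := by exact_mod_cast h.2
    have h1' : (1 : ℝ) ≤ r' := by exact_mod_cast h'.1
    have h2' : (r' : ℝ) ≤ Q := by exact_mod_cast h'.2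
    have e : (a : ℝ) / r - a' / r' = (((a : ℤ) * r' - r * a' : ℤ) : ℝ) / (r * r') := by
      rw [div_sub_div _ _ (by positivity) (by positivity)]; push_cast; ring
    have hz : ((a : ℤ) * r' - r * a' : ℤ) ≠ 0 := by
      intro h0
      rw [h0] at e
      apply hne
      have : (a : ℝ) / r - a' / r' = 0 := by rw [e]; simp
      linarith
    rw [e, abs_div, abs_of_pos (by positivity : (0 : ℝ) < r * r')]
    have h3 : (1 : ℝ) ≤ |(((a : ℤ) * r' - r * a' : ℤ) : ℝ)| := by exact_mod_cast Int.one_le_abs hz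
    refine div_le_div₀ (abs_nonneg _) h3 (by positivity) ?_
    nlinarith

lemma large_sieve_single (r : ℕ) (hr : 0 < r) (N : ℕ) (c : ℕ → ℂ) :
    ∑ χ ∈ prims r, ‖∑ n ∈ range (N + 1), c n * χ (n : ZMod r)‖ ^ 2 ≤
      ((r : ℝ) + 13 * (N + 1)) * ∑ n ∈ range (N + 1), ‖c n‖ ^ 2 := by
  have hr' : (1 : ℝ) ≤ r := by exact_mod_cast hr
  have := large_sieve {r} (1 / (r : ℝ)) (by positivity) ?_ ?_ N c
  · simpa using this
  · intro s hs; rw [mem_singleton] at hs; subst hs; exact ⟨hr, le_rfl⟩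
  · intro s hs s' hs' a a' hne
    rw [mem_singleton] at hs hs'; subst hs; subst hs'
    have e : (a : ℝ) / s' - a' / s' = (((a : ℤ) - a' : ℤ) : ℝ) / s' := by push_cast; ring
    have hz : ((a : ℤ) - a' : ℤ) ≠ 0 := by
      intro h0
      rw [h0] at e
      apply hne
      have : (a : ℝ) / s' - a' / s' = 0 := by rw [e]; simp
      linarith
    rw [e, abs_div, abs_of_pos (by positivity : (0 : ℝ) < s')]
    have h3 : (1 : ℝ) ≤ |(((a : ℤ) - a' : ℤ) : ℝ)| := by exact_mod_cast Int.one_le_abs hz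
    gcongr

lemma ps {𝕜 : Type*} [RCLike 𝕜] (c : ℕ → 𝕜) (κ : 𝕜) (f f' : ℝ → 𝕜) (a b : ℝ) (ha : 0 ≤ a)
    (hab : a ≤ b) (hf : ∀ t ∈ Set.Icc a b, HasDerivAt f (f' t) t)
    (hf' : ContinuousOn f' (Set.Icc a b)) :
    ∑ k ∈ Ioc ⌊a⌋₊ ⌊b⌋₊, f k * c k = κ * (∫ t in a..b, f t)
      + f b * (∑ k ∈ Icc 0 ⌊b⌋₊, c k - κ * (b : 𝕜)) - f a * (∑ k ∈ Icc 0 ⌊a⌋₊, c k - κ * (a : 𝕜))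
      - ∫ t in a..b, f' t * (∑ k ∈ Icc 0 ⌊t⌋₊, c k - κ * (t : 𝕜)) := by
  have hd : ∀ t ∈ Set.Icc a b, deriv f t = f' t := fun t ht => (hf t ht).deriv
  have hitg : IntegrableOn f' (Set.Icc a b) := hf'.integrableOn_Icc
  have hitg' : IntegrableOn (deriv f) (Set.Icc a b) :=
    hitg.congr_fun (fun t ht => (hd t ht).symm) measurableSet_Icc
  have h1 := sum_mul_eq_sub_sub_integral_mul c ha hab (fun t ht => (hf t ht).differentiableAt) hitg'
  have hI := integrableOn_mul_sum_Icc (m := 0) c ha hitg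
  have hI' : IntervalIntegrable (fun t => f' t * ∑ k ∈ Icc 0 ⌊t⌋₊, c k) volume a b := by
    rw [intervalIntegrable_iff_integrableOn_Icc_of_le hab]; exact hI
  have hfc : ContinuousOn f (Set.Icc a b) := fun t ht => (hf t ht).continuousAt.continuousWithinAt
  have hofr : Continuous (fun t : ℝ => (t : 𝕜)) := RCLike.continuous_ofReal
  have hI2 : IntervalIntegrable (fun t => f' t * (t : 𝕜)) volume a b := by
    apply ContinuousOn.intervalIntegrable_of_Icc hab
    exact hf'.mul hofr.continuousOn
  have hI3 : IntervalIntegrable f volume a b := hfc.intervalIntegrable_of_Icc hab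
  have hparts : f b * (b : 𝕜) - f a * (a : 𝕜) = (∫ t in a..b, f' t * (t : 𝕜)) + ∫ t in a..b, f t := by
    rw [← intervalIntegral.integral_add hI2 hI3]
    rw [intervalIntegral.integral_eq_sub_of_hasDerivAt (f := fun t => f t * (t : 𝕜))]
    · intro t ht
      rw [Set.uIcc_of_le hab] at ht
      have h2 : HasDerivAt (fun t : ℝ => (t : 𝕜)) 1 t := by
        have := (RCLike.ofRealCLM (K := 𝕜)).hasDerivAt (x := t)
        simpa using this
      have := (hf t ht).mul h2
      rw [mul_one] at this
      exact this
    · exact hI2.add hI3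
  rw [h1, ← intervalIntegral.integral_of_le hab]
  have hcg : ∫ t in a..b, deriv f t * ∑ k ∈ Icc 0 ⌊t⌋₊, c k
      = ∫ t in a..b, f' t * ∑ k ∈ Icc 0 ⌊t⌋₊, c k := by
    apply intervalIntegral.integral_congr
    intro t ht
    rw [Set.uIcc_of_le hab] at ht
    simp only [hd t ht]
  rw [hcg]
  have hsub : ∫ t in a..b, f' t * (∑ k ∈ Icc 0 ⌊t⌋₊, c k - κ * (t : 𝕜))
      = (∫ t in a..b, f' t * ∑ k ∈ Icc 0 ⌊t⌋₊, c k) - κ * ∫ t in a..b, f' t * (t : 𝕜) := by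
    rw [← intervalIntegral.integral_const_mul, ← intervalIntegral.integral_sub hI' (hI2.const_mul κ)]
    apply intervalIntegral.integral_congr
    intro t _
    simp only; ring
  rw [hsub]
  linear_combination κ * hparts

lemma ps_bound {𝕜 : Type*} [RCLike 𝕜] (c : ℕ → 𝕜) (κ : 𝕜) (f f' : ℝ → 𝕜) (a b : ℝ) (ha : 0 ≤ a)
    (hab : a ≤ b) (hf : ∀ t ∈ Set.Icc a b, HasDerivAt f (f' t) t)
    (hf' : ContinuousOn f' (Set.Icc a b)) (h : ℝ → ℝ) (hh : IntervalIntegrable h volume a b)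
    (hle : ∀ t ∈ Set.Icc a b, ‖f' t‖ * ‖∑ k ∈ Icc 0 ⌊t⌋₊, c k - κ * (t : 𝕜)‖ ≤ h t) :
    ‖∑ k ∈ Ioc ⌊a⌋₊ ⌊b⌋₊, f k * c k - κ * (∫ t in a..b, f t)‖ ≤
      ‖f b‖ * ‖∑ k ∈ Icc 0 ⌊b⌋₊, c k - κ * (b : 𝕜)‖ + ‖f a‖ * ‖∑ k ∈ Icc 0 ⌊a⌋₊, c k - κ * (a : 𝕜)‖
      + ∫ t in a..b, h t := by
  rw [ps c κ f f' a b ha hab hf hf']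
  have h1 : ‖∫ t in a..b, f' t * (∑ k ∈ Icc 0 ⌊t⌋₊, c k - κ * (t : 𝕜))‖ ≤ ∫ t in a..b, h t := by
    apply intervalIntegral.norm_integral_le_of_norm_le hab _ hh
    filter_upwards with t ht
    rw [norm_mul]
    exact hle t ⟨ht.1.le, ht.2⟩
  rw [← norm_mul, ← norm_mul]
  set A := κ * ∫ t in a..b, f t
  set X1 := f b * (∑ k ∈ Icc 0 ⌊b⌋₊, c k - κ * (b : 𝕜))
  set X2 := f a * (∑ k ∈ Icc 0 ⌊a⌋₊, c k - κ * (a : 𝕜))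
  set X3 := ∫ t in a..b, f' t * (∑ k ∈ Icc 0 ⌊t⌋₊, c k - κ * (t : 𝕜))
  have : A + X1 - X2 - X3 - A = X1 - X2 - X3 := by ring
  rw [this]
  calc ‖X1 - X2 - X3‖ ≤ ‖X1 - X2‖ + ‖X3‖ := norm_sub_le _ _
    _ ≤ ‖X1‖ + ‖X2‖ + ‖X3‖ := by gcongr; exact norm_sub_le _ _
    _ ≤ _ := by gcongr

open Filter Topology

def pw (j : ℕ) (s : ℂ) (u : ℝ) : ℂ := ((log u ^ j : ℝ) : ℂ) * (u : ℂ) ^ (-s)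

def pw' (j : ℕ) (s : ℂ) (u : ℝ) : ℂ :=
  ((j * log u ^ (j - 1) * u⁻¹ : ℝ) : ℂ) * (u : ℂ) ^ (-s)
    + ((log u ^ j : ℝ) : ℂ) * (-s * (u : ℂ) ^ (-s - 1))

lemma cpow_hasDerivAt (s : ℂ) (u : ℝ) (hu : 0 < u) :
    HasDerivAt (fun u : ℝ => (u : ℂ) ^ s) (s * (u : ℂ) ^ (s - 1)) u := by
  have h1 := (hasDerivAt_id (u : ℂ)).cpow_const (c := s) (Complex.ofReal_mem_slitPlane.2 hu)
  have := h1.comp_ofReal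
  simpa using this

lemma pw_hasDerivAt (j : ℕ) (s : ℂ) (u : ℝ) (hu : 0 < u) :
    HasDerivAt (pw j s) (pw' j s u) u := by
  have h1 : HasDerivAt (fun u : ℝ => log u ^ j) (j * log u ^ (j - 1) * u⁻¹) u :=
    (hasDerivAt_log hu.ne').pow j
  exact h1.ofReal_comp.mul (cpow_hasDerivAt (-s) u hu)

lemma pw'_continuousOn (j : ℕ) (s : ℂ) : ContinuousOn (pw' j s) (Set.Ioi 0) := by
  unfold pw'
  intro u hu
  have hu : (0:ℝ) < u := hu
  have h1 : ∀ s : ℂ, ContinuousAt (fun u : ℝ => (u : ℂ) ^ s) u :=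
    fun s => (cpow_hasDerivAt s u hu).continuousAt
  have h2 : ContinuousAt log u := continuousAt_log hu.ne'
  apply ContinuousAt.continuousWithinAt
  refine ContinuousAt.add (ContinuousAt.mul ?_ (h1 _)) (ContinuousAt.mul ?_ (ContinuousAt.mul continuousAt_const (h1 _)))
  · exact Complex.continuous_ofReal.continuousAt.comp
      ((continuousAt_const.mul (h2.pow _)).mul (continuousAt_id.inv₀ hu.ne'))
  · exact Complex.continuous_ofReal.continuousAt.comp (h2.pow _)

lemma norm_cpow_le (s : ℂ) (u : ℝ) (hu : 1 ≤ u) (a : ℝ) (ha : s.re ≤ a) : ‖(u : ℂ) ^ s‖ ≤ u ^ a := by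
  rw [Complex.norm_cpow_eq_rpow_re_of_pos (by linarith)]
  exact Real.rpow_le_rpow_of_exponent_le hu ha

lemma logpow_le (j : ℕ) (X t : ℝ) (hX : exp (2 * j) ≤ X) (hX1 : 1 < X) (ht : X ≤ t) :
    log t ^ j ≤ log X ^ j * (X ^ (-(1/2) : ℝ) * t ^ (1/2 : ℝ)) := by
  have hX0 : 0 < X := by linarith
  have ht0 : 0 < t := by linarith
  have hlX : 0 < log X := log_pos hX1
  have hlX2 : 2 * (j:ℝ) ≤ log X := by rw [← log_exp (2 * j)]; exact log_le_log (exp_pos _) hX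
  set w := log t - log X with hw
  have hw0 : 0 ≤ w := by have := log_le_log hX0 ht; linarith
  have e1 : log t = log X * (1 + w / log X) := by field_simp; linarith
  have e2 : X ^ (-(1/2) : ℝ) * t ^ (1/2 : ℝ) = exp (w / 2) := by
    rw [rpow_def_of_pos hX0, rpow_def_of_pos ht0, ← exp_add]
    congr 1; rw [hw]; ring
  rw [e1, mul_pow, e2]
  gcongr
  calc (1 + w / log X) ^ j ≤ (exp (w / log X)) ^ j := by
        have := add_one_le_exp (w / log X)
        have h0 : 0 ≤ w / log X := by positivity
        gcongr; linarith
    _ = exp (j * (w / log X)) := by rw [← exp_nat_mul]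
    _ ≤ exp (w / 2) := by
        apply exp_le_exp.2
        rw [mul_div_assoc', div_le_div_iff₀ hlX (by norm_num)]
        nlinarith

lemma pw_norm_le (j : ℕ) (s : ℂ) (hs : 1 ≤ s.re) (X t : ℝ) (hX : exp (2 * j) ≤ X)
    (hX1 : 1 < X) (ht : X ≤ t) : ‖pw j s t‖ ≤ log X ^ j / X := by
  have hX0 : 0 < X := by linarith
  have ht0 : 0 < t := by linarith
  have hl : 0 ≤ log t := log_nonneg (by linarith)
  have hlX : 0 ≤ log X := log_nonneg (by linarith)
  unfold pw
  rw [norm_mul, Complex.norm_real, norm_eq_abs, abs_of_nonneg (by positivity)]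
  have h1 := norm_cpow_le (-s) t (by linarith) (-1) (by simpa using hs)
  calc _ ≤ (log X ^ j * (X ^ (-(1/2) : ℝ) * t ^ (1/2 : ℝ))) * t ^ (-1:ℝ) := by
        gcongr; exact logpow_le j X t hX hX1 ht
    _ = log X ^ j * (X ^ (-(1/2) : ℝ) * t ^ (-(1/2) : ℝ)) := by
        have : t ^ (-(1/2) : ℝ) = t ^ (1/2 : ℝ) * t ^ (-1:ℝ) := by rw [← rpow_add ht0]; norm_num
        rw [this]; ring
    _ ≤ log X ^ j * (X ^ (-(1/2) : ℝ) * X ^ (-(1/2) : ℝ)) := by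
        gcongr ?_ * (?_ * ?_)
        exact Real.rpow_le_rpow_of_nonpos hX0 ht (by norm_num)
    _ = log X ^ j / X := by rw [← rpow_add hX0]; norm_num [rpow_neg_one]; rfl

lemma pw'_norm_le (j : ℕ) (s : ℂ) (hs : 1 ≤ s.re) (X t : ℝ) (hX : exp (2 * j) ≤ X)
    (hX1 : exp 1 ≤ X) (ht : X ≤ t) :
    ‖pw' j s t‖ ≤ (j + ‖s‖) * log X ^ j * X ^ (-(1/2) : ℝ) * t ^ (-(3/2) : ℝ) := by
  have he : (1:ℝ) < exp 1 := by simp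
  have hX0 : 0 < X := by linarith
  have ht0 : 0 < t := by linarith
  have hl : 1 ≤ log t := by rw [le_log_iff_exp_le ht0]; linarith
  have hlX : 0 ≤ log X := log_nonneg (by linarith)
  have h1 := norm_cpow_le (-s) t (by linarith) (-1) (by simpa using hs)
  have h2 := norm_cpow_le (-s - 1) t (by linarith) (-2) (by simp; linarith)
  have e1 : t⁻¹ * t ^ (-1:ℝ) = t ^ (-2:ℝ) := by rw [← rpow_neg_one, ← rpow_add ht0]; norm_num
  have e2 : t ^ (-(3/2) : ℝ) = t ^ (1/2 : ℝ) * t ^ (-2:ℝ) := by rw [← rpow_add ht0]; norm_num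
  have hmain : ‖pw' j s t‖ ≤ (j + ‖s‖) * log t ^ j * t ^ (-2:ℝ) := by
    unfold pw'
    refine (norm_add_le _ _).trans ?_
    rw [norm_mul, norm_mul, norm_mul, Complex.norm_real, Complex.norm_real, norm_eq_abs,
      norm_eq_abs, abs_of_nonneg (by positivity), abs_of_nonneg (by positivity), norm_neg]
    have hp : log t ^ (j - 1) ≤ log t ^ j := pow_le_pow_right₀ hl (by omega)
    calc _ ≤ j * log t ^ j * t⁻¹ * t ^ (-1:ℝ) + log t ^ j * (‖s‖ * t ^ (-2:ℝ)) := by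
          gcongr
      _ = _ := by rw [mul_assoc, e1]; ring
  refine hmain.trans ?_
  rw [e2]
  have := logpow_le j X t hX (by linarith) ht
  calc _ ≤ (j + ‖s‖) * (log X ^ j * (X ^ (-(1/2) : ℝ) * t ^ (1/2 : ℝ))) * t ^ (-2:ℝ) := by
        gcongr
    _ = _ := by ring

def Phi (s : ℂ) : ℕ → ℝ → ℂ
  | 0, u => (u : ℂ) ^ (1 - s) / (1 - s)
  | j + 1, u => ((log u ^ (j + 1) : ℝ) : ℂ) * (u : ℂ) ^ (1 - s) / (1 - s)
      - ((j : ℂ) + 1) / (1 - s) * Phi s j u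

lemma Phi_hasDerivAt (s : ℂ) (hs : s ≠ 1) (j : ℕ) (u : ℝ) (hu : 0 < u) :
    HasDerivAt (Phi s j) (pw j s u) u := by
  have h1s : 1 - s ≠ 0 := sub_ne_zero.2 hs.symm
  have hu' : (u : ℂ) ≠ 0 := by exact_mod_cast hu.ne'
  have hc := cpow_hasDerivAt (1 - s) u hu
  rw [show 1 - s - 1 = -s by ring] at hc
  induction j with
  | zero =>
    have := hc.div_const (1 - s)
    simp only [pw, pow_zero, Complex.ofReal_one, one_mul]
    rw [mul_div_cancel_left₀ _ h1s] at this
    exact this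
  | succ j ih =>
    have h1 : HasDerivAt (fun u : ℝ => log u ^ (j + 1)) ((j + 1 : ℕ) * log u ^ j * u⁻¹) u := by
      exact (hasDerivAt_log hu.ne').pow (j + 1)
    have h2 := ((h1.ofReal_comp.mul hc).div_const (1 - s)).sub (ih.const_mul (((j : ℂ) + 1) / (1 - s)))
    refine h2.congr_deriv ?_
    have e : (u : ℂ) ^ (1 - s) = u * (u : ℂ) ^ (-s) := by
      rw [sub_eq_add_neg, Complex.cpow_add _ _ hu', Complex.cpow_one]
    rw [e]
    simp only [pw]
    push_cast
    field_simp
    ring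

lemma Phi_norm_le (s : ℂ) (hs : 1 ≤ s.re) (M : ℝ) (hM : 1 ≤ M) (hM2 : ‖s - 1‖⁻¹ ≤ M) (j : ℕ) (u : ℝ)
    (hu : exp 1 ≤ u) : ‖Phi s j u‖ ≤ (j + 1).factorial * log u ^ j * M ^ (j + 1) := by
  have he : (1:ℝ) < exp 1 := by simp
  have hu0 : 0 < u := by linarith
  have hl : 1 ≤ log u := by rw [le_log_iff_exp_le hu0]; linarith
  have h1 : ‖(u : ℂ) ^ (1 - s)‖ ≤ 1 := by
    have := norm_cpow_le (1 - s) u (by linarith) 0 (by simp; linarith)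
    simpa using this
  have h2 : ‖1 - s‖⁻¹ ≤ M := by rwa [norm_sub_rev]
  induction j with
  | zero =>
    simp only [Phi, div_eq_mul_inv]
    simp
    calc _ ≤ 1 * M := by gcongr
      _ = M := one_mul _
  | succ j ih =>
    simp only [Phi]
    refine (norm_sub_le _ _).trans ?_
    rw [norm_div, norm_mul, norm_mul, norm_div, Complex.norm_real, norm_eq_abs,
      abs_of_nonneg (by positivity)]
    have e3 : ‖(j:ℂ) + 1‖ = (j:ℝ) + 1 := by
      have : ((j:ℂ) + 1) = ((j + 1 : ℕ) : ℂ) := by push_cast; rfl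
      rw [this, Complex.norm_natCast]; push_cast; rfl
    rw [e3, div_eq_mul_inv, div_eq_mul_inv]
    have e4 : (((j + 1 + 1).factorial : ℕ) : ℝ) = ((j:ℝ) + 2) * ((j+1).factorial : ℝ) := by
      rw [Nat.factorial_succ]; push_cast; ring
    have hf : (1:ℝ) ≤ ((j+1).factorial : ℝ) := by exact_mod_cast Nat.one_le_iff_ne_zero.2 (Nat.factorial_ne_zero _)
    have hMp : 1 ≤ M ^ (j+1) := one_le_pow₀ hM
    have hlp : log u ^ j ≤ log u ^ (j+1) := pow_le_pow_right₀ hl (by omega)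
    calc _ ≤ log u ^ (j+1) * 1 * M + (((j:ℝ) + 1) * M) * ((j + 1).factorial * log u ^ j * M ^ (j + 1)) := by
          gcongr
      _ ≤ (1 * log u ^ (j+1) * M ^ (j+1)) * M  + (((j:ℝ) + 1) * M) * ((j + 1).factorial * log u ^ (j+1) * M ^ (j + 1)) := by
          gcongr ?_ * _ + _ * (_ * ?_ * _)
          · rw [one_mul]
            gcongr
      _ ≤ ((j+1).factorial * log u ^ (j+1) * M ^ (j+1)) * M  + (((j:ℝ) + 1) * M) * ((j + 1).factorial * log u ^ (j+1) * M ^ (j + 1)) := by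
          gcongr
      _ = _ := by rw [e4]; ring

lemma Phi_tendsto (s : ℂ) (hs : 1 < s.re) (j : ℕ) :
    Tendsto (fun m : ℕ => Phi s j m) atTop (𝓝 0) := by
  have key : ∀ j : ℕ, Tendsto (fun m : ℕ => ((log (m:ℝ) ^ j : ℝ) : ℂ) * ((m:ℝ) : ℂ) ^ (1 - s) / (1 - s))
      atTop (𝓝 0) := by
    intro j
    rw [tendsto_zero_iff_norm_tendsto_zero]
    have h1 : Tendsto (fun x : ℝ => log x ^ (j:ℝ) / x ^ (s.re - 1)) atTop (𝓝 0) :=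
      (isLittleO_log_rpow_rpow_atTop (j:ℝ) (by linarith : 0 < s.re - 1)).tendsto_div_nhds_zero
    have h2 := (h1.comp tendsto_natCast_atTop_atTop).mul_const (‖1 - s‖⁻¹)
    rw [zero_mul] at h2
    refine h2.congr' ?_
    filter_upwards [eventually_ge_atTop 1] with m hm
    have hm0 : (0:ℝ) < m := by exact_mod_cast hm
    have hl : 0 ≤ log (m:ℝ) := log_natCast_nonneg m
    simp only [Function.comp]
    rw [norm_div, norm_mul, Complex.norm_real, norm_eq_abs, abs_of_nonneg (by positivity),
      Complex.norm_cpow_eq_rpow_re_of_pos hm0, rpow_natCast]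
    rw [show (1 - s).re = -(s.re - 1) by simp, Real.rpow_neg hm0.le]
    rw [div_eq_mul_inv, div_eq_mul_inv]
  induction j with
  | zero => simpa [Phi] using key 0
  | succ j ih =>
    have := (key (j+1)).sub (ih.const_mul (((j : ℂ) + 1) / (1 - s)))
    simpa [Phi] using this

lemma head_le (j : ℕ) (c : ℕ → ℂ) (hc : ∀ n, ‖c n‖ ≤ 1) (s : ℂ) (hs : 1 ≤ s.re) (X : ℝ) (hX : 1 ≤ X) :
    ‖∑ n ∈ Ioc 0 ⌊X⌋₊, pw j s n * c n‖ ≤ log X ^ j * (1 + log X) := by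
  have hlX : 0 ≤ log X := log_nonneg hX
  calc _ ≤ ∑ n ∈ Ioc 0 ⌊X⌋₊, log X ^ j * ((n:ℝ)⁻¹) := by
        refine (norm_sum_le _ _).trans (sum_le_sum fun n hn => ?_)
        have hn1 : 1 ≤ n := by have := (mem_Ioc.1 hn).1; omega
        have hnX : (n:ℝ) ≤ X := (Nat.le_floor_iff (by linarith)).1 (mem_Ioc.1 hn).2
        have hn1' : (1:ℝ) ≤ n := by exact_mod_cast hn1
        have hln : 0 ≤ log n := log_nonneg hn1'
        have h1 := norm_cpow_le (-s) n hn1' (-1) (by simpa using hs)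
        rw [rpow_neg_one] at h1
        unfold pw
        rw [norm_mul, norm_mul, Complex.norm_real, norm_eq_abs, abs_of_nonneg (by positivity)]
        calc _ ≤ log X ^ j * (n:ℝ)⁻¹ * 1 := by
              gcongr
              · exact hc n
          _ = _ := mul_one _
    _ = log X ^ j * ∑ n ∈ Ioc 0 ⌊X⌋₊, ((n:ℝ)⁻¹) := by rw [mul_sum]
    _ ≤ _ := by
        gcongr
        have := harmonic_floor_le_one_add_log X hX
        rw [harmonic_eq_sum_Icc] at this
        push_cast at this
        have e : Ioc 0 ⌊X⌋₊ = Icc 1 ⌊X⌋₊ := by ext n; simp; omega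
        rw [e]; exact this

lemma logPow_eq (c : ℕ → ℂ) (j : ℕ) :
    (fun n : ℕ => ((log n ^ j : ℝ) : ℂ) * c n) = LSeries.logMul^[j] c := by
  induction j with
  | zero => ext n; simp
  | succ j ih =>
    rw [Function.iterate_succ_apply', ← ih]
    ext n
    simp only [LSeries.logMul]
    rw [← Complex.natCast_log, pow_succ]; push_cast; ring

lemma dir_bound (j : ℕ) : ∃ C : ℝ, 0 < C ∧ ∀ (c : ℕ → ℂ) (κ B : ℝ) (s : ℂ) (M : ℝ), (∀ n, ‖c n‖ ≤ 1) →
    0 ≤ κ → 1 ≤ B → (∀ u : ℝ, 1 ≤ u → ‖∑ k ∈ Icc 0 ⌊u⌋₊, c k - (κ:ℂ) * (u : ℂ)‖ ≤ B) →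
    1 < s.re → s.re ≤ 2 → 1 ≤ M → ‖s - 1‖⁻¹ ≤ M →
    ‖LSeries (fun n => ((log n ^ j : ℝ) : ℂ) * c n) s‖ ≤
      C * (log (B * (|s.im| + 3)) ^ (j + 1) + κ * log (B * (|s.im| + 3)) ^ j * M ^ (j + 1)) := by
  refine ⟨(2 * j + 1) ^ (j + 1) * (2 + 2 * (j + 1) + (j + 1).factorial), by positivity, ?_⟩
  intro c κ B s M hc hκ hB hE hs1 hs2 hM hM2
  set Y := B * (|s.im| + 3) with hY
  have hY3 : 3 ≤ Y := by rw [hY]; nlinarith [abs_nonneg s.im]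
  set X := exp (2 * j) * Y with hXd
  have hej : 1 ≤ exp (2 * (j:ℝ)) := one_le_exp (by positivity)
  have hXY : Y ≤ X := by rw [hXd]; nlinarith
  have he3 : exp 1 ≤ 3 := by have := exp_one_lt_d9; linarith
  have hXe : exp 1 ≤ X := by linarith
  have hXj : exp (2 * j) ≤ X := by rw [hXd]; nlinarith
  have hX0 : 0 < X := by linarith
  have hlX1 : 1 ≤ log X := by rw [le_log_iff_exp_le hX0]; exact hXe
  have hlY1 : 1 ≤ log Y := by rw [le_log_iff_exp_le (by linarith)]; linarith
  have hlXY : log X ≤ (2 * j + 1) * log Y := by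
    rw [hXd, log_mul (exp_pos _).ne' (by linarith), log_exp]
    have : (0:ℝ) ≤ j := by positivity
    nlinarith
  have hsn : s ≠ 1 := by intro h; rw [h] at hs1; simp at hs1
  -- the bound for partial sums
  set H := log X ^ j * (1 + log X) + (B * (2 * (log X ^ j / X)) +
    B * ((j + ‖s‖) * 2 * (log X ^ j / X))) + κ * ((j + 1).factorial * log X ^ j * M ^ (j + 1)) with hH
  have hpart : ∀ m : ℕ, X ≤ m → ‖∑ n ∈ Ioc 0 m, pw j s n * c n‖ ≤ H + κ * ‖Phi s j m‖ := by
    intro m hm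
    have hfl : ⌊X⌋₊ ≤ m := Nat.floor_le_of_le hm
    have hsplit : ∑ n ∈ Ioc 0 m, pw j s n * c n = ∑ n ∈ Ioc 0 ⌊X⌋₊, pw j s n * c n
        + ∑ n ∈ Ioc ⌊X⌋₊ m, pw j s n * c n := by
      rw [← sum_union]
      · rw [Ioc_union_Ioc_eq_Ioc (Nat.zero_le _) hfl]
      · exact disjoint_left.2 fun a ha hb => by simp at ha hb; omega
    have hcont : ContinuousOn (pw' j s) (Set.Icc X m) :=
      (pw'_continuousOn j s).mono fun t ht => lt_of_lt_of_le hX0 ht.1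
    have hitg : IntervalIntegrable (fun t : ℝ => B * ((j + ‖s‖) * log X ^ j * X ^ (-(1/2) : ℝ)) * t ^ (-(3/2) : ℝ)) volume X m := by
      apply IntervalIntegrable.const_mul
      apply intervalIntegral.intervalIntegrable_rpow
      right
      rw [Set.uIcc_of_le hm]
      intro h; linarith [h.1]
    have hps := ps_bound c (κ:ℂ) (pw j s) (pw' j s) X m hX0.le hm
      (fun t ht => pw_hasDerivAt j s t (lt_of_lt_of_le hX0 ht.1)) hcont _ hitg (by
        intro t ht
        have h1 := pw'_norm_le j s hs1.le X t hXj hXe ht.1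
        have h2 := hE t (by linarith [ht.1])
        calc _ ≤ ((j + ‖s‖) * log X ^ j * X ^ (-(1/2) : ℝ) * t ^ (-(3/2) : ℝ)) * B := by
              refine mul_le_mul h1 h2 (norm_nonneg _) ((norm_nonneg _).trans h1)
          _ = _ := by ring)
    have hI : ∫ t in X..(m:ℝ), B * ((j + ‖s‖) * log X ^ j * X ^ (-(1/2) : ℝ)) * t ^ (-(3/2) : ℝ)
        ≤ B * ((j + ‖s‖) * 2 * (log X ^ j / X)) := by
      rw [intervalIntegral.integral_const_mul, integral_rpow (Or.inr ⟨by norm_num, by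
        rw [Set.uIcc_of_le hm]; intro h; linarith [h.1]⟩)]
      have h3 : (0:ℝ) ≤ (m:ℝ) ^ (-(1/2) : ℝ) := by positivity
      have h4 : X ^ (-(1/2) : ℝ) * X ^ (-(1/2) : ℝ) = X⁻¹ := by rw [← rpow_add hX0]; norm_num [rpow_neg_one]
      rw [show (-(3/2) + 1 : ℝ) = -(1/2) by norm_num]
      have h5 : ((m:ℝ) ^ (-(1/2) : ℝ) - X ^ (-(1/2) : ℝ)) / (-(1/2)) ≤ 2 * X ^ (-(1/2) : ℝ) := by
        rw [div_le_iff_of_neg (by norm_num)]; linarith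
      calc _ ≤ B * ((j + ‖s‖) * log X ^ j * X ^ (-(1/2) : ℝ)) * (2 * X ^ (-(1/2) : ℝ)) := by gcongr
        _ = B * ((j + ‖s‖) * 2 * (log X ^ j * (X ^ (-(1/2) : ℝ) * X ^ (-(1/2) : ℝ)))) := by ring
        _ = _ := by rw [h4, div_eq_mul_inv]
    have hPhi : ∫ t in X..(m:ℝ), pw j s t = Phi s j m - Phi s j X := by
      apply intervalIntegral.integral_eq_sub_of_hasDerivAt
      · intro t ht
        rw [Set.uIcc_of_le hm] at ht
        exact Phi_hasDerivAt s hsn j t (lt_of_lt_of_le hX0 ht.1)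
      · apply ContinuousOn.intervalIntegrable_of_Icc hm
        exact fun t ht => (pw_hasDerivAt j s t (lt_of_lt_of_le hX0 ht.1)).continuousAt.continuousWithinAt
    rw [Nat.floor_natCast, hPhi] at hps
    have hb1 := pw_norm_le j s hs1.le X m hXj (by linarith) hm
    have hb2 := pw_norm_le j s hs1.le X X hXj (by linarith) le_rfl
    have hE1 : ‖∑ k ∈ Icc 0 m, c k - (κ:ℂ) * ((m:ℝ):ℂ)‖ ≤ B := by
      have := hE m (by linarith); rwa [Nat.floor_natCast] at this
    have hE2 := hE X (by linarith)
    have htail : ‖∑ n ∈ Ioc ⌊X⌋₊ m, pw j s n * c n - (κ:ℂ) * (Phi s j m - Phi s j X)‖ ≤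
        B * (2 * (log X ^ j / X)) + B * ((j + ‖s‖) * 2 * (log X ^ j / X)) := by
      refine hps.trans ?_
      have hnn : 0 ≤ log X ^ j / X := by positivity
      calc _ ≤ (log X ^ j / X) * B + (log X ^ j / X) * B + B * ((j + ‖s‖) * 2 * (log X ^ j / X)) := by
            gcongr
            · exact hE1
            · exact hE2
        _ = _ := by ring
    have hPX := Phi_norm_le s hs1.le M hM hM2 j X hXe
    have hhead := head_le j c hc s hs1.le X (by linarith)
    rw [hsplit]
    have h6 : ‖∑ n ∈ Ioc ⌊X⌋₊ m, pw j s n * c n‖ ≤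
        (B * (2 * (log X ^ j / X)) + B * ((j + ‖s‖) * 2 * (log X ^ j / X)))
          + κ * (‖Phi s j m‖ + (j + 1).factorial * log X ^ j * M ^ (j + 1)) := by
      have e : ∑ n ∈ Ioc ⌊X⌋₊ m, pw j s n * c n = (∑ n ∈ Ioc ⌊X⌋₊ m, pw j s n * c n - (κ:ℂ) * (Phi s j m - Phi s j X))
        + (κ:ℂ) * (Phi s j m - Phi s j X) := by ring
      rw [e]
      refine (norm_add_le _ _).trans (add_le_add htail ?_)
      rw [norm_mul, Complex.norm_real, norm_eq_abs, abs_of_nonneg hκ]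
      gcongr
      exact (norm_sub_le _ _).trans (by gcongr)
    refine (norm_add_le _ _).trans ((add_le_add hhead h6).trans (le_of_eq ?_))
    rw [hH]; ring
  -- passing to the limit
  have hsum : LSeriesSummable (fun n => ((log n ^ j : ℝ) : ℂ) * c n) s := by
    rw [logPow_eq]
    apply LSeriesSummable_of_abscissaOfAbsConv_lt_re
    rw [LSeries.absicssaOfAbsConv_logPowMul]
    refine lt_of_le_of_lt (LSeries.abscissaOfAbsConv_le_of_le_const ⟨1, fun n _ => hc n⟩) ?_
    · exact_mod_cast hs1
  have hlim : Tendsto (fun m : ℕ => ∑ n ∈ Ioc 0 m, pw j s n * c n) atTop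
      (𝓝 (LSeries (fun n => ((log n ^ j : ℝ) : ℂ) * c n) s)) := by
    have h1 := hsum.hasSum.tendsto_sum_nat
    have h2 := h1.comp (tendsto_add_atTop_nat 1)
    refine h2.congr fun m => ?_
    simp only [Function.comp]
    rw [sum_range_succ', LSeries.term_zero, add_zero]
    have e : Ioc 0 m = Ico (0+1) (m+1) := by ext n; simp; omega
    rw [e, ← sum_Ico_add', Nat.Ico_zero_eq_range]
    refine sum_congr rfl fun n _ => ?_
    rw [LSeries.term_of_ne_zero (by omega)]
    simp only [pw]
    rw [Complex.cpow_neg, div_eq_mul_inv]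
    push_cast; ring
  have hfin : ‖LSeries (fun n => ((log n ^ j : ℝ) : ℂ) * c n) s‖ ≤ H := by
    have hr : Tendsto (fun m : ℕ => H + κ * ‖Phi s j m‖) atTop (𝓝 (H + κ * 0)) :=
      tendsto_const_nhds.add (((tendsto_zero_iff_norm_tendsto_zero.1 (Phi_tendsto s hs1 j))).const_mul κ)
    rw [mul_zero, add_zero] at hr
    refine le_of_tendsto_of_tendsto hlim.norm hr ?_
    filter_upwards [eventually_ge_atTop ⌈X⌉₊] with m hm
    exact hpart m (Nat.ceil_le.1 hm)
  refine hfin.trans ?_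
  have hsB : B * (1 + j + ‖s‖) ≤ (j + 1) * X := by
    have h1 : ‖s‖ ≤ 2 + |s.im| := by
      refine (Complex.norm_le_abs_re_add_abs_im s).trans ?_
      rw [abs_of_pos (by linarith : 0 < s.re)]; linarith
    calc B * (1 + j + ‖s‖) ≤ B * (1 + j + (2 + |s.im|)) := by gcongr
      _ ≤ B * ((j + 1) * (|s.im| + 3)) := by
          gcongr
          have : (0:ℝ) ≤ j := by positivity
          nlinarith [abs_nonneg s.im]
      _ = (j + 1) * Y := by rw [hY]; ring
      _ ≤ _ := by gcongr
  have hlp : log X ^ j ≤ (2 * j + 1) ^ (j + 1) * log Y ^ j := by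
    calc log X ^ j ≤ ((2 * j + 1) * log Y) ^ j := by gcongr
      _ = (2 * j + 1 : ℝ) ^ j * log Y ^ j := mul_pow _ _ _
      _ ≤ _ := by
        gcongr
        · linarith [(by positivity : (0:ℝ) ≤ j)]
        · omega
  have hlp1 : log X ^ (j+1) ≤ (2 * j + 1) ^ (j + 1) * log Y ^ (j+1) := by
    calc log X ^ (j+1) ≤ ((2 * j + 1) * log Y) ^ (j+1) := by gcongr
      _ = _ := mul_pow _ _ _
  have hYY : log Y ^ j ≤ log Y ^ (j+1) := pow_le_pow_right₀ hlY1 (by omega)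
  have hXX : log X ^ j ≤ log X ^ (j+1) := pow_le_pow_right₀ hlX1 (by omega)
  have hA1 : log X ^ j * (1 + log X) ≤ 2 * log X ^ (j+1) := by rw [pow_succ] at hXX ⊢; linarith
  have hA2 : B * (2 * (log X ^ j / X)) + B * ((j + ‖s‖) * 2 * (log X ^ j / X))
      ≤ 2 * (j + 1) * log X ^ (j+1) := by
    calc _ = (B * (1 + j + ‖s‖)) * (2 * log X ^ j / X) := by ring
      _ ≤ ((j + 1) * X) * (2 * log X ^ j / X) := by gcongr
      _ = 2 * (j + 1) * log X ^ j := by field_simp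
      _ ≤ _ := by gcongr
  set Cj : ℝ := (2 * j + 1) ^ (j + 1)
  have hCj : 0 ≤ Cj := by positivity
  calc H ≤ 2 * (Cj * log Y ^ (j+1)) + 2 * (j + 1) * (Cj * log Y ^ (j+1))
        + κ * ((j + 1).factorial * (Cj * log Y ^ j) * M ^ (j + 1)) := by
        rw [hH]
        refine add_le_add (add_le_add (hA1.trans ?_) (hA2.trans ?_)) ?_
        · gcongr
        · gcongr
        · gcongr
    _ = Cj * ((2 + 2 * (j + 1)) * log Y ^ (j+1) + (j + 1).factorial * (κ * log Y ^ j * M ^ (j + 1))) := by ring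
    _ ≤ Cj * ((2 + 2 * (j + 1) + (j + 1).factorial) * log Y ^ (j+1) + (2 + 2 * (j + 1) + (j + 1).factorial) * (κ * log Y ^ j * M ^ (j + 1))) := by
        gcongr ?_ * (?_ * _ + ?_ * _)
        · linarith [(by positivity : (0:ℝ) ≤ (j+1).factorial)]
        · linarith [(by positivity : (0:ℝ) ≤ j)]
    _ = _ := by ring

lemma sum_range_char (r : ℕ) [NeZero r] (χ : DirichletCharacter ℂ r) :
    ∑ k ∈ range r, χ (k : ZMod r) = ∑ a : ZMod r, χ a := by
  refine sum_bij' (fun k _ => (k : ZMod r)) (fun a _ => a.val) ?_ ?_ ?_ ?_ ?_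
  · intro k _; exact mem_univ _
  · intro a _; exact mem_range.2 (ZMod.val_lt a)
  · intro k hk; exact ZMod.val_cast_of_lt (mem_range.1 hk)
  · intro a _; simp
  · intro k _; rfl

lemma char_partial (r : ℕ) [NeZero r] (χ : DirichletCharacter ℂ r) :
    ∃ κ : ℝ, 0 ≤ κ ∧ κ ≤ 1 ∧ (χ ≠ 1 → κ = 0) ∧
      ∀ u : ℝ, 1 ≤ u → ‖∑ k ∈ Icc 0 ⌊u⌋₊, χ (k : ZMod r) - (κ : ℂ) * (u : ℂ)‖ ≤ 3 * r := by
  have hr : (0:ℝ) < r := by exact_mod_cast Nat.pos_of_ne_zero (NeZero.ne r)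
  obtain ⟨κ, h0, h1, h2, h3⟩ : ∃ κ : ℝ, 0 ≤ κ ∧ κ ≤ 1 ∧ (χ ≠ 1 → κ = 0) ∧
      ∑ k ∈ range r, χ (k : ZMod r) = (κ : ℂ) * r := by
    by_cases hχ : χ = 1
    · refine ⟨(Nat.totient r : ℝ) / r, by positivity, ?_, fun h => absurd hχ h, ?_⟩
      · rw [div_le_one hr]; exact_mod_cast Nat.totient_le r
      · rw [sum_range_char, hχ, MulChar.sum_one_eq_card_units, ZMod.card_units_eq_totient]
        push_cast
        rw [div_mul_cancel₀]
        exact_mod_cast hr.ne'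
    · refine ⟨0, le_rfl, zero_le_one, fun _ => rfl, ?_⟩
      rw [sum_range_char, MulChar.sum_eq_zero_of_ne_one hχ]; simp
  refine ⟨κ, h0, h1, h2, fun u hu => ?_⟩
  have hper : ∀ q m : ℕ, ∑ k ∈ range (r * q + m), χ (k : ZMod r) =
      q * ((κ : ℂ) * r) + ∑ k ∈ range m, χ (k : ZMod r) := by
    intro q m
    rw [sum_range_add]
    congr 1
    · induction q with
      | zero => simp
      | succ q ih =>
        rw [mul_add, mul_one, sum_range_add, ih]
        have : ∑ x ∈ range r, χ ((r * q + x : ℕ) : ZMod r) = ∑ k ∈ range r, χ (k : ZMod r) := by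
          refine sum_congr rfl fun x _ => ?_
          push_cast; simp
        rw [this, h3]; push_cast; ring
    · refine sum_congr rfl fun x _ => ?_
      push_cast; simp
  have e : Icc 0 ⌊u⌋₊ = range (⌊u⌋₊ + 1) := by ext n; simp
  set N := ⌊u⌋₊ + 1 with hN
  have hNu : |(N:ℝ) - u| ≤ 1 := by
    have h4 := Nat.floor_le (by linarith : 0 ≤ u)
    have h5 := Nat.lt_floor_add_one u
    rw [hN]; push_cast
    rw [abs_le]; constructor <;> linarith
  rw [e, ← Nat.div_add_mod N r, hper]
  have hm : N % r < r := Nat.mod_lt _ (Nat.pos_of_ne_zero (NeZero.ne r))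
  have hNN : (N : ℝ) = r * (N / r : ℕ) + (N % r : ℕ) := by exact_mod_cast (Nat.div_add_mod N r).symm
  set q := N / r
  set m := N % r
  have e2 : (q:ℂ) * ((κ : ℂ) * r) + ∑ k ∈ range m, χ (k : ZMod r) - (κ : ℂ) * (u : ℂ)
      = ∑ k ∈ range m, χ (k : ZMod r) - (((κ * m : ℝ)) : ℂ) + ((κ * ((N:ℝ) - u) : ℝ) : ℂ) := by
    rw [hNN]; push_cast; ring
  rw [e2]
  have hs : ‖∑ k ∈ range m, χ (k : ZMod r)‖ ≤ m := by
    refine (norm_sum_le _ _).trans ?_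
    calc _ ≤ ∑ k ∈ range m, (1:ℝ) := sum_le_sum fun k _ => DirichletCharacter.norm_le_one χ _
      _ = m := by simp
  have hmr : (m:ℝ) ≤ r := by exact_mod_cast hm.le
  have hr1 : (1:ℝ) ≤ r := by exact_mod_cast Nat.pos_of_ne_zero (NeZero.ne r)
  refine (norm_add_le _ _).trans ?_
  rw [Complex.norm_real]
  have h6 : ‖κ * ((N:ℝ) - u)‖ ≤ 1 := by
    rw [norm_mul, norm_eq_abs, norm_eq_abs, abs_of_nonneg h0]
    exact mul_le_one₀ h1 (abs_nonneg _) hNu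
  have h7 : ‖((κ * m : ℝ) : ℂ)‖ ≤ m := by
    rw [Complex.norm_real, norm_eq_abs, abs_of_nonneg (by positivity)]
    exact mul_le_of_le_one_left (by positivity) h1
  have h8 := norm_sub_le (∑ k ∈ range m, χ (k : ZMod r)) ((κ * m : ℝ) : ℂ)
  linarith

/-- the size parameter -/
def ell (r : ℕ) (t : ℝ) : ℝ := log (3 * r * (|t| + 3))

lemma one_le_ell (r : ℕ) (hr : 0 < r) (t : ℝ) : 1 ≤ ell r t := by
  have hr1 : (1:ℝ) ≤ r := by exact_mod_cast hr
  have he3 : exp 1 ≤ 3 := by have := exp_one_lt_d9; linarith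
  unfold ell
  rw [le_log_iff_exp_le (by positivity)]
  nlinarith [abs_nonneg t]

lemma ell_two_mul (r : ℕ) (hr : 0 < r) (t : ℝ) : ell r (2 * t) ≤ 2 * ell r t := by
  have hr1 : (1:ℝ) ≤ r := by exact_mod_cast hr
  have h1 := one_le_ell r hr t
  have h2 : ell r (2 * t) ≤ log 2 + ell r t := by
    unfold ell
    rw [← log_mul (by norm_num) (by positivity)]
    apply log_le_log (by positivity)
    rw [abs_mul, abs_two]
    nlinarith [abs_nonneg t]
  have := Real.log_two_lt_d9
  linarith

def Lj (j : ℕ) (r : ℕ) (χ : DirichletCharacter ℂ r) (s : ℂ) : ℂ :=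
  LSeries (fun n => ((log n ^ j : ℝ) : ℂ) * χ (n : ZMod r)) s

lemma Lj_bound (j : ℕ) : ∃ C : ℝ, 1 ≤ C ∧ ∀ (r : ℕ) (_ : 0 < r) (χ : DirichletCharacter ℂ r) (s : ℂ),
    χ ≠ 1 → 1 < s.re → s.re ≤ 2 → ‖Lj j r χ s‖ ≤ C * ell r s.im ^ (j + 1) := by
  obtain ⟨C, hC, h⟩ := dir_bound j
  refine ⟨max 1 C, le_max_left _ _, fun r hr χ s hχ h1 h2 => ?_⟩
  have : NeZero r := ⟨hr.ne'⟩
  obtain ⟨κ, hκ0, hκ1, hκ, hE⟩ := char_partial r χ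
  have hr1 : (1:ℝ) ≤ r := by exact_mod_cast hr
  have := h (fun n => χ (n : ZMod r)) κ (3 * r) s (max 1 (‖s - 1‖⁻¹))
    (fun n => DirichletCharacter.norm_le_one χ _) hκ0 (by linarith) hE h1 h2 (le_max_left _ _) (le_max_right _ _)
  rw [hκ hχ] at this
  simp only [zero_mul, add_zero] at this
  unfold Lj ell
  refine this.trans ?_
  have := one_le_ell r hr s.im
  unfold ell at this
  gcongr
  exact le_max_right _ _

lemma L0_bound : ∃ C : ℝ, 1 ≤ C ∧ ∀ (r : ℕ) (_ : 0 < r) (χ : DirichletCharacter ℂ r) (s : ℂ),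
    1 < s.re → s.re ≤ 2 → ‖Lj 0 r χ s‖ ≤ C * (ell r s.im + max 1 ‖s - 1‖⁻¹) := by
  obtain ⟨C, hC, h⟩ := dir_bound 0
  refine ⟨max 1 C, le_max_left _ _, fun r hr χ s h1 h2 => ?_⟩
  have : NeZero r := ⟨hr.ne'⟩
  obtain ⟨κ, hκ0, hκ1, hκ, hE⟩ := char_partial r χ
  have hr1 : (1:ℝ) ≤ r := by exact_mod_cast hr
  have := h (fun n => χ (n : ZMod r)) κ (3 * r) s (max 1 (‖s - 1‖⁻¹))
    (fun n => DirichletCharacter.norm_le_one χ _) hκ0 (by linarith) hE h1 h2 (le_max_left _ _) (le_max_right _ _)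
  unfold Lj ell
  refine this.trans ?_
  have h3 := one_le_ell r hr s.im
  unfold ell at h3
  have h4 : 0 ≤ max 1 ‖s - 1‖⁻¹ := le_trans zero_le_one (le_max_left _ _)
  calc _ ≤ max 1 C * (log (3 * r * (|s.im| + 3)) ^ (0 + 1) +
      1 * log (3 * r * (|s.im| + 3)) ^ 0 * max 1 (‖s - 1‖⁻¹) ^ (0 + 1)) := by
        gcongr
        exact le_max_right _ _
    _ = _ := by simp

lemma Lj_zero (r : ℕ) (χ : DirichletCharacter ℂ r) : Lj 0 r χ = LSeries (fun n => χ (n : ZMod r)) := by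
  ext s; unfold Lj; simp

lemma abscissa_char (r : ℕ) (χ : DirichletCharacter ℂ r) :
    LSeries.abscissaOfAbsConv (fun n => χ (n : ZMod r)) ≤ 1 :=
  LSeries.abscissaOfAbsConv_le_of_le_const ⟨1, fun _ _ => DirichletCharacter.norm_le_one χ _⟩

lemma Lj_iteratedDeriv (j r : ℕ) (χ : DirichletCharacter ℂ r) (s : ℂ) (hs : 1 < s.re) :
    iteratedDeriv j (Lj 0 r χ) s = (-1) ^ j * Lj j r χ s := by
  rw [Lj_zero, LSeries_iteratedDeriv j (lt_of_le_of_lt (abscissa_char r χ) (by exact_mod_cast hs))]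
  unfold Lj
  rw [logPow_eq]

lemma Lj_hasDerivAt (r : ℕ) (χ : DirichletCharacter ℂ r) (s : ℂ) (hs : 1 < s.re) :
    HasDerivAt (Lj 0 r χ) (- Lj 1 r χ s) s := by
  have h := LSeries_hasDerivAt (f := fun n => χ (n : ZMod r)) (s := s)
    (lt_of_le_of_lt (abscissa_char r χ) (by exact_mod_cast hs))
  rw [Lj_zero]
  unfold Lj
  rw [logPow_eq]
  simpa using h

/-- zeta on the real axis, crude -/
lemma L0_real : ∃ C : ℝ, 1 ≤ C ∧ ∀ (r : ℕ) (_ : 0 < r) (χ : DirichletCharacter ℂ r) (s : ℂ),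
    1 < s.re → s.re ≤ 2 → ‖Lj 0 r χ s‖ ≤ C / (s.re - 1) := by
  obtain ⟨C, hC, h⟩ := dir_bound 0
  set C' := C * (log 3 + 1) with hC'
  have hl3 : 0 < log 3 := log_pos (by norm_num)
  refine ⟨max 1 C', le_max_left _ _, fun r hr χ s h1 h2 => ?_⟩
  have hx : 0 < s.re - 1 := by linarith
  have key := h (fun _ => 1) 1 1 (s.re : ℂ) (s.re - 1)⁻¹ (fun _ => by simp) zero_le_one le_rfl (by
    intro u hu
    have h4 := Nat.floor_le (by linarith : 0 ≤ u)
    have h5 := Nat.lt_floor_add_one u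
    have : (∑ k ∈ Icc 0 ⌊u⌋₊, (1:ℂ) - ((1:ℝ):ℂ) * (u:ℂ)) = (((⌊u⌋₊ : ℝ) + 1 - u : ℝ) : ℂ) := by simp
    rw [this, Complex.norm_real, norm_eq_abs, abs_le]
    constructor <;> linarith) (by simpa using h1) (by simpa using h2)
    ((one_le_inv₀ hx).2 (by linarith)) (by
      have : (s.re : ℂ) - 1 = ((s.re - 1 : ℝ) : ℂ) := by push_cast; rfl
      rw [this, Complex.norm_real, norm_eq_abs, abs_of_pos hx])
  simp only [Complex.ofReal_im, abs_zero, zero_add, one_mul, pow_zero, Complex.ofReal_one, pow_one] at key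
  have hcmp : ‖Lj 0 r χ s‖ ≤ ‖LSeries (fun _ => (1:ℂ)) (s.re : ℂ)‖ := by
    have hs1 : LSeriesSummable (fun _ => (1:ℂ)) (s.re : ℂ) :=
      LSeriesSummable_of_bounded_of_one_lt_re (m := 1) (fun n _ => by simp) (by simpa using h1)
    have hs2 : LSeriesSummable (fun n => χ (n : ZMod r)) s :=
      LSeriesSummable_of_bounded_of_one_lt_re (m := 1) (fun n _ => DirichletCharacter.norm_le_one χ _) h1
    have e : ∀ n, LSeries.term (fun _ => (1:ℂ)) (s.re : ℂ) n = ((‖LSeries.term (fun _ => (1:ℂ)) (s.re : ℂ) n‖ : ℝ) : ℂ) := by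
      intro n
      rcases eq_or_ne n 0 with rfl | hn
      · simp
      · rw [LSeries.term_of_ne_zero hn, norm_div, Complex.norm_natCast_cpow_of_pos (Nat.pos_of_ne_zero hn)]
        simp [Complex.ofReal_cpow]
    have e2 : LSeries (fun _ => (1:ℂ)) (s.re : ℂ) = ((∑' n, ‖LSeries.term (fun _ => (1:ℂ)) (s.re : ℂ) n‖ : ℝ) : ℂ) := by
      unfold LSeries
      rw [Complex.ofReal_tsum]
      exact tsum_congr e
    rw [e2, Complex.norm_real, norm_eq_abs, abs_of_nonneg (tsum_nonneg fun _ => norm_nonneg _), Lj_zero]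
    unfold LSeries
    refine (norm_tsum_le_tsum_norm hs2.norm).trans (hs2.norm.tsum_le_tsum (fun n => ?_) hs1.norm)
    rcases eq_or_ne n 0 with rfl | hn
    · simp
    · rw [LSeries.term_of_ne_zero hn, LSeries.term_of_ne_zero hn, norm_div, norm_div,
        Complex.norm_natCast_cpow_of_pos (Nat.pos_of_ne_zero hn), Complex.norm_natCast_cpow_of_pos (Nat.pos_of_ne_zero hn)]
      simp only [Complex.ofReal_re, norm_one]
      gcongr
      exact DirichletCharacter.norm_le_one χ _
  refine hcmp.trans (key.trans ?_)
  have hi : 1 ≤ (s.re - 1)⁻¹ := (one_le_inv₀ hx).2 (by linarith)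
  simp only [div_eq_mul_inv]
  calc C * (log 3 + (s.re - 1)⁻¹) ≤ C * (log 3 * (s.re - 1)⁻¹ + (s.re - 1)⁻¹) := by
        gcongr; nlinarith
    _ = C' * (s.re - 1)⁻¹ := by rw [hC']; ring
    _ ≤ _ := by gcongr; exact le_max_right _ _

lemma Lj_bound' (j : ℕ) : ∃ C : ℝ, 1 ≤ C ∧ ∀ (r : ℕ) (_ : 0 < r) (χ : DirichletCharacter ℂ r) (s : ℂ),
    (χ ≠ 1 ∨ 1 ≤ |s.im|) → 1 < s.re → s.re ≤ 2 → ‖Lj j r χ s‖ ≤ C * ell r s.im ^ (j + 1) := by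
  obtain ⟨C, hC, h⟩ := dir_bound j
  obtain ⟨C', hC', h'⟩ := Lj_bound j
  refine ⟨max C' (2 * C), hC'.trans (le_max_left _ _), fun r hr χ s hχ h1 h2 => ?_⟩
  have h3 := one_le_ell r hr s.im
  rcases hχ with hχ | hχ
  · refine (h' r hr χ s hχ h1 h2).trans ?_
    gcongr; exact le_max_left _ _
  have : NeZero r := ⟨hr.ne'⟩
  obtain ⟨κ, hκ0, hκ1, hκ, hE⟩ := char_partial r χ
  have hr1 : (1:ℝ) ≤ r := by exact_mod_cast hr
  have hs1 : 1 ≤ ‖s - 1‖ := hχ.trans (by simpa using Complex.abs_im_le_norm (s - 1))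
  have := h (fun n => χ (n : ZMod r)) κ (3 * r) s 1
    (fun n => DirichletCharacter.norm_le_one χ _) hκ0 (by linarith) hE h1 h2 le_rfl (inv_le_one_of_one_le₀ hs1)
  unfold Lj
  refine this.trans ?_
  unfold ell at h3 ⊢
  set l := log (3 * r * (|s.im| + 3))
  have h4 : l ^ j ≤ l ^ (j + 1) := pow_le_pow_right₀ h3 (by omega)
  have h5 : κ * l ^ j ≤ l ^ (j + 1) := by
    have : 0 ≤ l ^ j := by positivity
    nlinarith
  calc C * (l ^ (j + 1) + κ * l ^ j * 1 ^ (j + 1)) ≤ C * (l ^ (j + 1) + l ^ (j + 1)) := by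
        rw [one_pow, mul_one]; gcongr
    _ = 2 * C * l ^ (j + 1) := by ring
    _ ≤ _ := by gcongr; exact le_max_right _ _

lemma L_lower_gen : ∃ C : ℝ, 1 ≤ C ∧ ∀ (r : ℕ) (_ : 0 < r) (χ : DirichletCharacter ℂ r) (t K : ℝ),
    (χ ≠ 1 ∨ 1 ≤ |t|) → 1 ≤ K → (∀ x : ℝ, 0 < x → x ≤ 1 → ‖Lj 0 r (χ ^ 2) (1 + x + 2 * Complex.I * t)‖ ≤ K) →
    ∀ x : ℝ, 0 < x → x ≤ 1 → 1 ≤ C * K * ell r t ^ 6 * ‖Lj 0 r χ (1 + x + Complex.I * t)‖ := by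
  obtain ⟨C1, hC1, h1⟩ := L0_real
  obtain ⟨C2, hC2, h2⟩ := Lj_bound' 1
  set d := 1 / (2 * C1 * C2) with hd
  have hd0 : 0 < d := by positivity
  have hd1 : d ≤ 1 := by rw [hd, div_le_one (by positivity)]; nlinarith
  refine ⟨2 * C1 / d ^ 3, ?_, ?_⟩
  · rw [le_div_iff₀ (by positivity)]
    have : d ^ 3 ≤ 1 := pow_le_one₀ hd0.le hd1
    linarith
  intro r hr χ t K hχ hK hK2
  have : NeZero r := ⟨hr.ne'⟩
  set l := ell r t with hl
  have hl1 : 1 ≤ l := one_le_ell r hr t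
  set a : ℝ → ℝ := fun x => ‖Lj 0 r χ (1 + x + Complex.I * t)‖ with ha
  have ha0 : ∀ x, 0 ≤ a x := fun x => norm_nonneg _
  have step1 : ∀ x, 0 < x → x ≤ 1 → x ^ 3 / (C1 ^ 3 * K) ≤ a x ^ 4 := by
    intro x hx hx1
    have h341 := DirichletCharacter.norm_LSeries_product_ge_one χ hx t
    rw [norm_mul, norm_mul, norm_pow, norm_pow] at h341
    have b1 : ‖LSeries (fun n => (1 : DirichletCharacter ℂ r) (n : ZMod r)) (1 + x)‖ ≤ C1 / x := by
      have := h1 r hr 1 (1 + x) (by simpa using hx) (by simp; linarith)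
      rw [Lj_zero] at this
      simpa using this
    have b2 : ‖LSeries (fun n => (χ ^ 2) (n : ZMod r)) (1 + x + 2 * Complex.I * t)‖ ≤ K := by
      have := hK2 x hx hx1; rwa [Lj_zero] at this
    have b3 : ‖LSeries (fun n => χ (n : ZMod r)) (1 + x + Complex.I * t)‖ = a x := by rw [ha]; simp only [Lj_zero]
    rw [b3] at h341
    have h5 : 1 ≤ (C1 / x) ^ 3 * a x ^ 4 * K := by
      refine le_trans h341 ?_
      have := ha0 x
      gcongr
    rw [div_le_iff₀ (by positivity)]
    have e : (C1 / x) ^ 3 * a x ^ 4 * K = (a x ^ 4 * (C1 ^ 3 * K)) / x ^ 3 := by rw [div_pow]; ring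
    rw [e, le_div_iff₀ (by positivity), one_mul] at h5
    exact h5
  set η := d ^ 4 / (K * l ^ 8) with hη
  have hη0 : 0 < η := by positivity
  have hKl : 1 ≤ K * l ^ 8 := one_le_mul_of_one_le_of_one_le hK (one_le_pow₀ hl1)
  have hη1 : η ≤ 1 := by
    rw [hη, div_le_one (by positivity)]
    exact (pow_le_one₀ hd0.le hd1).trans hKl
  have step2 : ∀ x, η ≤ x → x ≤ 1 → d ^ 3 / (C1 * K * l ^ 6) ≤ a x := by
    intro x hx hx1
    refine le_of_pow_le_pow_left₀ (n := 4) (by norm_num) (ha0 x) (le_trans ?_ (step1 x (by linarith) hx1))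
    calc (d ^ 3 / (C1 * K * l ^ 6)) ^ 4 = d ^ 12 / (K ^ 4 * l ^ 24) / C1 ^ 4 := by
          field_simp
      _ ≤ d ^ 12 / (K ^ 4 * l ^ 24) / C1 ^ 3 := by
          gcongr
          norm_num
      _ = η ^ 3 / (C1 ^ 3 * K) := by rw [hη]; field_simp
      _ ≤ _ := by gcongr
  have step3 : ∀ x, 0 < x → x ≤ 1 → d ^ 3 / (2 * C1 * K * l ^ 6) ≤ a x := by
    intro x hx hx1
    rcases le_or_gt η x with h | h
    · refine le_trans ?_ (step2 x h hx1)
      gcongr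
      nlinarith
    · have hder : ∀ y ∈ Set.Icc x η, HasDerivWithinAt (fun y : ℝ => Lj 0 r χ (1 + y + Complex.I * t))
          (- Lj 1 r χ (1 + y + Complex.I * t)) (Set.Icc x η) y := by
        intro y hy
        have h1 : HasDerivAt (fun z : ℂ => 1 + z + Complex.I * t) 1 (y : ℂ) :=
          ((hasDerivAt_id (y:ℂ)).const_add 1).add_const _
        have h2 := (Lj_hasDerivAt r χ (1 + y + Complex.I * t) (by simp; linarith [hy.1])).comp (y:ℂ) h1
        have h3 := h2.comp_ofReal
        rw [mul_one] at h3
        exact h3.hasDerivWithinAt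
      have hbd := (convex_Icc x η).norm_image_sub_le_of_norm_hasDerivWithin_le (C := C2 * l ^ 2) hder (by
        intro y hy
        rw [norm_neg]
        have := h2 r hr χ (1 + y + Complex.I * t) (by simpa using hχ) (by simp; linarith [hy.1]) (by simp; linarith [hy.2])
        simpa using this) (Set.left_mem_Icc.2 h.le) (Set.right_mem_Icc.2 h.le)
      have h7 := step2 η le_rfl hη1
      have h8 : ‖η - x‖ ≤ η := by rw [norm_eq_abs, abs_of_pos (by linarith)]; linarith
      have h9 : C2 * l ^ 2 * ‖η - x‖ ≤ d ^ 3 / (2 * C1 * K * l ^ 6) := by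
        calc _ ≤ C2 * l ^ 2 * η := by gcongr
          _ = d ^ 3 / (2 * C1 * K * l ^ 6) := by
              rw [hη]
              have : C2 = 1 / (2 * C1 * d) := by rw [hd]; field_simp
              rw [this]
              field_simp
      have h10 : a η - a x ≤ d ^ 3 / (2 * C1 * K * l ^ 6) := by
        refine le_trans ?_ (hbd.trans h9)
        exact norm_sub_norm_le _ _
      have h11 : d ^ 3 / (C1 * K * l ^ 6) = d ^ 3 / (2 * C1 * K * l ^ 6) + d ^ 3 / (2 * C1 * K * l ^ 6) := by
        field_simp; norm_num
      linarith
  intro x hx hx1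
  have := step3 x hx hx1
  rw [div_le_iff₀ (by positivity)] at this
  calc (1:ℝ) = d ^ 3 / d ^ 3 := by field_simp
    _ ≤ (a x * (2 * C1 * K * l ^ 6)) / d ^ 3 := by gcongr
    _ = _ := by rw [ha]; ring

lemma ell_mono (r : ℕ) (hr : 0 < r) (t u : ℝ) (h : |u| ≤ |t|) : ell r u ≤ ell r t := by
  unfold ell
  have hr1 : (0:ℝ) < r := by exact_mod_cast hr
  apply log_le_log (by positivity)
  gcongr

lemma L_lower : ∃ C : ℝ, 1 ≤ C ∧ ∀ (r : ℕ) (_ : 0 < r) (χ : DirichletCharacter ℂ r) (b0 : ℝ),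
    χ ≠ 1 → 1 ≤ b0 → (χ ^ 2 = 1 → ∀ x : ℝ, 0 < x → x ≤ 1 → 1 ≤ b0 * ‖Lj 0 r χ (1 + x)‖) →
    ∀ x t : ℝ, 0 < x → x ≤ 1 → 1 ≤ C * b0 * ell r t ^ 8 * ‖Lj 0 r χ (1 + x + Complex.I * t)‖ := by
  obtain ⟨C, hC, hgen⟩ := L_lower_gen
  obtain ⟨C2, hC2, h2⟩ := Lj_bound 1
  obtain ⟨C3, hC3, h3⟩ := Lj_bound 0
  obtain ⟨C4, hC4, h4⟩ := L0_bound
  refine ⟨C * (2 * C3) + C * (4 * C4 * C2) + 2, by nlinarith [mul_nonneg (by linarith : 0 ≤ C) (by linarith : 0 ≤ C3), mul_nonneg (by linarith : 0 ≤ C) (mul_nonneg (by linarith : 0 ≤ C4) (by linarith : 0 ≤ C2))], ?_⟩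
  intro r hr χ b0 hχ hb0 hreal x t hx hx1
  set l := ell r t with hl
  have hl1 : 1 ≤ l := one_le_ell r hr t
  have hl2 := ell_two_mul r hr t
  set a := ‖Lj 0 r χ (1 + x + Complex.I * t)‖ with ha
  have ha0 : 0 ≤ a := norm_nonneg _
  have hP : 0 ≤ b0 * l ^ 8 * a := by positivity
  suffices h : (1 ≤ C * (2 * C3) * (b0 * l ^ 8 * a)) ∨ (1 ≤ C * (4 * C4 * C2) * (b0 * l ^ 8 * a)) ∨ (1 ≤ 2 * (b0 * l ^ 8 * a)) by
    have p1 : 0 ≤ C * (2 * C3) * (b0 * l ^ 8 * a) := by positivity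
    have p2 : 0 ≤ C * (4 * C4 * C2) * (b0 * l ^ 8 * a) := by positivity
    have e : (C * (2 * C3) + C * (4 * C4 * C2) + 2) * b0 * l ^ 8 * a =
      C * (2 * C3) * (b0 * l ^ 8 * a) + C * (4 * C4 * C2) * (b0 * l ^ 8 * a) + 2 * (b0 * l ^ 8 * a) := by ring
    rw [e]
    rcases h with h | h | h <;> linarith
  have im2 : ∀ x : ℝ, (1 + (x:ℂ) + 2 * Complex.I * t).im = 2 * t := by intro x; simp
  by_cases hsq : χ ^ 2 = 1
  · right
    rcases le_or_gt (|t| * (2 * b0 * C2 * l ^ 2)) 1 with ht | ht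
    · right
      -- vertical segment
      have hder : ∀ y ∈ Set.uIcc 0 t, HasDerivWithinAt (fun y : ℝ => Lj 0 r χ (1 + x + Complex.I * y))
          (- Lj 1 r χ (1 + x + Complex.I * y) * Complex.I) (Set.uIcc 0 t) y := by
        intro y hy
        have h1 : HasDerivAt (fun z : ℂ => 1 + (x:ℂ) + Complex.I * z) Complex.I (y : ℂ) := by
          simpa using ((hasDerivAt_id (y:ℂ)).const_mul Complex.I).const_add (1 + (x:ℂ))
        have h2 := (Lj_hasDerivAt r χ (1 + x + Complex.I * y) (by simp; linarith)).comp (y:ℂ) h1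
        exact h2.comp_ofReal.hasDerivWithinAt
      have hbd := (convex_uIcc (0:ℝ) t).norm_image_sub_le_of_norm_hasDerivWithin_le (C := C2 * l ^ 2) hder (by
        intro y hy
        rw [norm_mul, norm_neg, Complex.norm_I, mul_one]
        have := h2 r hr χ (1 + x + Complex.I * y) hχ (by simp; linarith) (by simp; linarith)
        refine this.trans ?_
        have hyt : |y| ≤ |t| := by
          have := Set.abs_sub_left_of_mem_uIcc hy
          simpa using this
        have h5 := ell_mono r hr t y hyt
        have h6 := one_le_ell r hr y
        have him : (1 + (x:ℂ) + Complex.I * y).im = y := by simp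
        rw [him]
        gcongr) Set.right_mem_uIcc Set.left_mem_uIcc
      simp only [Complex.ofReal_zero, mul_zero, add_zero, zero_sub, norm_neg] at hbd
      have h7 := hreal hsq x hx hx1
      have h8 : ‖Lj 0 r χ (1 + x)‖ - a ≤ C2 * l ^ 2 * |t| := (norm_sub_norm_le _ _).trans hbd
      have h9 : 1 ≤ 2 * (b0 * a) := by
        have : b0 * (‖Lj 0 r χ (1 + x)‖ - a) ≤ b0 * (C2 * l ^ 2 * |t|) := by gcongr
        nlinarith
      have h10 : 1 ≤ l ^ 8 := one_le_pow₀ hl1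
      calc (1:ℝ) ≤ 2 * (b0 * a) := h9
        _ ≤ 2 * (b0 * a) * l ^ 8 := le_mul_of_one_le_right (by positivity) h10
        _ = _ := by ring
    · left
      have hK : ∀ x : ℝ, 0 < x → x ≤ 1 → ‖Lj 0 r (χ ^ 2) (1 + x + 2 * Complex.I * t)‖ ≤ 4 * C4 * C2 * b0 * l ^ 2 := by
        intro x hx hx1
        have h5 := h4 r hr (χ ^ 2) (1 + x + 2 * Complex.I * t) (by simp; linarith) (by simp; linarith)
        rw [im2] at h5
        have h6 : ‖(1 + (x:ℂ) + 2 * Complex.I * t - 1)‖⁻¹ ≤ b0 * C2 * l ^ 2 := by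
          have h7 : 2 * |t| ≤ ‖(1 + (x:ℂ) + 2 * Complex.I * t - 1)‖ := by
            have := Complex.abs_im_le_norm (1 + (x:ℂ) + 2 * Complex.I * t - 1)
            simp at this
            simpa using this
          have htp : 0 < |t| := by
            by_contra hc
            have : |t| = 0 := le_antisymm (not_lt.1 hc) (abs_nonneg _)
            rw [this] at ht; linarith
          refine (inv_anti₀ (by positivity) h7).trans ?_
          rw [inv_le_iff_one_le_mul₀ (by positivity)]
          nlinarith
        have hb : 1 ≤ b0 * C2 * l ^ 2 :=
          one_le_mul_of_one_le_of_one_le (one_le_mul_of_one_le_of_one_le hb0 hC2) (one_le_pow₀ hl1)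
        have hlb : l ≤ b0 * C2 * l ^ 2 := by
          have : 1 ≤ b0 * C2 * l := one_le_mul_of_one_le_of_one_le (one_le_mul_of_one_le_of_one_le hb0 hC2) hl1
          nlinarith
        calc _ ≤ _ := h5
          _ ≤ C4 * (2 * (b0 * C2 * l ^ 2) + b0 * C2 * l ^ 2) := by
              gcongr
              · linarith
              · exact max_le hb h6
          _ ≤ _ := by nlinarith [mul_nonneg (by linarith : 0 ≤ C4) (by linarith : 0 ≤ b0 * C2 * l ^ 2)]
      have := hgen r hr χ t (4 * C4 * C2 * b0 * l ^ 2) (Or.inl hχ) (by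
        refine one_le_mul_of_one_le_of_one_le (one_le_mul_of_one_le_of_one_le (one_le_mul_of_one_le_of_one_le ?_ hC2) hb0) (one_le_pow₀ hl1)
        linarith) hK x hx hx1
      refine this.trans (le_of_eq ?_)
      rw [← hl, ← ha]; ring
  · left
    have hK : ∀ x : ℝ, 0 < x → x ≤ 1 → ‖Lj 0 r (χ ^ 2) (1 + x + 2 * Complex.I * t)‖ ≤ 2 * C3 * l := by
      intro x hx hx1
      have h5 := h3 r hr (χ ^ 2) (1 + x + 2 * Complex.I * t) hsq (by simp; linarith) (by simp; linarith)
      rw [im2] at h5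
      simp only [zero_add, pow_one] at h5
      calc _ ≤ _ := h5
        _ ≤ C3 * (2 * l) := by gcongr
        _ = _ := by ring
    have := hgen r hr χ t (2 * C3 * l) (Or.inl hχ) (one_le_mul_of_one_le_of_one_le (by linarith) hl1) hK x hx hx1
    refine this.trans ?_
    rw [← hl, ← ha]
    have hll : l ^ 7 ≤ b0 * l ^ 8 := by
      calc l ^ 7 ≤ l ^ 8 := pow_le_pow_right₀ hl1 (by norm_num)
        _ ≤ _ := le_mul_of_one_le_left (by positivity) hb0
    calc C * (2 * C3 * l) * l ^ 6 * a = C * (2 * C3) * (l ^ 7 * a) := by ring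
      _ ≤ _ := by gcongr

def Ak (k : ℕ) (r : ℕ) (χ : DirichletCharacter ℂ r) (s : ℂ) : ℂ :=
  LSeries (fun n => ((log n ^ k : ℝ) : ℂ) * (χ (n : ZMod r) * (ArithmeticFunction.vonMangoldt n : ℂ))) s

lemma abscissa_twist (r : ℕ) (χ : DirichletCharacter ℂ r) :
    LSeries.abscissaOfAbsConv (fun n => χ (n : ZMod r) * (ArithmeticFunction.vonMangoldt n : ℂ)) ≤ 1 := by
  refine LSeries.abscissaOfAbsConv_le_of_forall_lt_LSeriesSummable' fun y hy => ?_
  have hy' : 1 < y := by exact_mod_cast hy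
  exact DirichletCharacter.LSeriesSummable_twist_vonMangoldt χ (s := (y:ℂ)) (by simpa using hy')

lemma Ak_leibniz (k r : ℕ) (χ : DirichletCharacter ℂ r) (s : ℂ) (hs : 1 < s.re) :
    ∑ i ∈ range (k + 1), (k.choose i : ℂ) * Ak i r χ s * Lj (k - i) r χ s = Lj (k + 1) r χ s := by
  set U : Set ℂ := {s | 1 < s.re} with hU
  have hUo : IsOpen U := isOpen_lt continuous_const Complex.continuous_re
  set f : ℕ → ℂ := fun n => χ (n : ZMod r) * (ArithmeticFunction.vonMangoldt n : ℂ) with hf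
  set g : ℕ → ℂ := fun n => χ (n : ZMod r) with hg
  have haf : ∀ s ∈ U, LSeries.abscissaOfAbsConv f < s.re := fun s hs =>
    lt_of_le_of_lt (abscissa_twist r χ) (by exact_mod_cast hs)
  have hag : ∀ s ∈ U, LSeries.abscissaOfAbsConv g < s.re := fun s hs =>
    lt_of_le_of_lt (abscissa_char r χ) (by exact_mod_cast hs)
  have hEq : Set.EqOn (LSeries f * LSeries g) (LSeries (LSeries.logMul g)) U := by
    intro z hz
    have h1 := DirichletCharacter.LSeries_twist_vonMangoldt_eq χ (s := z) hz
    have h2 := DirichletCharacter.LSeries_ne_zero_of_one_lt_re χ (s := z) hz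
    rw [LSeries_deriv (hag z hz), neg_neg, eq_div_iff h2] at h1
    exact h1
  have h3 := (hEq.iteratedDeriv_of_isOpen hUo k) hs
  have hcf : ContDiffAt ℂ k (LSeries f) s :=
    ((LSeries_analyticOnNhd f) s (haf s hs)).contDiffAt
  have hcg : ContDiffAt ℂ k (LSeries g) s :=
    ((LSeries_analyticOnNhd g) s (hag s hs)).contDiffAt
  rw [iteratedDeriv_mul hcf hcg, LSeries_iteratedDeriv k (by
    rw [LSeries.abscissaOfAbsConv_logMul]; exact hag s hs), ← Function.iterate_succ_apply] at h3
  have hA : ∀ i, Ak i r χ s = LSeries (LSeries.logMul^[i] f) s := by intro i; unfold Ak; rw [← logPow_eq]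
  have hL : ∀ i, Lj i r χ s = LSeries (LSeries.logMul^[i] g) s := by intro i; unfold Lj; rw [← logPow_eq]
  simp only [hA, hL]
  have h4 : (-1:ℂ) ^ k * (-1) ^ k = 1 := by rw [← mul_pow]; simp
  calc _ = (-1:ℂ) ^ k * ∑ i ∈ range (k + 1), (k.choose i : ℂ) * iteratedDeriv i (LSeries f) s * iteratedDeriv (k - i) (LSeries g) s := by
        rw [mul_sum]
        refine sum_congr rfl fun i hi => ?_
        rw [LSeries_iteratedDeriv i (haf s hs), LSeries_iteratedDeriv (k - i) (hag s hs)]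
        have h5 : (-1:ℂ) ^ k = (-1) ^ i * (-1) ^ (k - i) := by rw [← pow_add]; congr 1; have := mem_range.1 hi; omega
        have h6 : ∀ i, (-1:ℂ) ^ i * (-1) ^ i = 1 := fun i => by rw [← mul_pow]; simp
        rw [h5]
        linear_combination (-(k.choose i : ℂ) * LSeries (LSeries.logMul^[i] f) s * LSeries (LSeries.logMul^[k - i] g) s) * ((h6 (k - i)) + (-1:ℂ) ^ (k - i) * (-1) ^ (k - i) * h6 i)
    _ = _ := by rw [h3, ← mul_assoc, h4, one_mul]

lemma rec_bound (Cj : ℕ → ℝ) (hC : ∀ j, 1 ≤ Cj j) (k : ℕ) : ∃ C : ℝ, 1 ≤ C ∧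
    ∀ (A L : ℕ → ℂ) (W l : ℝ), 1 ≤ W → 1 ≤ l → 1 ≤ W * ‖L 0‖ → (∀ j, ‖L j‖ ≤ Cj j * l ^ (j + 1)) →
    (∀ k, ∑ i ∈ range (k + 1), (k.choose i : ℂ) * A i * L (k - i) = L (k + 1)) →
    ‖A k‖ ≤ C * (W * l ^ 2) ^ (k + 1) := by
  induction k using Nat.strong_induction_on with
  | _ k ih =>
  choose! D hD1 hD using ih
  refine ⟨Cj (k + 1) + ∑ i ∈ range k, (k.choose i : ℝ) * D i * Cj (k - i), ?_, ?_⟩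
  · have : 0 ≤ ∑ i ∈ range k, (k.choose i : ℝ) * D i * Cj (k - i) := by
      refine sum_nonneg fun i hi => ?_
      have := hD1 i (mem_range.1 hi)
      have := hC (k - i)
      positivity
    linarith [hC (k + 1)]
  intro A L W l hW hl hL0 hL hid
  have h1 := hid k
  rw [sum_range_succ] at h1
  simp only [Nat.choose_self, Nat.cast_one, one_mul, Nat.sub_self] at h1
  have h2 : A k * L 0 = L (k + 1) - ∑ i ∈ range k, (k.choose i : ℂ) * A i * L (k - i) := by rw [← h1]; ring
  have h3 : ‖A k‖ ≤ W * ‖A k * L 0‖ := by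
    rw [norm_mul]
    calc ‖A k‖ = ‖A k‖ * 1 := (mul_one _).symm
      _ ≤ ‖A k‖ * (W * ‖L 0‖) := by gcongr
      _ = _ := by ring
  refine h3.trans ?_
  rw [h2]
  have hWl : 0 ≤ W ^ k * l ^ (2 * k + 2) := by positivity
  have h4 : ‖L (k + 1)‖ ≤ Cj (k + 1) * (W ^ k * l ^ (2 * k + 2)) := by
    refine (hL (k + 1)).trans ?_
    have := hC (k + 1)
    gcongr
    calc l ^ (k + 1 + 1) ≤ l ^ (2 * k + 2) := pow_le_pow_right₀ hl (by omega)
      _ ≤ _ := le_mul_of_one_le_left (by positivity) (one_le_pow₀ hW)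
  have h5 : ∀ i ∈ range k, ‖(k.choose i : ℂ) * A i * L (k - i)‖ ≤
      (k.choose i : ℝ) * D i * Cj (k - i) * (W ^ k * l ^ (2 * k + 2)) := by
    intro i hi
    have hik := mem_range.1 hi
    rw [norm_mul, norm_mul, Complex.norm_natCast]
    have h6 := hD i hik A L W l hW hl hL0 hL hid
    have h7 := hL (k - i)
    have := hD1 i hik
    have := hC (k - i)
    calc _ ≤ (k.choose i : ℝ) * (D i * (W * l ^ 2) ^ (i + 1)) * (Cj (k - i) * l ^ (k - i + 1)) := by gcongr
      _ = (k.choose i : ℝ) * D i * Cj (k - i) * (W ^ (i + 1) * l ^ (2 * (i + 1) + (k - i + 1))) := by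
          rw [mul_pow, ← pow_mul, pow_add l]; ring
      _ ≤ _ := by
          exact mul_le_mul_of_nonneg_left (mul_le_mul (pow_le_pow_right₀ hW (by omega))
            (pow_le_pow_right₀ hl (by omega)) (by positivity) (by positivity)) (by positivity)
  have h8 : ‖L (k + 1) - ∑ i ∈ range k, (k.choose i : ℂ) * A i * L (k - i)‖ ≤
      (Cj (k + 1) + ∑ i ∈ range k, (k.choose i : ℝ) * D i * Cj (k - i)) * (W ^ k * l ^ (2 * k + 2)) := by
    refine (norm_sub_le _ _).trans ?_
    rw [add_mul, sum_mul]
    exact add_le_add h4 ((norm_sum_le _ _).trans (sum_le_sum h5))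
  calc _ ≤ W * ((Cj (k + 1) + ∑ i ∈ range k, (k.choose i : ℝ) * D i * Cj (k - i)) * (W ^ k * l ^ (2 * k + 2))) := by gcongr
    _ = _ := by rw [mul_pow, ← pow_mul]; ring

lemma ell_pow_le (m : ℕ) (hm : 0 < m) : ∃ C : ℝ, 1 ≤ C ∧ ∀ (r : ℕ) (_ : 0 < r) (t : ℝ),
    ell r t ^ m ≤ C * log (r + 2) ^ m * (1 + |t|) ^ (1 / 2 : ℝ) := by
  refine ⟨4 ^ m * (2 * m) ^ m * 3, ?_, ?_⟩
  · have h1 : (1:ℝ) ≤ 4 ^ m := one_le_pow₀ (by norm_num)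
    have hm' : (1:ℝ) ≤ m := by exact_mod_cast hm
    have h2 : (1:ℝ) ≤ (2 * m) ^ m := one_le_pow₀ (by linarith)
    nlinarith
  intro r hr t
  have hr1 : (1:ℝ) ≤ r := by exact_mod_cast hr
  have he3 : exp 1 ≤ 3 := by have := exp_one_lt_d9; linarith
  set y := |t| + 3 with hy
  have hy3 : 3 ≤ y := by rw [hy]; linarith [abs_nonneg t]
  have hly : 1 ≤ log y := by rw [le_log_iff_exp_le (by linarith)]; linarith
  have hlr : 1 ≤ log (r + 2) := by rw [le_log_iff_exp_le (by linarith)]; linarith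
  have h1 : ell r t ≤ 4 * log (r + 2) * log y := by
    have : ell r t = log (3 * r) + log y := by unfold ell; rw [log_mul (by positivity) (by positivity)]
    have h2 : log (3 * r) ≤ 3 * log (r + 2) := by
      have e : 3 * log ((r:ℝ) + 2) = log (((r:ℝ) + 2) ^ 3) := by rw [log_pow]; norm_num
      rw [e]
      apply log_le_log (by positivity)
      nlinarith [sq_nonneg (r:ℝ), pow_pos (by linarith : (0:ℝ) < r) 3]
    nlinarith
  have hm0 : (0:ℝ) < m := by exact_mod_cast hm
  have h3 : log y ^ m ≤ (2 * m) ^ m * y ^ (1 / 2 : ℝ) := by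
    have h4 := Real.log_le_rpow_div (x := y) (by linarith) (ε := 1 / (2 * m)) (by positivity)
    calc log y ^ m ≤ (y ^ (1 / (2 * m) : ℝ) / (1 / (2 * m))) ^ m := by gcongr
      _ = (2 * m) ^ m * (y ^ (1 / (2 * m) : ℝ)) ^ m := by rw [div_div_eq_mul_div, div_one, mul_pow]; ring
      _ = _ := by
        rw [← rpow_natCast (y ^ (1 / (2 * m) : ℝ)), ← rpow_mul (by linarith)]
        congr 2; field_simp
  have h5 : y ^ (1 / 2 : ℝ) ≤ 3 * (1 + |t|) ^ (1 / 2 : ℝ) := by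
    have h7 : (3:ℝ) ^ (1 / 2 : ℝ) ≤ 3 := by
      calc (3:ℝ) ^ (1 / 2 : ℝ) ≤ 3 ^ (1:ℝ) := Real.rpow_le_rpow_of_exponent_le (by norm_num) (by norm_num)
        _ = 3 := Real.rpow_one _
    calc y ^ (1 / 2 : ℝ) ≤ (3 * (1 + |t|)) ^ (1 / 2 : ℝ) := by
          gcongr; rw [hy]; linarith [abs_nonneg t]
      _ = 3 ^ (1 / 2 : ℝ) * (1 + |t|) ^ (1 / 2 : ℝ) := Real.mul_rpow (by norm_num) (by positivity)
      _ ≤ _ := by gcongr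
  have h0 := one_le_ell r hr t
  calc ell r t ^ m ≤ (4 * log (r + 2) * log y) ^ m := by gcongr
    _ = 4 ^ m * log (r + 2) ^ m * log y ^ m := by rw [mul_pow, mul_pow]
    _ ≤ 4 ^ m * log (r + 2) ^ m * ((2 * m) ^ m * (3 * (1 + |t|) ^ (1 / 2 : ℝ))) := by
        gcongr
        exact h3.trans (by gcongr)
    _ = _ := by ring

/-- the lower-bound parameter for a real character -/
def Good (r : ℕ) (χ : DirichletCharacter ℂ r) (b0 : ℝ) : Prop :=
  χ ^ 2 = 1 → ∀ x : ℝ, 0 < x → x ≤ 1 → 1 ≤ b0 * ‖Lj 0 r χ (1 + x)‖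

lemma Ak_bound (k : ℕ) : ∃ C : ℝ, 1 ≤ C ∧ ∀ (r : ℕ) (_ : 0 < r) (χ : DirichletCharacter ℂ r) (b0 : ℝ),
    χ ≠ 1 → 1 ≤ b0 → Good r χ b0 → ∀ s : ℂ, 1 < s.re → s.re ≤ 2 →
    ‖Ak k r χ s‖ ≤ C * (b0 * log (r + 2) ^ 10) ^ (k + 1) * (1 + |s.im|) ^ (1 / 2 : ℝ) := by
  choose Cj hCj hLj using Lj_bound
  obtain ⟨C1, hC1, hrec⟩ := rec_bound Cj hCj k
  obtain ⟨C2, hC2, hlow⟩ := L_lower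
  obtain ⟨C3, hC3, hell⟩ := ell_pow_le (10 * (k + 1)) (by omega)
  refine ⟨C1 * C2 ^ (k + 1) * C3, one_le_mul_of_one_le_of_one_le (one_le_mul_of_one_le_of_one_le hC1 (one_le_pow₀ hC2)) hC3, ?_⟩
  intro r hr χ b0 hχ hb0 hgood s hs1 hs2
  have hl1 := one_le_ell r hr s.im
  set l := ell r s.im
  have hs : s = 1 + ((s.re - 1 : ℝ) : ℂ) + Complex.I * (s.im : ℂ) := by apply Complex.ext <;> simp
  have h1 := hlow r hr χ b0 hχ hb0 hgood (s.re - 1) s.im (by linarith) (by linarith)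
  rw [← hs] at h1
  have h2 := hrec (fun i => Ak i r χ s) (fun i => Lj i r χ s) (C2 * b0 * l ^ 8) l
    (one_le_mul_of_one_le_of_one_le (one_le_mul_of_one_le_of_one_le hC2 hb0) (one_le_pow₀ hl1)) hl1 h1
    (fun j => hLj j r hr χ s hχ hs1 hs2) (fun k => Ak_leibniz k r χ s hs1)
  refine h2.trans ?_
  calc C1 * (C2 * b0 * l ^ 8 * l ^ 2) ^ (k + 1) = C1 * C2 ^ (k + 1) * b0 ^ (k + 1) * l ^ (10 * (k + 1)) := by
        rw [mul_assoc (C2 * b0), ← pow_add, mul_pow, mul_pow, ← pow_mul]; ring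
    _ ≤ C1 * C2 ^ (k + 1) * b0 ^ (k + 1) * (C3 * log (r + 2) ^ (10 * (k + 1)) * (1 + |s.im|) ^ (1 / 2 : ℝ)) := by
        gcongr
        exact hell r hr s.im
    _ = _ := by rw [mul_pow b0, ← pow_mul]; ring

lemma hasProd_Lj (r : ℕ) (χ : DirichletCharacter ℂ r) (s : ℂ) (hs : 1 < s.re) :
    HasProd (fun p : Nat.Primes => (1 - χ ((p : ℕ) : ZMod r) * ((p : ℕ) : ℂ) ^ (-s))⁻¹) (Lj 0 r χ s) := by
  have := DirichletCharacter.LSeries_eulerProduct_hasProd χ hs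
  rw [Lj_zero]
  exact this

lemma hasProd_norm_ge {ι : Type*} (f : ι → ℂ) (a : ℂ) (h : HasProd f a) (hf : ∀ i, 1 ≤ ‖f i‖) : 1 ≤ ‖a‖ := by
  refine ge_of_tendsto ((continuous_norm.tendsto a).comp h) (Eventually.of_forall fun S => ?_)
  simp only [Function.comp]
  rw [norm_prod]
  exact prod_induction _ (fun t => 1 ≤ t) (fun a b ha hb => one_le_mul_of_one_le_of_one_le ha hb) le_rfl (fun i _ => hf i)

lemma prime_cpow_real (p : Nat.Primes) (x : ℝ) (hx : 0 < x) :
    ∃ u : ℝ, 0 < u ∧ u ≤ 1 / 2 ∧ ((p : ℕ) : ℂ) ^ (-(1 + x : ℂ)) = (u : ℂ) := by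
  refine ⟨((p : ℕ) : ℝ) ^ (-(1 + x)), ?_, ?_, ?_⟩
  · have := p.2.pos
    positivity
  · have h2 : (2:ℝ) ≤ (p : ℕ) := by exact_mod_cast p.2.two_le
    calc ((p : ℕ) : ℝ) ^ (-(1 + x)) ≤ ((p : ℕ) : ℝ) ^ (-1 : ℝ) :=
          Real.rpow_le_rpow_of_exponent_le (by linarith) (by linarith)
      _ = ((p : ℕ) : ℝ)⁻¹ := rpow_neg_one _
      _ ≤ 1 / 2 := by rw [one_div]; gcongr
  · rw [Complex.ofReal_cpow (by positivity)]
    push_cast; rfl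

lemma one_le_norm_inv (z : ℂ) (hz : z ≠ 0) (h : ‖z‖ ≤ 1) : 1 ≤ ‖z⁻¹‖ := by
  rw [norm_inv]
  exact one_le_inv_iff₀.2 ⟨norm_pos_iff.2 hz, h⟩

lemma factor_ne (w : ℂ) (u : ℝ) (hu : 0 < u) (hu2 : u ≤ 1 / 2) (hw : ‖w‖ ≤ 1) : 1 - w * (u : ℂ) ≠ 0 := by
  intro h
  have h1 : w * (u : ℂ) = 1 := by linear_combination -h
  have : ‖w * (u : ℂ)‖ ≤ 1 * u := by rw [norm_mul, Complex.norm_real, norm_of_nonneg hu.le]; gcongr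
  rw [h1] at this
  simp at this
  linarith

lemma L_ge : ∃ C : ℝ, 1 ≤ C ∧ ∀ (r : ℕ) (χ : DirichletCharacter ℂ r) (x : ℝ), 0 < x → x ≤ 1 →
    x ≤ C * ‖Lj 0 r χ (1 + x)‖ := by
  obtain ⟨C, hC, h⟩ := L0_real
  refine ⟨C, hC, fun r χ x hx hx1 => ?_⟩
  have hs : 1 < (1 + x : ℂ).re := by simp; exact hx
  have h1 := (hasProd_Lj 1 1 (1 + x) hs).mul (hasProd_Lj r χ (1 + x) hs)
  have h2 := hasProd_norm_ge _ _ h1 (by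
    intro p
    obtain ⟨u, hu, hu2, e⟩ := prime_cpow_real p x hx
    rw [e, ← mul_inv]
    have hw := DirichletCharacter.norm_le_one χ ((p : ℕ) : ZMod r)
    have hone : (1 : DirichletCharacter ℂ 1) ((p : ℕ) : ZMod 1) = 1 := by
      rw [Subsingleton.elim ((p : ℕ) : ZMod 1) 1]; exact map_one _
    rw [hone]
    refine one_le_norm_inv _ (mul_ne_zero (factor_ne _ u hu hu2 (by simp)) (factor_ne _ u hu hu2 hw)) ?_
    have e1 : ‖1 - 1 * (u:ℂ)‖ = 1 - u := by
      rw [one_mul, ← Complex.ofReal_one, ← Complex.ofReal_sub, Complex.norm_real, norm_of_nonneg (by linarith)]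
    have e2 : ‖1 - χ ((p : ℕ) : ZMod r) * (u:ℂ)‖ ≤ 1 + u := by
      refine (norm_sub_le _ _).trans ?_
      rw [norm_mul, Complex.norm_real, norm_of_nonneg hu.le, norm_one]
      nlinarith
    rw [norm_mul, e1]
    nlinarith [norm_nonneg (1 - χ ((p : ℕ) : ZMod r) * (u:ℂ))])
  have h3 := h 1 one_pos 1 (1 + x) hs (by simp; linarith)
  rw [norm_mul] at h2
  have e3 : (1 + x : ℂ).re - 1 = x := by simp
  rw [e3] at h3
  have h4 : 1 ≤ C / x * ‖Lj 0 r χ (1 + x)‖ := h2.trans (by gcongr)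
  calc x = x * 1 := (mul_one _).symm
    _ ≤ x * (C / x * ‖Lj 0 r χ (1 + x)‖) := by gcongr
    _ = _ := by field_simp

/-- product of two characters at the level of the product of moduli -/
def prodChar (r₁ r₂ : ℕ) (χ₁ : DirichletCharacter ℂ r₁) (χ₂ : DirichletCharacter ℂ r₂) :
    DirichletCharacter ℂ (r₁ * r₂) :=
  DirichletCharacter.changeLevel (dvd_mul_right r₁ r₂) χ₁ * DirichletCharacter.changeLevel (dvd_mul_left r₂ r₁) χ₂

lemma prodChar_apply (r₁ r₂ : ℕ) (χ₁ : DirichletCharacter ℂ r₁) (χ₂ : DirichletCharacter ℂ r₂) (n : ℕ) :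
    prodChar r₁ r₂ χ₁ χ₂ (n : ZMod (r₁ * r₂)) = χ₁ (n : ZMod r₁) * χ₂ (n : ZMod r₂) := by
  by_cases h : IsUnit (n : ZMod (r₁ * r₂))
  · unfold prodChar
    rw [MulChar.mul_apply]
    have e1 := DirichletCharacter.changeLevel_eq_cast_of_dvd χ₁ (dvd_mul_right r₁ r₂) h.unit
    have e2 := DirichletCharacter.changeLevel_eq_cast_of_dvd χ₂ (dvd_mul_left r₂ r₁) h.unit
    rw [IsUnit.unit_spec] at e1 e2
    rw [e1, e2, ZMod.cast_natCast (dvd_mul_right r₁ r₂), ZMod.cast_natCast (dvd_mul_left r₂ r₁)]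
  · rw [MulChar.map_nonunit _ h]
    rw [ZMod.isUnit_iff_coprime] at h
    have : ¬ n.Coprime r₁ ∨ ¬ n.Coprime r₂ := by
      by_contra! hh
      exact h (Nat.Coprime.mul_right hh.1 hh.2)
    rcases this with h | h
    · rw [MulChar.map_nonunit χ₁ (by rwa [ZMod.isUnit_iff_coprime]), zero_mul]
    · rw [MulChar.map_nonunit χ₂ (by rwa [ZMod.isUnit_iff_coprime]), mul_zero]

lemma real_vals (r : ℕ) (χ : DirichletCharacter ℂ r) (h : χ ^ 2 = 1) (a : ZMod r) :
    χ a = 0 ∨ χ a = 1 ∨ χ a = -1 := MulChar.isQuadratic_iff_sq_eq_one.mpr h a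

lemma landau_prod (r₁ r₂ : ℕ) (χ₁ : DirichletCharacter ℂ r₁) (χ₂ : DirichletCharacter ℂ r₂)
    (h₁ : χ₁ ^ 2 = 1) (h₂ : χ₂ ^ 2 = 1) (x : ℝ) (hx : 0 < x) :
    1 ≤ ‖Lj 0 1 1 (1 + x)‖ * ‖Lj 0 r₁ χ₁ (1 + x)‖ * ‖Lj 0 r₂ χ₂ (1 + x)‖ *
      ‖Lj 0 (r₁ * r₂) (prodChar r₁ r₂ χ₁ χ₂) (1 + x)‖ := by
  have hs : 1 < (1 + x : ℂ).re := by simp; exact hx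
  have h := (((hasProd_Lj 1 1 (1 + x) hs).mul (hasProd_Lj r₁ χ₁ (1 + x) hs)).mul
    (hasProd_Lj r₂ χ₂ (1 + x) hs)).mul (hasProd_Lj (r₁ * r₂) (prodChar r₁ r₂ χ₁ χ₂) (1 + x) hs)
  rw [← norm_mul, ← norm_mul, ← norm_mul]
  refine hasProd_norm_ge _ _ h fun p => ?_
  obtain ⟨u, hu, hu2, e⟩ := prime_cpow_real p x hx
  have hone : (1 : DirichletCharacter ℂ 1) ((p : ℕ) : ZMod 1) = 1 := by
    rw [Subsingleton.elim ((p : ℕ) : ZMod 1) 1]; exact map_one _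
  rw [e, prodChar_apply, hone, ← mul_inv, ← mul_inv, ← mul_inv]
  have key : ∀ a b : ℝ, (a = 0 ∨ a = 1 ∨ a = -1) → (b = 0 ∨ b = 1 ∨ b = -1) →
      1 ≤ ‖((1 - 1 * (u:ℂ)) * (1 - (a:ℂ) * (u:ℂ)) * (1 - (b:ℂ) * (u:ℂ)) * (1 - (a:ℂ) * (b:ℂ) * (u:ℂ)))⁻¹‖ := by
    intro a b ha hb
    have : ((1 - 1 * (u:ℂ)) * (1 - (a:ℂ) * (u:ℂ)) * (1 - (b:ℂ) * (u:ℂ)) * (1 - (a:ℂ) * (b:ℂ) * (u:ℂ))) =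
      (((1 - 1 * u) * (1 - a * u) * (1 - b * u) * (1 - a * b * u) : ℝ) : ℂ) := by push_cast; ring
    rw [this]
    have h5 : 0 < (1 - 1 * u) * (1 - a * u) * (1 - b * u) * (1 - a * b * u) ∧
        (1 - 1 * u) * (1 - a * u) * (1 - b * u) * (1 - a * b * u) ≤ 1 := by
      have hv : 0 < 1 - u := by linarith
      have hv' : 1 - u ≤ 1 := by linarith
      have hw : 0 < 1 - u ^ 2 := by nlinarith
      have hw' : 1 - u ^ 2 ≤ 1 := by nlinarith
      have hq2 : (1 - u) ^ 2 ≤ 1 := pow_le_one₀ hv.le hv'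
      have hq4 : (1 - u) ^ 4 ≤ 1 := pow_le_one₀ hv.le hv'
      have hw2 : (1 - u ^ 2) ^ 2 ≤ 1 := pow_le_one₀ hw.le hw'
      have p2 := pow_pos hv 2
      have p4 := pow_pos hv 4
      have pw := pow_pos hw 2
      rcases ha with rfl | rfl | rfl <;> rcases hb with rfl | rfl | rfl <;> ring_nf at * <;>
        constructor <;> linarith
    rw [norm_inv, Complex.norm_real, norm_of_nonneg h5.1.le]
    exact one_le_inv_iff₀.2 h5
  have conv : ∀ w : ℂ, (w = 0 ∨ w = 1 ∨ w = -1) → ∃ a : ℝ, (a = 0 ∨ a = 1 ∨ a = -1) ∧ w = (a:ℂ) := by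
    rintro w (rfl | rfl | rfl)
    · exact ⟨0, by simp⟩
    · exact ⟨1, by simp⟩
    · exact ⟨-1, by simp⟩
  obtain ⟨a, ha, ea⟩ := conv _ (real_vals r₁ χ₁ h₁ ((p : ℕ) : ZMod r₁))
  obtain ⟨b, hb, eb⟩ := conv _ (real_vals r₂ χ₂ h₂ ((p : ℕ) : ZMod r₂))
  rw [ea, eb]
  exact key a b ha hb

lemma Lj_lip : ∃ C : ℝ, 1 ≤ C ∧ ∀ (r : ℕ) (_ : 0 < r) (χ : DirichletCharacter ℂ r), χ ≠ 1 → ∀ x y : ℝ,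
    0 < x → x ≤ 1 → 0 < y → y ≤ 1 →
    ‖Lj 0 r χ (1 + x)‖ ≤ ‖Lj 0 r χ (1 + y)‖ + C * ell r 0 ^ 2 * |x - y| := by
  obtain ⟨C, hC, h⟩ := Lj_bound 1
  refine ⟨C, hC, fun r hr χ hχ x y hx hx1 hy hy1 => ?_⟩
  have hd : ∀ t ∈ Set.Ioc (0:ℝ) 1, HasDerivWithinAt (fun t : ℝ => Lj 0 r χ (1 + t)) (- Lj 1 r χ (1 + t)) (Set.Ioc 0 1) t := by
    intro t ht
    have h1 := Lj_hasDerivAt r χ (1 + t) (by simp; exact ht.1)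
    have h2 : HasDerivAt (fun t : ℝ => (1 + t : ℂ)) 1 t := by
      simpa using (Complex.ofRealCLM.hasDerivAt (x := t)).const_add 1
    have h3 := h1.comp t h2
    simp only [mul_one] at h3
    exact h3.hasDerivWithinAt
  have hb : ∀ t ∈ Set.Ioc (0:ℝ) 1, ‖- Lj 1 r χ (1 + t)‖ ≤ C * ell r 0 ^ 2 := by
    intro t ht
    rw [norm_neg]
    have := h r hr χ (1 + t) hχ (by simp; exact ht.1) (by simp; linarith [ht.2])
    simpa using this
  have h5 := Convex.norm_image_sub_le_of_norm_hasDerivWithin_le hd hb (convex_Ioc 0 1) ⟨hy, hy1⟩ ⟨hx, hx1⟩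
  rw [norm_eq_abs] at h5
  have h6 := norm_sub_norm_le (Lj 0 r χ (1 + x)) (Lj 0 r χ (1 + y))
  linarith

/-- Landau: two distinct real characters cannot both have small `L`. -/
lemma landau : ∃ C : ℝ, 1 ≤ C ∧ ∀ (r₁ r₂ : ℕ) (_ : 0 < r₁) (_ : 0 < r₂) (χ₁ : DirichletCharacter ℂ r₁)
    (χ₂ : DirichletCharacter ℂ r₂), χ₁ ≠ 1 → χ₂ ≠ 1 → prodChar r₁ r₂ χ₁ χ₂ ≠ 1 →
    Good r₁ χ₁ (C * ell (r₁ * r₂) 0 ^ 5) ∨ Good r₂ χ₂ (C * ell (r₁ * r₂) 0 ^ 5) := by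
  obtain ⟨C1, hC1, hge⟩ := L_ge
  obtain ⟨C2, hC2, hlip⟩ := Lj_lip
  obtain ⟨C3, hC3, hz⟩ := L0_real
  obtain ⟨C4, hC4, hL⟩ := Lj_bound 0
  set K := (1 + (1 + C1) * C2) with hK
  have hK1 : 1 ≤ K := by rw [hK]; nlinarith
  refine ⟨2 * C3 * K ^ 2 * C4, ?_, ?_⟩
  · have : 1 ≤ C3 * K ^ 2 * C4 := one_le_mul_of_one_le_of_one_le (one_le_mul_of_one_le_of_one_le hC3 (one_le_pow₀ hK1)) hC4
    linarith
  intro r₁ r₂ hr1 hr2 χ₁ χ₂ hχ1 hχ2 hχ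
  by_contra! hh
  obtain ⟨hb1, hb2⟩ := hh
  unfold Good at hb1 hb2
  push Not at hb1 hb2
  obtain ⟨q1, x1, hx1, hx1', hs1⟩ := hb1
  obtain ⟨q2, x2, hx2, hx2', hs2⟩ := hb2
  have hl0 := one_le_ell (r₁ * r₂) (by positivity) 0
  have hl1 : ell r₁ 0 ≤ ell (r₁ * r₂) 0 := by
    unfold ell
    apply log_le_log (by positivity)
    have : (1:ℝ) ≤ r₂ := by exact_mod_cast hr2
    have : (0:ℝ) < r₁ := by exact_mod_cast hr1
    push_cast
    simp only [abs_zero]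
    nlinarith
  have hl2 : ell r₂ 0 ≤ ell (r₁ * r₂) 0 := by
    unfold ell
    apply log_le_log (by positivity)
    have : (1:ℝ) ≤ r₁ := by exact_mod_cast hr1
    have : (0:ℝ) < r₂ := by exact_mod_cast hr2
    push_cast
    simp only [abs_zero]
    nlinarith
  have hl10 := one_le_ell r₁ hr1 0
  have hl20 := one_le_ell r₂ hr2 0
  set l := ell (r₁ * r₂) 0
  have hD0 : 0 < C3 * K ^ 2 * C4 := by positivity
  have hbig : 1 ≤ 2 * (C3 * K ^ 2 * C4) * l ^ 5 := by
    have : 1 ≤ C3 * K ^ 2 * C4 := one_le_mul_of_one_le_of_one_le (one_le_mul_of_one_le_of_one_le hC3 (one_le_pow₀ hK1)) hC4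
    have h5 : 1 ≤ l ^ 5 := one_le_pow₀ hl0
    nlinarith
  set η := (2 * (C3 * K ^ 2 * C4) * l ^ 5)⁻¹ with hη
  have hη0 : 0 < η := by positivity
  have hη1 : η ≤ 1 := inv_le_one_of_one_le₀ hbig
  have main : ∀ (r : ℕ) (_ : 0 < r) (χ : DirichletCharacter ℂ r) (x : ℝ), χ ≠ 1 → 0 < x → x ≤ 1 → ell r 0 ≤ l → 1 ≤ ell r 0 →
      2 * C3 * K ^ 2 * C4 * l ^ 5 * ‖Lj 0 r χ (1 + x)‖ < 1 → ‖Lj 0 r χ (1 + η)‖ ≤ K * l ^ 2 * η := by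
    intro r hr χ x hχ hx hx' hl hl' hs
    have h1 : ‖Lj 0 r χ (1 + x)‖ ≤ η := by rw [hη, ← one_div, le_div_iff₀ (by positivity)]; linarith
    have h2 := hge r χ x hx hx'
    have h3 := hlip r hr χ hχ η x hη0 hη1 hx hx'
    have h4 : x ≤ C1 * η := h2.trans (by gcongr)
    have h5 : |η - x| ≤ (1 + C1) * η := by rw [abs_le]; constructor <;> nlinarith
    have h6 : ell r 0 ^ 2 ≤ l ^ 2 := by gcongr
    have h7 : C2 * ell r 0 ^ 2 * |η - x| ≤ C2 * l ^ 2 * ((1 + C1) * η) := by gcongr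
    have h8 : η ≤ l ^ 2 * η := le_mul_of_one_le_left hη0.le (one_le_pow₀ hl0)
    calc _ ≤ η + C2 * l ^ 2 * ((1 + C1) * η) := by linarith
      _ ≤ l ^ 2 * η + C2 * l ^ 2 * ((1 + C1) * η) := by linarith
      _ = _ := by rw [hK]; ring
  have m1 := main r₁ hr1 χ₁ x1 hχ1 hx1 hx1' hl1 hl10 hs1
  have m2 := main r₂ hr2 χ₂ x2 hχ2 hx2 hx2' hl2 hl20 hs2
  have m3 := landau_prod r₁ r₂ χ₁ χ₂ q1 q2 η hη0
  have hs : 1 < (1 + η : ℂ).re := by simp; exact hη0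
  have hs' : (1 + η : ℂ).re ≤ 2 := by simp; linarith
  have m4 := hz 1 one_pos 1 (1 + η) hs hs'
  have m5 := hL (r₁ * r₂) (by positivity) _ (1 + η) hχ hs hs'
  have e3 : (1 + η : ℂ).re - 1 = η := by simp
  have e4 : (1 + η : ℂ).im = 0 := by simp
  rw [e3] at m4
  rw [e4, zero_add, pow_one] at m5
  have m6 : 1 ≤ C3 / η * (K * l ^ 2 * η) * (K * l ^ 2 * η) * (C4 * l) := m3.trans (by gcongr)
  have m7 : C3 / η * (K * l ^ 2 * η) * (K * l ^ 2 * η) * (C4 * l) = (C3 * K ^ 2 * C4) * l ^ 5 * η := by field_simp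
  have m8 : (C3 * K ^ 2 * C4) * l ^ 5 * η = 1 / 2 := by rw [hη]; field_simp
  linarith

lemma abel_id (C G : ℕ → ℝ) (N : ℕ) : ∑ i ∈ range (N + 1), C i * G i =
    G N * ∑ i ∈ range (N + 1), C i + ∑ i ∈ range N, (G i - G (i + 1)) * ∑ j ∈ range (i + 1), C j := by
  induction N with
  | zero => simp [mul_comm]
  | succ N ih =>
    have e1 := sum_range_succ (fun i => C i * G i) (N + 1)
    have e2 := sum_range_succ C (N + 1)
    have e3 := sum_range_succ (fun i => (G i - G (i + 1)) * ∑ j ∈ range (i + 1), C j) N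
    rw [e1, ih, e3, e2]
    ring

lemma abel_bd (C G : ℕ → ℝ) (B : ℝ) (hG : ∀ i, G (i + 1) ≤ G i) (hG0 : ∀ i, 0 ≤ G i)
    (hB : ∀ n, |∑ i ∈ range n, C i| ≤ B) (N : ℕ) : |∑ i ∈ range N, C i * G i| ≤ B * G 0 := by
  have hB0 : 0 ≤ B := (abs_nonneg _).trans (hB 0)
  cases N with
  | zero => simpa using mul_nonneg hB0 (hG0 0)
  | succ N =>
    rw [abel_id]
    refine (abs_add_le _ _).trans ?_
    have h1 : |G N * ∑ i ∈ range (N + 1), C i| ≤ G N * B := by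
      rw [abs_mul, abs_of_nonneg (hG0 N)]; exact mul_le_mul_of_nonneg_left (hB _) (hG0 N)
    have h2 : |∑ i ∈ range N, (G i - G (i + 1)) * ∑ j ∈ range (i + 1), C j| ≤ ∑ i ∈ range N, (G i - G (i + 1)) * B := by
      refine (abs_sum_le_sum_abs _ _).trans (sum_le_sum fun i _ => ?_)
      rw [abs_mul, abs_of_nonneg (by linarith [hG i])]
      exact mul_le_mul_of_nonneg_left (hB _) (by linarith [hG i])
    rw [← sum_mul, sum_range_sub' G] at h2
    nlinarith

/-- AM-GM for geometric sums, squared form -/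
lemma geom_amgm (t : ℝ) (n : ℕ) : (n + 1 : ℝ) * t ^ n ≤ ∑ i ∈ range (n + 1), (t ^ 2) ^ i := by
  have h1 : ∑ i ∈ range (n + 1), (t ^ 2) ^ (n + 1 - 1 - i) = ∑ i ∈ range (n + 1), (t ^ 2) ^ i :=
    sum_range_reflect (fun i => (t ^ 2) ^ i) (n + 1)
  have h2 : ∑ i ∈ range (n + 1), (2 * t ^ n) ≤ ∑ i ∈ range (n + 1), ((t ^ 2) ^ (n + 1 - 1 - i) + (t ^ 2) ^ i) := by
    refine sum_le_sum fun i hi => ?_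
    have hi' : i ≤ n := by have := mem_range.1 hi; omega
    have e : t ^ n = t ^ (n - i) * t ^ i := by rw [← pow_add]; congr 1; omega
    have e1 : n + 1 - 1 - i = n - i := by omega
    rw [e, e1, ← pow_mul, ← pow_mul, mul_comm 2 (n - i), mul_comm 2 i, pow_mul, pow_mul]
    nlinarith [sq_nonneg (t ^ (n - i) - t ^ i)]
  rw [sum_add_distrib, h1, sum_const, card_range, nsmul_eq_mul] at h2
  push_cast at h2
  nlinarith

def gl (q : ℝ) (i : ℕ) : ℝ := 1 / (((i:ℝ) + 1) * (1 - q)) - q ^ (i + 1) / (1 - q ^ (i + 1))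

lemma gl_anti (q : ℝ) (hq0 : 0 < q) (hq1 : q < 1) (i : ℕ) : gl q (i + 1) ≤ gl q i := by
  obtain ⟨t, ht0, rfl⟩ : ∃ t : ℝ, 0 ≤ t ∧ t ^ 2 = q := ⟨√q, sqrt_nonneg q, Real.sq_sqrt hq0.le⟩
  have ht1 : t ≤ 1 := by nlinarith
  have h1 := geom_amgm t i
  have h2 := geom_amgm t (i + 1)
  have e1 := mul_neg_geom_sum (t ^ 2) (i + 1)
  have e2 := mul_neg_geom_sum (t ^ 2) (i + 1 + 1)
  set S1 := ∑ j ∈ range (i + 1), (t ^ 2) ^ j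
  set S2 := ∑ j ∈ range (i + 1 + 1), (t ^ 2) ^ j
  set q := t ^ 2 with hq
  have hv : 0 < 1 - q := by linarith
  have hti : 0 < t := lt_of_le_of_ne ht0 (by rintro rfl; simp [hq] at hq0)
  have hS1 : 0 < S1 := lt_of_lt_of_le (by positivity) h1
  have hS2 : 0 < S2 := lt_of_lt_of_le (by positivity) h2
  have hprod : ((i:ℝ) + 1) * (i + 2) * q ^ (i + 1) ≤ S1 * S2 := by
    calc ((i:ℝ) + 1) * (i + 2) * q ^ (i + 1) ≤ ((i:ℝ) + 1) * (i + 2) * (t ^ (2 * i + 1)) := by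
          gcongr
          rw [hq, ← pow_mul]
          exact pow_le_pow_of_le_one ht0 ht1 (by omega)
      _ = (((i:ℝ) + 1) * t ^ i) * ((((i + 1 : ℕ) : ℝ) + 1) * t ^ (i + 1)) := by push_cast; ring
      _ ≤ S1 * S2 := mul_le_mul h1 h2 (by positivity) hS1.le
  have hi : (0:ℝ) < (i:ℝ) + 1 := by positivity
  unfold gl
  rw [← e1, ← e2]
  push_cast
  have hA : 1 / (((i:ℝ) + 1) * (1 - q)) - 1 / (((i:ℝ) + 1 + 1) * (1 - q)) =
      1 / (((i:ℝ) + 1) * (i + 2) * (1 - q)) := by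
    field_simp; ring
  have hB : q ^ (i + 1) / ((1 - q) * S1) - q ^ (i + 1 + 1) / ((1 - q) * S2) = q ^ (i + 1) / ((1 - q) * (S1 * S2)) := by
    have : S2 - q * S1 = 1 := by
      have e3 : (1 - q) * (S2 - q * S1) = (1 - q) * 1 := by rw [mul_sub, e2, mul_left_comm, e1]; ring
      exact mul_left_cancel₀ hv.ne' e3
    rw [div_sub_div _ _ (by positivity) (by positivity), div_eq_div_iff (by positivity) (by positivity)]
    rw [show q ^ (i + 1) * ((1 - q) * S2) - (1 - q) * S1 * q ^ (i + 1 + 1) =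
      (1 - q) * q ^ (i + 1) * (S2 - q * S1) by ring, this]
    ring
  have hC : q ^ (i + 1) / ((1 - q) * (S1 * S2)) ≤ 1 / (((i:ℝ) + 1) * (i + 2) * (1 - q)) := by
    rw [div_le_div_iff₀ (by positivity) (by positivity)]
    nlinarith
  linarith

lemma gl_zero (q : ℝ) (hq1 : q < 1) : gl q 0 = 1 := by
  have : 0 < 1 - q := by linarith
  unfold gl
  simp only [zero_add, pow_one, Nat.cast_zero]
  field_simp

lemma gl_nonneg (q : ℝ) (hq0 : 0 < q) (hq1 : q < 1) (i : ℕ) : 0 ≤ gl q i := by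
  unfold gl
  have e1 := mul_neg_geom_sum q (i + 1)
  set S1 := ∑ j ∈ range (i + 1), q ^ j with hS
  have hv : 0 < 1 - q := by linarith
  have h1 : ((i:ℝ) + 1) * q ^ (i + 1) ≤ S1 := by
    have : ∑ j ∈ range (i + 1), q ^ (i + 1) ≤ S1 :=
      sum_le_sum fun j hj => pow_le_pow_of_le_one hq0.le hq1.le (mem_range.1 hj).le
    simpa using this
  have hS1 : 0 < S1 := lt_of_lt_of_le (by positivity) h1
  rw [← e1, sub_nonneg, div_le_div_iff₀ (by positivity) (by positivity)]
  nlinarith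

/-- `x(2+log n)/n`, n = i+1 -/
def psl (x : ℝ) (i : ℕ) : ℝ := x * (2 + log (i + 1)) / (i + 1)
def phl (x : ℝ) (i : ℕ) : ℝ := 1 / ((i:ℝ) + 1) - ((i:ℝ) + 1) ^ (-(1 + x))

lemma psl_nonneg (x : ℝ) (hx : 0 < x) (i : ℕ) : 0 ≤ psl x i := by
  unfold psl
  have : 0 ≤ log ((i:ℝ) + 1) := log_nonneg (by linarith [(Nat.cast_nonneg i : (0:ℝ) ≤ i)])
  positivity

lemma phl_nonneg (x : ℝ) (hx : 0 < x) (i : ℕ) : 0 ≤ phl x i := by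
  unfold phl
  have h1 : (1:ℝ) ≤ (i:ℝ) + 1 := by linarith [(Nat.cast_nonneg i : (0:ℝ) ≤ i)]
  rw [sub_nonneg, one_div, ← rpow_neg_one]
  exact Real.rpow_le_rpow_of_exponent_le h1 (by linarith)

lemma phl_diff (x : ℝ) (hx : 0 < x) (i : ℕ) : |phl x i - phl x (i + 1)| ≤ psl x i - psl x (i + 1) := by
  set n : ℝ := (i:ℝ) + 1 with hn
  have h1 : (1:ℝ) ≤ n := by linarith [(Nat.cast_nonneg i : (0:ℝ) ≤ i)]
  have hn0 : 0 < n := by linarith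
  set P := n ^ (-x) with hP
  set Q := (n + 1) ^ (-x) with hQ
  have eP : n ^ (-(1 + x)) = P / n := by rw [neg_add, rpow_add hn0, rpow_neg_one, hP]; field_simp
  have eQ : (n + 1) ^ (-(1 + x)) = Q / (n + 1) := by rw [neg_add, rpow_add (by linarith), rpow_neg_one, hQ]; field_simp
  have e1 : phl x i = 1 / n - P / n := by unfold phl; rw [← hn, eP]
  have e2 : phl x (i + 1) = 1 / (n + 1) - Q / (n + 1) := by unfold phl; push_cast; rw [← hn, eQ]
  have hP1 : P ≤ 1 := Real.rpow_le_one_of_one_le_of_nonpos h1 (by linarith)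
  have hP0 : 0 < P := by positivity
  have hQP : Q ≤ P := Real.rpow_le_rpow_of_nonpos hn0 (by linarith) (by linarith)
  have hlog0 : 0 ≤ log n := log_nonneg h1
  have hP2 : 1 - P ≤ x * log n := by
    rw [hP, rpow_def_of_pos hn0]
    have := add_one_le_exp (log n * -x)
    linarith
  have hll : log (n + 1) ≤ log n + 1 / n := by
    have : log (n + 1) = log n + log (1 + 1 / n) := by
      rw [← log_mul (by positivity) (by positivity)]; congr 1; field_simp
    have h2 := log_le_sub_one_of_pos (x := 1 + 1 / n) (by positivity)
    linarith
  have hQ2 : P - Q ≤ x / n := by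
    have e3 : Q = P * exp ((log (n + 1) - log n) * -x) := by
      rw [hP, hQ, rpow_def_of_pos hn0, rpow_def_of_pos (by linarith), ← exp_add]
      congr 1; ring
    have h3 := add_one_le_exp ((log (n + 1) - log n) * -x)
    have h4 : (log (n + 1) - log n) * x ≤ x / n := by
      have : log (n + 1) - log n ≤ 1 / n := by linarith
      calc _ ≤ 1 / n * x := by gcongr
        _ = _ := by ring
    have h5 : 0 < x / n := by positivity
    rw [e3]
    nlinarith
  have e4 : phl x i - phl x (i + 1) = (1 - P) / (n * (n + 1)) - (P - Q) / (n + 1) := by rw [e1, e2]; field_simp; ring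
  have e5 : psl x i - psl x (i + 1) = x * (2 + log n) / n - x * (2 + log (n + 1)) / (n + 1) := by
    unfold psl; push_cast; rw [← hn]
  have h6 : x * (1 + log n) / (n * (n + 1)) ≤ psl x i - psl x (i + 1) := by
    rw [e5]
    have : x * (2 + log (n + 1)) / (n + 1) ≤ x * (2 + (log n + 1 / n)) / (n + 1) := by gcongr
    have e6 : x * (2 + log n) / n - x * (2 + (log n + 1 / n)) / (n + 1) = x * (1 + log n) / (n * (n + 1)) := by
      field_simp; ring
    linarith
  have h7 : (1 - P) / (n * (n + 1)) ≤ x * log n / (n * (n + 1)) := by gcongr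
  have h8 : (P - Q) / (n + 1) ≤ x / (n * (n + 1)) := by
    calc (P - Q) / (n + 1) ≤ x / n / (n + 1) := by gcongr
      _ = _ := by field_simp
  have h9 : 0 ≤ (1 - P) / (n * (n + 1)) := div_nonneg (by linarith) (by positivity)
  have h10 : 0 ≤ (P - Q) / (n + 1) := div_nonneg (by linarith) (by positivity)
  have e7 : x * (1 + log n) / (n * (n + 1)) = x * log n / (n * (n + 1)) + x / (n * (n + 1)) := by ring
  have h11 : 0 ≤ x * log n / (n * (n + 1)) := by positivity
  have h12 : 0 ≤ x / (n * (n + 1)) := by positivity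
  rw [e4, abs_le]
  constructor <;> linarith

lemma phl_sum (C : ℕ → ℝ) (B x : ℝ) (hx : 0 < x) (hB : ∀ n, |∑ i ∈ range n, C i| ≤ B) (N : ℕ) :
    |∑ i ∈ range N, C i * phl x i| ≤ 4 * x * B := by
  have h1 := abel_bd C (fun i => phl x i + psl x i) B (fun i => by
    have := (abs_le.1 (phl_diff x hx i)).1; linarith) (fun i => add_nonneg (phl_nonneg x hx i) (psl_nonneg x hx i)) hB N
  have h2 := abel_bd C (psl x) B (fun i => by
    have := (abs_nonneg _).trans (phl_diff x hx i); linarith) (psl_nonneg x hx) hB N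
  have e1 : phl x 0 = 0 := by unfold phl; simp
  have e2 : psl x 0 = 2 * x := by unfold psl; simp; ring
  simp only [e1, e2, zero_add] at h1 h2
  have e3 : ∑ i ∈ range N, C i * phl x i = ∑ i ∈ range N, C i * (phl x i + psl x i) - ∑ i ∈ range N, C i * psl x i := by
    rw [← sum_sub_distrib]; exact sum_congr rfl fun _ _ => by ring
  rw [e3]
  refine (abs_sub _ _).trans ?_
  linarith

lemma zetaMul_apply' {r : ℕ} (χ : DirichletCharacter ℂ r) (n : ℕ) :
    χ.zetaMul n = ∑ d ∈ n.divisors, χ (d : ZMod r) := by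
  unfold DirichletCharacter.zetaMul
  rw [ArithmeticFunction.coe_zeta_mul_apply]
  refine sum_congr rfl fun d hd => ?_
  exact if_neg (Nat.pos_of_mem_divisors hd).ne'

open scoped ComplexOrder in
lemma zetaMul_sq {r : ℕ} (χ : DirichletCharacter ℂ r) (hχ : χ ^ 2 = 1) (m : ℕ) (hm : 0 < m) :
    1 ≤ (χ.zetaMul (m ^ 2)).re := by
  have key : (0:ℕ) < m → 1 ≤ χ.zetaMul (m ^ 2) := by
    induction m using Nat.recOnPosPrimePosCoprime with
    | zero => intro h; exact absurd h (lt_irrefl _)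
    | one => intro _; simp [χ.isMultiplicative_zetaMul.map_one]
    | prime_pow p n hp hn =>
      intro _
      rw [← pow_mul]
      rw [zetaMul_apply', Nat.sum_divisors_prime_pow hp]
      simp only [Nat.cast_pow, map_pow]
      rcases real_vals r χ hχ (p : ZMod r) with h | h | h
      · rw [h, sum_range_succ']; simp
      · rw [h]
        simp only [one_pow, sum_const, card_range, nsmul_eq_mul, mul_one]
        exact_mod_cast (by omega : 1 ≤ n * 2 + 1)
      · rw [h, neg_one_geom_sum]
        simp [parity_simps]
    | coprime a b ha hb hab iha ihb =>
      intro _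
      rw [mul_pow, χ.isMultiplicative_zetaMul.map_mul_of_coprime (Nat.Coprime.pow 2 2 hab)]
      exact one_le_mul_of_one_le_of_one_le (iha (by omega) (by omega)) (ihb (by omega) (by omega))
  exact (Complex.le_def.1 (key hm)).1

open scoped ComplexOrder in
lemma lambert_lower {r : ℕ} (χ : DirichletCharacter ℂ r) (hχ : χ ^ 2 = 1) (c : ℕ → ℝ) (hc : ∀ n : ℕ, χ (n : ZMod r) = (c n : ℂ))
    (hc1 : ∀ n, |c n| ≤ 1) (q : ℝ) (hq0 : 0 < q) (hq1 : q < 1) (M : ℕ) :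
    Summable (fun i : ℕ => c (i + 1) * (q ^ (i + 1) / (1 - q ^ (i + 1)))) ∧
    ∑ m ∈ Icc 1 M, q ^ (m ^ 2) ≤ ∑' i : ℕ, c (i + 1) * (q ^ (i + 1) / (1 - q ^ (i + 1))) := by
  have hsum : Summable (fun p : ℕ+ × ℕ+ => c p.2 * q ^ (p.1 * p.2 : ℕ)) := by
    refine Summable.of_norm_bounded (g := fun p : ℕ+ × ℕ+ => q ^ (p.1 * p.2 : ℕ)) ?_ ?_
    · have := summable_prod_mul_pow (𝕜 := ℝ) 0 (r := q) (by rw [norm_of_nonneg hq0.le]; exact hq1)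
      simpa using this
    · intro p
      rw [norm_mul, norm_eq_abs, norm_of_nonneg (by positivity)]
      exact mul_le_of_le_one_left (by positivity) (hc1 _)
  have e1 : ∑' p : ℕ+ × ℕ+, c p.2 * q ^ (p.1 * p.2 : ℕ) = ∑' n : ℕ+, (∑ d ∈ (n:ℕ).divisors, c d) * q ^ (n:ℕ) := by
    have hs2 := sigmaAntidiagonalEquivProd.summable_iff.2 hsum
    rw [← sigmaAntidiagonalEquivProd.tsum_eq]
    refine (Summable.tsum_sigma hs2).trans ?_
    refine tsum_congr fun n => ?_
    rw [tsum_fintype]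
    simp only [sigmaAntidiagonalEquivProd, divisorsAntidiagonalFactors, PNat.mk_coe, Equiv.coe_fn_mk, Function.comp, univ_eq_attach]
    rw [(n : ℕ).divisorsAntidiagonal.sum_attach (fun x : ℕ × ℕ => c x.2 * q ^ (x.1 * x.2)), sum_mul,
      Nat.sum_divisorsAntidiagonal' (fun x y => c y * q ^ (x * y))]
    refine sum_congr rfl fun d hd => ?_
    rw [Nat.div_mul_cancel (Nat.dvd_of_mem_divisors hd)]
  have hsum' : Summable (fun n : ℕ+ => (∑ d ∈ (n:ℕ).divisors, c d) * q ^ (n:ℕ)) := by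
    have hs2 := (sigmaAntidiagonalEquivProd.summable_iff.2 hsum).sigma
    refine hs2.congr fun n => ?_
    rw [tsum_fintype]
    simp only [sigmaAntidiagonalEquivProd, divisorsAntidiagonalFactors, PNat.mk_coe, Equiv.coe_fn_mk, Function.comp, univ_eq_attach]
    rw [(n : ℕ).divisorsAntidiagonal.sum_attach (fun x : ℕ × ℕ => c x.2 * q ^ (x.1 * x.2)), sum_mul,
      Nat.sum_divisorsAntidiagonal' (fun x y => c y * q ^ (x * y))]
    refine sum_congr rfl fun d hd => ?_
    rw [Nat.div_mul_cancel (Nat.dvd_of_mem_divisors hd)]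
  have hgeo : ∀ n : ℕ+, ∑' m : ℕ+, c n * q ^ (m * n : ℕ) = c n * (q ^ (n:ℕ) / (1 - q ^ (n:ℕ))) := by
    intro n
    rw [tsum_mul_left]
    congr 1
    have hqn : q ^ (n:ℕ) < 1 := pow_lt_one₀ hq0.le hq1 n.2.ne'
    rw [tsum_pnat_eq_tsum_succ (f := fun m => q ^ (m * n))]
    rw [div_eq_mul_inv, ← tsum_geometric_of_lt_one (by positivity) hqn, ← tsum_mul_left]
    refine tsum_congr fun m => ?_
    rw [← pow_mul, ← pow_add]; congr 1; ring
  have hswap : Summable (fun p : ℕ+ × ℕ+ => c p.1 * q ^ (p.2 * p.1 : ℕ)) := hsum.prod_symm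
  have e2 : ∑' p : ℕ+ × ℕ+, c p.2 * q ^ (p.1 * p.2 : ℕ) = ∑' n : ℕ+, c n * (q ^ (n:ℕ) / (1 - q ^ (n:ℕ))) := by
    rw [← (Equiv.prodComm ℕ+ ℕ+).tsum_eq]
    simp only [Equiv.prodComm_apply, Prod.snd_swap, Prod.fst_swap]
    rw [hswap.tsum_prod]
    exact tsum_congr hgeo
  have hsum3 : Summable (fun n : ℕ+ => c n * (q ^ (n:ℕ) / (1 - q ^ (n:ℕ)))) :=
    hswap.prod.congr hgeo
  have hre : ∀ n : ℕ, 0 < n → ∑ d ∈ n.divisors, c d = (χ.zetaMul n).re := by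
    intro n _
    rw [zetaMul_apply', Complex.re_sum]
    refine sum_congr rfl fun d hd => ?_
    rw [hc, Complex.ofReal_re]
  refine ⟨?_, ?_⟩
  · exact (summable_pnat_iff_summable_succ (f := fun n => c n * (q ^ n / (1 - q ^ n)))).1 hsum3
  rw [← tsum_pnat_eq_tsum_succ (f := fun n => c n * (q ^ n / (1 - q ^ n))), ← e2, e1]
  rw [tsum_pnat_eq_tsum_succ (f := fun n => (∑ d ∈ n.divisors, c d) * q ^ n)]
  have hsum4 := (summable_pnat_iff_summable_succ (f := fun n => (∑ d ∈ n.divisors, c d) * q ^ n)).1 hsum'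
  have hnn : ∀ n : ℕ, 0 ≤ (∑ d ∈ (n + 1).divisors, c d) * q ^ (n + 1) := by
    intro n
    rw [hre (n + 1) (by omega)]
    have := (Complex.le_def.1 (DirichletCharacter.zetaMul_nonneg hχ (n + 1))).1
    exact mul_nonneg this (by positivity)
  refine le_trans ?_ (hsum4.sum_le_tsum ((Icc 1 M).image (fun m => m ^ 2 - 1)) (fun n _ => hnn n))
  rw [sum_image]
  · refine sum_le_sum fun m hm => ?_
    have hm1 := (mem_Icc.1 hm).1
    have : m ^ 2 - 1 + 1 = m ^ 2 := Nat.sub_add_cancel (Nat.one_le_pow _ _ hm1)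
    rw [this, hre _ (by positivity)]
    exact le_mul_of_one_le_left (by positivity) (zetaMul_sq χ hχ m hm1)
  · intro a ha b hb hab
    have ha1 := Nat.one_le_pow 2 a (mem_Icc.1 ha).1
    have hb1 := Nat.one_le_pow 2 b (mem_Icc.1 hb).1
    simp only at hab
    have : a ^ 2 = b ^ 2 := by omega
    exact Nat.pow_left_injective (by norm_num : (2:ℕ) ≠ 0) this

lemma lambert : ∃ C : ℝ, 1 ≤ C ∧ ∀ (r : ℕ) (_ : 0 < r) (χ : DirichletCharacter ℂ r), χ ≠ 1 → Good r χ (C * r ^ 2) := by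
  obtain ⟨C1, hC1, hge⟩ := L_ge
  refine ⟨8192 * C1, by linarith, fun r hr χ hχ h2 x hx hx1 => ?_⟩
  have hr1 : (1:ℝ) ≤ r := by exact_mod_cast hr
  have : NeZero r := ⟨hr.ne'⟩
  rcases lt_or_ge 1 (8192 * x * (r:ℝ) ^ 2) with hlt | hle
  · have := hge r χ x hx hx1
    calc (1:ℝ) ≤ 8192 * x * (r:ℝ) ^ 2 := hlt.le
      _ ≤ 8192 * (C1 * ‖Lj 0 r χ (1 + x)‖) * (r:ℝ) ^ 2 := by gcongr
      _ = _ := by ring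
  have hcr : ∀ n : ℕ, ∃ a : ℝ, χ (n : ZMod r) = (a : ℂ) ∧ |a| ≤ 1 := by
    intro n
    rcases real_vals r χ h2 (n : ZMod r) with h | h | h
    · exact ⟨0, by simp [h], by simp⟩
    · exact ⟨1, by simp [h], by simp⟩
    · exact ⟨-1, by simp [h], by simp⟩
  choose c hc hc1 using hcr
  have hB : ∀ n, |∑ i ∈ range n, c (i + 1)| ≤ 4 * r := by
    intro n
    obtain ⟨κ, -, -, hκ, hE⟩ := char_partial r χ
    have hE' := hE ((n:ℝ) + 1) (by linarith [(Nat.cast_nonneg n : (0:ℝ) ≤ n)])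
    rw [hκ hχ] at hE'
    have e0 : ⌊(n:ℝ) + 1⌋₊ = n + 1 := by exact_mod_cast Nat.floor_natCast (R := ℝ) (n + 1)
    have hE2 : ‖∑ k ∈ Icc 0 n, χ (k : ZMod r)‖ ≤ 3 * r := by
      rcases Nat.eq_zero_or_pos n with rfl | hn
      · simp only [Icc_self, sum_singleton]
        exact (DirichletCharacter.norm_le_one χ _).trans (by linarith)
      · have := hE n (by exact_mod_cast hn)
        rw [hκ hχ] at this
        simpa using this
    have e1 : ∑ k ∈ Icc 0 n, χ (k : ZMod r) = ((c 0 + ∑ i ∈ range n, c (i + 1) : ℝ) : ℂ) := by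
      have : Icc 0 n = range (n + 1) := by ext; simp
      rw [this, sum_range_succ', Complex.ofReal_add, Complex.ofReal_sum, add_comm]
      simp only [hc]
    rw [e1, Complex.norm_real, norm_eq_abs] at hE2
    have h3 := hc1 0
    have h4 : ∑ i ∈ range n, c (i + 1) = (c 0 + ∑ i ∈ range n, c (i + 1)) - c 0 := by ring
    rw [h4]
    refine (abs_sub _ _).trans ?_
    linarith
  set M : ℕ := 32 * r with hM
  have hMr : (M:ℝ) = 32 * r := by rw [hM]; push_cast; ring
  have hM32 : (32:ℝ) ≤ M := by rw [hMr]; linarith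
  set q : ℝ := 1 - 1 / (M:ℝ) ^ 2 with hq
  have hMi : 1 / (M:ℝ) ^ 2 ≤ 1 / 2 := by apply one_div_le_one_div_of_le (by norm_num); nlinarith
  have hMp : 0 < 1 / (M:ℝ) ^ 2 := by positivity
  have hq0 : 0 < q := by rw [hq]; linarith
  have hq1 : q < 1 := by rw [hq]; linarith
  have h1q : 1 - q = 1 / (M:ℝ) ^ 2 := by rw [hq]; ring
  obtain ⟨hs1, hlow⟩ := lambert_lower χ h2 c hc hc1 q hq0 hq1 M
  have hlow2 : 8 * (r:ℝ) ≤ ∑ m ∈ Icc 1 M, q ^ (m ^ 2) := by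
    have hb : (1:ℝ) / 2 ≤ q ^ (512 * r ^ 2) := by
      have := one_add_mul_le_pow (a := - (1 / (M:ℝ) ^ 2)) (by linarith) (512 * r ^ 2)
      have e : 1 + -(1 / (M:ℝ) ^ 2) = q := by rw [hq]; ring
      rw [e] at this
      refine le_trans ?_ this
      push_cast
      rw [hMr]
      have : (r:ℝ) ≠ 0 := by linarith
      field_simp
      norm_num
    have hqM : (1:ℝ) / 4 ≤ q ^ (M ^ 2) := by
      have e : M ^ 2 = 512 * r ^ 2 + 512 * r ^ 2 := by rw [hM]; ring
      rw [e, pow_add]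
      nlinarith
    calc 8 * (r:ℝ) = ∑ m ∈ Icc 1 M, (1:ℝ) / 4 := by
          rw [sum_const, Nat.card_Icc, nsmul_eq_mul]; rw [show M + 1 - 1 = M by omega, hMr]; ring
      _ ≤ _ := by
          refine sum_le_sum fun m hm => hqM.trans (pow_le_pow_of_le_one hq0.le hq1.le ?_)
          exact Nat.pow_le_pow_left (mem_Icc.1 hm).2 2
  have hsL : Summable (fun i : ℕ => c (i + 1) * ((i:ℝ) + 1) ^ (-(1 + x))) := by
    have h1 : Summable (fun i : ℕ => ((i + 1 : ℕ) : ℝ) ^ (-(1 + x))) :=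
      (summable_nat_add_iff 1).2 (Real.summable_nat_rpow.2 (by linarith))
    refine Summable.of_norm_bounded h1 fun i => ?_
    rw [norm_mul, norm_eq_abs, norm_of_nonneg (by positivity)]
    push_cast
    exact mul_le_of_le_one_left (by positivity) (hc1 _)
  have hL : Lj 0 r χ (1 + x) = ((∑' i : ℕ, c (i + 1) * ((i:ℝ) + 1) ^ (-(1 + x)) : ℝ) : ℂ) := by
    rw [Lj_zero]
    unfold LSeries
    have hsm : LSeriesSummable (fun n => χ (n : ZMod r)) (1 + x) :=
      DirichletCharacter.LSeriesSummable_of_one_lt_re χ (by simp; exact hx)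
    rw [hsm.tsum_eq_zero_add, LSeries.term_zero, zero_add, Complex.ofReal_tsum]
    refine tsum_congr fun i => ?_
    rw [LSeries.term_of_ne_zero (by omega), hc, Complex.ofReal_mul, Complex.ofReal_cpow (by positivity),
      div_eq_mul_inv, ← Complex.cpow_neg]
    push_cast
    rfl
  set Lr := ∑' i : ℕ, c (i + 1) * ((i:ℝ) + 1) ^ (-(1 + x)) with hLr
  set f := ∑' i : ℕ, c (i + 1) * (q ^ (i + 1) / (1 - q ^ (i + 1))) with hf
  have hdiff : f - (M:ℝ) ^ 2 * Lr ≤ 4 * r + (M:ℝ) ^ 2 * (4 * x * (4 * r)) := by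
    have ht := (hs1.hasSum.sub (hsL.hasSum.mul_left ((M:ℝ) ^ 2))).tendsto_sum_nat
    refine le_of_tendsto ht (Eventually.of_forall fun N => ?_)
    have h1 := abel_bd (fun i => c (i + 1)) (gl q) (4 * r) (gl_anti q hq0 hq1) (gl_nonneg q hq0 hq1) hB N
    have h2 := phl_sum (fun i => c (i + 1)) (4 * r) x hx hB N
    rw [gl_zero q hq1, mul_one] at h1
    have e : ∑ i ∈ range N, (c (i + 1) * (q ^ (i + 1) / (1 - q ^ (i + 1))) - (M:ℝ) ^ 2 * (c (i + 1) * ((i:ℝ) + 1) ^ (-(1 + x))))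
        = (M:ℝ) ^ 2 * ∑ i ∈ range N, c (i + 1) * phl x i - ∑ i ∈ range N, c (i + 1) * gl q i := by
      rw [mul_sum, ← sum_sub_distrib]
      refine sum_congr rfl fun i _ => ?_
      unfold phl gl
      rw [h1q]
      have : (i:ℝ) + 1 ≠ 0 := by positivity
      have hM0 : (M:ℝ) ≠ 0 := by linarith
      have : 1 / (((i:ℝ) + 1) * (1 / (M:ℝ) ^ 2)) = (M:ℝ) ^ 2 * (1 / ((i:ℝ) + 1)) := by field_simp
      rw [this]
      ring
    rw [e]
    have h3 := (abs_le.1 h1).1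
    have h4 := (abs_le.1 h2).2
    have h5 : (M:ℝ) ^ 2 * ∑ i ∈ range N, c (i + 1) * phl x i ≤ (M:ℝ) ^ 2 * (4 * x * (4 * r)) := by gcongr
    linarith
  have hfin : 2 * (r:ℝ) ≤ (M:ℝ) ^ 2 * Lr := by
    have : (M:ℝ) ^ 2 * (4 * x * (4 * r)) = 2 * r * (8192 * x * (r:ℝ) ^ 2) := by rw [hMr]; ring
    rw [this] at hdiff
    have h9 : 2 * r * (8192 * x * (r:ℝ) ^ 2) ≤ 2 * r * 1 := by gcongr
    linarith
  rw [hL, Complex.norm_real]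
  have h10 : Lr ≤ ‖Lr‖ := Real.le_norm_self _
  rw [hMr] at hfin
  have h11 : 1 ≤ 512 * r * Lr := by nlinarith
  have hLr0 : 0 ≤ Lr := by
    by_contra! h
    nlinarith
  calc (1:ℝ) ≤ 512 * r * Lr := h11
    _ ≤ 8192 * C1 * r ^ 2 * ‖Lr‖ := by
      have : 512 * (r:ℝ) ≤ 8192 * C1 * r ^ 2 := by nlinarith
      gcongr

def Wk (s : ℂ) : ℂ := 1 / s - 1 / (s + 1)

lemma Wk_bound (σ t : ℝ) (hσ : 1 ≤ σ) : ‖Wk (σ + t * Complex.I)‖ ≤ 4 * (1 + |t|) ^ (-2 : ℝ) := by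
  set s : ℂ := σ + t * Complex.I with hs
  have hre : s.re = σ := by simp [hs]
  have him : s.im = t := by simp [hs]
  have h1 : (1 + |t|) / 2 ≤ ‖s‖ := by
    have a := Complex.abs_re_le_norm s
    have b := Complex.abs_im_le_norm s
    rw [hre, abs_of_nonneg (by linarith)] at a
    rw [him] at b
    linarith
  have h2 : (1 + |t|) / 2 ≤ ‖s + 1‖ := by
    have a := Complex.abs_re_le_norm (s + 1)
    have b := Complex.abs_im_le_norm (s + 1)
    simp only [Complex.add_re, Complex.add_im, Complex.one_re, Complex.one_im, add_zero, hre, him] at a b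
    rw [abs_of_nonneg (by linarith)] at a
    linarith
  have hp : 0 < (1 + |t|) / 2 := by positivity
  have hs0 : s ≠ 0 := norm_pos_iff.1 (hp.trans_le h1)
  have hs1 : s + 1 ≠ 0 := norm_pos_iff.1 (hp.trans_le h2)
  have e : Wk s = (s * (s + 1))⁻¹ := by unfold Wk; field_simp; ring
  rw [e, norm_inv, norm_mul, Real.rpow_neg (by positivity)]
  rw [show (1 + |t|) ^ (2:ℝ) = (1 + |t|) ^ 2 by exact_mod_cast rpow_natCast _ 2]
  have h3 : (1 + |t|) / 2 * ((1 + |t|) / 2) ≤ ‖s‖ * ‖s + 1‖ := mul_le_mul h1 h2 hp.le (norm_nonneg _)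
  calc (‖s‖ * ‖s + 1‖)⁻¹ ≤ ((1 + |t|) / 2 * ((1 + |t|) / 2))⁻¹ := inv_anti₀ (by positivity) h3
    _ = _ := by field_simp; norm_num

lemma Wk_cont (σ : ℝ) (hσ : 1 ≤ σ) : Continuous (fun t : ℝ => Wk (σ + t * Complex.I)) := by
  unfold Wk
  have h1 : ∀ t : ℝ, (σ + t * Complex.I : ℂ) ≠ 0 := by
    intro t h
    have := congrArg Complex.re h
    simp at this; linarith
  have h2 : ∀ t : ℝ, (σ + t * Complex.I + 1 : ℂ) ≠ 0 := by
    intro t h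
    have := congrArg Complex.re h
    simp at this; linarith
  exact (Continuous.div (by fun_prop) (by fun_prop) h1).sub (Continuous.div (by fun_prop) (by fun_prop) h2)

lemma Wk_int (σ : ℝ) (hσ : 1 ≤ σ) : Integrable (fun t : ℝ => Wk (σ + t * Complex.I)) := by
  have h : Integrable (fun t : ℝ => (1 + ‖t‖) ^ (-2 : ℝ)) := integrable_one_add_norm (by simp)
  refine (h.const_mul 4).mono' (Wk_cont σ hσ).aestronglyMeasurable (Eventually.of_forall fun t => ?_)
  exact Wk_bound σ t hσ

lemma perron (σ : ℝ) (hσ : 1 ≤ σ) (x : ℝ) (hx : 0 < x) :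
    ∫ t : ℝ, (x : ℂ) ^ (-(σ + t * Complex.I)) * Wk (σ + t * Complex.I) = ((2 * Real.pi * max (1 - x) 0 : ℝ) : ℂ) := by
  set f : ℝ → ℂ := fun t => Set.indicator (Set.Ioc 0 1) (fun _ => (1:ℂ)) t - Set.indicator (Set.Ioc 0 1) (fun t : ℝ => (t:ℂ) ^ (1:ℂ)) t with hf
  have hM : ∀ s : ℂ, 0 < s.re → HasMellin f s (Wk s) := by
    intro s hs
    have h1 := hasMellin_one_Ioc hs
    have h2 := hasMellin_cpow_Ioc 1 (s := s) (by simp; linarith)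
    have h3 := hasMellin_sub h1.1 h2.1
    rw [h1.2, h2.2] at h3
    exact h3
  have hfx : ∀ y : ℝ, 0 < y → f y = ((max (1 - y) 0 : ℝ) : ℂ) := by
    intro y hy
    simp only [hf]
    by_cases h : y ≤ 1
    · rw [Set.indicator_of_mem (by exact ⟨hy, h⟩), Set.indicator_of_mem (by exact ⟨hy, h⟩), Complex.cpow_one, max_eq_left (by linarith)]
      push_cast; rfl
    · rw [Set.indicator_of_notMem (fun hh => h hh.2), Set.indicator_of_notMem (fun hh => h hh.2), max_eq_right (by linarith)]
      simp
  have hc : ContinuousAt f x := by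
    have h1 : ContinuousAt (fun y : ℝ => ((max (1 - y) 0 : ℝ) : ℂ)) x := by fun_prop
    refine h1.congr ?_
    filter_upwards [lt_mem_nhds hx] with y hy
    exact (hfx y hy).symm
  have hvert : ∀ t : ℝ, mellin f (σ + t * Complex.I) = Wk (σ + t * Complex.I) := fun t => (hM _ (by simp; linarith)).2
  have key := mellinInv_mellin_eq σ f hx (hM σ (by simp; linarith)).1 (by
    unfold Complex.VerticalIntegrable
    exact (Wk_int σ hσ).congr (Eventually.of_forall fun t => (hvert t).symm)) hc
  unfold mellinInv at key
  simp only [hvert, smul_eq_mul] at key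
  rw [hfx x hx] at key
  have hpi : (0:ℝ) < 2 * Real.pi := by positivity
  rw [Complex.real_smul] at key
  rw [Complex.ofReal_mul, ← key, ← mul_assoc, ← Complex.ofReal_mul, mul_one_div_cancel hpi.ne', Complex.ofReal_one, one_mul]

lemma int_half : Integrable (fun t : ℝ => (1 + |t|) ^ (-(3 / 2) : ℝ)) := by
  have := integrable_one_add_norm (E := ℝ) (μ := volume) (r := 3 / 2) (by simp; norm_num)
  simpa using this

lemma tauber_V : ∃ C : ℝ, 1 ≤ C ∧ ∀ (d : ℕ → ℂ) (B : ℝ), 0 ≤ B → (∀ s : ℂ, 1 < s.re → LSeriesSummable d s) →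
    (∀ s : ℂ, 1 < s.re → s.re ≤ 2 → ‖LSeries d s‖ ≤ B * (1 + |s.im|) ^ (1 / 2 : ℝ)) → ∀ v : ℝ, 3 ≤ v →
    ‖∑ n ∈ Icc 1 ⌊v⌋₊, ((v - n : ℝ) : ℂ) * d n‖ ≤ C * v ^ 2 * B := by
  set I := ∫ t : ℝ, (1 + |t|) ^ (-(3 / 2) : ℝ) with hI
  have hI0 : 0 ≤ I := integral_nonneg fun t => by positivity
  refine ⟨1 + 4 * 3 * I, by linarith, ?_⟩
  intro d B hB hsm hbd v hv
  have hv0 : 0 < v := by linarith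
  have hl1 : 1 ≤ log v := by rw [le_log_iff_exp_le hv0]; have := exp_one_lt_d9; linarith
  set σ : ℝ := 1 + 1 / log v with hσ
  have hσ1 : 1 < σ := by rw [hσ]; have : 0 < 1 / log v := by positivity
                         linarith
  have hσ2 : σ ≤ 2 := by rw [hσ]; have : 1 / log v ≤ 1 := by rw [div_le_one (by linarith)]; exact hl1
                         linarith
  have hvσ : v ^ σ ≤ 3 * v := by
    rw [hσ, rpow_add hv0, Real.rpow_one, rpow_def_of_pos hv0]
    have : log v * (1 / log v) = 1 := by field_simp
    rw [this, mul_comm]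
    have := exp_one_lt_d9
    gcongr; linarith
  set S : ℝ → ℂ := fun t => σ + t * Complex.I with hS
  have hSre : ∀ t, (S t).re = σ := fun t => by simp [hS]
  have hSim : ∀ t, (S t).im = t := fun t => by simp [hS]
  set F : ℕ → ℝ → ℂ := fun n t => LSeries.term d (S t) n * ((v:ℂ) ^ (S t) * Wk (S t)) with hF
  have hvn : ∀ t, ‖(v:ℂ) ^ (S t)‖ = v ^ σ := fun t => by rw [Complex.norm_cpow_eq_rpow_re_of_pos hv0, hSre]
  have hnF : ∀ n t, ‖F n t‖ = ‖LSeries.term d σ n‖ * (v ^ σ * ‖Wk (S t)‖) := by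
    intro n t
    simp only [hF, norm_mul, hvn]
    congr 1
    rw [LSeries.norm_term_eq, LSeries.norm_term_eq, hSre, Complex.ofReal_re]
  have hFe : ∀ n : ℕ, n ≠ 0 → ∀ t, F n t = d n * ((((n:ℝ) / v : ℝ) : ℂ) ^ (-(S t)) * Wk (S t)) := by
    intro n hn t
    have hn0 : (0:ℝ) < n := by exact_mod_cast Nat.pos_of_ne_zero hn
    simp only [hF]
    rw [LSeries.term_of_ne_zero hn, Complex.ofReal_div, Complex.cpow_neg,
      Complex.div_cpow_ofReal_nonneg hn0.le hv0.le, inv_div]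
    push_cast
    ring
  have hWi := Wk_int σ hσ1.le
  have hFc : ∀ n, Continuous (F n) := by
    intro n
    by_cases hn : n = 0
    · subst hn
      simp only [hF, LSeries.term_zero, zero_mul]
      exact continuous_const
    · have hn0 : (0:ℝ) < n := by exact_mod_cast Nat.pos_of_ne_zero hn
      have : F n = fun t => d n * ((((n:ℝ) / v : ℝ) : ℂ) ^ (-(S t)) * Wk (S t)) := funext (hFe n hn)
      rw [this]
      refine continuous_const.mul (Continuous.mul ?_ (Wk_cont σ hσ1.le))
      have hne : (((n:ℝ) / v : ℝ) : ℂ) ≠ 0 := by rw [Complex.ofReal_ne_zero]; positivity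
      have hcS : Continuous (fun t => -(S t)) := by simp only [hS]; fun_prop
      exact hcS.const_cpow (Or.inl hne)
  have hFi : ∀ n, Integrable (F n) := by
    intro n
    refine (hWi.norm.const_mul (‖LSeries.term d σ n‖ * v ^ σ)).mono' (hFc n).aestronglyMeasurable (Eventually.of_forall fun t => ?_)
    rw [hnF]
    exact le_of_eq (by ring)
  have hsum : Summable fun n => ∫ t, ‖F n t‖ := by
    simp only [hnF]
    simp only [integral_const_mul]
    exact (hsm σ (by simpa using hσ1)).norm.mul_right _
  have key := hasSum_integral_of_summable_integral_norm hFi hsum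
  have hitg : ∀ n, ∫ t, F n t = if n ∈ Icc 1 ⌊v⌋₊ then ((2 * Real.pi / v : ℝ) : ℂ) * (((v - n : ℝ) : ℂ) * d n) else 0 := by
    intro n
    by_cases hn : n = 0
    · subst hn; simp [hF]
    · have hn0 : (0:ℝ) < n := by exact_mod_cast Nat.pos_of_ne_zero hn
      simp only [hFe n hn]
      rw [integral_const_mul, perron σ hσ1.le _ (by positivity)]
      split_ifs with h
      · have : (n:ℝ) ≤ v := (Nat.le_floor_iff hv0.le).1 (mem_Icc.1 h).2
        rw [max_eq_left (by rw [sub_nonneg, div_le_one hv0]; exact this)]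
        have : (2 * Real.pi * (1 - n / v) : ℝ) = 2 * Real.pi / v * (v - n) := by field_simp
        rw [this]; push_cast; ring
      · have : v < n := by
          by_contra! h'
          exact h (mem_Icc.2 ⟨Nat.pos_of_ne_zero hn, Nat.le_floor h'⟩)
        rw [max_eq_right (by rw [sub_nonpos, one_le_div hv0]; exact this.le)]
        simp
  have e1 : ∑' n, ∫ t, F n t = ((2 * Real.pi / v : ℝ) : ℂ) * ∑ n ∈ Icc 1 ⌊v⌋₊, ((v - n : ℝ) : ℂ) * d n := by
    simp only [hitg]
    rw [tsum_eq_sum (s := Icc 1 ⌊v⌋₊) (fun n hn => if_neg hn), mul_sum]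
    exact sum_congr rfl fun n hn => if_pos hn
  have e2 : ∀ t, ∑' n, F n t = LSeries d (S t) * ((v:ℂ) ^ (S t) * Wk (S t)) := by
    intro t; simp only [hF]; rw [tsum_mul_right]; rfl
  have e3 := key.tsum_eq
  rw [e1] at e3
  have hbound : ‖∫ t, ∑' n, F n t‖ ≤ B * (3 * v) * 4 * I := by
    rw [hI, ← integral_const_mul]
    refine norm_integral_le_of_norm_le (int_half.const_mul _) (Eventually.of_forall fun t => ?_)
    rw [e2, norm_mul, norm_mul, hvn]
    have h1 := hbd (S t) (by rw [hSre]; exact hσ1) (by rw [hSre]; exact hσ2)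
    rw [hSim] at h1
    have h2 := Wk_bound σ t hσ1.le
    calc _ ≤ B * (1 + |t|) ^ (1 / 2 : ℝ) * (3 * v * (4 * (1 + |t|) ^ (-2 : ℝ))) := by gcongr
      _ = B * (3 * v) * 4 * ((1 + |t|) ^ (1 / 2 : ℝ) * (1 + |t|) ^ (-2 : ℝ)) := by ring
      _ = _ := by rw [← rpow_add (by positivity)]; norm_num
  rw [← e3, norm_mul, Complex.norm_real, norm_of_nonneg (by positivity)] at hbound
  have hpi : 1 ≤ 2 * Real.pi := by linarith [Real.pi_gt_three]
  set T := ‖∑ n ∈ Icc 1 ⌊v⌋₊, ((v - n : ℝ) : ℂ) * d n‖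
  have hT : 0 ≤ T := norm_nonneg _
  have h5 : T / v ≤ B * (3 * v) * 4 * I := by
    refine le_trans ?_ hbound
    rw [div_mul_eq_mul_div]
    gcongr
    nlinarith
  rw [div_le_iff₀ hv0] at h5
  nlinarith [mul_nonneg (sq_nonneg v) hB]

lemma logpow_ge (m : ℕ) : ∃ C : ℝ, 1 ≤ C ∧ ∀ u : ℝ, 1 ≤ u → log u ^ m ≤ C * u := by
  refine ⟨max 1 ((m:ℝ) ^ m), le_max_left _ _, fun u hu => ?_⟩
  have hu0 : 0 < u := by linarith
  rcases Nat.eq_zero_or_pos m with rfl | hm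
  · simpa using hu
  have hm0 : (0:ℝ) < m := by exact_mod_cast hm
  have h1 := Real.log_le_rpow_div (x := u) hu0.le (ε := 1 / m) (by positivity)
  have h0 := log_nonneg hu
  calc log u ^ m ≤ (u ^ (1 / m : ℝ) / (1 / m)) ^ m := by gcongr
    _ = (m:ℝ) ^ m * (u ^ (1 / m : ℝ)) ^ m := by rw [div_div_eq_mul_div, div_one, mul_pow]; ring
    _ = (m:ℝ) ^ m * u := by
      rw [← rpow_natCast (u ^ (1 / m : ℝ)), ← rpow_mul hu0.le]
      rw [one_div, inv_mul_cancel₀ hm0.ne', Real.rpow_one]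
    _ ≤ _ := by gcongr; exact le_max_right _ _

lemma summable_of_log (m : ℕ) (d : ℕ → ℂ) (hd : ∀ n : ℕ, 1 ≤ n → ‖d n‖ ≤ (1 + log n) ^ m) (s : ℂ) (hs : 1 < s.re) :
    LSeriesSummable d s := by
  set e := (s.re - 1) / 2 with he
  have he0 : 0 < e := by rw [he]; linarith
  refine LSeriesSummable_of_le_const_mul_rpow (x := 1 + e) (by rw [he]; linarith) ?_
  set k : ℝ := (m:ℝ) + 1
  have hk : 0 < k := by positivity
  refine ⟨(1 + k / e) ^ m, fun n hn => (hd n (Nat.pos_of_ne_zero hn)).trans ?_⟩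
  have hn1 : (1:ℝ) ≤ n := by exact_mod_cast Nat.pos_of_ne_zero hn
  have h1 := Real.log_le_rpow_div (x := n) (by linarith) (ε := e / k) (by positivity)
  have h2 : 1 ≤ (n:ℝ) ^ (e / k) := Real.one_le_rpow hn1 (by positivity)
  have h0 := log_nonneg hn1
  have e2 : (n:ℝ) ^ (e / k) / (e / k) = k / e * (n:ℝ) ^ (e / k) := by field_simp
  rw [e2] at h1
  calc (1 + log n) ^ m ≤ ((1 + k / e) * (n:ℝ) ^ (e / k)) ^ m := by
        gcongr; nlinarith
    _ = (1 + k / e) ^ m * (n:ℝ) ^ (e / k * m) := by rw [mul_pow, rpow_mul (by linarith), rpow_natCast]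
    _ ≤ _ := by
        gcongr
        rw [div_mul_eq_mul_div, div_le_iff₀ hk]; simp only [k]; nlinarith

lemma tauber (m : ℕ) : ∃ C : ℝ, 1 ≤ C ∧ ∀ (d : ℕ → ℂ) (B : ℝ), 1 ≤ B → (∀ n : ℕ, 1 ≤ n → ‖d n‖ ≤ (1 + log n) ^ m) →
    (∀ s : ℂ, 1 < s.re → s.re ≤ 2 → ‖LSeries d s‖ ≤ B * (1 + |s.im|) ^ (1 / 2 : ℝ)) → ∀ u : ℝ, 3 ≤ u →
    ‖∑ n ∈ Icc 1 ⌊u⌋₊, d n‖ ≤ C * u * √(B * log u ^ m) := by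
  obtain ⟨C1, hC1, hV⟩ := tauber_V
  obtain ⟨C2, hC2, hlog⟩ := logpow_ge m
  refine ⟨5 * C1 + 3 ^ m * (1 + C2), by nlinarith [one_le_pow₀ (by norm_num : (1:ℝ) ≤ 3) (n := m)], ?_⟩
  intro d B hB hd hbd u hu
  have hu0 : 0 < u := by linarith
  have hl1 : 1 ≤ log u := by rw [le_log_iff_exp_le hu0]; have := exp_one_lt_d9; linarith
  set l := log u
  have hsm := summable_of_log m d hd
  have hdle : ∀ n : ℕ, 1 ≤ n → (n:ℝ) ≤ 2 * u → ‖d n‖ ≤ 3 ^ m * l ^ m := by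
    intro n hn hnu
    refine (hd n hn).trans ?_
    have hn1 : (1:ℝ) ≤ n := by exact_mod_cast hn
    have h0 := log_nonneg hn1
    rw [← mul_pow]
    gcongr
    have : log n ≤ log 2 + l := by
      rw [← log_mul (by norm_num) hu0.ne']
      exact log_le_log (by linarith) hnu
    have := Real.log_two_lt_d9
    linarith
  have hlm : 1 ≤ l ^ m := one_le_pow₀ hl1
  rcases le_or_gt (l ^ m) B with hBl | hBl
  · -- trivial
    have h1 : ‖∑ n ∈ Icc 1 ⌊u⌋₊, d n‖ ≤ ∑ n ∈ Icc 1 ⌊u⌋₊, 3 ^ m * l ^ m := by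
      refine (norm_sum_le _ _).trans (sum_le_sum fun n hn => ?_)
      have h2 := (Nat.le_floor_iff hu0.le).1 (mem_Icc.1 hn).2
      exact hdle n (mem_Icc.1 hn).1 (by linarith)
    rw [sum_const, Nat.card_Icc, nsmul_eq_mul, Nat.add_sub_cancel] at h1
    have h3 : l ^ m ≤ √(B * l ^ m) := by apply le_sqrt_of_sq_le; rw [sq]; gcongr
    calc _ ≤ (⌊u⌋₊:ℝ) * (3 ^ m * l ^ m) := h1
      _ ≤ u * (3 ^ m * √(B * l ^ m)) := by gcongr; exact Nat.floor_le hu0.le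
      _ ≤ _ := by
        have : 0 ≤ u * √(B * l ^ m) := by positivity
        have h5 : (1:ℝ) ≤ 3 ^ m := one_le_pow₀ (by norm_num)
        have : 3 ^ m * (u * √(B * l ^ m)) ≤ (5 * C1 + 3 ^ m * (1 + C2)) * (u * √(B * l ^ m)) := by gcongr; nlinarith
        linarith
  set w := √(B / l ^ m) with hw
  have hw0 : 0 < w := by positivity
  have hw1 : w ≤ 1 := by rw [hw, sqrt_le_iff, one_pow, div_le_one (by positivity)]; exact ⟨zero_le_one, hBl.le⟩
  set H := u * w with hH
  have hH0 : 0 < H := by positivity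
  have hHu : H ≤ u := by rw [hH]; nlinarith
  have hww : w * w = B / l ^ m := mul_self_sqrt (by positivity)
  have hs1 : √(B * l ^ m) = w * l ^ m := by
    rw [Real.sqrt_eq_iff_mul_self_eq (by positivity) (by positivity)]
    symm
    calc w * l ^ m * (w * l ^ m) = (w * w) * (l ^ m * l ^ m) := by ring
      _ = B * l ^ m := by rw [hww, div_mul_eq_mul_div, ← mul_assoc, mul_div_assoc, div_self (by positivity), mul_one]
  have hBw : B / w = w * l ^ m := by rw [div_eq_iff hw0.ne', mul_right_comm, hww, div_mul_cancel₀ _ (by positivity)]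
  have hH1 : 1 ≤ C2 * H := by
    have h1 : l ^ m ≤ C2 * u := hlog u (by linarith)
    have h2 : 1 / l ^ m ≤ w := by
      apply le_sqrt_of_sq_le
      rw [div_pow, one_pow, div_le_div_iff₀ (by positivity) (by positivity)]
      have : l ^ m ≤ B * (l ^ m) ^ 2 := by
        have : l ^ m ≤ (l ^ m) ^ 2 := by nlinarith
        nlinarith
      linarith
    calc (1:ℝ) = l ^ m * (1 / l ^ m) := by field_simp
      _ ≤ C2 * u * w := by gcongr
      _ = _ := by rw [hH]; ring
  have hV1 := hV d B (by linarith) hsm hbd u hu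
  have hV2 := hV d B (by linarith) hsm hbd (u + H) (by linarith)
  set A := ∑ n ∈ Icc 1 ⌊u⌋₊, d n
  have hfl : ⌊u⌋₊ ≤ ⌊u + H⌋₊ := Nat.floor_mono (by linarith)
  have hsplit : ∑ n ∈ Icc 1 ⌊u + H⌋₊, ((u + H - n : ℝ) : ℂ) * d n =
      ∑ n ∈ Icc 1 ⌊u⌋₊, ((u + H - n : ℝ) : ℂ) * d n + ∑ n ∈ Ioc ⌊u⌋₊ ⌊u + H⌋₊, ((u + H - n : ℝ) : ℂ) * d n := by
    rw [← sum_union]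
    · congr 1
      ext n
      simp only [mem_Icc, mem_union, mem_Ioc]
      have : 1 ≤ ⌊u⌋₊ := Nat.le_floor (by push_cast; linarith)
      omega
    · rw [disjoint_left]; intro n h1 h2
      simp only [mem_Icc, mem_Ioc] at h1 h2; omega
  have hHA : (H:ℂ) * A = ∑ n ∈ Icc 1 ⌊u + H⌋₊, ((u + H - n : ℝ) : ℂ) * d n - ∑ n ∈ Icc 1 ⌊u⌋₊, ((u - n : ℝ) : ℂ) * d n
      - ∑ n ∈ Ioc ⌊u⌋₊ ⌊u + H⌋₊, ((u + H - n : ℝ) : ℂ) * d n := by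
    have : (H:ℂ) * A = ∑ n ∈ Icc 1 ⌊u⌋₊, ((u + H - n : ℝ) : ℂ) * d n - ∑ n ∈ Icc 1 ⌊u⌋₊, ((u - n : ℝ) : ℂ) * d n := by
      rw [mul_sum, ← sum_sub_distrib]
      refine sum_congr rfl fun n _ => ?_
      push_cast; ring
    rw [hsplit, this]; ring
  have hshort : ‖∑ n ∈ Ioc ⌊u⌋₊ ⌊u + H⌋₊, ((u + H - n : ℝ) : ℂ) * d n‖ ≤ (H + 1) * (H * (3 ^ m * l ^ m)) := by
    have h1 : ‖∑ n ∈ Ioc ⌊u⌋₊ ⌊u + H⌋₊, ((u + H - n : ℝ) : ℂ) * d n‖ ≤ ∑ n ∈ Ioc ⌊u⌋₊ ⌊u + H⌋₊, H * (3 ^ m * l ^ m) := by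
      refine (norm_sum_le _ _).trans (sum_le_sum fun n hn => ?_)
      have h2 := (Nat.le_floor_iff (by linarith : 0 ≤ u + H)).1 (mem_Ioc.1 hn).2
      have h3 := (Nat.floor_lt hu0.le).1 (mem_Ioc.1 hn).1
      rw [norm_mul, Complex.norm_real, norm_of_nonneg (by linarith)]
      exact mul_le_mul (by linarith) (hdle n (by have := (mem_Ioc.1 hn).1; omega) (by linarith)) (norm_nonneg _) hH0.le
    rw [sum_const, Nat.card_Ioc, nsmul_eq_mul] at h1
    refine h1.trans ?_
    gcongr
    rw [Nat.cast_sub hfl]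
    have h2 := Nat.floor_le (by linarith : 0 ≤ u + H)
    have h3 := Nat.lt_floor_add_one u
    linarith
  have hA : H * ‖A‖ ≤ C1 * (u + H) ^ 2 * B + C1 * u ^ 2 * B + (H + 1) * (H * (3 ^ m * l ^ m)) := by
    have : H * ‖A‖ = ‖(H:ℂ) * A‖ := by rw [norm_mul, Complex.norm_real, norm_of_nonneg hH0.le]
    rw [this, hHA]
    refine (norm_sub_le _ _).trans (add_le_add ((norm_sub_le _ _).trans (add_le_add hV2 hV1)) hshort)
  rw [hs1]
  have hB0 : 0 ≤ B := by linarith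
  have h6 : C1 * (u + H) ^ 2 * B ≤ C1 * (u + u) ^ 2 * B := by gcongr
  have h7 : H + 1 ≤ (1 + C2) * H := by linarith
  have h8 : (H + 1) * (H * (3 ^ m * l ^ m)) ≤ (1 + C2) * H * (H * (3 ^ m * l ^ m)) := by gcongr
  have h9 : C1 * (u + u) ^ 2 * B + C1 * u ^ 2 * B = H * (5 * C1 * u * (B / w)) := by rw [hH]; field_simp; ring
  have h10 : (1 + C2) * H * (H * (3 ^ m * l ^ m)) = H * (3 ^ m * (1 + C2) * u * (w * l ^ m)) := by rw [hH]; ring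
  have h11 : H * ‖A‖ ≤ H * (5 * C1 * u * (w * l ^ m) + 3 ^ m * (1 + C2) * u * (w * l ^ m)) := by
    rw [mul_add, ← h10, ← hBw, ← h9]; linarith
  have h12 := le_of_mul_le_mul_left h11 hH0
  linarith

lemma vm_prime_diff (u : ℝ) (hu : 1 ≤ u) (g : ℕ → ℂ) (W : ℝ) (hW : 0 ≤ W) (hg : ∀ n : ℕ, 1 ≤ n → (n:ℝ) ≤ u → ‖g n‖ ≤ W) :
    ‖∑ n ∈ Icc 1 ⌊u⌋₊, g n * (ArithmeticFunction.vonMangoldt n : ℂ) - ∑ p ∈ (Icc 1 ⌊u⌋₊).filter Nat.Prime, g p * (log p : ℂ)‖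
      ≤ W * (2 * √u * log u) := by
  have h1 : ∑ p ∈ (Icc 1 ⌊u⌋₊).filter Nat.Prime, g p * (log p : ℂ) =
      ∑ n ∈ Icc 1 ⌊u⌋₊, g n * ((if n.Prime then log n else 0 : ℝ) : ℂ) := by
    rw [sum_filter]
    refine sum_congr rfl fun n _ => ?_
    split_ifs <;> simp
  rw [h1, ← sum_sub_distrib]
  have hnn : ∀ n : ℕ, 0 ≤ ArithmeticFunction.vonMangoldt n - (if n.Prime then log n else 0) := by
    intro n
    split_ifs with h
    · rw [ArithmeticFunction.vonMangoldt_apply_prime h]; simp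
    · simp
  have h2 : ‖∑ n ∈ Icc 1 ⌊u⌋₊, (g n * (ArithmeticFunction.vonMangoldt n : ℂ) - g n * ((if n.Prime then log n else 0 : ℝ) : ℂ))‖
      ≤ ∑ n ∈ Icc 1 ⌊u⌋₊, W * (ArithmeticFunction.vonMangoldt n - (if n.Prime then log n else 0)) := by
    refine (norm_sum_le _ _).trans (sum_le_sum fun n hn => ?_)
    rw [← mul_sub, norm_mul, ← Complex.ofReal_sub, Complex.norm_real, norm_of_nonneg (hnn n)]
    have h3 := (Nat.le_floor_iff (by linarith : 0 ≤ u)).1 (mem_Icc.1 hn).2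
    exact mul_le_mul_of_nonneg_right (hg n (mem_Icc.1 hn).1 h3) (hnn n)
  refine h2.trans ?_
  rw [← mul_sum]
  refine mul_le_mul_of_nonneg_left ?_ hW
  have h4 := Chebyshev.abs_psi_sub_theta_le_sqrt_mul_log hu
  refine le_trans (le_of_eq ?_) ((le_abs_self _).trans h4)
  rw [sum_sub_distrib, Chebyshev.psi, Chebyshev.theta, sum_filter]
  rfl

lemma logpow_sqrt (m : ℕ) : ∃ C : ℝ, 1 ≤ C ∧ ∀ u : ℝ, 1 ≤ u → log u ^ m ≤ C * √u := by
  obtain ⟨C, hC, h⟩ := logpow_ge (2 * m)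
  refine ⟨√C, one_le_sqrt.2 hC, fun u hu => ?_⟩
  rw [← sqrt_mul (by linarith)]
  apply le_sqrt_of_sq_le
  rw [← pow_mul, mul_comm m 2]
  exact h u hu

/-- weighted prime sums -/
lemma prime_weighted (K : ℕ) (hK : 1 ≤ K) : ∃ C : ℝ, 1 ≤ C ∧ ∀ (r : ℕ) (_ : 0 < r) (χ : DirichletCharacter ℂ r) (b0 : ℝ), χ ≠ 1 → 1 ≤ b0 →
    Good r χ b0 → ∀ u : ℝ, 3 ≤ u →
    ‖∑ p ∈ (Icc 1 ⌊u⌋₊).filter Nat.Prime, ((log p : ℂ) ^ (2 * K)) * χ (p : ZMod r)‖ ≤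
      C * u * (b0 * log (r + 2) ^ 10 * log u) ^ K := by
  obtain ⟨C1, hC1, hA⟩ := Ak_bound (2 * K - 1)
  obtain ⟨C2, hC2, hT⟩ := tauber (2 * K)
  obtain ⟨C3, hC3, hS⟩ := logpow_sqrt (2 * K)
  refine ⟨C2 * √C1 + 2 * C3, by nlinarith [sqrt_nonneg C1], ?_⟩
  intro r hr χ b0 hχ hb0 hgood u hu
  have hu0 : 0 < u := by linarith
  have hl1 : 1 ≤ log u := by rw [le_log_iff_exp_le hu0]; have := exp_one_lt_d9; linarith
  have hlr : 1 ≤ log (r + 2) := by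
    have : (1:ℝ) ≤ r := by exact_mod_cast hr
    rw [le_log_iff_exp_le (by linarith)]; have := exp_one_lt_d9; linarith
  set β := b0 * log (r + 2) ^ 10 with hβ
  have hβ1 : 1 ≤ β := by have := one_le_pow₀ hlr (n := 10); rw [hβ]; nlinarith
  have hk : 2 * K - 1 + 1 = 2 * K := by omega
  set d : ℕ → ℂ := fun n => (log n : ℂ) ^ (2 * K - 1) * (χ (n : ZMod r) * (ArithmeticFunction.vonMangoldt n : ℂ)) with hd
  have hdb : ∀ n : ℕ, 1 ≤ n → ‖d n‖ ≤ (1 + log n) ^ (2 * K) := by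
    intro n hn
    have h0 : 0 ≤ log n := log_natCast_nonneg n
    simp only [hd]
    rw [norm_mul, norm_pow, Complex.norm_real, norm_mul, Complex.norm_real, norm_of_nonneg h0,
      norm_of_nonneg ArithmeticFunction.vonMangoldt_nonneg, ← hk, pow_succ]
    have h1 := ArithmeticFunction.vonMangoldt_le_log (n := n)
    have h2 : ‖χ (n : ZMod r)‖ ≤ 1 := χ.norm_le_one _
    have h3 : 0 ≤ ArithmeticFunction.vonMangoldt n := ArithmeticFunction.vonMangoldt_nonneg
    refine mul_le_mul (pow_le_pow_left₀ h0 (by linarith) _) (by nlinarith) (by positivity) (by positivity)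
  have hLd : ∀ s : ℂ, 1 < s.re → s.re ≤ 2 → ‖LSeries d s‖ ≤ C1 * β ^ (2 * K) * (1 + |s.im|) ^ (1 / 2 : ℝ) := by
    intro s h1 h2
    have := hA r hr χ b0 hχ hb0 hgood s h1 h2
    rw [hk] at this
    have e : Ak (2 * K - 1) r χ s = LSeries d s := by unfold Ak; congr 1; ext n; simp only [hd, Complex.ofReal_pow]
    rw [← e]; exact this
  have hB1 : 1 ≤ C1 * β ^ (2 * K) := by have := one_le_pow₀ hβ1 (n := 2 * K); nlinarith
  have hmain := hT d _ hB1 hdb hLd u hu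
  have hsq : √(C1 * β ^ (2 * K) * log u ^ (2 * K)) = √C1 * (β * log u) ^ K := by
    rw [mul_assoc, ← mul_pow, sqrt_mul (by linarith), mul_comm 2 K, pow_mul, sqrt_sq (by positivity)]
  rw [hsq] at hmain
  have hl0 : 0 ≤ log u := by linarith
  have hdiff := vm_prime_diff u (by linarith) (fun n => (log n : ℂ) ^ (2 * K - 1) * χ (n : ZMod r)) (log u ^ (2 * K - 1)) (by positivity) (by
    intro n hn hnu
    have h0 : 0 ≤ log n := log_natCast_nonneg n
    rw [norm_mul, norm_pow, Complex.norm_real, norm_of_nonneg h0]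
    have h2 : ‖χ (n : ZMod r)‖ ≤ 1 := χ.norm_le_one _
    have h3 : log n ≤ log u := log_le_log (by exact_mod_cast hn) hnu
    calc _ ≤ log u ^ (2 * K - 1) * 1 := by gcongr
      _ = _ := mul_one _)
  have e1 : ∑ n ∈ Icc 1 ⌊u⌋₊, (log n : ℂ) ^ (2 * K - 1) * χ (n : ZMod r) * (ArithmeticFunction.vonMangoldt n : ℂ) = ∑ n ∈ Icc 1 ⌊u⌋₊, d n :=
    sum_congr rfl fun n _ => by simp only [hd]; ring
  have e2 : ∑ p ∈ (Icc 1 ⌊u⌋₊).filter Nat.Prime, (log p : ℂ) ^ (2 * K - 1) * χ (p : ZMod r) * (log p : ℂ) =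
      ∑ p ∈ (Icc 1 ⌊u⌋₊).filter Nat.Prime, ((log p : ℂ) ^ (2 * K)) * χ (p : ZMod r) := by
    refine sum_congr rfl fun n _ => ?_
    rw [← hk, pow_succ]; simp only [Nat.add_sub_cancel]; ring
  rw [e1, e2] at hdiff
  have hW : log u ^ (2 * K - 1) * (2 * √u * log u) ≤ 2 * C3 * u := by
    calc log u ^ (2 * K - 1) * (2 * √u * log u) = 2 * √u * log u ^ (2 * K - 1 + 1) := by rw [pow_succ]; ring
      _ = 2 * √u * log u ^ (2 * K) := by rw [hk]
      _ ≤ 2 * √u * (C3 * √u) := by gcongr; exact hS u (by linarith)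
      _ = 2 * C3 * (√u * √u) := by ring
      _ = _ := by rw [mul_self_sqrt hu0.le]
  have hone : 1 ≤ (β * log u) ^ K := one_le_pow₀ (by nlinarith)
  set X := ∑ n ∈ Icc 1 ⌊u⌋₊, d n
  set Y := ∑ p ∈ (Icc 1 ⌊u⌋₊).filter Nat.Prime, ((log p : ℂ) ^ (2 * K)) * χ (p : ZMod r)
  have h5 : ‖Y‖ ≤ ‖X‖ + ‖X - Y‖ := by
    have : Y = X - (X - Y) := by ring
    calc ‖Y‖ = ‖X - (X - Y)‖ := by rw [← this]
      _ ≤ _ := norm_sub_le _ _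
  have h6 : 2 * C3 * u ≤ 2 * C3 * u * (β * log u) ^ K := le_mul_of_one_le_right (by positivity) hone
  nlinarith

lemma primes_char (K : ℕ) (hK : 1 ≤ K) : ∃ C : ℝ, 1 ≤ C ∧ ∀ (r : ℕ) (_ : 0 < r) (χ : DirichletCharacter ℂ r) (b0 : ℝ), χ ≠ 1 → 1 ≤ b0 →
    Good r χ b0 → ∀ u : ℝ, 3 ≤ u →
    ‖∑ p ∈ (Icc 1 ⌊u⌋₊).filter Nat.Prime, χ (p : ZMod r)‖ ≤
      C * u * (b0 * log (r + 2) ^ 10 / log u) ^ K := by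
  obtain ⟨C1, hC1, hW⟩ := prime_weighted K hK
  obtain ⟨C3, hC3, hS⟩ := logpow_sqrt K
  refine ⟨3 ^ K + C3 + C1 * 2 ^ K * (2 + 4 * K), ?_, ?_⟩
  · have : (1:ℝ) ≤ 3 ^ K := one_le_pow₀ (by norm_num)
    have : 0 ≤ C1 * 2 ^ K * (2 + 4 * K) := by positivity
    linarith
  intro r hr χ b0 hχ hb0 hgood u hu
  have hu0 : 0 < u := by linarith
  have hl1 : ∀ v : ℝ, 3 ≤ v → 1 ≤ log v := by
    intro v hv
    rw [le_log_iff_exp_le (by linarith)]; have := exp_one_lt_d9; linarith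
  have hl := hl1 u hu
  have hlr : 1 ≤ log (r + 2) := by
    have : (1:ℝ) ≤ r := by exact_mod_cast hr
    exact hl1 _ (by linarith)
  have hWW := hW r hr χ b0 hχ hb0 hgood
  set β := b0 * log (r + 2) ^ 10 with hβ
  have hβ1 : 1 ≤ β := by have := one_le_pow₀ hlr (n := 10); rw [hβ]; nlinarith
  have hβK : 1 ≤ β ^ K := one_le_pow₀ hβ1
  have hcnt : ∀ v : ℝ, 0 ≤ v → ‖∑ p ∈ (Icc 1 ⌊v⌋₊).filter Nat.Prime, χ (p : ZMod r)‖ ≤ v := by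
    intro v hv
    refine (norm_sum_le _ _).trans ?_
    refine (sum_le_sum (g := fun _ => (1:ℝ)) fun p _ => χ.norm_le_one _).trans ?_
    rw [sum_const, nsmul_eq_mul, mul_one]
    refine le_trans ?_ (Nat.floor_le hv)
    exact_mod_cast (card_filter_le _ _).trans (by simp)
  rw [div_pow]
  have hQ : 0 ≤ u * (β ^ K / log u ^ K) := by positivity
  rcases lt_or_ge u 9 with h9 | h9
  · refine (hcnt u hu0.le).trans ?_
    have h3 : log u ≤ 3 := by
      have : log u ≤ log 9 := log_le_log hu0 h9.le
      have : log 9 = 2 * log 3 := by rw [show (9:ℝ) = 3 ^ 2 by norm_num, log_pow]; norm_num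
      have : log 3 ≤ 1.5 := by
        rw [log_le_iff_le_exp (by norm_num)]
        have := add_one_le_exp (0.5:ℝ)
        have h7 := Real.exp_one_gt_d9
        have : exp 1.5 = exp 1 * exp 0.5 := by rw [← exp_add]; norm_num
        nlinarith
      linarith
    have h4 : log u ^ K ≤ 3 ^ K := pow_le_pow_left₀ (by linarith) h3 _
    have h5 : 1 ≤ 3 ^ K * (β ^ K / log u ^ K) := by
      rw [mul_div_assoc', le_div_iff₀ (by positivity), one_mul]
      exact h4.trans (le_mul_of_one_le_right (by positivity) hβK)
    have h6 : 0 ≤ C3 + C1 * 2 ^ K * (2 + 4 * K) := by positivity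
    calc u = u * 1 := (mul_one u).symm
      _ ≤ u * (3 ^ K * (β ^ K / log u ^ K)) := by gcongr
      _ ≤ _ := by nlinarith
  have hs3 : 3 ≤ √u := by apply le_sqrt_of_sq_le; norm_num; exact h9
  have hsu : √u ≤ u := by rw [sqrt_le_iff]; constructor <;> nlinarith
  have hss : √u * √u = u := mul_self_sqrt hu0.le
  have hls : log √u = log u / 2 := Real.log_sqrt hu0.le
  set c : ℕ → ℂ := fun n => if n.Prime then (log n : ℂ) ^ (2 * K) * χ (n : ZMod r) else 0 with hc
  set f : ℝ → ℂ := fun t => (((log t) ^ (2 * K))⁻¹ : ℝ) with hf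
  set f' : ℝ → ℂ := fun t => ((-(((2 * K : ℕ):ℝ) * log t ^ (2 * K - 1) * t⁻¹) / (log t ^ (2 * K)) ^ 2 : ℝ) : ℂ) with hf'
  have hIcc : ∀ v : ℝ, ∑ n ∈ Icc 0 ⌊v⌋₊, c n = ∑ p ∈ (Icc 1 ⌊v⌋₊).filter Nat.Prime, (log p : ℂ) ^ (2 * K) * χ (p : ZMod r) := by
    intro v
    rw [sum_filter]
    symm
    refine sum_subset_zero_on_sdiff (Icc_subset_Icc_left (by omega)) ?_ (fun n _ => rfl)
    intro n hn
    simp only [Finset.mem_sdiff, mem_Icc] at hn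
    have : n = 0 := by omega
    simp [hc, this, Nat.not_prime_zero]
  have hE : ∀ t : ℝ, 3 ≤ t → ‖∑ n ∈ Icc 0 ⌊t⌋₊, c n - 0 * (t:ℂ)‖ ≤ C1 * t * (β * log t) ^ K := by
    intro t ht
    rw [zero_mul, sub_zero, hIcc]; exact hWW t ht
  have hnf : ∀ t : ℝ, 3 ≤ t → ‖f t‖ = (log t ^ (2 * K))⁻¹ := by
    intro t ht
    have := hl1 t ht
    simp only [hf]; rw [Complex.norm_real, norm_of_nonneg (by positivity)]
  have hfE : ∀ t : ℝ, √u ≤ t → t ≤ u → ‖f t‖ * ‖∑ n ∈ Icc 0 ⌊t⌋₊, c n - 0 * (t:ℂ)‖ ≤ C1 * 2 ^ K * (u * (β ^ K / log u ^ K)) := by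
    intro t ht htu
    have ht3 : 3 ≤ t := hs3.trans ht
    have hlt := hl1 t ht3
    have hlt2 : log u / 2 ≤ log t := by rw [← hls]; exact log_le_log (by linarith) ht
    rw [hnf t ht3]
    calc _ ≤ (log t ^ (2 * K))⁻¹ * (C1 * t * (β * log t) ^ K) := by gcongr; exact hE t ht3
      _ = C1 * t * (β ^ K / log t ^ K) := by rw [mul_pow, two_mul, pow_add]; field_simp
      _ ≤ C1 * u * (β ^ K / (log u / 2) ^ K) := by gcongr
      _ = _ := by rw [div_pow]; field_simp
  have hfE' : ∀ t ∈ Set.Icc √u u, ‖f' t‖ * ‖∑ n ∈ Icc 0 ⌊t⌋₊, c n - 0 * (t:ℂ)‖ ≤ 4 * K * (C1 * 2 ^ K * (β ^ K / log u ^ K)) := by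
    intro t ⟨ht, htu⟩
    have ht3 : 3 ≤ t := hs3.trans ht
    have hlt := hl1 t ht3
    have hlt2 : log u / 2 ≤ log t := by rw [← hls]; exact log_le_log (by linarith) ht
    have hn : ‖f' t‖ = ((2 * K : ℕ):ℝ) * log t ^ (2 * K - 1) * t⁻¹ / (log t ^ (2 * K)) ^ 2 := by
      simp only [hf']
      rw [Complex.norm_real, neg_div, norm_neg, norm_of_nonneg (by positivity)]
    have hpw : log t ^ (2 * K - 1) ≤ log t ^ (2 * K) := pow_le_pow_right₀ hlt (by omega)
    rw [hn]
    calc _ ≤ ((2 * K : ℕ):ℝ) * log t ^ (2 * K) * t⁻¹ / (log t ^ (2 * K)) ^ 2 * (C1 * t * (β * log t) ^ K) := by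
          gcongr; exact hE t ht3
      _ = 2 * K * C1 * (β ^ K / log t ^ K) := by
        have e1 : log t ^ (2 * K) = log t ^ K * log t ^ K := by rw [two_mul, pow_add]
        have e2 : log t ^ K ≠ 0 := by positivity
        rw [mul_pow, e1]; push_cast
        generalize log t ^ K = q at *
        field_simp
      _ ≤ 2 * K * C1 * (β ^ K / (log u / 2) ^ K) := by gcongr
      _ = 2 * K * (C1 * 2 ^ K * (β ^ K / log u ^ K)) := by rw [div_pow]; field_simp
      _ ≤ _ := by
        have : 0 ≤ K * (C1 * 2 ^ K * (β ^ K / log u ^ K)) := by positivity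
        linarith
  have hder : ∀ t ∈ Set.Icc √u u, HasDerivAt f (f' t) t := by
    intro t ⟨ht, htu⟩
    have ht3 : 3 ≤ t := hs3.trans ht
    have hlt := hl1 t ht3
    have h1 := ((hasDerivAt_log (by linarith : t ≠ 0)).pow (2 * K)).inv (by simp only [Pi.pow_apply]; positivity)
    exact h1.ofReal_comp
  have hcont : ContinuousOn f' (Set.Icc √u u) := by
    have hlc : ContinuousOn log (Set.Icc √u u) := Real.continuousOn_log.mono fun t ht => by
      have := hs3.trans ht.1; simp only [Set.mem_compl_iff, Set.mem_singleton_iff]; linarith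
    refine Complex.continuous_ofReal.comp_continuousOn ?_
    refine ContinuousOn.div ?_ ((hlc.pow _).pow _) ?_
    · refine ((continuousOn_const.mul (hlc.pow _)).mul (continuousOn_id.inv₀ fun t ht => ?_)).neg
      have := hs3.trans ht.1; simp only [id]; linarith
    · intro t ht
      have := hl1 t (hs3.trans ht.1); positivity
  have hps := ps_bound c 0 f f' √u u (sqrt_nonneg _) hsu hder hcont (fun _ => 4 * K * (C1 * 2 ^ K * (β ^ K / log u ^ K))) (by simp) (by
    intro t ht; exact hfE' t ht)
  rw [intervalIntegral.integral_const] at hps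
  have h1 := hfE u hsu le_rfl
  have h2 := hfE √u le_rfl hsu
  have hsplit : ∑ p ∈ (Icc 1 ⌊u⌋₊).filter Nat.Prime, χ (p : ZMod r) = ∑ p ∈ (Icc 1 ⌊√u⌋₊).filter Nat.Prime, χ (p : ZMod r)
      + ∑ n ∈ Ioc ⌊√u⌋₊ ⌊u⌋₊, f n * c n := by
    have e1 : ∑ n ∈ Ioc ⌊√u⌋₊ ⌊u⌋₊, f n * c n = ∑ p ∈ (Ioc ⌊√u⌋₊ ⌊u⌋₊).filter Nat.Prime, χ (p : ZMod r) := by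
      rw [sum_filter]
      refine sum_congr rfl fun n _ => ?_
      simp only [hc, hf]
      split_ifs with h
      · have : log n ≠ 0 := (log_pos (by exact_mod_cast h.one_lt)).ne'
        push_cast
        rw [← mul_assoc, inv_mul_cancel₀, one_mul]
        exact pow_ne_zero _ (by exact_mod_cast this)
      · simp
    rw [e1, ← sum_union]
    · congr 1
      rw [← filter_union]
      congr 1
      ext n
      have := Nat.floor_mono hsu
      simp only [mem_Icc, mem_union, mem_Ioc]; omega
    · refine disjoint_filter_filter ?_
      rw [disjoint_left]; intro n h1 h2
      simp only [mem_Icc, mem_Ioc] at h1 h2; omega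
  rw [hsplit]
  have h7 := hcnt √u (sqrt_nonneg _)
  have h8 : √u ≤ C3 * (u * (β ^ K / log u ^ K)) := by
    have h3 : log u ^ K ≤ C3 * √u := hS u (by linarith)
    have : 1 ≤ C3 * √u * (β ^ K / log u ^ K) := by
      rw [mul_div_assoc', le_div_iff₀ (by positivity)]; nlinarith [mul_nonneg (show 0 ≤ C3 by linarith) (sqrt_nonneg u)]
    calc √u = √u * 1 := (mul_one _).symm
      _ ≤ √u * (C3 * √u * (β ^ K / log u ^ K)) := by gcongr
      _ = C3 * ((√u * √u) * (β ^ K / log u ^ K)) := by ring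
      _ = _ := by rw [hss]
  have h10 : ‖∑ n ∈ Ioc ⌊√u⌋₊ ⌊u⌋₊, f n * c n‖ ≤ C1 * 2 ^ K * (2 + 4 * K) * (u * (β ^ K / log u ^ K)) := by
    rw [zero_mul, sub_zero] at hps
    refine hps.trans ?_
    have h11 : (u - √u) • (4 * K * (C1 * 2 ^ K * (β ^ K / log u ^ K))) ≤ 4 * K * (C1 * 2 ^ K * (u * (β ^ K / log u ^ K))) := by
      rw [smul_eq_mul]
      calc _ ≤ u * (4 * K * (C1 * 2 ^ K * (β ^ K / log u ^ K))) := by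
            gcongr; linarith [sqrt_nonneg u]
        _ = _ := by ring
    rw [zero_mul] at h1 h2
    first | linarith | (simp only [zero_mul] at *; linarith)
  have h12 : 0 ≤ (3:ℝ) ^ K * (u * (β ^ K / log u ^ K)) := by positivity
  refine (norm_add_le _ _).trans ?_
  linarith

lemma one_char (n : ℕ) : (1 : DirichletCharacter ℂ 1) (n : ZMod 1) = 1 := by
  have : (n : ZMod 1) = 1 := Subsingleton.elim _ _
  rw [this, map_one]

lemma zeta_far : ∃ C : ℝ, 1 ≤ C ∧ ∀ s : ℂ, 1 < s.re → s.re ≤ 2 → 1 ≤ |s.im| →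
    ‖Ak 3 1 1 s - Lj 3 1 1 s‖ ≤ C * (1 + |s.im|) ^ (1 / 2 : ℝ) := by
  choose Cj hCj hLj using Lj_bound'
  obtain ⟨C1, hC1, hrec⟩ := rec_bound Cj hCj 3
  obtain ⟨C2, hC2, hlow⟩ := L_lower_gen
  obtain ⟨C3, hC3, hell⟩ := ell_pow_le 36 (by omega)
  set C4 := C1 * (C2 * (2 * Cj 0)) ^ 4 + Cj 3 with hC4
  have h20 : 1 ≤ C2 * (2 * Cj 0) := by nlinarith [hCj 0]
  have hC40 : 1 ≤ C4 := by
    have : 1 ≤ (C2 * (2 * Cj 0)) ^ 4 := one_le_pow₀ h20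
    have := hCj 3
    nlinarith
  have hl3 : 1 ≤ log ((1:ℕ) + 2) := by rw [le_log_iff_exp_le (by norm_num)]; have := exp_one_lt_d9; norm_num; linarith
  refine ⟨C4 * (C3 * log ((1:ℕ) + 2) ^ 36), one_le_mul_of_one_le_of_one_le hC40 (one_le_mul_of_one_le_of_one_le hC3 (one_le_pow₀ hl3)), ?_⟩
  intro s hs1 hs2 ht
  have hl1 := one_le_ell 1 one_pos s.im
  have hell' := hell 1 one_pos s.im
  have htwo := ell_two_mul 1 one_pos s.im
  have hs : s = 1 + ((s.re - 1 : ℝ) : ℂ) + Complex.I * (s.im : ℂ) := by apply Complex.ext <;> simp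
  have hc0 := hCj 0
  have h1 := hlow 1 one_pos 1 s.im (2 * Cj 0 * ell 1 s.im) (Or.inr ht) (one_le_mul_of_one_le_of_one_le (by linarith) hl1) (by
    intro x hx hx1
    have := hLj 0 1 one_pos ((1 : DirichletCharacter ℂ 1) ^ 2) (1 + x + 2 * Complex.I * s.im) (Or.inr (by
      simp [abs_mul]; linarith)) (by simpa using hx) (by simp; linarith)
    have e : (1 + (x:ℂ) + 2 * Complex.I * s.im).im = 2 * s.im := by simp
    rw [e, zero_add, pow_one] at this
    refine this.trans ?_
    nlinarith) (s.re - 1) (by linarith) (by linarith)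
  rw [← hs] at h1
  set l := ell 1 s.im
  have h2 := hrec (fun i => Ak i 1 1 s) (fun i => Lj i 1 1 s) (C2 * (2 * Cj 0) * l ^ 7) l
    (one_le_mul_of_one_le_of_one_le h20 (one_le_pow₀ hl1)) hl1 (by refine h1.trans (le_of_eq ?_); ring)
    (fun j => hLj j 1 one_pos 1 s (Or.inr ht) hs1 hs2) (fun k => Ak_leibniz k 1 1 s hs1)
  have h3 := hLj 3 1 one_pos 1 s (Or.inr ht) hs1 hs2
  have h4 : l ^ (3 + 1) ≤ l ^ 36 := pow_le_pow_right₀ hl1 (by norm_num)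
  have := hCj 3
  calc ‖Ak 3 1 1 s - Lj 3 1 1 s‖ ≤ ‖Ak 3 1 1 s‖ + ‖Lj 3 1 1 s‖ := norm_sub_le _ _
    _ ≤ C1 * (C2 * (2 * Cj 0) * l ^ 7 * l ^ 2) ^ (3 + 1) + Cj 3 * l ^ 36 := add_le_add h2 (h3.trans (by gcongr))
    _ = C4 * l ^ 36 := by rw [hC4]; ring
    _ ≤ C4 * (C3 * log ((1:ℕ) + 2) ^ 36 * (1 + |s.im|) ^ (1 / 2 : ℝ)) := by gcongr
    _ = _ := by ring

def Hz : ℂ → ℂ := Function.update (fun s => (s - 1) * riemannZeta s) 1 1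

lemma Hz_diff : Differentiable ℂ Hz := by
  rw [← differentiableOn_univ, ← Complex.differentiableOn_compl_singleton_and_continuousAt_iff (c := (1:ℂ)) univ_mem]
  constructor
  · intro s hs
    have hs1 : s ≠ 1 := by simpa using hs
    refine DifferentiableAt.differentiableWithinAt ?_
    have h1 : DifferentiableAt ℂ (fun s => (s - 1) * riemannZeta s) s :=
      (differentiableAt_id.sub_const 1).mul (differentiableAt_riemannZeta hs1)
    refine h1.congr_of_eventuallyEq ?_
    filter_upwards [isOpen_ne.mem_nhds hs1] with z hz
    exact Function.update_of_ne hz _ _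
  · unfold Hz
    rw [continuousAt_update_same]
    exact riemannZeta_residue_one

lemma Hz_ne (s : ℂ) (hs : 1 ≤ s.re) : Hz s ≠ 0 := by
  unfold Hz
  rcases eq_or_ne s 1 with rfl | h
  · simp
  · rw [Function.update_of_ne h]
    exact mul_ne_zero (sub_ne_zero.2 h) (riemannZeta_ne_zero_of_one_le_re hs)

def Fz (s : ℂ) : ℂ := - (deriv Hz s / Hz s) - dslope Hz 1 s

lemma Fz_an : AnalyticOnNhd ℂ Fz {s | Hz s ≠ 0} := by
  have hU : IsOpen {s | Hz s ≠ 0} := isOpen_ne_fun Hz_diff.continuous continuous_const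
  refine DifferentiableOn.analyticOnNhd ?_ hU
  have h1 : Differentiable ℂ (deriv Hz) := by
    have := (Complex.analyticOnNhd_univ_iff_differentiable.2 Hz_diff).deriv
    exact Complex.analyticOnNhd_univ_iff_differentiable.1 this
  have h2 : Differentiable ℂ (dslope Hz 1) := by
    rw [← differentiableOn_univ, Complex.differentiableOn_dslope univ_mem]
    exact Hz_diff.differentiableOn
  exact ((h1.differentiableOn.div Hz_diff.differentiableOn fun s hs => hs).neg).sub h2.differentiableOn

def ez (n : ℕ) : ℂ := (ArithmeticFunction.vonMangoldt n : ℂ) - 1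

lemma ez_abs : LSeries.abscissaOfAbsConv ez ≤ 1 := by
  have h : ez = (fun n => (ArithmeticFunction.vonMangoldt n : ℂ)) - 1 := by ext n; simp [ez]
  rw [h]
  refine (LSeries.abscissaOfAbsConv_sub_le _ _).trans (max_le ?_ LSeries.abscissaOfAbsConv_one.le)
  have := abscissa_twist 1 1
  simpa only [one_char, one_mul] using this

lemma ez_eq (s : ℂ) (hs : 1 < s.re) : LSeries ez s = Fz s := by
  have h : ez = (fun n => (ArithmeticFunction.vonMangoldt n : ℂ)) - 1 := by ext n; simp [ez]
  have hs1 : s ≠ 1 := by rintro rfl; simp at hs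
  rw [h, LSeries_sub (ArithmeticFunction.LSeriesSummable_vonMangoldt hs) (LSeriesSummable_one_iff.2 hs),
    ArithmeticFunction.LSeries_vonMangoldt_eq_deriv_riemannZeta_div hs, LSeries_one_eq_riemannZeta hs]
  have hz : riemannZeta s ≠ 0 := riemannZeta_ne_zero_of_one_le_re hs.le
  have hs0 := sub_ne_zero.2 hs1
  have e1 : Hz s = (s - 1) * riemannZeta s := Function.update_of_ne hs1 _ _
  have e2 : deriv Hz s = riemannZeta s + (s - 1) * deriv riemannZeta s := by
    have h1 : HasDerivAt (fun s => (s - 1) * riemannZeta s) (1 * riemannZeta s + (s - 1) * deriv riemannZeta s) s :=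
      ((hasDerivAt_id s).sub_const 1).mul (differentiableAt_riemannZeta hs1).hasDerivAt
    rw [one_mul] at h1
    refine (h1.congr_of_eventuallyEq ?_).deriv
    filter_upwards [isOpen_ne.mem_nhds hs1] with z hz
    exact Function.update_of_ne hz _ _
  have e3 : Hz 1 = 1 := by simp [Hz]
  unfold Fz
  rw [dslope_of_ne _ hs1, slope_def_field, e1, e2, e3]
  field_simp
  ring

lemma ez_log3 (s : ℂ) (hs : 1 < s.re) : LSeries (fun n : ℕ => ((log n ^ 3 : ℝ) : ℂ) * ez n) s = - deriv^[3] Fz s := by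
  have h1 := LSeries_iteratedDeriv 3 (lt_of_le_of_lt ez_abs (by exact_mod_cast hs : (1:EReal) < s.re))
  rw [← logPow_eq] at h1
  have h2 : Set.EqOn (LSeries ez) Fz {s | 1 < s.re} := fun z hz => ez_eq z hz
  have h3 := h2.iteratedDeriv_of_isOpen (isOpen_lt continuous_const Complex.continuous_re) 3 hs
  rw [h1, iteratedDeriv_eq_iterate] at h3
  rw [← h3]; ring

lemma zeta_near : ∃ C : ℝ, 1 ≤ C ∧ ∀ s : ℂ, 1 < s.re → s.re ≤ 2 → |s.im| ≤ 1 →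
    ‖LSeries (fun n : ℕ => ((log n ^ 3 : ℝ) : ℂ) * ez n) s‖ ≤ C := by
  set S : Set ℂ := Set.Icc (1:ℝ) 2 ×ℂ Set.Icc (-1:ℝ) 1 with hS
  have hSc : IsCompact S := isCompact_Icc.reProdIm isCompact_Icc
  have hcont : ContinuousOn (deriv^[3] Fz) S := by
    refine (Fz_an.iterated_deriv 3).continuousOn.mono ?_
    intro s hs
    exact Hz_ne s (Complex.mem_reProdIm.1 hs).1.1
  obtain ⟨C, hC⟩ := hSc.exists_bound_of_continuousOn hcont
  refine ⟨max 1 C, le_max_left _ _, fun s h1 h2 h3 => ?_⟩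
  rw [ez_log3 s h1, norm_neg]
  exact (hC s (Complex.mem_reProdIm.2 ⟨⟨h1.le, h2⟩, abs_le.1 h3⟩)).trans (le_max_right _ _)

lemma zeta_all : ∃ C : ℝ, 1 ≤ C ∧ ∀ s : ℂ, 1 < s.re → s.re ≤ 2 →
    ‖LSeries (fun n : ℕ => ((log n ^ 3 : ℝ) : ℂ) * ez n) s‖ ≤ C * (1 + |s.im|) ^ (1 / 2 : ℝ) := by
  obtain ⟨C1, hC1, h1⟩ := zeta_far
  obtain ⟨C2, hC2, h2⟩ := zeta_near
  refine ⟨C1 + C2, by linarith, fun s hs hs2 => ?_⟩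
  have hp : 1 ≤ (1 + |s.im|) ^ (1 / 2 : ℝ) := Real.one_le_rpow (by linarith [abs_nonneg s.im]) (by norm_num)
  rcases le_total |s.im| 1 with h | h
  · have := h2 s hs hs2 h; nlinarith
  · have := h1 s hs hs2 h
    have e : LSeries (fun n : ℕ => ((log n ^ 3 : ℝ) : ℂ) * ez n) s = Ak 3 1 1 s - Lj 3 1 1 s := by
      unfold Ak Lj
      rw [← LSeries_sub]
      · congr 1; ext n; simp only [Pi.sub_apply, one_char, ez]; ring
      · have := abscissa_twist 1 1
        rw [logPow_eq]
        refine LSeriesSummable_of_abscissaOfAbsConv_lt_re ?_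
        rw [LSeries.absicssaOfAbsConv_logPowMul]
        exact lt_of_le_of_lt this (by exact_mod_cast hs)
      · have := abscissa_char 1 1
        rw [logPow_eq]
        refine LSeriesSummable_of_abscissaOfAbsConv_lt_re ?_
        rw [LSeries.absicssaOfAbsConv_logPowMul]
        exact lt_of_le_of_lt this (by exact_mod_cast hs)
    rw [e]; nlinarith

lemma unweight (a : ℕ → ℂ) (M : ℝ) (hM : 0 ≤ M)
    (h : ∀ t : ℝ, 3 ≤ t → ‖∑ n ∈ Icc 0 ⌊t⌋₊, ((log n ^ 3 : ℝ) : ℂ) * a n‖ ≤ M * t * log t ^ 2) (u : ℝ) (hu : 9 ≤ u) :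
    ‖∑ n ∈ Ioc ⌊√u⌋₊ ⌊u⌋₊, a n‖ ≤ 10 * M * (u / log u) := by
  have hu0 : 0 < u := by linarith
  have hl1 : ∀ v : ℝ, 3 ≤ v → 1 ≤ log v := by
    intro v hv
    rw [le_log_iff_exp_le (by linarith)]; have := exp_one_lt_d9; linarith
  have hl := hl1 u (by linarith)
  have hs3 : 3 ≤ √u := by apply le_sqrt_of_sq_le; norm_num; exact hu
  have hsu : √u ≤ u := by rw [sqrt_le_iff]; constructor <;> nlinarith
  have hls : log √u = log u / 2 := Real.log_sqrt hu0.le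
  set c : ℕ → ℂ := fun n => ((log n ^ 3 : ℝ) : ℂ) * a n with hc
  set f : ℝ → ℂ := fun t => (((log t) ^ 3)⁻¹ : ℝ) with hf
  set f' : ℝ → ℂ := fun t => ((-(((3 : ℕ):ℝ) * log t ^ 2 * t⁻¹) / (log t ^ 3) ^ 2 : ℝ) : ℂ) with hf'
  have hE : ∀ t : ℝ, 3 ≤ t → ‖∑ n ∈ Icc 0 ⌊t⌋₊, c n - 0 * (t:ℂ)‖ ≤ M * t * log t ^ 2 := by
    intro t ht
    rw [zero_mul, sub_zero]; exact h t ht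
  have hlt2 : ∀ t : ℝ, √u ≤ t → log u / 2 ≤ log t := by intro t ht; rw [← hls]; exact log_le_log (by linarith) ht
  have hfE : ∀ t : ℝ, √u ≤ t → t ≤ u → ‖f t‖ * ‖∑ n ∈ Icc 0 ⌊t⌋₊, c n - 0 * (t:ℂ)‖ ≤ 2 * M * (u / log u) := by
    intro t ht htu
    have ht3 : 3 ≤ t := hs3.trans ht
    have hlt := hl1 t ht3
    have := hlt2 t ht
    have hnf : ‖f t‖ = (log t ^ 3)⁻¹ := by simp only [hf]; rw [Complex.norm_real, norm_of_nonneg (by positivity)]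
    rw [hnf]
    calc _ ≤ (log t ^ 3)⁻¹ * (M * t * log t ^ 2) := by gcongr; exact hE t ht3
      _ = M * (t / log t) := by field_simp
      _ ≤ M * (u / (log u / 2)) := by gcongr
      _ = _ := by field_simp
  have hfE' : ∀ t ∈ Set.Icc √u u, ‖f' t‖ * ‖∑ n ∈ Icc 0 ⌊t⌋₊, c n - 0 * (t:ℂ)‖ ≤ 6 * M * (1 / log u) := by
    intro t ⟨ht, htu⟩
    have ht3 : 3 ≤ t := hs3.trans ht
    have hlt := hl1 t ht3
    have := hlt2 t ht
    have hn : ‖f' t‖ = ((3 : ℕ):ℝ) * log t ^ 2 * t⁻¹ / (log t ^ 3) ^ 2 := by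
      simp only [hf']
      rw [Complex.norm_real, neg_div, norm_neg, norm_of_nonneg (by positivity)]
    rw [hn]
    calc _ ≤ ((3 : ℕ):ℝ) * log t ^ 2 * t⁻¹ / (log t ^ 3) ^ 2 * (M * t * log t ^ 2) := by
          gcongr; exact hE t ht3
      _ = 3 * M * (1 / (log t * log t)) := by push_cast; field_simp
      _ ≤ 3 * M * (1 / (log u / 2 * 1)) := by gcongr
      _ = _ := by field_simp; ring
  have hder : ∀ t ∈ Set.Icc √u u, HasDerivAt f (f' t) t := by
    intro t ⟨ht, htu⟩
    have ht3 : 3 ≤ t := hs3.trans ht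
    have hlt := hl1 t ht3
    have h1 := ((hasDerivAt_log (by linarith : t ≠ 0)).pow 3).inv (by simp only [Pi.pow_apply]; positivity)
    exact h1.ofReal_comp
  have hcont : ContinuousOn f' (Set.Icc √u u) := by
    have hlc : ContinuousOn log (Set.Icc √u u) := Real.continuousOn_log.mono fun t ht => by
      have := hs3.trans ht.1; simp only [Set.mem_compl_iff, Set.mem_singleton_iff]; linarith
    refine Complex.continuous_ofReal.comp_continuousOn ?_
    refine ContinuousOn.div ?_ ((hlc.pow _).pow _) ?_
    · refine ((continuousOn_const.mul (hlc.pow _)).mul (continuousOn_id.inv₀ fun t ht => ?_)).neg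
      have := hs3.trans ht.1; simp only [id]; linarith
    · intro t ht
      have := hl1 t (hs3.trans ht.1); positivity
  have hps := ps_bound c 0 f f' √u u (sqrt_nonneg _) hsu hder hcont (fun _ => 6 * M * (1 / log u)) (by simp) (by
    intro t ht; exact hfE' t ht)
  rw [intervalIntegral.integral_const, zero_mul, sub_zero] at hps
  have h1 := hfE u hsu le_rfl
  have h2 := hfE √u le_rfl hsu
  have e1 : ∑ n ∈ Ioc ⌊√u⌋₊ ⌊u⌋₊, f n * c n = ∑ n ∈ Ioc ⌊√u⌋₊ ⌊u⌋₊, a n := by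
    refine sum_congr rfl fun n hn => ?_
    have h3 : 3 < n := lt_of_le_of_lt (Nat.le_floor (by exact_mod_cast hs3)) (mem_Ioc.1 hn).1
    have : log n ≠ 0 := (log_pos (by exact_mod_cast (by omega : 1 < n))).ne'
    simp only [hc, hf]
    rw [← mul_assoc, ← Complex.ofReal_mul, inv_mul_cancel₀ (pow_ne_zero _ this)]; simp
  rw [e1] at hps
  refine hps.trans ?_
  have h11 : (u - √u) • (6 * M * (1 / log u)) ≤ 6 * M * (u / log u) := by
    rw [smul_eq_mul]
    calc _ ≤ u * (6 * M * (1 / log u)) := by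
          gcongr; linarith [sqrt_nonneg u]
      _ = _ := by ring
  refine (add_le_add (add_le_add h1 h2) h11).trans (le_of_eq (by ring))

/-- PNT with error term -/
theorem pnt : ∃ C : ℝ, 1 ≤ C ∧ ∀ u : ℝ, 2 ≤ u → |Chebyshev.psi u - u| ≤ C * u / log u ∧ |Chebyshev.theta u - u| ≤ C * u / log u := by
  obtain ⟨C1, hC1, hz⟩ := zeta_all
  obtain ⟨C2, hC2, hT⟩ := tauber 4
  obtain ⟨C3, hC3, hS⟩ := logpow_sqrt 2
  set M := C2 * √C1 with hM
  have hM0 : 0 ≤ M := by positivity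
  have hez : ∀ n : ℕ, 1 ≤ n → ‖ez n‖ ≤ 1 + log n := by
    intro n hn
    have h0 : 0 ≤ log n := log_natCast_nonneg n
    have h1 := ArithmeticFunction.vonMangoldt_le_log (n := n)
    have h3 : 0 ≤ ArithmeticFunction.vonMangoldt n := ArithmeticFunction.vonMangoldt_nonneg
    unfold ez
    rw [← Complex.ofReal_one, ← Complex.ofReal_sub, Complex.norm_real, norm_eq_abs, abs_le]
    constructor <;> linarith
  have hw : ∀ t : ℝ, 3 ≤ t → ‖∑ n ∈ Icc 0 ⌊t⌋₊, ((log n ^ 3 : ℝ) : ℂ) * ez n‖ ≤ M * t * log t ^ 2 := by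
    intro t ht
    have hlt : 0 ≤ log t := log_nonneg (by linarith)
    have := hT (fun n : ℕ => ((log n ^ 3 : ℝ) : ℂ) * ez n) C1 hC1 (by
      intro n hn
      have h0 : 0 ≤ log n := log_natCast_nonneg n
      rw [norm_mul, Complex.norm_real, norm_of_nonneg (by positivity), pow_succ (1 + log n) 3]
      have := hez n hn
      gcongr
      linarith) hz t ht
    have e : ∑ n ∈ Icc 0 ⌊t⌋₊, ((log n ^ 3 : ℝ) : ℂ) * ez n = ∑ n ∈ Icc 1 ⌊t⌋₊, ((log n ^ 3 : ℝ) : ℂ) * ez n := by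
      symm
      refine sum_subset (Icc_subset_Icc_left (by omega)) ?_
      intro n h1 h2
      simp only [mem_Icc] at h1 h2
      have : n = 0 := by omega
      simp [this]
    rw [e]
    refine this.trans (le_of_eq ?_)
    rw [sqrt_mul (by linarith), show log t ^ 4 = (log t ^ 2) ^ 2 by ring, sqrt_sq (by positivity), hM]
    ring
  have hbig : ∀ u : ℝ, 9 ≤ u → |Chebyshev.psi u - u| ≤ (10 * M + 4 * C3) * (u / log u) := by
    intro u hu
    have hu0 : 0 < u := by linarith
    have hl : 1 ≤ log u := by rw [le_log_iff_exp_le (by linarith)]; have := exp_one_lt_d9; linarith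
    have h1 := unweight ez M hM0 hw u hu
    have hsu : √u ≤ u := by rw [sqrt_le_iff]; constructor <;> nlinarith
    have hfl := Nat.floor_mono hsu
    have hs1 : 1 ≤ √u := one_le_sqrt.2 (by linarith)
    have hf1 : 1 ≤ ⌊√u⌋₊ := Nat.le_floor (by exact_mod_cast hs1)
    have e1 : ((Chebyshev.psi u - ⌊u⌋₊ : ℝ) : ℂ) = ∑ n ∈ Icc 1 ⌊√u⌋₊, ez n + ∑ n ∈ Ioc ⌊√u⌋₊ ⌊u⌋₊, ez n := by
      rw [← sum_union]
      · have : Icc 1 ⌊√u⌋₊ ∪ Ioc ⌊√u⌋₊ ⌊u⌋₊ = Ioc 0 ⌊u⌋₊ := by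
          ext n; simp only [mem_Icc, mem_union, mem_Ioc]; omega
        rw [this, Chebyshev.psi]
        simp [ez, sum_sub_distrib]
      · rw [disjoint_left]; intro n h1 h2
        simp only [mem_Icc, mem_Ioc] at h1 h2; omega
    have h2 : ‖∑ n ∈ Icc 1 ⌊√u⌋₊, ez n‖ ≤ √u * (2 * log u) := by
      refine (norm_sum_le _ _).trans ?_
      refine (sum_le_sum (g := fun _ => 2 * log u) fun n hn => ?_).trans ?_
      · refine (hez n (mem_Icc.1 hn).1).trans ?_
        have h3 := (Nat.le_floor_iff (sqrt_nonneg u)).1 (mem_Icc.1 hn).2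
        have : log n ≤ log u := log_le_log (by exact_mod_cast (mem_Icc.1 hn).1) (h3.trans hsu)
        linarith
      · rw [sum_const, Nat.card_Icc, nsmul_eq_mul, Nat.add_sub_cancel]
        gcongr; exact Nat.floor_le (sqrt_nonneg u)
    have h3 : |Chebyshev.psi u - ⌊u⌋₊| ≤ √u * (2 * log u) + 10 * M * (u / log u) := by
      rw [← norm_eq_abs, ← Complex.norm_real, e1]
      exact (norm_add_le _ _).trans (add_le_add h2 h1)
    have h4 : |(⌊u⌋₊:ℝ) - u| ≤ 1 := by
      have h4 := Nat.floor_le hu0.le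
      have h5 := Nat.lt_floor_add_one u
      rw [abs_le]; constructor <;> linarith
    have h5 : √u * log u ≤ C3 * (u / log u) := by
      have h6 := hS u (by linarith)
      rw [mul_div_assoc', le_div_iff₀ (by linarith)]
      calc √u * log u * log u = √u * log u ^ 2 := by ring
        _ ≤ √u * (C3 * √u) := by gcongr
        _ = C3 * (√u * √u) := by ring
        _ = _ := by rw [mul_self_sqrt hu0.le]
    have h7 : 1 ≤ √u * log u := one_le_mul_of_one_le_of_one_le hs1 hl
    have h8 : |Chebyshev.psi u - u| ≤ |Chebyshev.psi u - ⌊u⌋₊| + |(⌊u⌋₊:ℝ) - u| := abs_sub_le _ _ _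
    nlinarith
  have hlin : ∀ u : ℝ, 2 ≤ u → u < 9 → |Chebyshev.psi u - u| ≤ 100 * (u / log u) := by
    intro u hu hu9
    have h1 := Chebyshev.psi_le_const_mul_self (x := u) (by linarith)
    have h2 := Chebyshev.psi_nonneg u
    have h3 : log 4 ≤ 2 := by
      have : log 4 = 2 * log 2 := by rw [show (4:ℝ) = 2 ^ 2 by norm_num, log_pow]; norm_num
      have := Real.log_two_lt_d9; linarith
    have hl0 : 0 < log u := log_pos (by linarith)
    have hl3 : log u ≤ 8 := by have := log_le_sub_one_of_pos (by linarith : 0 < u); linarith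
    have h4 : |Chebyshev.psi u - u| ≤ 8 * u := by rw [abs_le]; constructor <;> nlinarith
    refine h4.trans ?_
    rw [mul_div_assoc', le_div_iff₀ hl0]
    nlinarith
  have hpsi : ∀ u : ℝ, 2 ≤ u → |Chebyshev.psi u - u| ≤ (10 * M + 4 * C3 + 100) * (u / log u) := by
    intro u hu
    have hl0 : 0 < log u := log_pos (by linarith)
    have hq : 0 ≤ u / log u := by positivity
    have hq2 : 0 ≤ (10 * M + 4 * C3) * (u / log u) := by positivity
    rcases lt_or_ge u 9 with h | h
    · have := hlin u hu h; nlinarith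
    · have := hbig u h; nlinarith
  refine ⟨10 * M + 6 * C3 + 100, by nlinarith, fun u hu => ?_⟩
  have hl0 : 0 < log u := log_pos (by linarith)
  have hq : 0 ≤ u / log u := by positivity
  have h1 := hpsi u hu
  have h2 := Chebyshev.abs_psi_sub_theta_le_sqrt_mul_log (x := u) (by linarith)
  have h5 : √u * log u ≤ C3 * (u / log u) := by
    have h6 := hS u (by linarith)
    rw [mul_div_assoc', le_div_iff₀ hl0]
    calc √u * log u * log u = √u * log u ^ 2 := by ring
      _ ≤ √u * (C3 * √u) := by gcongr
      _ = C3 * (√u * √u) := by ring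
      _ = _ := by rw [mul_self_sqrt (by linarith)]
  have h3 : |Chebyshev.theta u - u| ≤ |Chebyshev.theta u - Chebyshev.psi u| + |Chebyshev.psi u - u| := abs_sub_le _ _ _
  rw [abs_sub_comm (Chebyshev.theta u) (Chebyshev.psi u)] at h3
  rw [mul_div_assoc]
  have h9 : 0 ≤ C3 * (u / log u) := by positivity
  constructor
  · linarith
  · linarith

lemma half_le_log {t : ℝ} (ht : 2 ≤ t) : 1 / 2 ≤ log t := by
  have := Real.log_two_gt_d9
  have := log_le_log (by norm_num) ht
  linarith

/-- sums over primes of a slowly varying function against `1/p` -/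
lemma prime_sum : ∃ C : ℝ, 1 ≤ C ∧ ∀ (φ φ' : ℝ → ℝ) (K a b : ℝ), 2 ≤ a → a ≤ b → 0 ≤ K →
    (∀ t ∈ Set.Icc a b, HasDerivAt φ (φ' t) t) → ContinuousOn φ' (Set.Icc a b) →
    (∀ t ∈ Set.Icc a b, |φ t| ≤ K) → (∀ t ∈ Set.Icc a b, |φ' t| ≤ K / t) →
    |∑ p ∈ (Ioc ⌊a⌋₊ ⌊b⌋₊).filter Nat.Prime, φ p / p - ∫ t in a..b, φ t / (t * log t)|
      ≤ C * K / log a := by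
  obtain ⟨C, hC, hp⟩ := pnt
  refine ⟨12 * C, by linarith, ?_⟩
  intro φ φ' K a b ha hab hK hder hcont hφ hφ'
  set c : ℕ → ℝ := fun n => if n.Prime then log n else 0 with hc
  have hE : ∀ t : ℝ, 2 ≤ t → |∑ k ∈ Icc 0 ⌊t⌋₊, c k - 1 * t| ≤ C * t / log t := by
    intro t ht
    have h1 : ∑ k ∈ Icc 0 ⌊t⌋₊, c k = Chebyshev.theta t := by
      rw [Chebyshev.theta, sum_filter]
      symm
      apply sum_subset
      · intro k; simp only [mem_Ioc, mem_Icc]; omega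
      · intro k hk hk'
        simp only [mem_Ioc, mem_Icc] at hk hk'
        have : k = 0 := by omega
        subst this; simp
    rw [h1, one_mul]; exact (hp t ht).2
  have hpos : ∀ t ∈ Set.Icc a b, 0 < t ∧ 1 / 2 ≤ log t ∧ 2 ≤ t := fun t ht =>
    ⟨by linarith [ht.1], half_le_log (by linarith [ht.1]), by linarith [ht.1]⟩
  have hne : ∀ t ∈ Set.Icc a b, t * log t ≠ 0 := fun t ht => by
    obtain ⟨h1, h2, _⟩ := hpos t ht
    have : 0 < log t := by linarith
    positivity
  set f : ℝ → ℝ := fun t => φ t / (t * log t) with hf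
  set f' : ℝ → ℝ := fun t => (φ' t * (t * log t) - φ t * (1 * log t + t * t⁻¹)) / (t * log t) ^ 2 with hf'
  have hder' : ∀ t ∈ Set.Icc a b, HasDerivAt f (f' t) t := by
    intro t ht
    exact (hder t ht).div ((hasDerivAt_id t).mul (hasDerivAt_log (hpos t ht).1.ne')) (hne t ht)
  have hlogc : ContinuousOn log (Set.Icc a b) := fun t ht => (continuousAt_log (hpos t ht).1.ne').continuousWithinAt
  have hφc : ContinuousOn φ (Set.Icc a b) := fun t ht => (hder t ht).continuousAt.continuousWithinAt
  have hinv : ContinuousOn (fun t : ℝ => t⁻¹) (Set.Icc a b) := continuousOn_id.inv₀ (fun t ht => (hpos t ht).1.ne')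
  have hcont' : ContinuousOn f' (Set.Icc a b) := by
    apply ContinuousOn.div
    · exact (hcont.mul (continuousOn_id.mul hlogc)).sub (hφc.mul ((continuousOn_const.mul hlogc).add (continuousOn_id.mul hinv)))
    · exact (continuousOn_id.mul hlogc).pow 2
    · exact fun t ht => pow_ne_zero _ (hne t ht)
  have hGd : ∀ t ∈ Set.uIcc a b, HasDerivAt (fun t => -(4 * C * K) * (log t)⁻¹) (4 * C * K / (t * log t ^ 2)) t := by
    intro t ht
    rw [Set.uIcc_of_le hab] at ht
    obtain ⟨h1, h2, _⟩ := hpos t ht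
    have h3 : log t ≠ 0 := by linarith
    have := ((hasDerivAt_log h1.ne').inv h3).const_mul (-(4 * C * K))
    refine this.congr_deriv ?_
    field_simp
  have hhi : IntervalIntegrable (fun t => 4 * C * K / (t * log t ^ 2)) volume a b := by
    apply ContinuousOn.intervalIntegrable
    rw [Set.uIcc_of_le hab]
    apply continuousOn_const.div (continuousOn_id.mul (hlogc.pow 2))
    intro t ht
    obtain ⟨h1, h2, _⟩ := hpos t ht
    have : 0 < log t := by linarith
    change t * log t ^ 2 ≠ 0
    positivity
  have hps := ps_bound c 1 f f' a b (by linarith) hab hder' hcont' (fun t => 4 * C * K / (t * log t ^ 2)) hhi (by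
    intro t ht
    obtain ⟨h1, h2, h3⟩ := hpos t ht
    have h4 : 0 < log t := by linarith
    have h5 : ‖f' t‖ ≤ 4 * K / (t ^ 2 * log t) := by
      rw [hf', norm_eq_abs, abs_div, abs_of_pos (show 0 < (t * log t) ^ 2 by positivity), div_le_div_iff₀ (by positivity) (by positivity)]
      have e1 : |φ' t * (t * log t) - φ t * (1 * log t + t * t⁻¹)| ≤ 4 * K * log t := by
        have e2 : |φ' t * (t * log t)| ≤ K * log t := by
          rw [abs_mul, abs_of_pos (show 0 < t * log t by positivity)]
          have := mul_le_mul_of_nonneg_right (hφ' t ht) (show 0 ≤ t * log t by positivity)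
          refine this.trans (le_of_eq ?_)
          field_simp
        have e3 : |φ t * (1 * log t + t * t⁻¹)| ≤ K * (3 * log t) := by
          rw [mul_inv_cancel₀ h1.ne', abs_mul, abs_of_pos (show 0 < 1 * log t + 1 by positivity)]
          exact mul_le_mul (hφ t ht) (by linarith) (by positivity) hK
        have := abs_sub (φ' t * (t * log t)) (φ t * (1 * log t + t * t⁻¹))
        linarith
      calc _ ≤ 4 * K * log t * (t ^ 2 * log t) := by gcongr
        _ = _ := by ring
    calc ‖f' t‖ * ‖∑ k ∈ Icc 0 ⌊t⌋₊, c k - 1 * t‖ ≤ 4 * K / (t ^ 2 * log t) * (C * t / log t) := by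
          apply mul_le_mul h5 (hE t h3) (abs_nonneg _) (by positivity)
      _ = _ := by field_simp)
  have hG := intervalIntegral.integral_eq_sub_of_hasDerivAt hGd hhi
  have hfb : ∀ t ∈ Set.Icc a b, ‖f t‖ * ‖∑ k ∈ Icc 0 ⌊t⌋₊, c k - 1 * t‖ ≤ 2 * C * K / log a := by
    intro t ht
    obtain ⟨h1, h2, h3⟩ := hpos t ht
    have h4 : 0 < log t := by linarith
    have h6 : log a ≤ log t := log_le_log (by linarith) ht.1
    have h7 := half_le_log ha
    have h5 : ‖f t‖ ≤ K / (t * log t) := by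
      rw [hf, norm_eq_abs, abs_div, abs_of_pos (show 0 < t * log t by positivity)]
      gcongr; exact hφ t ht
    calc _ ≤ K / (t * log t) * (C * t / log t) := mul_le_mul h5 (hE t h3) (abs_nonneg _) (by positivity)
      _ = C * K / log t ^ 2 := by field_simp
      _ ≤ 2 * C * K / log a := by
        rw [div_le_div_iff₀ (by positivity) (by linarith)]
        have : log a ≤ 2 * log t ^ 2 := by nlinarith
        have := mul_le_mul_of_nonneg_left this (show 0 ≤ C * K by positivity)
        linarith
  have hsum : ∑ k ∈ Ioc ⌊a⌋₊ ⌊b⌋₊, f k * c k = ∑ p ∈ (Ioc ⌊a⌋₊ ⌊b⌋₊).filter Nat.Prime, φ p / p := by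
    rw [sum_filter]
    apply sum_congr rfl
    intro k hk
    simp only [hc, hf]
    split_ifs with h
    · have h1 : 0 < (k:ℝ) := by exact_mod_cast h.pos
      have h2 : log k ≠ 0 := by
        have : 0 < log (k:ℝ) := log_pos (by exact_mod_cast h.one_lt)
        exact this.ne'
      field_simp
    · simp
  rw [hsum, hG] at hps
  have hla := half_le_log ha
  have hlb := half_le_log (ha.trans hab)
  have hfin : -(4 * C * K) * (log b)⁻¹ - -(4 * C * K) * (log a)⁻¹ ≤ 4 * C * K / log a := by
    have : 0 ≤ (4 * C * K) * (log b)⁻¹ := by positivity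
    rw [div_eq_mul_inv]; linarith
  rw [norm_eq_abs, one_mul] at hps
  refine hps.trans ?_
  have := add_le_add (add_le_add (hfb b ⟨hab, le_rfl⟩) (hfb a ⟨le_rfl, hab⟩)) hfin
  refine this.trans ?_
  rw [← add_div, ← add_div]
  gcongr
  have : 0 ≤ C * K := by positivity
  linarith

lemma loglog_int {a b : ℝ} (ha : 2 ≤ a) (hab : a ≤ b) :
    ∫ t in a..b, 1 / (t * log t) = log (log b) - log (log a) := by
  have hpos : ∀ t ∈ Set.uIcc a b, 0 < t ∧ 0 < log t := fun t ht => by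
    rw [Set.uIcc_of_le hab] at ht
    exact ⟨by linarith [ht.1], by linarith [half_le_log (ha.trans ht.1)]⟩
  apply intervalIntegral.integral_eq_sub_of_hasDerivAt (f := fun t => log (log t))
  · intro t ht
    obtain ⟨h1, h2⟩ := hpos t ht
    have := (hasDerivAt_log h1.ne').log h2.ne'
    refine this.congr_deriv ?_
    field_simp
  · apply ContinuousOn.intervalIntegrable
    apply continuousOn_const.div
    · exact continuousOn_id.mul fun t ht => (continuousAt_log (hpos t ht).1.ne').continuousWithinAt
    · intro t ht
      obtain ⟨h1, h2⟩ := hpos t ht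
      positivity

/-- `-log(1-1/p)` -/
def hm (n : ℕ) : ℝ := if n.Prime then -log (1 - 1 / (n:ℝ)) else 0

lemma hm_bounds {n : ℕ} (hn : n.Prime) : 1 / (n:ℝ) ≤ hm n ∧ hm n ≤ 1 / n + 2 * ((n:ℝ) ^ 2)⁻¹ := by
  have h2 : (2:ℝ) ≤ n := by exact_mod_cast hn.two_le
  have h0 : (0:ℝ) < n := by linarith
  have h1 : 0 < 1 - 1 / (n:ℝ) := by rw [sub_pos, div_lt_one h0]; linarith
  rw [hm, if_pos hn]
  constructor
  · have := log_le_sub_one_of_pos h1; linarith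
  · have := Real.one_sub_inv_le_log_of_pos h1
    have h3 : (1 - 1 / (n:ℝ))⁻¹ ≤ 1 + (1 / n + 2 * ((n:ℝ) ^ 2)⁻¹) := by
      rw [inv_le_iff_one_le_mul₀ h1]
      have : (1 + (1 / (n:ℝ) + 2 * ((n:ℝ) ^ 2)⁻¹)) * (1 - 1 / (n:ℝ)) = 1 + (n - 2) / (n:ℝ) ^ 3 := by field_simp; ring
      rw [this]
      have : 0 ≤ ((n:ℝ) - 2) / (n:ℝ) ^ 3 := div_nonneg (by linarith) (by positivity)
      linarith
    linarith

lemma hm_nonneg (n : ℕ) : 0 ≤ hm n := by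
  by_cases hn : n.Prime
  · exact le_trans (by positivity) (hm_bounds hn).1
  · simp [hm, hn]

lemma hm_diff : ∃ C : ℝ, 1 ≤ C ∧ ∀ a b : ℝ, 2 ≤ a → a ≤ b →
    |∑ n ∈ Ioc ⌊a⌋₊ ⌊b⌋₊, hm n - (log (log b) - log (log a))| ≤ C / log a := by
  obtain ⟨C, hC, h⟩ := prime_sum
  refine ⟨C + 4, by linarith, ?_⟩
  intro a b ha hab
  have h1 := h (fun _ => 1) (fun _ => 0) 1 a b ha hab zero_le_one (fun t _ => hasDerivAt_const t 1)
    continuousOn_const (fun t _ => by simp) (fun t ht => by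
      have : 0 < t := by linarith [ht.1]
      simp; positivity)
  rw [loglog_int ha hab, mul_one] at h1
  have hfl : 2 ≤ ⌊a⌋₊ := Nat.le_floor (by exact_mod_cast ha)
  have h2 : |∑ n ∈ Ioc ⌊a⌋₊ ⌊b⌋₊, hm n - ∑ p ∈ (Ioc ⌊a⌋₊ ⌊b⌋₊).filter Nat.Prime, 1 / (p:ℝ)| ≤ 4 / log a := by
    rw [sum_filter, ← sum_sub_distrib]
    have hb : ∀ n ∈ Ioc ⌊a⌋₊ ⌊b⌋₊, 0 ≤ hm n - (if n.Prime then 1 / (n:ℝ) else 0) ∧ hm n - (if n.Prime then 1 / (n:ℝ) else 0) ≤ 2 * ((n:ℝ) ^ 2)⁻¹ := by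
      intro n _
      split_ifs with hn
      · have := hm_bounds hn
        constructor <;> linarith
      · simp only [hm, if_neg hn]
        constructor
        · simp
        · simp
    rw [abs_of_nonneg (sum_nonneg fun n hn => (hb n hn).1)]
    refine (sum_le_sum fun n hn => (hb n hn).2).trans ?_
    rw [← mul_sum]
    have h3 := sum_Ioc_inv_sq_le_sub (α := ℝ) (k := ⌊a⌋₊) (n := ⌊b⌋₊) (by omega) (Nat.floor_mono hab)
    have h4 : (⌊a⌋₊:ℝ)⁻¹ ≤ 2 / log a := by
      have e1 : a / 2 ≤ ⌊a⌋₊ := by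
        have := Nat.lt_floor_add_one a
        linarith
      have e2 : log a ≤ a := (log_le_sub_one_of_pos (by linarith)).trans (by linarith)
      have e3 := half_le_log ha
      calc (⌊a⌋₊:ℝ)⁻¹ ≤ (a / 2)⁻¹ := by gcongr
        _ = 2 / a := by rw [inv_div]
        _ ≤ 2 / log a := by gcongr
    have h5 : 0 ≤ (⌊b⌋₊:ℝ)⁻¹ := by positivity
    have : 4 / log a = 2 * (2 / log a) := by ring
    linarith
  have := abs_add_le (∑ n ∈ Ioc ⌊a⌋₊ ⌊b⌋₊, hm n - ∑ p ∈ (Ioc ⌊a⌋₊ ⌊b⌋₊).filter Nat.Prime, 1 / (p:ℝ)) (∑ p ∈ (Ioc ⌊a⌋₊ ⌊b⌋₊).filter Nat.Prime, 1 / (p:ℝ) - (log (log b) - log (log a)))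
  rw [sub_add_sub_cancel] at this
  rw [add_div]; linarith

/-- partial sums -/
def Qm (u : ℝ) : ℝ := ∑ n ∈ Ioc 0 ⌊u⌋₊, hm n

lemma Qm_sub {a b : ℝ} (hab : a ≤ b) : Qm b - Qm a = ∑ n ∈ Ioc ⌊a⌋₊ ⌊b⌋₊, hm n := by
  rw [Qm, Qm, ← sum_Ioc_consecutive _ (Nat.zero_le _) (Nat.floor_mono hab)]; ring

lemma mertens_const : ∃ C c : ℝ, 1 ≤ C ∧ ∀ a : ℝ, 2 ≤ a → |Qm a - log (log a) - c| ≤ C / log a := by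
  obtain ⟨C, hC, h⟩ := hm_diff
  set q : ℝ → ℝ := fun a => Qm a - log (log a) with hq
  have h1 : ∀ a b : ℝ, 2 ≤ a → a ≤ b → |q b - q a| ≤ C / log a := by
    intro a b ha hab
    have := h a b ha hab
    rw [← Qm_sub hab] at this
    convert this using 2
    simp only [hq]; ring
  have hlim : Tendsto (fun n : ℕ => C / log ((n:ℝ) + 2)) atTop (𝓝 0) := by
    apply Tendsto.div_atTop tendsto_const_nhds
    exact Real.tendsto_log_atTop.comp (tendsto_atTop_add_const_right _ _ tendsto_natCast_atTop_atTop)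
  have hca : CauchySeq (fun n : ℕ => q ((n:ℝ) + 2)) := by
    apply cauchySeq_of_le_tendsto_0 _ _ hlim
    have key : ∀ n m N : ℕ, N ≤ n → n ≤ m → dist (q ((n:ℝ) + 2)) (q ((m:ℝ) + 2)) ≤ C / log ((N:ℝ) + 2) := by
      intro n m N hn hm
      have hn' : (N:ℝ) ≤ n := by exact_mod_cast hn
      have hm' : (n:ℝ) ≤ m := by exact_mod_cast hm
      have hN0 : (0:ℝ) ≤ N := by positivity
      rw [dist_comm, Real.dist_eq]
      refine (h1 _ _ (by linarith) (by linarith)).trans ?_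
      have := half_le_log (t := (N:ℝ) + 2) (by linarith)
      gcongr
    intro n m N hn hm
    rcases le_total n m with h | h
    · exact key n m N hn h
    · rw [dist_comm]; exact key m n N hm h
  obtain ⟨c, hc⟩ := cauchySeq_tendsto_of_complete hca
  refine ⟨C, c, hC, fun a ha => ?_⟩
  have h2 : Tendsto (fun n : ℕ => |q ((n:ℝ) + 2) - q a|) atTop (𝓝 |c - q a|) := (hc.sub_const _).abs
  rw [abs_sub_comm]
  refine le_of_tendsto h2 ?_
  obtain ⟨m, hm⟩ := exists_nat_ge a
  filter_upwards [eventually_ge_atTop m] with n hn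
  have : (m:ℝ) ≤ n := by exact_mod_cast hn
  exact h1 a _ ha (by linarith)

/-- Euler factor logs -/
def Zm (η : ℝ) (n : ℕ) : ℝ := if n.Prime then -log (1 - (n:ℝ) ^ (-(1 + η))) else 0

lemma neglog_bounds {v : ℝ} (h0 : 0 < v) (h1 : v ≤ 1 / 2) :
    v ≤ -log (1 - v) ∧ -log (1 - v) ≤ v + 2 * v ^ 2 := by
  have h2 : 0 < 1 - v := by linarith
  constructor
  · have := log_le_sub_one_of_pos h2; linarith
  · have := Real.one_sub_inv_le_log_of_pos h2
    have h3 : (1 - v)⁻¹ ≤ 1 + (v + 2 * v ^ 2) := by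
      rw [inv_le_iff_one_le_mul₀ h2]
      nlinarith [mul_nonneg (sq_nonneg v) (sub_nonneg.2 h1)]
    linarith

lemma rpow_neg_le {n : ℕ} (hn : 2 ≤ n) {η : ℝ} (hη : 0 < η) :
    0 < (n:ℝ) ^ (-(1 + η)) ∧ (n:ℝ) ^ (-(1 + η)) ≤ 1 / n ∧ (n:ℝ) ^ (-(1 + η)) = 1 / n * (n:ℝ) ^ (-η) ∧ (n:ℝ) ^ (-η) ≤ 1 ∧ 1 / (n:ℝ) ≤ 1 / 2 := by
  have h2 : (2:ℝ) ≤ n := by exact_mod_cast hn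
  have h0 : (0:ℝ) < n := by linarith
  have e : (n:ℝ) ^ (-(1 + η)) = 1 / n * (n:ℝ) ^ (-η) := by rw [neg_add, rpow_add h0, rpow_neg_one, one_div]
  have e1 : (n:ℝ) ^ (-η) ≤ 1 := Real.rpow_le_one_of_one_le_of_nonpos (by linarith) (by linarith)
  refine ⟨by positivity, ?_, e, e1, by gcongr⟩
  rw [e]
  exact mul_le_of_le_one_right (by positivity) e1

lemma hZ_diff {n : ℕ} {η : ℝ} (hη : 0 < η) : |hm n * (n:ℝ) ^ (-η) - Zm η n| ≤ 2 * (1 / (n:ℝ) ^ 2) := by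
  by_cases hn : n.Prime
  · obtain ⟨a1, a2, a3, a4, a5⟩ := rpow_neg_le hn.two_le hη
    have b1 := neglog_bounds a1 (a2.trans a5)
    have b2 := hm_bounds hn
    have h0 : (0:ℝ) < n := by exact_mod_cast hn.pos
    have h6 : 0 < (n:ℝ) ^ (-η) := by positivity
    simp only [Zm, if_pos hn]
    have c1 : hm n * (n:ℝ) ^ (-η) ≤ (n:ℝ) ^ (-(1 + η)) + 2 * (1 / (n:ℝ) ^ 2) := by
      rw [a3]
      have := mul_le_mul_of_nonneg_right b2.2 h6.le
      have h7 : 2 * ((n:ℝ) ^ 2)⁻¹ * (n:ℝ) ^ (-η) ≤ 2 * ((n:ℝ) ^ 2)⁻¹ := mul_le_of_le_one_right (by positivity) a4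
      rw [one_div ((n:ℝ)^2)]
      linarith
    have c2 : (n:ℝ) ^ (-(1 + η)) ≤ hm n * (n:ℝ) ^ (-η) := by rw [a3]; exact mul_le_mul_of_nonneg_right b2.1 h6.le
    have c3 : ((n:ℝ) ^ (-(1 + η))) ^ 2 ≤ 1 / (n:ℝ) ^ 2 := by
      calc _ ≤ (1 / (n:ℝ)) ^ 2 := by gcongr
        _ = _ := by rw [one_div_pow]
    rw [abs_le]; constructor <;> linarith
  · simp [hm, Zm, hn]

lemma hm_sum {η : ℝ} (hη : 0 < η) : Summable (fun n : ℕ => hm n * (n:ℝ) ^ (-η)) := by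
  have h1 : Summable (fun n : ℕ => 2 * (n:ℝ) ^ (-(1 + η))) := (Real.summable_nat_rpow.2 (by linarith)).mul_left 2
  refine Summable.of_nonneg_of_le (fun n => mul_nonneg (hm_nonneg n) (by positivity)) (fun n => ?_) h1
  by_cases hn : n.Prime
  · obtain ⟨a1, a2, a3, a4, a5⟩ := rpow_neg_le hn.two_le hη
    have b2 := hm_bounds hn
    have h0 : (0:ℝ) < n := by exact_mod_cast hn.pos
    rw [a3, ← mul_assoc]
    gcongr
    have : 2 * ((n:ℝ) ^ 2)⁻¹ = (2 * (1 / n)) * (1 / n) := by field_simp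
    rw [this] at b2
    have : (2 * (1 / (n:ℝ))) * (1 / n) ≤ 1 * (1 / n) := by gcongr; linarith
    linarith
  · simp [hm, hn]; positivity

lemma Zm_sum {η : ℝ} (hη : 0 < η) : Summable (Zm η) := by
  have h1 : Summable (fun n : ℕ => hm n * (n:ℝ) ^ (-η) - Zm η n) := by
    apply Summable.of_norm_bounded (g := fun n : ℕ => 2 * (1 / (n:ℝ) ^ 2))
    · exact (Real.summable_one_div_nat_pow.2 one_lt_two).mul_left 2
    · intro n; exact hZ_diff hη
  have := (hm_sum hη).sub h1
  simpa using this

lemma TZ_tendsto : Tendsto (fun η : ℝ => ∑' n : ℕ, (hm n * (n:ℝ) ^ (-η) - Zm η n)) (𝓝[>] 0) (𝓝 0) := by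
  have h := tendsto_tsum_of_dominated_convergence (𝓕 := 𝓝[>] (0:ℝ)) (f := fun (η : ℝ) (n : ℕ) => hm n * (n:ℝ) ^ (-η) - Zm η n)
    (g := fun _ => (0:ℝ)) (bound := fun n : ℕ => 2 * (1 / (n:ℝ) ^ 2))
    ((Real.summable_one_div_nat_pow.2 one_lt_two).mul_left 2) (by
      intro n
      by_cases hn : n.Prime
      · have h0 : (0:ℝ) < n := by exact_mod_cast hn.pos
        have h2 : (2:ℝ) ≤ n := by exact_mod_cast hn.two_le
        have hc : ContinuousAt (fun η : ℝ => hm n * (n:ℝ) ^ (-η) - Zm η n) 0 := by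
          simp only [Zm, if_pos hn]
          apply ContinuousAt.sub
          · apply continuousAt_const.mul
            exact ContinuousAt.rpow continuousAt_const continuousAt_id.neg (Or.inl h0.ne')
          · apply ContinuousAt.neg
            apply ContinuousAt.log
            · exact continuousAt_const.sub (ContinuousAt.rpow continuousAt_const (continuousAt_const.add continuousAt_id).neg (Or.inl h0.ne'))
            · simp only [add_zero, rpow_neg_one]
              have : (n:ℝ)⁻¹ ≤ 2⁻¹ := by gcongr
              have : (2:ℝ)⁻¹ < 1 := by norm_num
              linarith
        have h3 := hc.tendsto.mono_left (nhdsWithin_le_nhds (s := Set.Ioi 0))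
        convert h3 using 2
        simp [Zm, hm, hn, rpow_neg_one]
      · simp [hm, Zm, hn]) (by
      filter_upwards [self_mem_nhdsWithin] with η hη n
      exact hZ_diff hη)
  simpa using h

lemma exp_Z {η : ℝ} (hη : 0 < η) : exp (∑' n, Zm η n) = ‖riemannZeta (1 + η : ℝ)‖ := by
  rw [← riemannZeta_eulerProduct_exp_log (s := ((1 + η : ℝ) : ℂ)) (by simp; linarith), Complex.norm_exp]
  congr 1
  have h1 : ∑' p : Nat.Primes, -Complex.log (1 - (p:ℂ) ^ (-((1 + η : ℝ):ℂ))) = ((∑' p : Nat.Primes, -log (1 - (p:ℝ) ^ (-(1 + η))) : ℝ) : ℂ) := by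
    rw [Complex.ofReal_tsum]
    congr 1; ext p
    obtain ⟨a1, a2, a3, a4, a5⟩ := rpow_neg_le p.2.two_le hη
    rw [Complex.ofReal_neg, Complex.ofReal_log (by linarith)]
    congr 2
    push_cast
    rw [Complex.ofReal_cpow (by positivity)]
    push_cast
    rfl
  rw [h1, Complex.ofReal_re]
  have h2 : ∑' p : Nat.Primes, -log (1 - (p:ℝ) ^ (-(1 + η))) = ∑' n, Set.indicator {p : ℕ | p.Prime} (fun n : ℕ => -log (1 - (n:ℝ) ^ (-(1 + η)))) n :=
    tsum_subtype {p : ℕ | p.Prime} (fun n : ℕ => -log (1 - (n:ℝ) ^ (-(1 + η))))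
  rw [h2]
  congr 1; ext n
  simp only [Zm, Set.indicator, Set.mem_ofPred_eq]

lemma Z_tendsto : Tendsto (fun η : ℝ => ∑' n, Zm η n + log η) (𝓝[>] 0) (𝓝 0) := by
  have h1 : Tendsto (fun η : ℝ => (((1 + η : ℝ) : ℂ))) (𝓝[>] 0) (𝓝[≠] 1) := by
    apply tendsto_nhdsWithin_of_tendsto_nhds_of_eventually_within
    · have : ContinuousAt (fun η : ℝ => (((1 + η : ℝ) : ℂ))) 0 := by fun_prop
      have := this.tendsto.mono_left (nhdsWithin_le_nhds (s := Set.Ioi 0))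
      simpa using this
    · filter_upwards [self_mem_nhdsWithin] with η hη
      have hη' : (0:ℝ) < η := hη
      simp [hη'.ne']
  have h2 := (riemannZeta_residue_one.comp h1).norm
  have h3 : Tendsto (fun η : ℝ => log (‖((((1 + η : ℝ) : ℂ)) - 1) * riemannZeta ((1 + η : ℝ) : ℂ)‖)) (𝓝[>] 0) (𝓝 (log ‖(1:ℂ)‖)) :=
    h2.log (by simp)
  rw [norm_one, Real.log_one] at h3
  refine h3.congr' ?_
  filter_upwards [self_mem_nhdsWithin] with η hη
  have hη' : (0:ℝ) < η := hη
  rw [norm_mul, ← exp_Z hη', log_mul _ (exp_pos _).ne', log_exp, add_comm]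
  · congr 2
    have : (((1 + η : ℝ) : ℂ)) - 1 = (η : ℂ) := by push_cast; ring
    rw [this, Complex.norm_real, norm_eq_abs, abs_of_pos hη']
  · have : (((1 + η : ℝ) : ℂ)) - 1 = (η : ℂ) := by push_cast; ring
    rw [this]; simp [hη'.ne']

lemma U_le {η : ℝ} (hη : 0 < η) (M : ℕ) :
    ∑ m ∈ range M, (Qm (exp (m + 1 : ℕ)) - Qm (exp (m:ℕ))) * exp (-η) ^ (m + 1) ≤
      ∑' n : ℕ, hm n * (n:ℝ) ^ (-η) := by
  have h1 : ∑ m ∈ range M, (Qm (exp (m + 1 : ℕ)) - Qm (exp (m:ℕ))) * exp (-η) ^ (m + 1) ≤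
      ∑ n ∈ Ioc 0 ⌊exp (M:ℕ)⌋₊, hm n * (n:ℝ) ^ (-η) := by
    induction M with
    | zero => simp [hm]
    | succ M ih =>
      have hle : exp (M:ℕ) ≤ exp (M + 1 : ℕ) := exp_le_exp.2 (by push_cast; linarith)
      rw [sum_range_succ, ← sum_Ioc_consecutive _ (Nat.zero_le _) (Nat.floor_mono hle)]
      refine add_le_add ih ?_
      rw [Qm_sub hle, sum_mul]
      apply sum_le_sum
      intro n hn
      apply mul_le_mul_of_nonneg_left _ (hm_nonneg n)
      rw [mem_Ioc] at hn
      have hn0 : (0:ℝ) < n := by exact_mod_cast (Nat.zero_le _).trans_lt hn.1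
      have hn1 : (n:ℝ) ≤ exp (M + 1 : ℕ) := (Nat.le_floor_iff (exp_pos _).le).1 hn.2
      rw [← exp_nat_mul, rpow_def_of_pos hn0]
      apply exp_le_exp.2
      have : log n ≤ (M + 1 : ℕ) := by rw [← log_exp (M + 1 : ℕ)]; exact log_le_log hn0 hn1
      nlinarith
  refine h1.trans ?_
  exact (hm_sum hη).sum_le_tsum _ (fun n _ => mul_nonneg (hm_nonneg n) (by positivity))

lemma const_le {C c : ℝ} (h : ∀ a : ℝ, 2 ≤ a → |Qm a - log (log a) - c| ≤ C / log a) :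
    c ≤ eulerMascheroniConstant := by
  set Δ : ℕ → ℝ := fun m => Qm (exp (m + 1 : ℕ)) - Qm (exp (m:ℕ)) with hΔ
  set f : ℕ → ℝ := fun m => Δ m - 1 / ((m:ℝ) + 1) with hf
  have hpart : ∀ M : ℕ, ∑ m ∈ range M, f m = (Qm (exp (M:ℕ)) - log M) - ((harmonic M : ℚ) - log M) := by
    intro M
    have e0 : ∑ m ∈ range M, Δ m = Qm (exp (M:ℕ)) - Qm (exp ((0:ℕ):ℝ)) :=
      sum_range_sub (fun m : ℕ => Qm (exp (m:ℕ))) M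
    simp only [hf]
    rw [sum_sub_distrib, e0]
    have : Qm (exp ((0:ℕ):ℝ)) = 0 := by simp [Qm, hm]
    rw [this, harmonic]
    push_cast
    simp only [one_div]
    ring
  have hlim : Tendsto (fun M => ∑ m ∈ range M, f m) atTop (𝓝 (c - eulerMascheroniConstant)) := by
    simp_rw [hpart]
    refine Tendsto.sub ?_ Real.tendsto_harmonic_sub_log
    have h1 : Tendsto (fun M : ℕ => (Qm (exp (M:ℕ)) - log M) - c) atTop (𝓝 0) := by
      apply squeeze_zero_norm' (a := fun M : ℕ => C / (M:ℝ))
      · filter_upwards [eventually_ge_atTop 1] with M hM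
        have : (1:ℝ) ≤ M := by exact_mod_cast hM
        have h2 := h (exp M) (by have := add_one_le_exp (M:ℝ); linarith)
        rwa [log_exp] at h2
      · exact Tendsto.div_atTop tendsto_const_nhds tendsto_natCast_atTop_atTop
    have := h1.add_const c
    simpa using this
  have hA := Real.tendsto_tsum_powerSeries_nhdsWithin_lt hlim
  have hf0 : Tendsto f atTop (𝓝 0) := by
    have h1 := (hlim.comp (tendsto_add_atTop_nat 1)).sub hlim
    rw [sub_self] at h1
    refine h1.congr fun M => ?_
    simp only [Function.comp]
    rw [sum_range_succ]; ring
  obtain ⟨B, hB⟩ := hf0.abs.bddAbove_range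
  have hB' : ∀ m, |f m| ≤ B := fun m => hB ⟨m, rfl⟩
  have hx : Tendsto (fun η : ℝ => exp (-η)) (𝓝[>] 0) (𝓝[<] 1) := by
    apply tendsto_nhdsWithin_of_tendsto_nhds_of_eventually_within
    · have : ContinuousAt (fun η : ℝ => exp (-η)) 0 := by fun_prop
      have := this.tendsto.mono_left (nhdsWithin_le_nhds (s := Set.Ioi 0))
      simpa using this
    · filter_upwards [self_mem_nhdsWithin] with η hη
      have hη' : (0:ℝ) < η := hη
      simpa using hη'
  have hA2 := (hx.mono_right nhdsWithin_le_nhds).mul (hA.comp hx)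
  rw [one_mul] at hA2
  have hR := TZ_tendsto.add Z_tendsto
  rw [add_zero] at hR
  have := le_of_tendsto_of_tendsto hA2 hR (by
    filter_upwards [self_mem_nhdsWithin] with η hη
    have hη' : (0:ℝ) < η := hη
    set x := exp (-η) with hx
    have hx0 : 0 < x := exp_pos _
    have hx1 : x < 1 := by rw [hx]; simpa using hη'
    have hsf : Summable (fun m => f m * x ^ (m + 1)) := by
      apply Summable.of_norm_bounded (g := fun m => B * x ^ m)
      · exact (summable_geometric_of_lt_one hx0.le hx1).mul_left B
      · intro m
        rw [norm_mul, norm_eq_abs, norm_eq_abs, abs_of_pos (pow_pos hx0 _)]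
        exact mul_le_mul (hB' m) (pow_le_pow_of_le_one hx0.le hx1.le (Nat.le_succ m)) (by positivity) ((abs_nonneg _).trans (hB' m))
    have hlog := Real.hasSum_pow_div_log_of_abs_lt_one (x := x) (by rw [abs_of_pos hx0]; exact hx1)
    have e1 : x * ∑' n, f n * x ^ n = ∑' m, f m * x ^ (m + 1) := by
      rw [← tsum_mul_left]
      congr 1; ext m; ring
    have e2 : ∀ M, ∑ m ∈ range M, f m * x ^ (m + 1) + ∑ m ∈ range M, x ^ (m + 1) / ((m:ℝ) + 1) ≤ ∑' n : ℕ, hm n * (n:ℝ) ^ (-η) := by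
      intro M
      rw [← sum_add_distrib]
      refine le_trans (le_of_eq ?_) (U_le hη' M)
      apply sum_congr rfl
      intro m _
      simp only [hf, hΔ, ← hx]; ring
    have e3 : ∑' m, f m * x ^ (m + 1) + -log (1 - x) ≤ ∑' n : ℕ, hm n * (n:ℝ) ^ (-η) :=
      le_of_tendsto' (hsf.hasSum.tendsto_sum_nat.add hlog.tendsto_sum_nat) e2
    have e4 : log (1 - x) ≤ log η := by
      apply log_le_log (by linarith)
      have := add_one_le_exp (-η)
      linarith
    have e5 : ∑' n : ℕ, (hm n * (n:ℝ) ^ (-η) - Zm η n) = ∑' n : ℕ, hm n * (n:ℝ) ^ (-η) - ∑' n, Zm η n :=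
      (hm_sum hη').tsum_sub (Zm_sum hη')
    simp only [Function.comp]
    rw [e1, e5]
    linarith)
  linarith

/-- Mertens' third theorem (lower bound). -/
theorem mertens3 : ∃ C : ℝ, 1 ≤ C ∧ ∀ z : ℝ, 2 ≤ z →
    exp (-eulerMascheroniConstant) * (1 - C / log z) / log z ≤
      ∏ p ∈ (Ioc 0 ⌊z⌋₊).filter Nat.Prime, (1 - 1 / (p:ℝ)) := by
  obtain ⟨C, c, hC, h⟩ := mertens_const
  have hc := const_le h
  refine ⟨C, hC, fun z hz => ?_⟩
  have hl := half_le_log hz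
  have hp : ∏ p ∈ (Ioc 0 ⌊z⌋₊).filter Nat.Prime, (1 - 1 / (p:ℝ)) = exp (-Qm z) := by
    rw [Qm, ← sum_neg_distrib, Real.exp_sum, prod_filter]
    apply prod_congr rfl
    intro n _
    simp only [hm]
    split_ifs with hn
    · have h2 : (2:ℝ) ≤ n := by exact_mod_cast hn.two_le
      have : 1 / (n:ℝ) < 1 := by rw [div_lt_one (by linarith)]; linarith
      rw [neg_neg, exp_log (by linarith)]
    · simp
  rw [hp]
  have h1 := (abs_le.1 (h z hz)).2
  have h2 : -eulerMascheroniConstant - C / log z - log (log z) ≤ -Qm z := by linarith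
  refine le_trans ?_ (exp_le_exp.2 h2)
  rw [Real.exp_sub, exp_log (by linarith), sub_eq_add_neg (-eulerMascheroniConstant), exp_add]
  have := add_one_le_exp (-(C / log z))
  gcongr
  linarith

lemma geom_icc {p : ℝ} (hp : 2 ≤ p) (K : ℕ) : ∑ k ∈ Icc 1 K, (1 / p) ^ k ≤ 1 / (p - 1) := by
  have h : ∑ k ∈ Icc 1 K, (1 / p) ^ k = (1 - (1 / p) ^ K) / (p - 1) := by
    induction K with
    | zero => simp
    | succ K ih =>
      rw [sum_Icc_succ_top (by omega), ih, pow_succ]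
      have : p - 1 ≠ 0 := by linarith
      have : p ≠ 0 := by linarith
      field_simp
      ring
  rw [h]
  have : 0 < (1 / p) ^ K := by positivity
  gcongr
  · linarith
  · linarith

lemma rad_sum (F S : Finset ℕ) (hF : ∀ p ∈ F, p.Prime) (hS : ∀ n ∈ S, n ≠ 0 ∧ n.primeFactors = F) :
    ∑ n ∈ S, 1 / (n:ℝ) ≤ ∏ p ∈ F, 1 / ((p:ℝ) - 1) := by
  classical
  set K := S.sup id with hK
  have h1 : ∏ p ∈ F, ∑ k ∈ Icc 1 K, (1 / (p:ℝ)) ^ k ≤ ∏ p ∈ F, 1 / ((p:ℝ) - 1) := by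
    apply Finset.prod_le_prod
    · intro p _; positivity
    · intro p hp; exact geom_icc (by exact_mod_cast (hF p hp).two_le) K
  refine le_trans ?_ h1
  rw [prod_sum]
  set i : ℕ → ((a : ℕ) → a ∈ F → ℕ) := fun n a _ => n.factorization a with hi
  have hval : ∀ n ∈ S, (n:ℝ) = ∏ p ∈ F, (p:ℝ) ^ n.factorization p := by
    intro n hn
    obtain ⟨h0, h2⟩ := hS n hn
    have h3 := Nat.prod_factorization_pow_eq_self h0
    rw [Finsupp.prod, Nat.support_factorization, h2] at h3
    conv_lhs => rw [← h3]
    push_cast; rfl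
  have hinj : Set.InjOn i S := by
    intro n hn m hm hnm
    have : (n:ℝ) = m := by
      rw [hval n hn, hval m hm]
      apply prod_congr rfl
      intro p hp
      have := congrFun (congrFun hnm p) hp
      simp only [hi] at this
      rw [this]
    exact_mod_cast this
  have h2 : ∑ n ∈ S, 1 / (n:ℝ) = ∑ g ∈ S.image i, ∏ x ∈ F.attach, (1 / (x.1:ℝ)) ^ g x.1 x.2 := by
    rw [sum_image hinj]
    apply sum_congr rfl
    intro n hn
    rw [prod_attach F (fun p => (1 / (p:ℝ)) ^ n.factorization p), hval n hn, one_div, ← prod_inv_distrib]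
    apply prod_congr rfl
    intro p _
    rw [one_div, inv_pow]
  rw [h2]
  apply sum_le_sum_of_subset_of_nonneg
  · intro g hg
    rw [mem_image] at hg
    obtain ⟨n, hn, rfl⟩ := hg
    rw [Finset.mem_pi]
    intro p hp
    obtain ⟨h0, h3⟩ := hS n hn
    rw [mem_Icc]
    constructor
    · have : p ∈ n.primeFactors := by rw [h3]; exact hp
      exact Nat.pos_of_ne_zero (by rw [← Nat.support_factorization, Finsupp.mem_support_iff] at this; exact this)
    · have e1 : n.factorization p < n := Nat.factorization_lt p h0
      have e2 : n ≤ K := le_sup (f := id) hn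
      simp only [hi]; omega
  · intro g _ _; exact prod_nonneg fun x _ => by positivity

lemma harm_le (Q B : Finset ℕ) (Y : ℕ) (hQ : ∀ p ∈ Q, p.Prime) (hB : ∀ p ∈ B, p.Prime)
    (hcov : ∀ p : ℕ, p.Prime → p ≤ Y → p ∈ Q ∨ p ∈ B) :
    ∑ n ∈ Icc 1 Y, 1 / (n:ℝ) ≤ (∑ E ∈ Q.powerset.filter (fun E => ∏ p ∈ E, p ≤ Y), ∏ p ∈ E, 1 / ((p:ℝ) - 1)) *
      ∏ p ∈ B, (1 + 1 / ((p:ℝ) - 1)) := by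
  classical
  set FF := (Icc 1 Y).image Nat.primeFactors with hFF
  have h1 : ∑ n ∈ Icc 1 Y, 1 / (n:ℝ) ≤ ∑ F ∈ FF, ∏ p ∈ F, 1 / ((p:ℝ) - 1) := by
    rw [← sum_fiberwise_of_maps_to (g := Nat.primeFactors) (t := FF) (fun n hn => mem_image_of_mem _ hn)]
    apply sum_le_sum
    intro F hF
    rw [hFF, mem_image] at hF
    obtain ⟨m, hm, rfl⟩ := hF
    apply rad_sum
    · intro p hp; exact Nat.prime_of_mem_primeFactors hp
    · intro n hn
      rw [mem_filter, mem_Icc] at hn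
      exact ⟨by omega, hn.2⟩
  refine h1.trans ?_
  rw [prod_one_add, sum_mul_sum, ← sum_product']
  set i : Finset ℕ → Finset ℕ × Finset ℕ := fun F => (F ∩ Q, F \ Q) with hi
  have hinj : Set.InjOn i FF := by
    intro F _ G _ h
    simp only [hi, Prod.mk.injEq] at h
    have hF : F = (F ∩ Q) ∪ (F \ Q) := by ext a; simp; tauto
    have hG : G = (G ∩ Q) ∪ (G \ Q) := by ext a; simp; tauto
    rw [hF, hG, h.1, h.2]
  have h2 : ∑ F ∈ FF, ∏ p ∈ F, 1 / ((p:ℝ) - 1) = ∑ x ∈ FF.image i, (∏ p ∈ x.1, 1 / ((p:ℝ) - 1)) * ∏ p ∈ x.2, 1 / ((p:ℝ) - 1) := by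
    rw [sum_image hinj]
    apply sum_congr rfl
    intro F _
    simp only [hi]
    rw [prod_inter_mul_prod_sdiff]
  rw [h2]
  have hnn : ∀ p : ℕ, p.Prime → 0 ≤ 1 / ((p:ℝ) - 1) := fun p hp => by
    have : (2:ℝ) ≤ p := by exact_mod_cast hp.two_le
    apply one_div_nonneg.2; linarith
  apply sum_le_sum_of_subset_of_nonneg
  · intro x hx
    rw [mem_image] at hx
    obtain ⟨F, hF, rfl⟩ := hx
    rw [hFF, mem_image] at hF
    obtain ⟨n, hn, rfl⟩ := hF
    rw [mem_Icc] at hn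
    simp only [hi, mem_product, mem_filter, mem_powerset]
    refine ⟨⟨inter_subset_right, ?_⟩, ?_⟩
    · have e1 : ∏ p ∈ n.primeFactors ∩ Q, p ∣ ∏ p ∈ n.primeFactors, p := prod_dvd_prod_of_subset _ _ _ inter_subset_left
      exact (Nat.le_of_dvd (by omega) (e1.trans (Nat.prod_primeFactors_dvd n))).trans hn.2
    · intro p hp
      rw [Finset.mem_sdiff] at hp
      have hpp := Nat.prime_of_mem_primeFactors hp.1
      have := Nat.le_of_dvd (by omega) (Nat.dvd_of_mem_primeFactors hp.1)
      rcases hcov p hpp (by omega) with h | h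
      · exact absurd h hp.2
      · exact h
  · intro x hx _
    rw [mem_product, mem_filter, mem_powerset, mem_powerset] at hx
    exact mul_nonneg (prod_nonneg fun p hp => hnn p (hQ p (hx.1.1 hp))) (prod_nonneg fun p hp => hnn p (hB p (hx.2 hp)))

lemma log_powerset (P : Finset ℕ) (v l : ℕ → ℝ) (hv : ∀ p ∈ P, 0 ≤ v p) (hl : ∀ p ∈ P, 0 ≤ l p) :
    ∑ M ∈ P.powerset, (∏ p ∈ M, v p) * ∑ p ∈ M, l p ≤ (∏ p ∈ P, (1 + v p)) * ∑ p ∈ P, v p * l p := by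
  classical
  induction P using Finset.induction_on with
  | empty => simp
  | insert q P hq ih =>
    have ih := ih (fun p hp => hv p (mem_insert_of_mem hp)) (fun p hp => hl p (mem_insert_of_mem hp))
    rw [sum_powerset_insert hq, prod_insert hq, sum_insert hq]
    have h1 : ∑ t ∈ P.powerset, (∏ p ∈ insert q t, v p) * ∑ p ∈ insert q t, l p = v q * ∑ t ∈ P.powerset, (∏ p ∈ t, v p) * ∑ p ∈ t, l p + v q * l q * ∏ p ∈ P, (1 + v p) := by
      rw [prod_one_add, mul_sum, mul_sum, ← sum_add_distrib]
      apply sum_congr rfl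
      intro t ht
      have : q ∉ t := fun h => hq (mem_powerset.1 ht h)
      rw [prod_insert this, sum_insert this]
      ring
    rw [h1]
    have hvq := hv q (mem_insert_self _ _)
    have hlq := hl q (mem_insert_self _ _)
    have hPi : 0 ≤ ∏ p ∈ P, (1 + v p) := prod_nonneg fun p hp => by have := hv p (mem_insert_of_mem hp); linarith
    have h2 := mul_le_mul_of_nonneg_left ih (show 0 ≤ 1 + v q by linarith)
    have h3 : 0 ≤ v q * (v q * l q) * ∏ p ∈ P, (1 + v p) := by positivity
    nlinarith

lemma sieveG_expand (P : Finset ℕ) (hP : ∀ p ∈ P, p.Prime ∧ 3 ≤ p) (ξ : ℕ) :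
    sieveG P ξ = ∑ M ∈ sieveFam P ξ, (∏ p ∈ M, 1 / (((p:ℝ) - 1) * (p - 2))) *
      ∑ E ∈ (P \ M).powerset.filter (fun E => ∏ p ∈ E, p ≤ ξ / ∏ p ∈ M, p), ∏ p ∈ E, 1 / ((p:ℝ) - 1) := by
  classical
  have hpos : ∀ S ⊆ P, 0 < ∏ p ∈ S, p := fun S hS => prod_pos fun p hp => (hP p (hS hp)).1.pos
  have h1 : sieveG P ξ = ∑ S ∈ sieveFam P ξ, ∑ M ∈ S.powerset, (∏ p ∈ M, 1 / (((p:ℝ) - 1) * (p - 2))) * ∏ p ∈ S \ M, 1 / ((p:ℝ) - 1) := by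
    rw [sieveG]
    apply sum_congr rfl
    intro S hS
    rw [← prod_add]
    apply prod_congr rfl
    intro p hp
    have : (3:ℝ) ≤ p := by exact_mod_cast (hP p (mem_powerset.1 (mem_filter.1 hS).1 hp)).2
    have h2 : (p:ℝ) - 2 ≠ 0 := by linarith
    have h3 : (p:ℝ) - 1 ≠ 0 := by linarith
    field_simp
    ring
  rw [h1, sum_comm' (t' := sieveFam P ξ) (s' := fun M => (sieveFam P ξ).filter (fun S => M ⊆ S))]
  · apply sum_congr rfl
    intro M hM
    rw [mul_sum]
    rw [sieveFam, mem_filter, mem_powerset] at hM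
    apply sum_nbij' (fun S => S \ M) (fun E => E ∪ M)
    · intro S hS
      rw [mem_filter, sieveFam, mem_filter, mem_powerset] at hS
      rw [mem_filter, mem_powerset]
      refine ⟨sdiff_subset_sdiff hS.1.1 (Finset.Subset.refl _), ?_⟩
      rw [Nat.le_div_iff_mul_le (hpos M hM.1), prod_sdiff hS.2]
      exact hS.1.2
    · intro E hE
      rw [mem_filter, mem_powerset] at hE
      rw [mem_filter, sieveFam, mem_filter, mem_powerset]
      have hd : Disjoint E M := disjoint_of_subset_left hE.1 sdiff_disjoint
      refine ⟨⟨union_subset (hE.1.trans sdiff_subset) hM.1, ?_⟩, subset_union_right⟩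
      rw [prod_union hd]
      exact (Nat.le_div_iff_mul_le (hpos M hM.1)).1 hE.2
    · intro S hS
      rw [mem_filter] at hS
      exact sdiff_union_of_subset hS.2
    · intro E hE
      rw [mem_filter, mem_powerset] at hE
      have hd : Disjoint E M := disjoint_of_subset_left hE.1 sdiff_disjoint
      exact union_sdiff_cancel_right hd
    · intro S _; rfl
  · intro S M
    simp only [mem_filter, mem_powerset, sieveFam]
    constructor
    · rintro ⟨⟨h1, h2⟩, h3⟩
      exact ⟨⟨⟨h1, h2⟩, h3⟩, h3.trans h1, (Nat.le_of_dvd (hpos S h1) (prod_dvd_prod_of_subset _ _ _ h3)).trans h2⟩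
    · rintro ⟨⟨⟨h1, h2⟩, h3⟩, _, _⟩
      exact ⟨⟨h1, h2⟩, h3⟩

lemma log_le_harm (Y : ℕ) : log (Y + 1) ≤ ∑ n ∈ Icc 1 Y, 1 / (n:ℝ) := by
  have := log_add_one_le_harmonic Y
  rw [harmonic_eq_sum_Icc] at this
  push_cast at this
  simpa [one_div] using this

lemma g_lower_aux (P B : Finset ℕ) (hP : ∀ p ∈ P, p.Prime ∧ 3 ≤ p) (hB : ∀ p ∈ B, p.Prime) (hd : Disjoint P B) (ξ : ℕ) (hξ : 1 ≤ ξ)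
    (hcov : ∀ p : ℕ, p.Prime → p ≤ ξ → p ∈ P ∨ p ∈ B) :
    (∏ p ∈ B, (1 - 1 / (p:ℝ))) * (∏ p ∈ P, (1 + 1 / ((p:ℝ) * (p - 2)))) * (log ξ - ∑ p ∈ P, 1 / ((p:ℝ) * (p - 2)) * log p) ≤ sieveG P ξ := by
  classical
  have h3 : ∀ p ∈ P, (3:ℝ) ≤ p := fun p hp => by exact_mod_cast (hP p hp).2
  set v : ℕ → ℝ := fun p => 1 / ((p:ℝ) * (p - 2)) with hv
  have hv0 : ∀ p ∈ P, 0 ≤ v p := fun p hp => by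
    have := h3 p hp
    exact one_div_nonneg.2 (mul_nonneg (by linarith) (by linarith))
  have hl0 : ∀ p ∈ P, 0 ≤ log (p:ℝ) := fun p hp => log_nonneg (by have := h3 p hp; linarith)
  have hpB : ∀ p : ℕ, p.Prime → 0 < 1 - 1 / (p:ℝ) := fun p hp => by
    have : (2:ℝ) ≤ p := by exact_mod_cast hp.two_le
    rw [sub_pos, div_lt_one (by linarith)]; linarith
  set β := ∏ p ∈ B, (1 - 1 / (p:ℝ)) with hβ
  have hβ0 : 0 < β := prod_pos fun p hp => hpB p (hB p hp)
  rw [sieveG_expand P hP ξ]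
  have hlogM : ∀ M ⊆ P, log ((∏ p ∈ M, p : ℕ) : ℝ) = ∑ p ∈ M, log p := by
    intro M hM
    push_cast
    rw [Real.log_prod]
    intro p hp
    have := h3 p (hM hp); linarith
  have hterm : ∀ M ∈ sieveFam P ξ, β * ((∏ p ∈ M, v p) * (log ξ - ∑ p ∈ M, log p)) ≤ (∏ p ∈ M, 1 / (((p:ℝ) - 1) * (p - 2))) *
      ∑ E ∈ (P \ M).powerset.filter (fun E => ∏ p ∈ E, p ≤ ξ / ∏ p ∈ M, p), ∏ p ∈ E, 1 / ((p:ℝ) - 1) := by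
    intro M hM
    rw [sieveFam, mem_filter, mem_powerset] at hM
    set m := ∏ p ∈ M, p with hm
    have hm0 : 0 < m := prod_pos fun p hp => (hP p (hM.1 hp)).1.pos
    set Y := ξ / m with hY
    set S := ∑ E ∈ (P \ M).powerset.filter (fun E => ∏ p ∈ E, p ≤ Y), ∏ p ∈ E, 1 / ((p:ℝ) - 1) with hS
    have hBM : Disjoint B M := (disjoint_of_subset_left hM.1 hd).symm
    have h1 := harm_le (P \ M) (B ∪ M) Y (fun p hp => (hP p (Finset.mem_sdiff.1 hp).1).1)
      (fun p hp => by rcases mem_union.1 hp with h | h; exacts [hB p h, (hP p (hM.1 h)).1]) (by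
        intro p hp hpY
        rcases hcov p hp (hpY.trans (Nat.div_le_self _ _)) with h | h
        · by_cases h' : p ∈ M
          · right; exact mem_union_right _ h'
          · left; exact Finset.mem_sdiff.2 ⟨h, h'⟩
        · right; exact mem_union_left _ h)
    have h2 : log ξ - ∑ p ∈ M, log p ≤ log (Y + 1) := by
      rw [← hlogM M hM.1, ← hm, ← log_div (by positivity) (by positivity)]
      apply log_le_log (by positivity)
      rw [div_le_iff₀ (by positivity)]
      have := (Nat.lt_div_mul_add (a := ξ) hm0)
      rw [← hY] at this
      have h' : ξ ≤ (Y + 1) * m := by nlinarith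
      exact_mod_cast h'
    have h4 := (h2.trans (log_le_harm Y)).trans h1
    rw [prod_union hBM] at h4
    have e1 : ∀ p : ℕ, p.Prime → (1 - 1 / (p:ℝ)) * (1 + 1 / ((p:ℝ) - 1)) = 1 := fun p hp => by
      have : (2:ℝ) ≤ p := by exact_mod_cast hp.two_le
      have h5 : (p:ℝ) - 1 ≠ 0 := by linarith
      have h6 : (p:ℝ) ≠ 0 := by linarith
      field_simp
      ring
    have e2 : β * ∏ p ∈ B, (1 + 1 / ((p:ℝ) - 1)) = 1 := by
      rw [hβ, ← prod_mul_distrib]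
      exact prod_eq_one fun p hp => e1 p (hB p hp)
    have e3 : (∏ p ∈ M, v p) * ∏ p ∈ M, (1 + 1 / ((p:ℝ) - 1)) = ∏ p ∈ M, 1 / (((p:ℝ) - 1) * (p - 2)) := by
      rw [← prod_mul_distrib]
      apply prod_congr rfl
      intro p hp
      have := h3 p (hM.1 hp)
      have h5 : (p:ℝ) - 1 ≠ 0 := by linarith
      have h6 : (p:ℝ) ≠ 0 := by linarith
      have h7 : (p:ℝ) - 2 ≠ 0 := by linarith
      simp only [hv]
      field_simp
      ring
    have hvM : 0 ≤ ∏ p ∈ M, v p := prod_nonneg fun p hp => hv0 p (hM.1 hp)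
    calc β * ((∏ p ∈ M, v p) * (log ξ - ∑ p ∈ M, log p)) ≤ β * ((∏ p ∈ M, v p) * (S * ((∏ p ∈ B, (1 + 1 / ((p:ℝ) - 1))) * ∏ p ∈ M, (1 + 1 / ((p:ℝ) - 1))))) := by gcongr
      _ = (β * ∏ p ∈ B, (1 + 1 / ((p:ℝ) - 1))) * ((∏ p ∈ M, v p) * ∏ p ∈ M, (1 + 1 / ((p:ℝ) - 1))) * S := by ring
      _ = _ := by rw [e2, e3, one_mul]
  refine le_trans ?_ (sum_le_sum hterm)
  rw [← mul_sum, mul_assoc]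
  apply mul_le_mul_of_nonneg_left _ hβ0.le
  have h5 : ∑ M ∈ P.powerset, (∏ p ∈ M, v p) * (log ξ - ∑ p ∈ M, log p) ≤ ∑ M ∈ sieveFam P ξ, (∏ p ∈ M, v p) * (log ξ - ∑ p ∈ M, log p) := by
    rw [sieveFam, sum_filter]
    apply sum_le_sum
    intro M hM
    rw [mem_powerset] at hM
    split_ifs with h
    · exact le_rfl
    · apply mul_nonpos_of_nonneg_of_nonpos (prod_nonneg fun p hp => hv0 p (hM hp))
      rw [← hlogM M hM, sub_nonpos]
      exact log_le_log (by positivity) (by exact_mod_cast (not_le.1 h).le)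
  refine le_trans ?_ h5
  have h6 := log_powerset P v (fun p => log p) hv0 hl0
  have h7 : ∑ M ∈ P.powerset, (∏ p ∈ M, v p) * (log ξ - ∑ p ∈ M, log p) = (∏ p ∈ P, (1 + v p)) * log ξ - ∑ M ∈ P.powerset, (∏ p ∈ M, v p) * ∑ p ∈ M, log p := by
    simp_rw [mul_sub]
    rw [sum_sub_distrib, ← sum_mul, ← prod_one_add]
  rw [h7]
  change (∏ p ∈ P, (1 + v p)) * (log ξ - ∑ p ∈ P, v p * log p) ≤ _
  rw [mul_sub]
  linarith

lemma prod_anti {s t : Finset ℕ} {f : ℕ → ℝ} (hst : s ⊆ t) (h0 : ∀ p ∈ t, 0 ≤ f p) (h1 : ∀ p ∈ t, f p ≤ 1) :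
    ∏ p ∈ t, f p ≤ ∏ p ∈ s, f p := by
  classical
  rw [← prod_sdiff hst]
  exact mul_le_of_le_one_left (prod_nonneg fun p hp => h0 p (hst hp))
    (prod_le_one (fun p hp => h0 p (sdiff_subset hp)) fun p hp => h1 p (sdiff_subset hp))

lemma one_le_prod {s : Finset ℕ} {f : ℕ → ℝ} (h1 : ∀ p ∈ s, 1 ≤ f p) : 1 ≤ ∏ p ∈ s, f p := by
  refine prod_induction f (fun x => 1 ≤ x) (fun a b ha hb => ?_) le_rfl h1
  exact one_le_mul_of_one_le_of_one_le ha hb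

lemma prod_mono' {s t : Finset ℕ} {f : ℕ → ℝ} (hst : s ⊆ t) (h1 : ∀ p ∈ t, 1 ≤ f p) :
    ∏ p ∈ s, f p ≤ ∏ p ∈ t, f p := by
  classical
  rw [← prod_sdiff hst]
  exact le_mul_of_one_le_left (zero_le_one.trans (one_le_prod fun p hp => h1 p (hst hp))) (one_le_prod fun p hp => h1 p (sdiff_subset hp))

/-- odd primes below `y` not dividing `b` -/
def PP (b : ℕ) (y : ℝ) : Finset ℕ := (range ⌈y⌉₊).filter fun q => q.Prime ∧ Odd q ∧ ¬ q ∣ b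

lemma mem_PP {b : ℕ} {y : ℝ} {q : ℕ} : q ∈ PP b y ↔ (q:ℝ) < y ∧ q.Prime ∧ Odd q ∧ ¬ q ∣ b := by
  rw [PP, mem_filter, mem_range, Nat.lt_ceil]

lemma PP_three {b : ℕ} {y : ℝ} {q : ℕ} (h : q ∈ PP b y) : q.Prime ∧ 3 ≤ q := by
  rw [mem_PP] at h
  refine ⟨h.2.1, ?_⟩
  have h2 := h.2.1.two_le
  obtain ⟨m, hm⟩ := h.2.2.1
  omega

lemma V_pos (b : ℕ) (z : ℝ) : 0 < V b z := by
  rw [V]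
  apply prod_pos
  intro q hq
  rw [mem_filter] at hq
  have h2 : q ≠ 2 := by
    rintro rfl
    exact hq.2.2.2 (dvd_mul_right 2 b)
  have h3 : 3 ≤ q := by
    have := hq.2.1.two_le
    omega
  have : (3:ℝ) ≤ q := by exact_mod_cast h3
  rw [sub_pos, div_lt_one (by linarith)]; linarith

theorem GV_bound : ∃ K : ℝ, 1 ≤ K ∧ ∀ (b : ℕ) (y z : ℝ) (ξ : ℕ) (I : Finset ℕ), 0 < b → (2 * b : ℝ) < z → z ≤ y →
    1 ≤ ξ → (ξ:ℝ) < y → K ≤ log ξ → (∀ p ∈ I, p.Prime ∧ z ≤ (p:ℝ)) →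
    (∏ p ∈ (Ioc 0 ⌊z⌋₊).filter Nat.Prime, (1 - 1 / (p:ℝ))) * (∏ p ∈ I, (1 - 1 / (p:ℝ))) * (log ξ - K) ≤
      sieveG (PP b y \ I) ξ * V b z := by
  classical
  have hsum : Summable (fun n : ℕ => 6 * (n:ℝ) ^ (-(3/2) : ℝ)) := (Real.summable_nat_rpow.2 (by norm_num)).mul_left 6
  refine ⟨1 + ∑' n : ℕ, 6 * (n:ℝ) ^ (-(3/2) : ℝ), ?_, ?_⟩
  · have : 0 ≤ ∑' n : ℕ, 6 * (n:ℝ) ^ (-(3/2) : ℝ) := tsum_nonneg fun n => by positivity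
    linarith
  intro b y z ξ I hb hbz hzy hξ hξy hK hI
  set P := PP b y \ I with hPdef
  have hP : ∀ p ∈ P, p.Prime ∧ 3 ≤ p := fun p hp => PP_three (Finset.mem_sdiff.1 hp).1
  have h3 : ∀ p ∈ P, (3:ℝ) ≤ p := fun p hp => by exact_mod_cast (hP p hp).2
  set B := (2 * b).primeFactors ∪ I with hB
  have hb2 : ∀ p ∈ (2 * b).primeFactors, (p:ℝ) < z := fun p hp => by
    have := Nat.le_of_dvd (by omega) (Nat.dvd_of_mem_primeFactors hp)
    have : (p:ℝ) ≤ 2 * b := by exact_mod_cast this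
    linarith
  have hBp : ∀ p ∈ B, p.Prime := fun p hp => by
    rcases mem_union.1 hp with h | h
    · exact Nat.prime_of_mem_primeFactors h
    · exact (hI p h).1
  have hdis : Disjoint P B := by
    rw [disjoint_left]
    intro p hp hp'
    rw [hPdef, Finset.mem_sdiff] at hp
    rcases mem_union.1 hp' with h | h
    · have h1 := Nat.dvd_of_mem_primeFactors h
      have h2 := mem_PP.1 hp.1
      rcases (Nat.Prime.dvd_mul h2.2.1).1 h1 with h4 | h4
      · have := Nat.le_of_dvd (by norm_num) h4
        have := (PP_three hp.1).2
        omega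
      · exact h2.2.2.2 h4
    · exact hp.2 h
  have hmain := g_lower_aux P B hP hBp hdis ξ hξ (by
    intro p hp hpξ
    by_cases h1 : p ∈ B
    · right; exact h1
    · left
      rw [hB, mem_union, not_or] at h1
      rw [hPdef, Finset.mem_sdiff, mem_PP]
      have h4 : ¬ p ∣ 2 * b := fun h => h1.1 (Nat.mem_primeFactors.2 ⟨hp, h, by omega⟩)
      refine ⟨⟨?_, hp, ?_, fun h => h4 (Dvd.dvd.mul_left h 2)⟩, h1.2⟩
      · have : (p:ℝ) ≤ ξ := by exact_mod_cast hpξ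
        linarith
      · apply hp.odd_of_ne_two
        rintro rfl
        exact h4 (dvd_mul_right 2 b))
  have hKs : ∑ p ∈ P, 1 / ((p:ℝ) * (p - 2)) * log p ≤ ∑' n : ℕ, 6 * (n:ℝ) ^ (-(3/2) : ℝ) := by
    refine le_trans (sum_le_sum fun p hp => ?_) (hsum.sum_le_tsum P fun n _ => by positivity)
    have h4 := h3 p hp
    have h5 : log p ≤ 2 * (p:ℝ) ^ (1/2 : ℝ) := by
      have := Real.log_le_rpow_div (x := p) (by linarith) (ε := 1/2) (by norm_num)
      linarith
    have h6 : (p:ℝ) ^ (-(3/2) : ℝ) = (p:ℝ) ^ (1/2 : ℝ) / (p * p) := by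
      rw [show (-(3/2) : ℝ) = 1/2 - 2 by norm_num, Real.rpow_sub (by linarith), Real.rpow_two, sq]
    rw [h6, one_div_mul_eq_div, mul_div_assoc', div_le_div_iff₀ (mul_pos (by linarith) (by linarith)) (by nlinarith)]
    have h7 : (p:ℝ) * p ≤ 3 * (p * (p - 2)) := by nlinarith
    calc log p * (p * p) ≤ (2 * (p:ℝ) ^ (1/2 : ℝ)) * (3 * (p * (p - 2))) := by gcongr
      _ = _ := by ring
  set VS := (range (Nat.ceil z + 1)).filter (fun q : ℕ => q.Prime ∧ (q : ℝ) < z ∧ ¬ q ∣ 2 * b) with hVS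
  have hVeq : V b z = ∏ q ∈ VS, (1 - 1 / ((q : ℝ) - 1)) := by rw [V, hVS]
  have hVSm : ∀ q, q ∈ VS ↔ q.Prime ∧ (q:ℝ) < z ∧ ¬ q ∣ 2 * b := by
    intro q
    rw [hVS, mem_filter, mem_range]
    refine ⟨fun h => h.2, fun h => ⟨?_, h⟩⟩
    have := Nat.lt_ceil.2 h.2.1
    omega
  have hVSP : VS ⊆ P := by
    intro q hq
    rw [hVSm] at hq
    rw [hPdef, Finset.mem_sdiff, mem_PP]
    refine ⟨⟨by linarith, hq.1, ?_, fun h => hq.2.2 (Dvd.dvd.mul_left h 2)⟩, fun h => ?_⟩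
    · apply hq.1.odd_of_ne_two
      rintro rfl
      exact hq.2.2 (dvd_mul_right 2 b)
    · have := (hI q h).2
      linarith
  have hf01 : ∀ p : ℕ, p.Prime → 0 ≤ 1 - 1 / (p:ℝ) ∧ 1 - 1 / (p:ℝ) ≤ 1 := fun p hp => by
    have : (2:ℝ) ≤ p := by exact_mod_cast hp.two_le
    constructor
    · rw [sub_nonneg, div_le_one (by linarith)]; linarith
    · have : 0 ≤ 1 / (p:ℝ) := by positivity
      linarith
  have hBI : Disjoint (2 * b).primeFactors I := by
    rw [disjoint_left]
    intro p hp hp'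
    have := hb2 p hp
    have := (hI p hp').2
    linarith
  have hH : ∏ p ∈ VS, (1 + 1 / ((p:ℝ) * (p - 2))) ≤ ∏ p ∈ P, (1 + 1 / ((p:ℝ) * (p - 2))) := by
    apply prod_mono' hVSP
    intro p hp
    have := h3 p hp
    have : 0 ≤ 1 / ((p:ℝ) * (p - 2)) := one_div_nonneg.2 (mul_nonneg (by linarith) (by linarith))
    linarith
  have hHV : (∏ p ∈ VS, (1 + 1 / ((p:ℝ) * (p - 2)))) * V b z = ∏ p ∈ VS, (1 - 1 / (p:ℝ)) := by
    rw [hVeq, ← prod_mul_distrib]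
    apply prod_congr rfl
    intro p hp
    have := h3 p (hVSP hp)
    have h5 : (p:ℝ) - 1 ≠ 0 := by linarith
    have h6 : (p:ℝ) ≠ 0 := by linarith
    have h7 : (p:ℝ) - 2 ≠ 0 := by linarith
    field_simp
    ring
  have hd2 : Disjoint (2 * b).primeFactors VS := by
    rw [disjoint_left]
    intro p hp hp'
    exact ((hVSm p).1 hp').2.2 (Nat.dvd_of_mem_primeFactors hp)
  have hprod : ∏ p ∈ (Ioc 0 ⌊z⌋₊).filter Nat.Prime, (1 - 1 / (p:ℝ)) ≤ (∏ p ∈ (2 * b).primeFactors, (1 - 1 / (p:ℝ))) * ∏ p ∈ VS, (1 - 1 / (p:ℝ)) := by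
    rw [← prod_union hd2]
    apply prod_anti
    · intro p hp
      have : p.Prime ∧ (p:ℝ) < z := by
        rcases mem_union.1 hp with h | h
        · exact ⟨Nat.prime_of_mem_primeFactors h, hb2 p h⟩
        · exact ⟨((hVSm p).1 h).1, ((hVSm p).1 h).2.1⟩
      rw [mem_filter, mem_Ioc]
      exact ⟨⟨this.1.pos, Nat.le_floor this.2.le⟩, this.1⟩
    · intro p hp; exact (hf01 p (mem_filter.1 hp).2).1
    · intro p hp; exact (hf01 p (mem_filter.1 hp).2).2
  have hV0 := V_pos b z
  set LK := log ξ - (1 + ∑' n : ℕ, 6 * (n:ℝ) ^ (-(3/2) : ℝ)) with hLK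
  have hLK0 : 0 ≤ LK := by rw [hLK]; linarith
  have hLK1 : LK ≤ log ξ - ∑ p ∈ P, 1 / ((p:ℝ) * (p - 2)) * log p := by rw [hLK]; linarith
  have hI0 : 0 ≤ ∏ p ∈ I, (1 - 1 / (p:ℝ)) := prod_nonneg fun p hp => (hf01 p (hI p hp).1).1
  have hb0 : 0 ≤ ∏ p ∈ (2 * b).primeFactors, (1 - 1 / (p:ℝ)) := prod_nonneg fun p hp => (hf01 p (Nat.prime_of_mem_primeFactors hp)).1
  have hH0 : 0 ≤ ∏ p ∈ VS, (1 + 1 / ((p:ℝ) * (p - 2))) := prod_nonneg fun p hp => by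
    have := h3 p (hVSP hp)
    have : 0 ≤ 1 / ((p:ℝ) * (p - 2)) := one_div_nonneg.2 (mul_nonneg (by linarith) (by linarith))
    linarith
  rw [hB, prod_union hBI] at hmain
  calc _ ≤ ((∏ p ∈ (2 * b).primeFactors, (1 - 1 / (p:ℝ))) * ∏ p ∈ VS, (1 - 1 / (p:ℝ))) * (∏ p ∈ I, (1 - 1 / (p:ℝ))) * LK := by gcongr
    _ = ((∏ p ∈ (2 * b).primeFactors, (1 - 1 / (p:ℝ))) * (∏ p ∈ I, (1 - 1 / (p:ℝ)))) * (∏ p ∈ VS, (1 + 1 / ((p:ℝ) * (p - 2)))) * LK * V b z := by rw [← hHV]; ring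
    _ ≤ ((∏ p ∈ (2 * b).primeFactors, (1 - 1 / (p:ℝ))) * (∏ p ∈ I, (1 - 1 / (p:ℝ)))) * (∏ p ∈ P, (1 + 1 / ((p:ℝ) * (p - 2)))) * (log ξ - ∑ p ∈ P, 1 / ((p:ℝ) * (p - 2)) * log p) * V b z := by
      gcongr
      exact mul_nonneg (mul_nonneg hb0 hI0) (hH0.trans hH)
    _ ≤ _ := by gcongr

lemma prims_ne_one {r : ℕ} (hr : 1 < r) {χ : DirichletCharacter ℂ r} (h : χ ∈ prims r) : χ ≠ 1 := by
  rintro rfl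
  have : NeZero r := ⟨by omega⟩
  have h1 := (DirichletCharacter.isPrimitive_def _).1 (mem_prims.1 h)
  rw [DirichletCharacter.conductor_one] at h1
  omega

lemma prodChar_ne_one {r₁ r₂ : ℕ} (h1 : 1 < r₁) (h2 : 1 < r₂) {χ₁ : DirichletCharacter ℂ r₁}
    {χ₂ : DirichletCharacter ℂ r₂} (m1 : χ₁ ∈ prims r₁) (m2 : χ₂ ∈ prims r₂) (hsq : χ₂ ^ 2 = 1)
    (hne : (⟨r₁, χ₁⟩ : Σ r, DirichletCharacter ℂ r) ≠ ⟨r₂, χ₂⟩) : prodChar r₁ r₂ χ₁ χ₂ ≠ 1 := by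
  intro h
  have n1 : NeZero r₁ := ⟨by omega⟩
  have n2 : NeZero r₂ := ⟨by omega⟩
  have n3 : NeZero (r₁ * r₂) := ⟨by positivity⟩
  have c1 := (DirichletCharacter.isPrimitive_def _).1 (mem_prims.1 m1)
  have c2 := (DirichletCharacter.isPrimitive_def _).1 (mem_prims.1 m2)
  unfold prodChar at h
  have h' := eq_inv_of_mul_eq_one_left h
  have hc := congrArg DirichletCharacter.conductor h'
  rw [DirichletCharacter.conductor_inv, DirichletCharacter.conductor_changeLevel,
    DirichletCharacter.conductor_changeLevel, c1, c2] at hc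
  subst hc
  rw [← map_inv] at h'
  have := DirichletCharacter.changeLevel_injective _ h'
  apply hne
  rw [this]
  have : χ₂⁻¹ = χ₂ := by rw [inv_eq_iff_mul_eq_one, ← sq, hsq]
  rw [this]

lemma Good.mono {r : ℕ} {χ : DirichletCharacter ℂ r} {b c : ℝ} (h : Good r χ b) (hbc : b ≤ c) : Good r χ c := by
  intro h2 x hx hx1
  refine (h h2 x hx hx1).trans ?_
  gcongr

set_option maxHeartbeats 1000000 in
/-- Siegel-Walfisz type bound with at most one exceptional character. -/
lemma char_good (A K : ℕ) (hK : 1 ≤ K) : ∃ C : ℝ, 1 ≤ C ∧ ∃ X0 : ℝ, ∀ L : ℝ, X0 ≤ L →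
    ∃ (r1 : ℕ) (χ1 : DirichletCharacter ℂ r1), L ≤ (r1 : ℝ) ^ 4 ∧ ∀ (r : ℕ) (χ : DirichletCharacter ℂ r),
      1 < r → (r : ℝ) ≤ L ^ A → χ ∈ prims r → (⟨r, χ⟩ : Σ r, DirichletCharacter ℂ r) ≠ ⟨r1, χ1⟩ →
      ∀ u : ℝ, 0 < u → L / 4 ≤ log u →
      ‖∑ p ∈ (Icc 1 ⌊u⌋₊).filter Nat.Prime, χ (p : ZMod r)‖ ≤ C * u / L ^ K := by
  obtain ⟨C1, hC1, hlandau⟩ := landau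
  obtain ⟨C2, hC2, hlam⟩ := lambert
  obtain ⟨C3, hC3, hpc⟩ := primes_char (4 * K) (by omega)
  obtain ⟨C4, hC4, hlog⟩ := logpow_ge 60
  set m : ℝ := 3 + 2 * A with hm
  have hm3 : 3 ≤ m := by rw [hm]; have : (0:ℝ) ≤ A := by positivity
                         linarith
  set B : ℝ := C1 + C2 with hB
  set W : ℝ := 4 ^ 4 * B ^ 4 * m ^ 60 * C4 with hW
  have hW1 : 1 ≤ W := by
    rw [hW]
    have : (1:ℝ) ≤ B := by linarith
    have e1 : (1:ℝ) ≤ B ^ 4 := one_le_pow₀ this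
    have e2 : (1:ℝ) ≤ m ^ 60 := one_le_pow₀ (by linarith)
    have := one_le_mul_of_one_le_of_one_le (one_le_mul_of_one_le_of_one_le
      (one_le_mul_of_one_le_of_one_le (by norm_num : (1:ℝ) ≤ 4 ^ 4) e1) e2) hC4
    exact this
  refine ⟨C3 * W ^ K, one_le_mul_of_one_le_of_one_le hC3 (one_le_pow₀ hW1), 100, fun L hL => ?_⟩
  have hL0 : 0 < L := by linarith
  have he : exp 1 ≤ 3 := by have := exp_one_lt_d9; linarith
  have hl1 : 1 ≤ log L := by rw [le_log_iff_exp_le hL0]; linarith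
  set w : ℝ := m * log L with hw
  have hw1 : 1 ≤ w := by rw [hw]; exact one_le_mul_of_one_le_of_one_le (by linarith) hl1
  have hsL : 1 ≤ √L := by rw [one_le_sqrt]; linarith
  have hA1 : (1:ℝ) ≤ L ^ A := one_le_pow₀ (by linarith)
  have hw2 : log (9 * L ^ (2 * A)) ≤ w := by
    rw [log_mul (by norm_num) (by positivity), log_pow, hw, hm]
    have : log 9 ≤ 3 := by
      rw [log_le_iff_le_exp (by norm_num)]
      have := add_one_le_exp (3:ℝ)
      have h2 : exp 3 = exp 1 ^ 3 := by rw [← exp_nat_mul]; norm_num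
      have h3 := Real.exp_one_gt_d9
      rw [h2]
      calc (9:ℝ) ≤ 2.7 ^ 3 := by norm_num
        _ ≤ _ := by gcongr; linarith
    push_cast
    have h5 : (0:ℝ) ≤ (A:ℝ) := by positivity
    calc log 9 + 2 * (A:ℝ) * log L ≤ 3 * log L + 2 * (A:ℝ) * log L := by linarith
      _ = _ := by ring
  -- bound for a character which is good with B0
  have key : ∀ (r : ℕ) (χ : DirichletCharacter ℂ r), 1 < r → (r : ℝ) ≤ L ^ A → χ ∈ prims r →
      Good r χ (B * √L * w ^ 5) → ∀ u : ℝ, 0 < u → L / 4 ≤ log u →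
      ‖∑ p ∈ (Icc 1 ⌊u⌋₊).filter Nat.Prime, χ (p : ZMod r)‖ ≤ C3 * W ^ K * u / L ^ K := by
    intro r χ hr hrA hχ hG u hu0 hu
    have hr0 : (1:ℝ) < r := by exact_mod_cast hr
    have hu3 : 3 ≤ u := by
      have : exp 1 ^ 2 ≤ u := by rw [← exp_nat_mul, ← le_log_iff_exp_le hu0]; push_cast; linarith
      have h3 := Real.exp_one_gt_d9
      have h5 : (2.7:ℝ) ^ 2 ≤ exp 1 ^ 2 := by gcongr; linarith
      have h6 : (3:ℝ) ≤ 2.7 ^ 2 := by norm_num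
      exact h6.trans (h5.trans this)
    have hB1 : 1 ≤ B * √L * w ^ 5 := one_le_mul_of_one_le_of_one_le
      (one_le_mul_of_one_le_of_one_le (by linarith) hsL) (one_le_pow₀ hw1)
    refine (hpc r (by omega) χ _ (prims_ne_one hr hχ) hB1 hG u hu3).trans ?_
    have hlr : log (r + 2) ≤ w := by
      refine le_trans (log_le_log (by positivity) ?_) hw2
      rw [two_mul, pow_add]
      have : L ^ A ≤ L ^ A * L ^ A := le_mul_of_one_le_left (by linarith) hA1
      linarith
    have hlr0 : 0 ≤ log (r + 2) := log_nonneg (by linarith)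
    have h1 : B * √L * w ^ 5 * log (r + 2) ^ 10 / log u ≤ B * √L * w ^ 5 * w ^ 10 / (L / 4) := by gcongr
    have hlu : 0 < log u := by linarith
    have h0 : 0 ≤ B * √L * w ^ 5 * log (r + 2) ^ 10 / log u := by positivity
    have h4 : (B * √L * w ^ 5 * w ^ 10 / (L / 4)) ^ 4 ≤ W / L := by
      have hs4 : √L ^ 4 = L ^ 2 := by rw [show 4 = 2 * 2 by norm_num, pow_mul, Real.sq_sqrt hL0.le]
      have e : (B * √L * w ^ 5 * w ^ 10 / (L / 4)) ^ 4 = 4 ^ 4 * B ^ 4 * m ^ 60 * (√L ^ 4 * log L ^ 60) / L ^ 4 := by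
        rw [hw, div_pow, div_pow]; field_simp
      rw [e, hs4, hW]
      have := hlog L (by linarith)
      calc _ ≤ 4 ^ 4 * B ^ 4 * m ^ 60 * (L ^ 2 * (C4 * L)) / L ^ 4 := by gcongr
        _ = _ := by field_simp
    calc C3 * u * (B * √L * w ^ 5 * log (r + 2) ^ 10 / log u) ^ (4 * K)
        ≤ C3 * u * (B * √L * w ^ 5 * w ^ 10 / (L / 4)) ^ (4 * K) := by gcongr
      _ ≤ C3 * u * (W / L) ^ K := by rw [pow_mul]; gcongr
      _ = _ := by rw [div_pow]; ring
  have small : ∀ (r : ℕ) (χ : DirichletCharacter ℂ r), 1 < r → χ ∈ prims r → ¬ L < (r:ℝ) ^ 4 →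
      Good r χ (B * √L * w ^ 5) := by
    intro r χ hr hχ h4
    refine (hlam r (by omega) χ (prims_ne_one hr hχ)).mono ?_
    have : (r:ℝ) ^ 2 ≤ √L := by
      apply le_sqrt_of_sq_le
      rw [← pow_mul]; push Not at h4; exact h4
    calc C2 * (r:ℝ) ^ 2 ≤ B * √L := by gcongr; linarith
      _ = B * √L * 1 := by ring
      _ ≤ _ := by gcongr; exact one_le_pow₀ hw1
  by_cases hex : ∃ (r1 : ℕ) (χ1 : DirichletCharacter ℂ r1), 1 < r1 ∧ (r1 : ℝ) ≤ L ^ A ∧ χ1 ∈ prims r1 ∧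
      ¬ Good r1 χ1 (B * √L * w ^ 5) ∧ L < (r1 : ℝ) ^ 4
  · obtain ⟨r1, χ1, hr1, hr1A, hm1, hG1, hL1⟩ := hex
    refine ⟨r1, χ1, hL1.le, fun r χ hr hrA hχ hne => key r χ hr hrA hχ ?_⟩
    by_contra hG
    have hsq : χ1 ^ 2 = 1 := by by_contra h; exact hG1 (fun h' => absurd h' h)
    have hb : C1 * ell (r * r1) 0 ^ 5 ≤ B * √L * w ^ 5 := by
      have : ell (r * r1) 0 ≤ w := by
        refine le_trans (log_le_log ?_ ?_) hw2
        · have : 0 < r * r1 := by positivity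
          have : (0:ℝ) < ((r * r1 : ℕ) : ℝ) := by exact_mod_cast this
          positivity
        · push_cast
          have : (r:ℝ) * r1 ≤ L ^ A * L ^ A := by gcongr
          rw [abs_zero, two_mul, pow_add]; linarith
      have h1 := one_le_ell (r * r1) (by positivity) 0
      calc C1 * ell (r * r1) 0 ^ 5 ≤ (B * √L) * w ^ 5 := by
            gcongr
            calc C1 ≤ B := by linarith
              _ ≤ _ := le_mul_of_one_le_right (by linarith) hsL
        _ = _ := by ring
    rcases hlandau r r1 (by omega) (by omega) χ χ1 (prims_ne_one hr hχ) (prims_ne_one hr1 hm1)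
      (prodChar_ne_one hr hr1 hχ hm1 hsq hne) with h | h
    · exact hG (h.mono hb)
    · exact hG1 (h.mono hb)
  · refine ⟨⌈L ^ A⌉₊ + ⌈L⌉₊ + 1, 1, ?_, fun r χ hr hrA hχ _ => key r χ hr hrA hχ ?_⟩
    · have h1 := Nat.le_ceil L
      have h2 : L ≤ ((⌈L ^ A⌉₊ + ⌈L⌉₊ + 1 : ℕ) : ℝ) := by
        push_cast; have : (0:ℝ) ≤ (⌈L ^ A⌉₊ : ℝ) := by positivity
        linarith
      exact h2.trans (le_self_pow₀ (by linarith) (by norm_num))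
    · by_contra hG
      exact hex ⟨r, χ, hr, hrA, hχ, hG, by_contra fun h => hG (small r χ hr hχ h)⟩

lemma mem_sieveR {P : Finset ℕ} {D r : ℕ} : r ∈ sieveR P D ↔ (1 < r ∧ r ≤ D) ∧ Squarefree r ∧ r.primeFactors ⊆ P := by
  simp [sieveR]

lemma prod_pf {r : ℕ} (h : Squarefree r) (c : ℝ) :
    c ^ r.primeFactors.card / r = ∏ p ∈ r.primeFactors, c / (p:ℝ) := by
  rw [prod_div_distrib, prod_const]
  congr 1
  conv_lhs => rw [← Nat.prod_primeFactors_of_squarefree h]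
  push_cast; rfl

lemma F_bound : ∃ C : ℝ, 1 ≤ C ∧ ∀ (P : Finset ℕ) (D : ℕ), 3 ≤ D →
    ∑ r ∈ sieveR P D, (81:ℝ) ^ r.primeFactors.card / r ≤ C * log D ^ 81 := by
  obtain ⟨C, c, hC, h⟩ := mertens_const
  refine ⟨max 1 (exp (81 * (c + C))), le_max_left _ _, fun P D hD => ?_⟩
  have hD3 : (3:ℝ) ≤ D := by exact_mod_cast hD
  have hl1 : 1 ≤ log D := by
    rw [le_log_iff_exp_le (by linarith)]
    have := exp_one_lt_d9; linarith
  set W := (Ioc 0 D).filter Nat.Prime with hW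
  have h1 : ∑ r ∈ sieveR P D, (81:ℝ) ^ r.primeFactors.card / r ≤ ∏ p ∈ W, (1 + 81 / (p:ℝ)) := by
    rw [prod_one_add]
    have e : ∑ r ∈ sieveR P D, (81:ℝ) ^ r.primeFactors.card / r =
        ∑ t ∈ (sieveR P D).image Nat.primeFactors, ∏ p ∈ t, 81 / (p:ℝ) := by
      rw [sum_image]
      · exact sum_congr rfl fun r hr => prod_pf (mem_sieveR.1 hr).2.1 81
      · intro r hr s hs hrs
        have hr' := (mem_sieveR.1 hr).2.1
        have hs' := (mem_sieveR.1 hs).2.1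
        rw [← Nat.prod_primeFactors_of_squarefree hr', ← Nat.prod_primeFactors_of_squarefree hs']
        have hrs' : r.primeFactors = s.primeFactors := hrs
        rw [hrs']
    rw [e]
    apply sum_le_sum_of_subset_of_nonneg
    · intro t ht
      obtain ⟨r, hr, rfl⟩ := mem_image.1 ht
      rw [mem_powerset]
      intro p hp
      have hp' := Nat.prime_of_mem_primeFactors hp
      have := Nat.le_of_mem_primeFactors hp
      have := (mem_sieveR.1 hr).1.2
      simp only [hW, mem_filter, mem_Ioc]
      exact ⟨⟨hp'.pos, by omega⟩, hp'⟩
    · intro t _ _; positivity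
  have h2 : ∏ p ∈ W, (1 + 81 / (p:ℝ)) ≤ exp (81 * Qm D) := by
    have : 81 * Qm D = ∑ n ∈ Ioc 0 D, 81 * hm n := by rw [Qm, Nat.floor_natCast, mul_sum]
    have h3 : ∑ p ∈ W, 81 * hm p ≤ ∑ n ∈ Ioc 0 D, 81 * hm n := by
      apply sum_le_sum_of_subset_of_nonneg (filter_subset _ _)
      intro i _ _; have := hm_nonneg i; positivity
    rw [this]
    refine le_trans ?_ (exp_le_exp.2 h3)
    rw [Real.exp_sum]
    apply Finset.prod_le_prod
    · intro i _; positivity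
    · intro p hp
      have hp' : p.Prime := (mem_filter.1 hp).2
      have := (hm_bounds hp').1
      have h4 := add_one_le_exp (81 * hm p)
      have : (81:ℝ) / p = 81 * (1 / p) := by ring
      linarith
  have h3 : Qm D ≤ log (log D) + (c + C) := by
    have := h D (by linarith)
    have h4 := (abs_le.1 this).2
    have : C / log D ≤ C := div_le_self (by linarith) hl1
    linarith
  refine (h1.trans h2).trans ?_
  calc exp (81 * Qm D) ≤ exp (81 * (c + C) + (81:ℕ) * log (log D)) := by
        apply exp_le_exp.2; push_cast; linarith
    _ = exp (81 * (c + C)) * log D ^ 81 := by rw [exp_add, exp_nat_mul, exp_log (by linarith)]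
    _ ≤ _ := by gcongr; exact le_max_right _ _

lemma omega_bound : ∃ C : ℝ, 1 ≤ C ∧ ∀ r : ℕ, Squarefree r → ((9:ℝ) ^ r.primeFactors.card) ^ 4 ≤ C * r := by
  obtain ⟨n, hn⟩ : ∃ n : ℕ, n = 9 ^ 4 := ⟨_, rfl⟩
  have hn1 : (1:ℝ) ≤ n := by rw [hn]; norm_num
  refine ⟨∏ p ∈ range n, (n:ℝ), ?_, fun r hr => ?_⟩
  · rw [prod_const]; exact one_le_pow₀ hn1
  have e1 : ((9:ℝ) ^ r.primeFactors.card) ^ 4 = ∏ p ∈ r.primeFactors, (n:ℝ) := by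
    rw [prod_const, ← pow_mul, mul_comm, pow_mul, hn]; norm_num
  have e2 : (r:ℝ) = ∏ p ∈ r.primeFactors, (p:ℝ) := by
    conv_lhs => rw [← Nat.prod_primeFactors_of_squarefree hr]
    push_cast; rfl
  set g : ℕ → ℝ := fun p => if p < n then (n:ℝ) else 1 with hg
  have hg1 : ∀ p, 1 ≤ g p := fun p => by
    rw [hg]; dsimp only; split_ifs
    · exact hn1
    · exact le_rfl
  have e3 : ∏ p ∈ r.primeFactors, g p ≤ ∏ p ∈ range n, (n:ℝ) := by
    rw [hg, prod_ite, prod_const_one, mul_one, prod_const, prod_const]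
    apply pow_le_pow_right₀ hn1
    apply card_le_card
    intro p hp
    simp only [mem_filter] at hp
    exact mem_range.2 hp.2
  calc ((9:ℝ) ^ r.primeFactors.card) ^ 4 = ∏ p ∈ r.primeFactors, (n:ℝ) := e1
    _ ≤ ∏ p ∈ r.primeFactors, g p * p := by
        apply Finset.prod_le_prod
        · intro i _; positivity
        · intro p hp
          have hp1 : (1:ℝ) ≤ p := by exact_mod_cast (Nat.prime_of_mem_primeFactors hp).one_le
          rw [hg]; dsimp only; split_ifs with h
          · exact le_mul_of_one_le_right (by linarith) hp1
          · rw [one_mul]; push Not at h; exact_mod_cast h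
    _ = (∏ p ∈ r.primeFactors, g p) * r := by rw [prod_mul_distrib, ← e2]
    _ ≤ _ := by gcongr

lemma ls_ind (S : Finset ℕ) (N : ℕ) (hS : S ⊆ range (N + 1)) (r : ℕ) (χ : DirichletCharacter ℂ r) :
    ∑ n ∈ S, χ (n : ZMod r) = ∑ n ∈ range (N + 1), (if n ∈ S then (1:ℂ) else 0) * χ (n : ZMod r) := by
  simp only [ite_mul, one_mul, zero_mul]
  rw [← sum_filter, filter_mem_eq_inter, inter_eq_right.2 hS]

lemma ls_ind_norm (S : Finset ℕ) (N : ℕ) :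
    ∑ n ∈ range (N + 1), ‖(if n ∈ S then (1:ℂ) else 0)‖ ^ 2 ≤ (N + 1 : ℝ) := by
  calc _ ≤ ∑ n ∈ range (N + 1), (1:ℝ) := by
        apply sum_le_sum; intro i _; split_ifs <;> simp
    _ = _ := by simp

lemma bilinear_block (B : Finset ℕ) (Q : ℕ) (hQ : 0 < Q) (hB : ∀ r ∈ B, Q ≤ r ∧ r ≤ 2 * Q) (M N : ℕ) (S T : Finset ℕ)
    (hS : S ⊆ range (M + 1)) (hT : T ⊆ range (N + 1)) (F : ℝ)
    (hF : ∑ r ∈ B, (81:ℝ) ^ r.primeFactors.card / r ≤ F) :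
    ∑ r ∈ B, (9:ℝ) ^ r.primeFactors.card / r * ∑ χ ∈ prims r,
      ‖∑ m ∈ S, χ (m : ZMod r)‖ * ‖∑ n ∈ T, χ (n : ZMod r)‖ ≤
    √(338 * F * ((M + 1) * (N + 1)) * (Q ^ 2 + (N + 1) + (M + 1) * Q + (M + 1) * (N + 1) / Q)) := by
  have hQ1 : (1:ℝ) ≤ Q := by exact_mod_cast hQ
  have hF0 : 0 ≤ F := le_trans (by positivity) hF
  set M' : ℝ := (M:ℝ) + 1 with hM'
  set N' : ℝ := (N:ℝ) + 1 with hN'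
  have hM0 : 0 < M' := by positivity
  have hN0 : 0 < N' := by positivity
  have h1 : ∑ r ∈ B, (9:ℝ) ^ r.primeFactors.card / r * ∑ χ ∈ prims r,
      ‖∑ m ∈ S, χ (m : ZMod r)‖ * ‖∑ n ∈ T, χ (n : ZMod r)‖ ≤
      (1 / Q) * ∑ s ∈ B.sigma prims, (9 ^ s.1.primeFactors.card * ‖∑ m ∈ S, s.2 (m : ZMod s.1)‖) *
        ‖∑ n ∈ T, s.2 (n : ZMod s.1)‖ := by
    rw [sum_sigma, mul_sum]
    apply sum_le_sum
    intro r hr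
    have : (Q:ℝ) ≤ r := by exact_mod_cast (hB r hr).1
    simp only [mul_assoc, ← mul_sum]
    rw [← mul_assoc]
    gcongr
    rw [one_div, inv_mul_eq_div]; gcongr
  have h2 := Real.sum_mul_le_sqrt_mul_sqrt (B.sigma prims)
    (fun s => (9 ^ s.1.primeFactors.card * ‖∑ m ∈ S, s.2 (m : ZMod s.1)‖)) (fun s => ‖∑ n ∈ T, s.2 (n : ZMod s.1)‖)
  have hA : ∑ s ∈ B.sigma prims, ((9:ℝ) ^ s.1.primeFactors.card * ‖∑ m ∈ S, s.2 (m : ZMod s.1)‖) ^ 2 ≤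
      2 * Q * F * ((2 * Q + 13 * M') * M') := by
    rw [sum_sigma]
    calc _ ≤ ∑ r ∈ B, 2 * Q * ((81:ℝ) ^ r.primeFactors.card / r) * ((2 * Q + 13 * M') * M') := by
          apply sum_le_sum
          intro r hr
          have hr1 := (hB r hr).1
          have hr2 : (r:ℝ) ≤ 2 * Q := by exact_mod_cast (hB r hr).2
          have hr0 : (0:ℝ) < r := by exact_mod_cast (by omega : 0 < r)
          simp only [mul_pow, ← mul_sum, ls_ind S M hS]
          have := large_sieve_single r (by omega) M (fun n => if n ∈ S then (1:ℂ) else 0)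
          have h3 := ls_ind_norm S M
          gcongr
          · rw [← pow_mul, mul_comm _ 2, pow_mul]
            calc ((9:ℝ) ^ 2) ^ r.primeFactors.card = 81 ^ r.primeFactors.card / r * r := by
                  rw [div_mul_cancel₀ _ hr0.ne']; norm_num
              _ ≤ 81 ^ r.primeFactors.card / r * (2 * Q) := by gcongr
              _ = _ := by ring
          · refine this.trans ?_
            gcongr
      _ = (∑ r ∈ B, (81:ℝ) ^ r.primeFactors.card / r) * (2 * Q * ((2 * Q + 13 * M') * M')) := by
          rw [sum_mul]; apply sum_congr rfl; intros; ring
      _ ≤ F * (2 * Q * ((2 * Q + 13 * M') * M')) := by gcongr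
      _ = _ := by ring
  have hC : ∑ s ∈ B.sigma prims, ‖∑ n ∈ T, s.2 (n : ZMod s.1)‖ ^ 2 ≤ ((2 * Q) ^ 2 + 13 * N') * N' := by
    rw [sum_sigma]
    simp only [ls_ind T N hT]
    have := large_sieve_Q (2 * Q) B (fun r hr => by
      have := hB r hr; rw [mem_Icc]; omega) N (fun n => if n ∈ T then (1:ℂ) else 0)
    have h3 := ls_ind_norm T N
    push_cast at this
    refine this.trans ?_
    gcongr
  refine h1.trans ?_
  calc _ ≤ 1 / (Q:ℝ) * (√(2 * Q * F * ((2 * Q + 13 * M') * M')) * √(((2 * Q) ^ 2 + 13 * N') * N')) := by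
        gcongr
        refine h2.trans ?_
        gcongr
    _ = √((2 * Q * F * ((2 * Q + 13 * M') * M')) * (((2 * Q) ^ 2 + 13 * N') * N') / Q ^ 2) := by
        rw [Real.sqrt_div' _ (by positivity), sqrt_mul (by positivity) (((2 * (Q:ℝ)) ^ 2 + 13 * N') * N'),
          sqrt_sq (by positivity)]; ring
    _ ≤ _ := by
        apply Real.sqrt_le_sqrt
        have e : (2 * Q * F * ((2 * Q + 13 * M') * M')) * (((2 * Q) ^ 2 + 13 * N') * N') / (Q:ℝ) ^ 2 =
          2 * F * (M' * N') * ((2 + 13 * (M' / Q)) * (4 * Q ^ 2 + 13 * N')) := by field_simp; ring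
        have e2 : 338 * F * (M' * N') * ((Q:ℝ) ^ 2 + N' + M' * Q + M' * N' / Q) =
          2 * F * (M' * N') * ((13 + 13 * (M' / Q)) * (13 * Q ^ 2 + 13 * N')) := by field_simp; ring
        rw [e, e2]
        gcongr <;> norm_num

lemma bilinear_large (P : Finset ℕ) (D M N : ℕ) (S T : Finset ℕ)
    (hS : S ⊆ range (M + 1)) (hT : T ⊆ range (N + 1)) (F X η R : ℝ) (hη : 0 ≤ η)
    (hF : ∑ r ∈ sieveR P D, (81:ℝ) ^ r.primeFactors.card / r ≤ F)
    (hX : ((M:ℝ) + 1) * (N + 1) ≤ X) (hD : (D:ℝ) ^ 2 ≤ η * X) (hN : (N:ℝ) + 1 ≤ η * X)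
    (hM : ((M:ℝ) + 1) * D ≤ η * X) (hR0 : 0 < R) (hR : 1 ≤ η * R) :
    ∑ r ∈ (sieveR P D).filter (fun r : ℕ => R < (r:ℝ)), (9:ℝ) ^ r.primeFactors.card / r * ∑ χ ∈ prims r,
      ‖∑ m ∈ S, χ (m : ZMod r)‖ * ‖∑ n ∈ T, χ (n : ZMod r)‖ ≤
    (Nat.log 2 D + 1) * (√(1690 * F * η) * X) := by
  have hX0 : 0 < X := lt_of_lt_of_le (by positivity) hX
  have hF0 : 0 ≤ F := le_trans (by positivity) hF
  have hmap : ∀ r ∈ (sieveR P D).filter (fun r : ℕ => R < (r:ℝ)), Nat.log 2 r ∈ range (Nat.log 2 D + 1) := by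
    intro r hr
    have := (mem_sieveR.1 (mem_filter.1 hr).1).1
    have := Nat.log_mono_right (b := 2) this.2
    rw [mem_range]; omega
  rw [← sum_fiberwise_of_maps_to hmap]
  calc _ ≤ ∑ k ∈ range (Nat.log 2 D + 1), (√(1690 * F * η) * X) := by
        apply sum_le_sum
        intro k _
        set B := ((sieveR P D).filter (fun r : ℕ => R < (r:ℝ))).filter (fun r => Nat.log 2 r = k) with hB
        rcases B.eq_empty_or_nonempty with hemp | ⟨r0, hr0⟩
        · rw [hemp, sum_empty]; positivity
        have hmem : ∀ r ∈ B, 2 ^ k ≤ r ∧ r ≤ 2 * 2 ^ k ∧ r ≤ D ∧ R < (r:ℝ) := by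
          intro r hr
          obtain ⟨hr1, hr2⟩ := mem_filter.1 hr
          obtain ⟨hr3, hr4⟩ := mem_filter.1 hr1
          have h5 := (mem_sieveR.1 hr3).1
          have h6 := Nat.pow_log_le_self 2 (x := r) (by omega)
          have h7 := Nat.lt_pow_succ_log_self (b := 2) (by norm_num) r
          rw [hr2] at h6 h7
          rw [pow_succ] at h7
          exact ⟨h6, by omega, h5.2, hr4⟩
        refine (bilinear_block B (2 ^ k) (by positivity) (fun r hr => ⟨(hmem r hr).1, (hmem r hr).2.1⟩) M N S T
          hS hT F (le_trans ?_ hF)).trans ?_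
        · apply sum_le_sum_of_subset_of_nonneg
          · exact (filter_subset _ _).trans (filter_subset _ _)
          · intros; positivity
        obtain ⟨a1, a2, a3, a4⟩ := hmem r0 hr0
        have b1 : ((2 ^ k : ℕ) : ℝ) ≤ D := by exact_mod_cast a1.trans a3
        have b2 : (r0 : ℝ) ≤ 2 * ((2 ^ k : ℕ) : ℝ) := by exact_mod_cast a2
        have b0 : (0:ℝ) < ((2 ^ k : ℕ) : ℝ) := by positivity
        generalize ((2 ^ k : ℕ) : ℝ) = Q at b0 b1 b2
        have c1 : ((M:ℝ) + 1) * (N + 1) / Q ≤ 2 * (η * X) := by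
          rw [div_le_iff₀ b0]
          calc ((M:ℝ) + 1) * (N + 1) ≤ X * 1 := by linarith
            _ ≤ X * (η * R) := by gcongr
            _ ≤ X * (η * (2 * Q)) := by gcongr; linarith
            _ = _ := by ring
        have c2 : Q ^ 2 ≤ (D:ℝ) ^ 2 := by gcongr
        have c3 : ((M:ℝ) + 1) * Q ≤ (M + 1) * D := by gcongr
        calc _ ≤ √((338 * F * X) * (5 * (η * X))) := by
              apply Real.sqrt_le_sqrt
              gcongr
              linarith
          _ = √((1690 * F * η) * X ^ 2) := by ring_nf
          _ = _ := by rw [sqrt_mul (by positivity), sqrt_sq hX0.le]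
    _ = _ := by simp

lemma prime_sum_le : ∃ C : ℝ, 1 ≤ C ∧ ∀ (φ φ' : ℝ → ℝ) (K a b : ℝ), 2 ≤ a → a ≤ b → 0 ≤ K →
    (∀ t ∈ Set.Icc a b, HasDerivAt φ (φ' t) t) → ContinuousOn φ' (Set.Icc a b) →
    (∀ t ∈ Set.Icc a b, 0 ≤ φ t ∧ φ t ≤ K) → (∀ t ∈ Set.Icc a b, |φ' t| ≤ K / t) →
    ∀ s : Finset ℕ, (∀ p ∈ s, p.Prime ∧ a ≤ p ∧ (p:ℝ) ≤ b) →
    ∑ p ∈ s, φ p / p ≤ (∫ t in a..b, φ t / (t * log t)) + C * K / log a := by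
  obtain ⟨C, hC, h⟩ := prime_sum
  refine ⟨C + 1, by linarith, fun φ φ' K a b ha hab hK hd hc hb hb' s hs => ?_⟩
  have hla : 0 < log a := by linarith [half_le_log ha]
  have h1 := (abs_le.1 (h φ φ' K a b ha hab hK hd hc
    (fun t ht => by rw [abs_of_nonneg (hb t ht).1]; exact (hb t ht).2) hb')).2
  have h2 : ∑ p ∈ s.filter (fun p => ¬ p = ⌊a⌋₊), φ p / p ≤ ∑ p ∈ (Ioc ⌊a⌋₊ ⌊b⌋₊).filter Nat.Prime, φ p / p := by
    apply sum_le_sum_of_subset_of_nonneg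
    · intro p hp
      obtain ⟨hp1, hp2⟩ := mem_filter.1 hp
      obtain ⟨c1, c2, c3⟩ := hs p hp1
      rw [mem_filter, mem_Ioc]
      have : ⌊a⌋₊ ≤ p := by have := Nat.floor_mono c2; rwa [Nat.floor_natCast] at this
      exact ⟨⟨by omega, Nat.le_floor c3⟩, c1⟩
    · intro p hp _
      rw [mem_filter, mem_Ioc] at hp
      have c2 : a < p := (Nat.floor_lt (by linarith)).1 hp.1.1
      have c3 : (p:ℝ) ≤ b := (Nat.le_floor_iff (by linarith)).1 hp.1.2
      have := (hb p ⟨c2.le, c3⟩).1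
      positivity
  have h3 : ∑ p ∈ s.filter (fun p => p = ⌊a⌋₊), φ p / p ≤ K / log a := by
    have hcard : ((s.filter (fun p => p = ⌊a⌋₊)).card : ℝ) ≤ 1 := by
      have : (s.filter (fun p => p = ⌊a⌋₊)).card ≤ 1 := by
        rw [card_le_one]; intro p hp q hq
        rw [(mem_filter.1 hp).2, (mem_filter.1 hq).2]
      exact_mod_cast this
    calc _ ≤ ∑ p ∈ s.filter (fun p => p = ⌊a⌋₊), K / log a := by
          apply sum_le_sum
          intro p hp
          obtain ⟨c1, c2, c3⟩ := hs p (mem_filter.1 hp).1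
          have := log_le_sub_one_of_pos (by linarith : 0 < a)
          exact div_le_div₀ hK (hb p ⟨c2, c3⟩).2 hla (by linarith)
      _ = ((s.filter (fun p => p = ⌊a⌋₊)).card : ℝ) * (K / log a) := by simp
      _ ≤ 1 * (K / log a) := by gcongr
      _ = _ := one_mul _
  rw [← sum_filter_add_sum_filter_not s (fun p => p = ⌊a⌋₊)]
  have : (C + 1) * K / log a = C * K / log a + K / log a := by ring
  linarith

lemma pi_le : ∃ C : ℝ, 1 ≤ C ∧ ∃ X : ℝ, 2 ≤ X ∧ ∀ u : ℝ, X ≤ u →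
    (Nat.primeCounting ⌊u⌋₊ : ℝ) ≤ u / log u * (1 + C / log u) := by
  obtain ⟨C, hC, h⟩ := pnt
  obtain ⟨c, hc⟩ := Chebyshev.primeCounting_sub_theta_div_log_isBigO.bound
  obtain ⟨X, hX⟩ := eventually_atTop.1 hc
  refine ⟨C + |c|, by linarith [abs_nonneg c], max X 2, le_max_right _ _, fun u hu => ?_⟩
  have hu2 : 2 ≤ u := (le_max_right _ _).trans hu
  have hl : 0 < log u := by linarith [half_le_log hu2]
  have h1 := hX u ((le_max_left _ _).trans hu)
  rw [norm_eq_abs, norm_eq_abs, abs_of_nonneg (by positivity : 0 ≤ u / log u ^ 2)] at h1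
  have h2 := (abs_le.1 h1).2
  have h3 := (abs_le.1 (h u hu2).2).2
  have h4 : Chebyshev.theta u / log u ≤ (u + C * u / log u) / log u := by gcongr; linarith
  have h5 : c * (u / log u ^ 2) ≤ |c| * (u / log u ^ 2) := by gcongr; exact le_abs_self c
  have h6 : (u + C * u / log u) / log u + |c| * (u / log u ^ 2) =
    u / log u * (1 + (C + |c|) / log u) := by field_simp; ring
  linarith

lemma inner_sum : ∃ C : ℝ, 1 ≤ C ∧ ∀ L ε ℓ : ℝ, 100 ≤ L → 1 / L ≤ ε → ε ≤ 1 → 2 * L / 3 ≤ ℓ → ℓ ≤ L →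
    ∀ s : Finset ℕ, (∀ q ∈ s, q.Prime ∧ exp (L / 3) ≤ q ∧ (q:ℝ) ≤ exp ((ℓ + 3 * ε) / 2)) →
    ∑ q ∈ s, 1 / (ℓ - log q) / q ≤ 1 / ℓ * log ((ℓ - L / 3) / (L / 3)) + C * ε / L := by
  obtain ⟨C, hC, h⟩ := prime_sum_le
  refine ⟨12 * C + 100, by linarith, fun L ε ℓ hL hLε hε h1 h2 s hs => ?_⟩
  have hL0 : 0 < L := by linarith
  have hε0 : 0 < ε := lt_of_lt_of_le (by positivity) hLε
  set a := exp (L / 3) with ha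
  set b := exp ((ℓ + 3 * ε) / 2) with hb
  have ha2 : 2 ≤ a := by have := add_one_le_exp (L / 3); linarith
  have hab : a ≤ b := exp_le_exp.2 (by linarith)
  have key : ∀ t ∈ Set.Icc a b, 0 < t ∧ L / 4 ≤ ℓ - log t ∧ L / 3 ≤ log t := by
    intro t ht
    have ht0 : 0 < t := by linarith [ht.1]
    have e1 : log t ≤ (ℓ + 3 * ε) / 2 := (log_le_iff_le_exp ht0).2 ht.2
    have e2 : L / 3 ≤ log t := (le_log_iff_exp_le ht0).2 ht.1
    exact ⟨ht0, by linarith, e2⟩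
  have hder : ∀ t ∈ Set.Icc a b, HasDerivAt (fun t => 1 / (ℓ - log t)) (1 / (t * (ℓ - log t) ^ 2)) t := by
    intro t ht
    obtain ⟨k1, k2, k3⟩ := key t ht
    have hne : ℓ - log t ≠ 0 := by linarith
    have := ((hasDerivAt_log k1.ne').const_sub ℓ).inv hne
    simp only [one_div]
    refine this.congr_deriv ?_
    field_simp
  have hcont : ContinuousOn (fun t => 1 / (t * (ℓ - log t) ^ 2)) (Set.Icc a b) := by
    intro t ht
    obtain ⟨k1, k2, k3⟩ := key t ht
    have hne : ℓ - log t ≠ 0 := by linarith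
    have hne2 : t * (ℓ - log t) ^ 2 ≠ 0 := mul_ne_zero k1.ne' (pow_ne_zero 2 hne)
    have := continuousAt_log k1.ne'
    exact ContinuousAt.continuousWithinAt (by fun_prop (disch := assumption))
  have hres := h (fun t => 1 / (ℓ - log t)) (fun t => 1 / (t * (ℓ - log t) ^ 2)) (4 / L) a b ha2 hab
    (by positivity) hder hcont (by
      intro t ht
      obtain ⟨k1, k2, k3⟩ := key t ht
      have : 0 < ℓ - log t := by linarith
      refine ⟨by positivity, ?_⟩
      rw [div_le_div_iff₀ this hL0]; linarith) (by
      intro t ht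
      obtain ⟨k1, k2, k3⟩ := key t ht
      have hp : 0 < ℓ - log t := by linarith
      rw [abs_of_nonneg (by positivity), div_div, div_le_div_iff₀ (by positivity) (by positivity), one_mul]
      have : L ≤ 4 * (ℓ - log t) ^ 2 := by nlinarith
      nlinarith) s hs
  have hitg : ∫ t in a..b, 1 / (ℓ - log t) / (t * log t) =
      1 / ℓ * (log ((ℓ + 3 * ε) / 2) - log (ℓ - (ℓ + 3 * ε) / 2)) -
        1 / ℓ * (log (L / 3) - log (ℓ - L / 3)) := by
    have := intervalIntegral.integral_eq_sub_of_hasDerivAt (a := a) (b := b)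
      (f := fun t => 1 / ℓ * (log (log t) - log (ℓ - log t)))
      (f' := fun t => 1 / (ℓ - log t) / (t * log t)) (by
        intro t ht
        rw [Set.uIcc_of_le hab] at ht
        obtain ⟨k1, k2, k3⟩ := key t ht
        have hne : ℓ - log t ≠ 0 := by linarith
        have hne2 : log t ≠ 0 := by linarith
        have hℓ : ℓ ≠ 0 := by linarith
        have := (((hasDerivAt_log k1.ne').log hne2).sub
          (((hasDerivAt_log k1.ne').const_sub ℓ).log hne)).const_mul (1 / ℓ)
        refine this.congr_deriv ?_
        have ht0 := k1.ne'
        field_simp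
        ring) (by
        apply ContinuousOn.intervalIntegrable
        rw [Set.uIcc_of_le hab]
        intro t ht
        obtain ⟨k1, k2, k3⟩ := key t ht
        have hne : ℓ - log t ≠ 0 := by linarith
        have hne2 : t * log t ≠ 0 := mul_ne_zero k1.ne' (by linarith)
        have := continuousAt_log k1.ne'
        exact ContinuousAt.continuousWithinAt (by fun_prop (disch := assumption)))
    rw [this, ha, hb, log_exp, log_exp]
  rw [hitg, ha, log_exp] at hres
  refine hres.trans ?_
  have hℓ0 : 0 < ℓ := by linarith
  have e1 : log ((ℓ + 3 * ε) / 2) - log (ℓ - (ℓ + 3 * ε) / 2) ≤ 30 * ε / L := by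
    rw [← log_div (by linarith) (by linarith)]
    refine (log_le_sub_one_of_pos (div_pos (by linarith) (by linarith))).trans ?_
    rw [div_sub_one (by linarith), div_le_div_iff₀ (by linarith) hL0]
    nlinarith
  have e2 : 1 / ℓ * (log ((ℓ + 3 * ε) / 2) - log (ℓ - (ℓ + 3 * ε) / 2)) ≤ 100 * ε / L := by
    have : 1 / ℓ ≤ 1 := by rw [div_le_one hℓ0]; linarith
    calc _ ≤ 1 / ℓ * (30 * ε / L) := by gcongr
      _ ≤ 1 * (30 * ε / L) := by gcongr
      _ ≤ _ := by rw [one_mul]; gcongr; norm_num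
  have e3 : C * (4 / L) / (L / 3) ≤ 12 * C * ε / L := by
    have : C * (4 / L) / (L / 3) = 12 * C * (1 / L) / L := by field_simp; ring
    rw [this]; gcongr
  have e4 : log ((ℓ - L / 3) / (L / 3)) = log (ℓ - L / 3) - log (L / 3) :=
    log_div (by linarith) (by linarith)
  rw [e4]
  have e5 : (12 * C + 100) * ε / L = 12 * C * ε / L + 100 * ε / L := by ring
  rw [e5]
  linarith

lemma outer_sum (δ : ℝ) (hδ0 : 0 < δ) (hδ1 : δ < 1 / 3) : ∃ C : ℝ, 1 ≤ C ∧ ∃ X : ℝ, 100 ≤ X ∧ ∀ L : ℝ, X ≤ L →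
    ∀ s : Finset ℕ, (∀ p ∈ s, p.Prime ∧ exp (δ * L) ≤ p ∧ (p:ℝ) ≤ exp (1 / 3 * L)) →
    ∑ p ∈ s, log (2 - 3 * (log p / L)) / (1 - log p / L) / p ≤
      (∫ β in δ..(1/3:ℝ), log (2 - 3 * β) / (β * (1 - β))) + C / L ∧ ∑ p ∈ s, 1 / (p:ℝ) ≤ C := by
  obtain ⟨C, hC, h⟩ := prime_sum_le
  set E : ℝ := log (1 / 3) - log δ with hE
  have hE0 : 0 ≤ E := by rw [hE]; linarith [log_le_log hδ0 hδ1.le]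
  refine ⟨10 * C / δ + E, ?_, max 100 (1 / δ), le_max_left _ _, fun L hL s hs => ?_⟩
  · have : 10 * C ≤ 10 * C / δ := le_div_self (by linarith) hδ0 (by linarith)
    linarith
  have hL1 : 100 ≤ L := (le_max_left _ _).trans hL
  have hL2 : 1 / δ ≤ L := (le_max_right _ _).trans hL
  have hL0 : 0 < L := by linarith
  have hδL : 1 ≤ δ * L := by rw [div_le_iff₀ hδ0] at hL2; linarith
  set a := exp (δ * L) with ha
  set b := exp (1 / 3 * L) with hb
  have ha2 : 2 ≤ a := by have := add_one_le_exp (δ * L); linarith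
  have hab : a ≤ b := exp_le_exp.2 (by gcongr)
  have key : ∀ t ∈ Set.Icc a b, 0 < t ∧ δ ≤ log t / L ∧ log t / L ≤ 1 / 3 := by
    intro t ht
    have ht0 : 0 < t := by linarith [ht.1]
    have e1 : log t ≤ 1 / 3 * L := (log_le_iff_le_exp ht0).2 ht.2
    have e2 : δ * L ≤ log t := (le_log_iff_exp_le ht0).2 ht.1
    exact ⟨ht0, (le_div_iff₀ hL0).2 e2, (div_le_iff₀ hL0).2 e1⟩
  constructor
  · set H : ℝ → ℝ := fun β => log (2 - 3 * β) / (1 - β) with hH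
    set H' : ℝ → ℝ := fun β => (-3 / (2 - 3 * β) * (1 - β) - log (2 - 3 * β) * (-1)) / (1 - β) ^ 2 with hH'
    have hHd : ∀ β, β ≤ 1 / 3 → HasDerivAt H (H' β) β := by
      intro β hβ
      have e1 : 2 - 3 * β ≠ 0 := by linarith
      have e2 : 1 - β ≠ 0 := by linarith
      have d1 : HasDerivAt (fun β : ℝ => 2 - 3 * β) (-3) β := by simpa using ((hasDerivAt_id β).const_mul 3).const_sub 2
      have d2 : HasDerivAt (fun β : ℝ => 1 - β) (-1) β := by simpa using (hasDerivAt_id β).const_sub 1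
      exact (d1.log e1).div d2 e2
    have hlog : ∀ β, 0 ≤ β → β ≤ 1 / 3 → 0 ≤ log (2 - 3 * β) ∧ log (2 - 3 * β) ≤ 1 := by
      intro β h0 h1
      refine ⟨log_nonneg (by linarith), ?_⟩
      have := log_le_sub_one_of_pos (by linarith : 0 < 2 - 3 * β)
      linarith
    have hHb : ∀ β, 0 ≤ β → β ≤ 1 / 3 → 0 ≤ H β ∧ H β ≤ 10 ∧ |H' β| ≤ 10 := by
      intro β h0 h1
      obtain ⟨l1, l2⟩ := hlog β h0 h1
      have e1 : 1 ≤ 2 - 3 * β := by linarith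
      have e2 : 2 / 3 ≤ 1 - β := by linarith
      refine ⟨div_nonneg l1 (by linarith), ?_, ?_⟩
      · simp only [hH]
        rw [div_le_iff₀ (by linarith)]; linarith
      · simp only [hH']
        have e3 : 0 ≤ 3 / (2 - 3 * β) ∧ 3 / (2 - 3 * β) ≤ 3 := ⟨by positivity, div_le_self (by norm_num) e1⟩
        have e4 : -3 / (2 - 3 * β) = - (3 / (2 - 3 * β)) := by ring
        rw [abs_div, abs_of_nonneg (sq_nonneg (1 - β)), div_le_iff₀ (by positivity), e4, abs_le]
        generalize 3 / (2 - 3 * β) = w at e3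
        constructor <;> nlinarith
    have hres := h (fun t => H (log t / L)) (fun t => H' (log t / L) * (1 / t / L)) 10 a b ha2 hab (by norm_num)
      (by
        intro t ht
        obtain ⟨k1, k2, k3⟩ := key t ht
        have := (hHd _ k3).comp t ((hasDerivAt_log k1.ne').div_const L)
        simp only [one_div]
        exact this) (by
        intro t ht
        obtain ⟨k1, k2, k3⟩ := key t ht
        have c1 := continuousAt_log k1.ne'
        have c3 : 2 - 3 * (log t / L) ≠ 0 := by linarith
        have c2 : ContinuousAt (fun t => log (2 - 3 * (log t / L))) t := ContinuousAt.log (by fun_prop) c3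
        have c4 : (1 - log t / L) ^ 2 ≠ 0 := pow_ne_zero 2 (by linarith)
        have c5 := k1.ne'
        have c6 := hL0.ne'
        simp only [hH']
        exact ContinuousAt.continuousWithinAt (by fun_prop (disch := assumption))) (by
        intro t ht
        obtain ⟨k1, k2, k3⟩ := key t ht
        have := hHb _ (hδ0.le.trans k2) k3
        exact ⟨this.1, this.2.1⟩) (by
        intro t ht
        obtain ⟨k1, k2, k3⟩ := key t ht
        have := (hHb _ (hδ0.le.trans k2) k3).2.2
        rw [abs_mul, abs_of_nonneg (by positivity : 0 ≤ 1 / t / L)]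
        calc _ ≤ 10 * (1 / t / 1) := by gcongr; linarith
          _ = _ := by ring) s hs
    have hitg : ∫ t in a..b, H (log t / L) / (t * log t) =
        ∫ β in δ..(1/3:ℝ), log (2 - 3 * β) / (β * (1 - β)) := by
      have e1 : log a / L = δ := by rw [ha, log_exp]; field_simp
      have e2 : log b / L = 1 / 3 := by rw [hb, log_exp]; field_simp
      have := intervalIntegral.integral_comp_mul_deriv' (a := a) (b := b) (f := fun t => log t / L)
        (f' := fun t => 1 / t / L) (g := fun β => log (2 - 3 * β) / (β * (1 - β))) (by
          intro t ht
          rw [Set.uIcc_of_le hab] at ht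
          obtain ⟨k1, k2, k3⟩ := key t ht
          simpa only [one_div] using (hasDerivAt_log k1.ne').div_const L) (by
          intro t ht
          rw [Set.uIcc_of_le hab] at ht
          have c5 := (key t ht).1.ne'
          have c6 := hL0.ne'
          exact ContinuousAt.continuousWithinAt (by fun_prop (disch := assumption))) (by
          rintro β ⟨t, ht, rfl⟩
          rw [Set.uIcc_of_le hab] at ht
          obtain ⟨k1, k2, k3⟩ := key t ht
          dsimp only
          generalize log t / L = β at k2 k3
          have c3 : 2 - 3 * β ≠ 0 := by linarith
          have c2 : ContinuousAt (fun β : ℝ => log (2 - 3 * β)) β := ContinuousAt.log (by fun_prop) c3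
          have c4 : β * (1 - β) ≠ 0 := mul_ne_zero (by linarith) (by linarith)
          exact ContinuousAt.continuousWithinAt (by fun_prop (disch := assumption)))
      rw [e1, e2] at this
      rw [← this]
      apply intervalIntegral.integral_congr
      intro t ht
      rw [Set.uIcc_of_le hab] at ht
      obtain ⟨k1, k2, k3⟩ := key t ht
      simp only [hH, Function.comp]
      have c1 : log t ≠ 0 := by rintro h0; rw [h0, zero_div] at k2; linarith
      have c2 : 1 - log t / L ≠ 0 := by linarith
      have c3 := k1.ne'
      generalize log (2 - 3 * (log t / L)) = w
      field_simp
    rw [hitg, ha, log_exp] at hres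
    refine hres.trans ?_
    have : C * 10 / (δ * L) = 10 * C / δ / L := by field_simp
    rw [this, add_div]
    have : 0 ≤ E / L := by positivity
    linarith
  · have hres := h (fun _ => 1) (fun _ => 0) 1 a b ha2 hab (by norm_num) (fun t _ => hasDerivAt_const t 1)
      continuousOn_const (fun t _ => by norm_num) (fun t ht => by have := (key t ht).1; rw [abs_zero]; positivity) s hs
    rw [loglog_int ha2 hab, ha, hb, log_exp, log_exp, log_mul (by norm_num) hL0.ne',
      log_mul hδ0.ne' hL0.ne'] at hres
    refine hres.trans ?_
    have e1 : C * 1 / (δ * L) ≤ 10 * C / δ := by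
      rw [div_le_div_iff₀ (by positivity) hδ0]
      nlinarith [mul_pos (by linarith : 0 < C) hδ0]
    linarith

/-- The main term. -/
lemma main_sum (δ : ℝ) (hδ0 : 0 < δ) (hδ1 : δ < 1 / 3) : ∃ C : ℝ, 1 ≤ C ∧ ∃ X : ℝ, 100 ≤ X ∧ ∀ L ε : ℝ, X ≤ L →
    1 / L ≤ ε → ε ≤ 1 → ∀ (s : Finset ℕ) (t : ℕ → Finset ℕ),
    (∀ p ∈ s, p.Prime ∧ exp (δ * L) ≤ p ∧ (p:ℝ) ≤ exp (1 / 3 * L)) →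
    (∀ p ∈ s, ∀ q ∈ t p, q.Prime ∧ exp (1 / 3 * L) ≤ q ∧ log p + 2 * log q ≤ L + 3 * ε) →
    ∑ p ∈ s, ∑ q ∈ t p, (Nat.primeCounting ⌊exp (L + 2 * ε) / (p * q)⌋₊ : ℝ) ≤
      ((∫ β in δ..(1/3:ℝ), log (2 - 3 * β) / (β * (1 - β))) + C * ε) * exp L / L := by
  obtain ⟨C1, hC1, X1, hX1, h1⟩ := outer_sum δ hδ0 hδ1
  obtain ⟨C2, hC2, h2⟩ := inner_sum
  obtain ⟨C3, hC3, X3, hX3, h3⟩ := pi_le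
  set I := ∫ β in δ..(1/3:ℝ), log (2 - 3 * β) / (β * (1 - β)) with hI
  have hI0 : 0 ≤ I := by
    rw [hI]; apply intervalIntegral.integral_nonneg hδ1.le
    intro β hβ
    exact div_nonneg (log_nonneg (by linarith [hβ.2])) (mul_nonneg (by linarith [hβ.1]) (by linarith [hβ.2]))
  set G := 20 * (1 + 5 * C3) with hG
  refine ⟨(1 + G) * (C1 + C1 * C2) + G * I, ?_, max X1 (4 * X3), hX1.trans (le_max_left _ _), ?_⟩
  · have : 0 ≤ G := by rw [hG]; positivity
    have e1 : 1 ≤ C1 + C1 * C2 := by nlinarith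
    have : 0 ≤ G * I := by positivity
    nlinarith
  intro L ε hL hLε hε s t hs ht
  have hLX1 : X1 ≤ L := (le_max_left _ _).trans hL
  have hLX3 : 4 * X3 ≤ L := (le_max_right _ _).trans hL
  have hL1 : 100 ≤ L := hX1.trans hLX1
  have hL0 : 0 < L := by linarith
  have hε0 : 0 < ε := lt_of_lt_of_le (by positivity) hLε
  have hG0 : 0 < G := by rw [hG]; positivity
  have hp : ∀ p ∈ s, 0 < (p:ℝ) ∧ δ * L ≤ log p ∧ log p ≤ 1 / 3 * L := by
    intro p hp
    obtain ⟨a1, a2, a3⟩ := hs p hp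
    have ht0 : 0 < (p:ℝ) := by exact_mod_cast a1.pos
    exact ⟨ht0, (le_log_iff_exp_le ht0).2 a2, (log_le_iff_le_exp ht0).2 a3⟩
  have term : ∀ p ∈ s, ∀ q ∈ t p, (Nat.primeCounting ⌊exp (L + 2 * ε) / (p * q)⌋₊ : ℝ) ≤
      (1 + G * ε) * exp L * (1 / (p:ℝ) * (1 / ((L - log p) - log q) / q)) := by
    intro p hp' q hq
    obtain ⟨p0, p1, p2⟩ := hp p hp'
    obtain ⟨a1, a2, a3⟩ := ht p hp' q hq
    have q0 : 0 < (q:ℝ) := by exact_mod_cast a1.pos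
    have q1 : 1 / 3 * L ≤ log q := (le_log_iff_exp_le q0).2 a2
    set u := exp (L + 2 * ε) / (p * q) with hu
    have hu0 : 0 < u := by positivity
    set v := L - log p - log q with hv
    have hlu : log u = v + 2 * ε := by
      rw [hu, log_div (by positivity) (by positivity), log_exp, log_mul p0.ne' q0.ne']; ring
    have hv4 : L / 4 ≤ v := by linarith
    have hu3 : X3 ≤ u := by
      have := add_one_le_exp (log u)
      rw [exp_log hu0] at this
      linarith
    refine (h3 u hu3).trans ?_
    have e1 : u / log u * (1 + C3 / log u) ≤ u / v * (1 + C3 * (4 * ε)) := by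
      have hvu : v ≤ log u := by linarith
      have hv0 : 0 < v := by linarith
      have : 1 / log u ≤ 4 * ε := by
        calc 1 / log u ≤ 1 / (L / 4) := one_div_le_one_div_of_le (by linarith) (by linarith)
          _ = 4 * (1 / L) := by field_simp
          _ ≤ _ := by gcongr
      rw [div_eq_mul_one_div C3]
      have : 0 < log u := by linarith
      gcongr
    refine e1.trans ?_
    have e2 : u / v * (1 + C3 * (4 * ε)) = exp (2 * ε) * (1 + C3 * (4 * ε)) * exp L * (1 / (p:ℝ) * (1 / v / q)) := by
      rw [hu, exp_add]; field_simp
    rw [e2]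
    have hv0 : 0 < v := by linarith
    gcongr
    have e3 : exp (2 * ε) ≤ 1 + 20 * ε := by
      have c1 : exp 2 ≤ 9 := by
        have : exp 2 = exp 1 ^ 2 := by rw [← exp_nat_mul]; norm_num
        rw [this]
        have e1 := exp_one_lt_d9
        have : exp 1 ^ 2 ≤ (3:ℝ) ^ 2 := by gcongr; linarith
        linarith
      have c2 := convexOn_exp.2 (Set.mem_univ 0) (Set.mem_univ 2) (by linarith : 0 ≤ 1 - ε) hε0.le (by ring)
      simp only [smul_eq_mul, mul_zero, zero_add, Real.exp_zero, mul_one] at c2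
      rw [mul_comm 2 ε]
      nlinarith
    calc exp (2 * ε) * (1 + C3 * (4 * ε)) ≤ (1 + 20 * ε) * (1 + C3 * (4 * ε)) := by gcongr
      _ = 1 + (20 + 4 * C3 + 80 * C3 * ε) * ε := by ring
      _ ≤ 1 + G * ε := by
          have : 80 * C3 * ε ≤ 80 * C3 * 1 := by gcongr
          gcongr
          rw [hG]; linarith
  have hinner : ∀ p ∈ s, ∑ q ∈ t p, 1 / ((L - log p) - log q) / q ≤
      1 / L * (log (2 - 3 * (log p / L)) / (1 - log p / L)) + C2 * ε / L := by
    intro p hp'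
    obtain ⟨p0, p1, p2⟩ := hp p hp'
    have hp00 : 0 < log p := lt_of_lt_of_le (by positivity) p1
    have := h2 L ε (L - log p) hL1 hLε hε (by linarith) (by linarith) (t p) (by
      intro q hq
      obtain ⟨a1, a2, a3⟩ := ht p hp' q hq
      have q0 : 0 < (q:ℝ) := by exact_mod_cast a1.pos
      refine ⟨a1, by rwa [show L / 3 = 1 / 3 * L by ring], ?_⟩
      rw [← log_le_iff_le_exp q0]; linarith)
    refine this.trans (le_of_eq ?_)
    congr 1
    have e1 : (L - log p - L / 3) / (L / 3) = 2 - 3 * (log p / L) := by field_simp; ring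
    rw [e1]
    have e2 : 1 - log p / L = (L - log p) / L := by field_simp
    rw [e2]
    have : L - log p ≠ 0 := by linarith
    field_simp
  obtain ⟨o1, o2⟩ := h1 L hLX1 s hs
  calc _ ≤ ∑ p ∈ s, ∑ q ∈ t p, (1 + G * ε) * exp L * (1 / (p:ℝ) * (1 / ((L - log p) - log q) / q)) :=
        sum_le_sum fun p hp' => sum_le_sum fun q hq => term p hp' q hq
    _ = (1 + G * ε) * exp L * ∑ p ∈ s, 1 / (p:ℝ) * ∑ q ∈ t p, (1 / ((L - log p) - log q) / q) := by simp only [mul_sum]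
    _ ≤ (1 + G * ε) * exp L * ∑ p ∈ s, 1 / (p:ℝ) *
          (1 / L * (log (2 - 3 * (log p / L)) / (1 - log p / L)) + C2 * ε / L) := by
        gcongr with p hp'
        exact hinner p hp'
    _ = (1 + G * ε) * exp L * (1 / L * (∑ p ∈ s, log (2 - 3 * (log p / L)) / (1 - log p / L) / p +
          C2 * ε * ∑ p ∈ s, 1 / (p:ℝ))) := by
        congr 1
        rw [mul_add, mul_sum, mul_sum, mul_sum, ← sum_add_distrib]
        apply sum_congr rfl; intro p _; ring
    _ ≤ (1 + G * ε) * exp L * (1 / L * ((I + C1 * ε) + C2 * ε * C1)) := by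
        gcongr
        refine o1.trans ?_
        rw [div_eq_mul_one_div C1]
        gcongr
    _ = ((1 + G * ε) * (I + (C1 + C1 * C2) * ε)) * exp L / L := by ring
    _ ≤ _ := by
        gcongr
        have : (1 + G * ε) * (I + (C1 + C1 * C2) * ε) = I + (1 + G * ε) * (C1 + C1 * C2) * ε + G * I * ε := by ring
        rw [this]
        have : (1 + G * ε) * (C1 + C1 * C2) * ε ≤ (1 + G * 1) * (C1 + C1 * C2) * ε := by gcongr
        linarith

lemma exp_poly (n : ℕ) (K : ℝ) {c : ℝ} (hc : 0 < c) : ∀ᶠ L : ℝ in atTop, K * L ^ n ≤ exp (c * L) := by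
  have h := (isLittleO_pow_exp_pos_mul_atTop n hc).bound (show (0:ℝ) < 1 / (|K| + 1) by positivity)
  filter_upwards [h, eventually_ge_atTop 0] with L hL h0
  rw [norm_of_nonneg (by positivity), norm_of_nonneg (by positivity), one_div, inv_mul_eq_div,
    le_div_iff₀ (by positivity)] at hL
  have : K ≤ |K| + 1 := by linarith [le_abs_self K]
  calc K * L ^ n ≤ (|K| + 1) * L ^ n := by gcongr
    _ ≤ _ := by linarith

/-- size of the sieve support -/
def xi (L : ℝ) : ℕ := ⌊exp (1 / 4 * L) / L ^ 61⌋₊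

lemma prod_ge (s : Finset ℕ) (f : ℕ → ℝ) (h : ∀ p ∈ s, 0 ≤ f p ∧ f p ≤ 1) :
    1 - ∑ p ∈ s, f p ≤ ∏ p ∈ s, (1 - f p) := by
  classical
  induction s using Finset.induction_on with
  | empty => simp
  | insert a s ha ih =>
    rw [sum_insert ha, prod_insert ha]
    have h1 := ih fun p hp => h p (mem_insert_of_mem hp)
    obtain ⟨h2, h3⟩ := h a (mem_insert_self _ _)
    have h4 : 0 ≤ ∑ p ∈ s, f p := sum_nonneg fun p hp => (h p (mem_insert_of_mem hp)).1
    nlinarith [mul_le_mul_of_nonneg_left h1 (by linarith : 0 ≤ 1 - f a), mul_nonneg h2 h4]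

lemma eps_facts {L ε : ℝ} (hL : 1 ≤ L) (h0 : 0 < ε) (h : ε ^ 6 * L = 1) :
    ε ≤ 1 ∧ 1 / L ≤ ε ∧ √L ≤ L * ε ∧ 1 ≤ ε ^ 2 * L := by
  have h1 : ε ≤ 1 := by
    by_contra hc; push Not at hc
    have : 1 < ε ^ 6 := one_lt_pow₀ hc (by norm_num)
    nlinarith
  have hL0 : 0 < L := by linarith
  have hs : ∀ n, 1 ≤ n → n ≤ 6 → 1 ≤ ε ^ n * L := fun n _ hn => by
    rw [← h]; gcongr ?_ * L; exact pow_le_pow_of_le_one h0.le h1 hn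
  refine ⟨h1, ?_, ?_, hs 2 (by norm_num) (by norm_num)⟩
  · rw [div_le_iff₀ hL0]; simpa using hs 1 le_rfl (by norm_num)
  · rw [Real.sqrt_le_left (by positivity)]
    calc L = L * 1 := by ring
      _ ≤ L * (ε ^ 2 * L) := by gcongr; exact hs 2 (by norm_num) (by norm_num)
      _ = _ := by ring

lemma eps_small (c : ℝ) (hc : 0 < c) : ∀ᶠ L : ℝ in atTop, ∀ ε : ℝ, 0 < ε → ε ^ 6 * L = 1 → ε ≤ c := by
  filter_upwards [eventually_gt_atTop (1 / c ^ 6), eventually_gt_atTop 0] with L hL hL0 ε h0 h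
  by_contra hcon; push Not at hcon
  have : c ^ 6 ≤ ε ^ 6 := by gcongr
  rw [div_lt_iff₀ (by positivity)] at hL
  nlinarith

lemma bin_sum {ε : ℝ} (h0 : 0 < ε) (h1 : ε ≤ 1) {w : ℝ} (hw : 0 < w) (i : ℕ) (I : Finset ℕ)
    (hI : ∀ p ∈ I, p.Prime ∧ w ≤ (p:ℝ) ∧ i * ε ≤ log p ∧ log p < (i + 1) * ε) :
    ∑ p ∈ I, 1 / (p:ℝ) ≤ 2 * ε + 3 / w := by
  set a := exp (i * ε) with ha
  have ha0 : 0 < a := exp_pos _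
  have hb : exp ((i + 1) * ε) = a * exp ε := by rw [ha, ← exp_add]; ring_nf
  have hexp : exp ε ≤ 1 + 2 * ε := by
    have c2 := convexOn_exp.2 (Set.mem_univ 0) (Set.mem_univ 1) (by linarith : 0 ≤ 1 - ε) h0.le (by ring)
    simp only [smul_eq_mul, mul_zero, zero_add, Real.exp_zero, mul_one] at c2
    have := exp_one_lt_d9
    nlinarith
  have hsub : I ⊆ Ico ⌈a⌉₊ ⌈a * exp ε⌉₊ := by
    intro p hp
    obtain ⟨c1, c2, c3, c4⟩ := hI p hp
    have p0 : (0:ℝ) < p := by exact_mod_cast c1.pos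
    rw [mem_Ico, Nat.ceil_le, Nat.lt_ceil, ← hb]
    exact ⟨(le_log_iff_exp_le p0).1 c3, (Real.log_lt_iff_lt_exp p0).1 c4⟩
  rcases I.eq_empty_or_nonempty with rfl | ⟨q, hq⟩
  · simp only [sum_empty]; positivity
  have hcard : (I.card : ℝ) ≤ 2 * ε * a + 1 := by
    have h3 := card_le_card hsub
    rw [Nat.card_Ico] at h3
    have h4 : ((I.card : ℕ) : ℝ) ≤ (⌈a * exp ε⌉₊ : ℝ) - ⌈a⌉₊ := by
      rw [← Nat.cast_sub (Nat.ceil_mono (le_mul_of_one_le_right ha0.le (one_le_exp h0.le)))]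
      exact_mod_cast h3
    have h5 := Nat.ceil_lt_add_one (show 0 ≤ a * exp ε by positivity)
    have h6 := Nat.le_ceil a
    nlinarith
  have haw : w ≤ 3 * a := by
    obtain ⟨c1, c2, c3, c4⟩ := hI q hq
    have p0 : (0:ℝ) < q := by exact_mod_cast c1.pos
    have := (Real.log_lt_iff_lt_exp p0).1 c4
    rw [hb] at this
    nlinarith
  calc ∑ p ∈ I, 1 / (p:ℝ) ≤ ∑ p ∈ I, 1 / a := by
        apply sum_le_sum; intro p hp
        obtain ⟨c1, c2, c3, c4⟩ := hI p hp
        have p0 : (0:ℝ) < p := by exact_mod_cast c1.pos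
        exact one_div_le_one_div_of_le ha0 ((le_log_iff_exp_le p0).1 c3)
    _ = I.card * (1 / a) := by simp
    _ ≤ (2 * ε * a + 1) * (1 / a) := by gcongr
    _ = 2 * ε + 1 / a := by field_simp
    _ ≤ _ := by
        have : 1 / a ≤ 3 / w := by rw [div_le_div_iff₀ ha0 hw]; linarith
        linarith

lemma xi_log : ∃ C : ℝ, 1 ≤ C ∧ ∀ᶠ L : ℝ in atTop, 2 ≤ xi L ∧ (xi L : ℝ) ≤ exp (1 / 4 * L) / L ^ 61 ∧
    L / 4 - C * √L ≤ log (xi L) := by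
  obtain ⟨C, hC, h⟩ := logpow_sqrt 1
  refine ⟨61 * C + 1, by linarith, ?_⟩
  filter_upwards [exp_poly 61 2 (show (0:ℝ) < 1 / 4 by norm_num), eventually_ge_atTop 1] with L h1 hL
  have hL0 : 0 < L := by linarith
  set E := exp (1 / 4 * L) / L ^ 61 with hE
  have hE2 : 2 ≤ E := by rw [hE, le_div_iff₀ (by positivity)]; exact h1
  have hx : xi L = ⌊E⌋₊ := rfl
  rw [hx]
  refine ⟨Nat.le_floor (by exact_mod_cast hE2), Nat.floor_le (by linarith), ?_⟩
  have h2 := Nat.lt_floor_add_one E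
  have h3 : E / 2 ≤ ⌊E⌋₊ := by linarith
  have h4 := log_le_log (by positivity) h3
  rw [log_div (by positivity) (by norm_num), hE, log_div (by positivity) (by positivity), log_exp,
    log_pow, ← hE] at h4
  have h5 := h L hL
  rw [pow_one] at h5
  have h6 : log 2 ≤ 1 := by linarith [Real.log_two_lt_d9]
  have h7 : 1 ≤ √L := by rw [one_le_sqrt]; exact hL
  push_cast at h4
  nlinarith

set_option maxHeartbeats 1000000 in
/-- lower bound for the sieve denominator, and a crude lower bound for `V` -/
lemma G_lower (b : ℕ) (hb : 0 < b) (δ : ℝ) (hδ0 : 0 < δ) (hδ1 : δ < 1 / 3) : ∃ C : ℝ, 1 ≤ C ∧ ∀ᶠ L : ℝ in atTop,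
    1 ≤ C * L ^ 2 * V b (exp (δ * L)) ∧
    ∀ ε : ℝ, 0 < ε → ε ^ 6 * L = 1 → ∀ (i : ℕ) (I : Finset ℕ),
      (∀ p ∈ I, p.Prime ∧ exp (δ * L) ≤ (p:ℝ) ∧ i * ε ≤ log p ∧ log p < (i + 1) * ε) →
      1 ≤ 4 * δ * exp eulerMascheroniConstant * (1 + C * ε) *
        (sieveG (PP b (exp (1 / 3 * L)) \ I) (xi L) * V b (exp (δ * L))) := by
  obtain ⟨K, hK, hGV⟩ := GV_bound
  obtain ⟨C1, hC1, hm⟩ := mertens3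
  obtain ⟨C2, hC2, hxi⟩ := xi_log
  set γ := eulerMascheroniConstant with hγ
  set t := C1 / δ + 5 + 4 * (C2 + K) with ht
  have ht0 : 0 < t := by positivity
  have hC1δ : 0 < C1 / δ := by positivity
  refine ⟨2 * t + (2 * δ * exp γ) ^ 2, ?_, ?_⟩
  · have : 0 ≤ (2 * δ * exp γ) ^ 2 := by positivity
    linarith
  filter_upwards [hxi, eventually_ge_atTop 1, eps_small (1 / (2 * t)) (by positivity), exp_poly 1 1 hδ0,
    exp_poly 0 (2 * b + 2) hδ0, eventually_ge_atTop (2 * C1 / δ), eventually_ge_atTop (16 * (C2 + K) ^ 2)] with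
    L ⟨x1, x2, x3⟩ hL hes hexp hexpb hLC hLK
  have hL0 : 0 < L := by linarith
  set z := exp (δ * L) with hz
  set y := exp (1 / 3 * L) with hy
  rw [pow_zero, mul_one] at hexpb
  rw [pow_one, one_mul] at hexp
  have hb0 : (0:ℝ) ≤ b := by positivity
  have hz2 : 2 ≤ z := by linarith
  have hmz := hm z hz2
  rw [hz, log_exp, ← hz] at hmz
  set Pz := ∏ p ∈ (Ioc 0 ⌊z⌋₊).filter Nat.Prime, (1 - 1 / (p:ℝ)) with hPz
  have hhalf : C1 / (δ * L) ≤ 1 / 2 := by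
    rw [div_le_iff₀ hδ0] at hLC
    rw [div_le_iff₀ (by positivity)]; linarith
  have hPz0 : 0 < Pz := lt_of_lt_of_le (by
    have : 0 < 1 - C1 / (δ * L) := by linarith
    positivity) hmz
  have hge : exp γ * exp (-γ) = 1 := by rw [← exp_add]; simp
  refine ⟨?_, fun ε h0 h6 i I hI => ?_⟩
  · have hV : Pz ^ 2 ≤ V b z := by
      rw [hPz, ← prod_pow, V]
      calc _ ≤ ∏ q ∈ (range (Nat.ceil z + 1)).filter
              (fun q : ℕ => q.Prime ∧ (q : ℝ) < z ∧ ¬ q ∣ 2 * b), (1 - 1 / (q:ℝ)) ^ 2 := by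
            apply prod_anti
            · intro q hq
              obtain ⟨h1, h2, h3, h4⟩ := mem_filter.1 hq
              rw [mem_filter, mem_Ioc]
              exact ⟨⟨h2.pos, Nat.le_floor h3.le⟩, h2⟩
            · intro p _; positivity
            · intro p hp
              have : (1:ℝ) ≤ p := by exact_mod_cast (mem_filter.1 hp).2.one_le
              have h1 : 1 / (p:ℝ) ≤ 1 := by rw [div_le_one (by linarith)]; exact this
              have h2 : 0 < 1 / (p:ℝ) := by positivity
              nlinarith
        _ ≤ _ := by
            apply Finset.prod_le_prod
            · intro p _; positivity
            · intro q hq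
              obtain ⟨h1, h2, h3, h4⟩ := mem_filter.1 hq
              have hq2 : q ≠ 2 := by rintro rfl; exact h4 (dvd_mul_right 2 b)
              have hq3 : 3 ≤ q := by have := h2.two_le; omega
              have hq3' : (3:ℝ) ≤ q := by exact_mod_cast hq3
              rw [one_sub_div (by linarith), one_sub_div (by linarith), div_pow, div_le_div_iff₀ (by positivity) (by linarith)]
              nlinarith
    have h1 : 1 ≤ 2 * δ * exp γ * L * Pz := by
      have e1 : exp (-γ) * (1 / 2) / (δ * L) ≤ Pz := by
        refine le_trans ?_ hmz
        gcongr; linarith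
      calc (1:ℝ) = 2 * δ * L * (exp (-γ) * (1 / 2) / (δ * L)) * exp γ := by
            field_simp; rw [mul_comm, hge]
        _ ≤ 2 * δ * L * Pz * exp γ := by gcongr
        _ = _ := by ring
    calc (1:ℝ) = 1 ^ 2 := by norm_num
      _ ≤ (2 * δ * exp γ * L * Pz) ^ 2 := by gcongr
      _ = (2 * δ * exp γ) ^ 2 * L ^ 2 * Pz ^ 2 := by ring
      _ ≤ (2 * t + (2 * δ * exp γ) ^ 2) * L ^ 2 * V b z := by
          gcongr
          linarith
  · obtain ⟨f1, f2, f3, f4⟩ := eps_facts hL h0 h6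
    have hεt : t * ε ≤ 1 / 2 := by
      have := hes ε h0 h6
      rw [le_div_iff₀ (by positivity)] at this; linarith
    have hexy : (xi L : ℝ) < y := by
      refine lt_of_le_of_lt x2 (lt_of_le_of_lt (div_le_self (exp_pos _).le (one_le_pow₀ hL)) ?_)
      rw [hy]; apply Real.exp_lt_exp.2; linarith
    have hsq : 4 * (C2 + K) ≤ √L := by apply le_sqrt_of_sq_le; rw [mul_pow]; norm_num; exact hLK
    have h1s : 1 ≤ √L := by rw [one_le_sqrt]; exact hL
    have hss : √L * √L = L := mul_self_sqrt hL0.le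
    have hlx : L / 4 * (1 - 4 * (C2 + K) * ε) ≤ log (xi L) - K := by
      have : (C2 + K) * √L ≤ (C2 + K) * (L * ε) := by gcongr
      have e2 : K * 1 ≤ K * √L := by gcongr
      have e3 : L / 4 * (1 - 4 * (C2 + K) * ε) = L / 4 - (C2 + K) * (L * ε) := by ring
      linarith
    have hKx : K ≤ log (xi L) := by
      have e1 : 4 * (C2 + K) * √L ≤ √L * √L := by gcongr
      have e2 : K * 1 ≤ K * √L := by gcongr
      linarith
    have main := hGV b y z (xi L) I hb (by linarith) (exp_le_exp.2 (by gcongr)) (by omega) hexy hKx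
      (fun p hp => ⟨(hI p hp).1, (hI p hp).2.1⟩)
    rw [← hPz] at main
    have hIs : 1 - 5 * ε ≤ ∏ p ∈ I, (1 - 1 / (p:ℝ)) := by
      have e1 := bin_sum h0 f1 (by positivity : 0 < z) i I hI
      have e2 : 3 / z ≤ 3 * ε := by
        calc 3 / z ≤ 3 / L := by gcongr
          _ = 3 * (1 / L) := by ring
          _ ≤ _ := by gcongr
      have e3 := prod_ge I (fun p => 1 / (p:ℝ)) (fun p hp => by
        have : (1:ℝ) ≤ p := by exact_mod_cast (hI p hp).1.one_le
        exact ⟨by positivity, by rw [div_le_one (by linarith)]; exact this⟩)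
      linarith
    have hC1' : C1 / (δ * L) ≤ C1 / δ * ε := by
      calc C1 / (δ * L) = C1 / δ * (1 / L) := by field_simp
        _ ≤ _ := by gcongr
    have hu1 : C1 / δ * ε ≤ 1 / 2 := le_trans (by gcongr; linarith) hεt
    have hu2 : 5 * ε ≤ 1 / 2 := le_trans (by gcongr; linarith) hεt
    have hu3 : 4 * (C2 + K) * ε ≤ 1 / 2 := le_trans (by gcongr; linarith) hεt
    have hA : exp (-γ) / (δ * L) * (1 - C1 / δ * ε) ≤ Pz := by
      refine le_trans ?_ hmz
      rw [mul_div_right_comm]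
      gcongr
    have hprod : exp (-γ) / (4 * δ) * (1 - t * ε) ≤ Pz * (∏ p ∈ I, (1 - 1 / (p:ℝ))) * (log (xi L) - K) := by
      calc exp (-γ) / (4 * δ) * (1 - t * ε)
          ≤ exp (-γ) / (4 * δ) * ((1 - C1 / δ * ε) * (1 - 5 * ε) * (1 - 4 * (C2 + K) * ε)) := by
            gcongr
            have n1 : 0 ≤ C1 / δ * ε := by positivity
            have n2 : 0 ≤ 5 * ε := by positivity
            have n3 : 0 ≤ 4 * (C2 + K) * ε := by positivity
            have : t * ε = C1 / δ * ε + 5 * ε + 4 * (C2 + K) * ε := by rw [ht]; ring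
            rw [this]
            generalize C1 / δ * ε = u1 at *
            generalize 5 * ε = u2 at *
            generalize 4 * (C2 + K) * ε = u3 at *
            nlinarith [mul_nonneg n1 n2, mul_nonneg (mul_nonneg n1 n2) (by linarith : 0 ≤ 1 - u3), mul_nonneg (add_nonneg n1 n2) n3]
        _ = (exp (-γ) / (δ * L) * (1 - C1 / δ * ε)) * (1 - 5 * ε) * (L / 4 * (1 - 4 * (C2 + K) * ε)) := by field_simp
        _ ≤ _ := by
            have n1 : 0 ≤ 1 - C1 / δ * ε := by linarith
            have n2 : 0 ≤ 1 - 5 * ε := by linarith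
            have n3 : 0 ≤ 1 - 4 * (C2 + K) * ε := by linarith
            have n4 : 0 ≤ ∏ p ∈ I, (1 - 1 / (p:ℝ)) := n2.trans hIs
            have n5 : 0 ≤ Pz * ∏ p ∈ I, (1 - 1 / (p:ℝ)) := mul_nonneg hPz0.le n4
            gcongr
    have hfin := hprod.trans main
    have hV0 := V_pos b z
    have hS0 : 0 ≤ sieveG (PP b y \ I) (xi L) * V b z := le_trans (by
      have : 0 ≤ 1 - t * ε := by linarith
      positivity) hfin
    calc (1:ℝ) ≤ (1 + 2 * t * ε) * (1 - t * ε) := by nlinarith [mul_pos ht0 h0]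
      _ = 4 * δ * exp γ * (1 + 2 * t * ε) * (exp (-γ) / (4 * δ) * (1 - t * ε)) := by
          have : 4 * δ * exp γ * (1 + 2 * t * ε) * (exp (-γ) / (4 * δ) * (1 - t * ε)) =
            (exp γ * exp (-γ)) * ((1 + 2 * t * ε) * (1 - t * ε)) := by field_simp
          rw [this, hge, one_mul]
      _ ≤ 4 * δ * exp γ * (1 + (2 * t + (2 * δ * exp γ) ^ 2) * ε) * (sieveG (PP b y \ I) (xi L) * V b z) := by
          have e1 : 0 ≤ (2 * δ * exp γ) ^ 2 := by positivity
          have e2 : 0 ≤ 1 - t * ε := by linarith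
          have e3 : (1 + 2 * t * ε) ≤ 1 + (2 * t + (2 * δ * exp γ) ^ 2) * ε := by gcongr; linarith
          exact mul_le_mul (mul_le_mul_of_nonneg_left e3 (by positivity)) hfin (by positivity) (by positivity)

def cset (L w : ℝ) : Finset ℕ :=
  (Icc 1 ⌊w⌋₊).filter Nat.Prime \ (Icc 1 (⌈exp (1 / 3 * L)⌉₊ - 1)).filter Nat.Prime

/-- large conductors -/
lemma E_large : ∃ C : ℝ, 1 ≤ C ∧ ∀ᶠ L : ℝ in atTop, ∀ (P S T : Finset ℕ) (u w : ℝ),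
    u ≤ w → exp (1 / 3 * L) ≤ u → u * w ≤ 8 * exp L → S ⊆ range (⌊u⌋₊ + 1) → T ⊆ range (⌊w⌋₊ + 1) →
    ∑ r ∈ (sieveR P (xi L ^ 2)).filter (fun r : ℕ => L ^ 120 < (r:ℝ)), (9:ℝ) ^ r.primeFactors.card / r *
      ∑ χ ∈ prims r, ‖∑ m ∈ S, χ (m : ZMod r)‖ * ‖∑ n ∈ T, χ (n : ZMod r)‖ ≤ C * (exp L / L ^ 7) := by
  obtain ⟨C1, hC1, hF⟩ := F_bound
  obtain ⟨C2, hC2, hxi⟩ := xi_log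
  refine ⟨2 * (1690 * C1 * 40), by linarith, ?_⟩
  filter_upwards [hxi, eventually_ge_atTop 1, exp_poly 120 1 (by norm_num : (0:ℝ) < 1 / 3)] with
    L ⟨x1, x2, _⟩ hL hexp P S T u w huw hyu huw8 hS hT
  have hL0 : 0 < L := by linarith
  set y := exp (1 / 3 * L) with hy
  set X := 40 * exp L with hX
  have hyy : y * y * y = exp L := by rw [hy, ← exp_add, ← exp_add]; ring_nf
  have hy1 : 1 ≤ y := one_le_exp (by positivity)
  have hu1 : 1 ≤ u := hy1.trans hyu
  have hw1 : 1 ≤ w := hu1.trans huw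
  have hp : (0:ℝ) < L ^ 120 := by positivity
  have hee : exp (1 / 4 * L) ^ 2 = exp (1 / 2 * L) := by rw [← exp_nat_mul]; ring_nf
  have hhe : exp (1 / 2 * L) ^ 2 = exp L := by rw [← exp_nat_mul]; ring_nf
  have hD : ((xi L ^ 2 : ℕ):ℝ) ≤ exp (1 / 2 * L) / L ^ 120 := by
    push_cast
    calc (xi L : ℝ) ^ 2 ≤ (exp (1 / 4 * L) / L ^ 61) ^ 2 := by gcongr
      _ = exp (1 / 2 * L) / L ^ 122 := by rw [div_pow, hee]; ring
      _ ≤ _ := by gcongr; norm_num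
  have hDe : ((xi L ^ 2 : ℕ):ℝ) ≤ exp (1 / 2 * L) :=
    hD.trans (div_le_self (exp_pos _).le (one_le_pow₀ hL))
  have hD3 : 3 ≤ xi L ^ 2 := by nlinarith
  have hD0 : (0:ℝ) < ((xi L ^ 2 : ℕ):ℝ) := by exact_mod_cast (by omega : 0 < xi L ^ 2)
  have hlogD : log ((xi L ^ 2 : ℕ):ℝ) ≤ 1 / 2 * L := (log_le_iff_le_exp hD0).2 hDe
  have hflu : ((⌊u⌋₊ : ℕ):ℝ) ≤ u := Nat.floor_le (by linarith)
  have hflw : ((⌊w⌋₊ : ℕ):ℝ) ≤ w := Nat.floor_le (by linarith)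
  have hη : (0:ℝ) ≤ 1 / L ^ 120 := by positivity
  have hu4 : u + 1 ≤ 6 * exp (1 / 2 * L) := by
    have h1 : u * u ≤ (3 * exp (1 / 2 * L)) ^ 2 := by
      calc u * u ≤ u * w := by gcongr
        _ ≤ 8 * exp L := huw8
        _ ≤ _ := by rw [mul_pow, hhe]; linarith [exp_pos L]
    have h2 : u ≤ 3 * exp (1 / 2 * L) := by rw [← sq] at h1; exact le_of_sq_le_sq h1 (by positivity)
    linarith
  have hbl := bilinear_large P (xi L ^ 2) ⌊u⌋₊ ⌊w⌋₊ S T hS hT (C1 * L ^ 81) X (1 / L ^ 120) (L ^ 120) hη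
    ((hF P _ hD3).trans (by
      gcongr
      linarith))
    (by
      calc ((⌊u⌋₊ : ℝ) + 1) * (⌊w⌋₊ + 1) ≤ (u + u) * (w + w) := by gcongr
        _ ≤ X := by rw [hX]; nlinarith [exp_pos L])
    (by
      calc ((xi L ^ 2 : ℕ):ℝ) ^ 2 ≤ (exp (1 / 2 * L) / L ^ 120) ^ 2 := by gcongr
        _ = 1 / L ^ 120 * (exp L / L ^ 120) := by rw [div_pow, hhe]; ring
        _ ≤ _ := by
          rw [hX]; gcongr
          exact (div_le_self (exp_pos _).le (one_le_pow₀ hL)).trans (by linarith [exp_pos L]))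
    (by
      have h1 : w * y ≤ 8 * (y * y) * y := by nlinarith
      have h2 : w ≤ 8 * (y * y) := le_of_mul_le_mul_right h1 (by linarith)
      rw [one_div_mul_eq_div, le_div_iff₀ hp, hX, ← hyy]
      rw [one_mul] at hexp
      calc ((⌊w⌋₊ : ℝ) + 1) * L ^ 120 ≤ (8 * (y * y) + y * y) * y := by
            gcongr
            · linarith
            · nlinarith
        _ ≤ _ := by nlinarith [mul_pos (mul_pos (by linarith : 0 < y) (by linarith : 0 < y)) (by linarith : 0 < y)])
    (by
      calc ((⌊u⌋₊ : ℝ) + 1) * ((xi L ^ 2 : ℕ):ℝ) ≤ (6 * exp (1 / 2 * L)) * (exp (1 / 2 * L) / L ^ 120) := by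
            gcongr; linarith
        _ = 1 / L ^ 120 * (6 * exp (1 / 2 * L) ^ 2) := by ring
        _ ≤ _ := by rw [hhe, hX]; gcongr; norm_num)
    hp (by field_simp; exact le_rfl)
  refine hbl.trans ?_
  have hlog : (Nat.log 2 (xi L ^ 2) : ℝ) ≤ L := by
    have h1 : ((2:ℝ) ^ Nat.log 2 (xi L ^ 2)) ≤ ((xi L ^ 2 : ℕ):ℝ) := by exact_mod_cast Nat.pow_log_le_self 2 (by omega)
    have h2 := (log_le_log (by positivity) h1).trans hlogD
    rw [log_pow] at h2
    have := Real.log_two_gt_d9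
    have h3 : (Nat.log 2 (xi L ^ 2) : ℝ) * (1 / 2) ≤ Nat.log 2 (xi L ^ 2) * log 2 := by gcongr; linarith
    linarith
  have hsq : √(1690 * (C1 * L ^ 81) * (1 / L ^ 120)) ≤ 1690 * C1 / L ^ 8 := by
    refine sqrt_le_iff.2 ⟨by positivity, ?_⟩
    calc 1690 * (C1 * L ^ 81) * (1 / L ^ 120) = (1690 * C1) / L ^ 39 := by field_simp
      _ ≤ (1690 * C1) ^ 2 / L ^ 16 := by
        gcongr
        · exact le_self_pow₀ (by linarith) (by norm_num)
        · norm_num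
      _ = _ := by ring
  calc _ ≤ (L + L) * (1690 * C1 / L ^ 8 * X) := by gcongr
    _ = _ := by rw [hX]; field_simp; ring

/-- small conductors -/
lemma E_small : ∃ C : ℝ, 1 ≤ C ∧ ∀ᶠ L : ℝ in atTop, ∀ ε : ℝ, 0 < ε → ε ^ 6 * L = 1 → ∀ (P S : Finset ℕ) (u w : ℝ),
    exp (1 / 3 * L) ≤ u → exp (1 / 3 * L) ≤ w → u * w ≤ 8 * exp L → S ⊆ range (⌊u⌋₊ + 1) →
    ∑ r ∈ (sieveR P (xi L ^ 2)).filter (fun r : ℕ => ¬ L ^ 120 < (r:ℝ)), (9:ℝ) ^ r.primeFactors.card / r *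
      ∑ χ ∈ prims r, ‖∑ m ∈ S, χ (m : ZMod r)‖ * ‖∑ n ∈ cset L w, χ (n : ZMod r)‖ ≤
      C * (exp L / L ^ 7) + C * ε * (S.card * (cset L w).card) := by
  obtain ⟨C1, hC1, hw⟩ := omega_bound
  obtain ⟨C2, hC2, X0, hchar⟩ := char_good 120 247 (by norm_num)
  refine ⟨C1 * (32 * C2), by nlinarith, ?_⟩
  filter_upwards [eventually_ge_atTop 1, eventually_ge_atTop X0, exp_poly 0 2 (by norm_num : (0:ℝ) < 1 / 12)] with
    L hL hX0 hexp ε h0 h6 P S u w hu hw' huw hS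
  classical
  obtain ⟨r1, χ1, hr1, hgood⟩ := hchar L hX0
  have hL0 : 0 < L := by linarith
  obtain ⟨f1, f2, -, -⟩ := eps_facts hL h0 h6
  set y := exp (1 / 3 * L) with hy
  set g := 32 * C2 * (exp L / L ^ 247) with hg
  set Y : ℕ := ⌈y⌉₊ - 1 with hY
  have hy0 : 0 < y := exp_pos _
  have hy1 : 1 ≤ y := one_le_exp (by positivity)
  have hYy : (Y:ℝ) ≤ y := by
    have : ⌈y⌉₊ - 1 < ⌈y⌉₊ := by have := Nat.ceil_pos.2 hy0; omega
    exact (Nat.lt_ceil.1 this).le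
  have hYL : L / 4 ≤ log Y ∧ (0:ℝ) < Y := by
    have h1 : y ≤ Y + 1 := by
      have h2 : ⌈y⌉₊ ≤ Y + 1 := by omega
      exact (Nat.le_ceil y).trans (by exact_mod_cast h2)
    rw [pow_zero, mul_one] at hexp
    have h3 : y = exp (L / 4) * exp (1 / 12 * L) := by rw [hy, ← exp_add]; ring_nf
    have h4 : 1 ≤ exp (L / 4) := one_le_exp (by positivity)
    have h5 : exp (L / 4) ≤ Y := by nlinarith
    exact ⟨(le_log_iff_exp_le (by linarith)).2 h5, by linarith⟩
  have hwl : L / 4 ≤ log w := by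
    rw [le_log_iff_exp_le (by linarith)]
    exact le_trans (exp_le_exp.2 (by linarith)) hw'
  have hScard : (S.card : ℝ) ≤ 2 * u := by
    have h1 := card_le_card hS
    rw [card_range] at h1
    have h2 : (⌊u⌋₊ : ℝ) ≤ u := Nat.floor_le (by linarith)
    have h3 : (S.card : ℝ) ≤ ⌊u⌋₊ + 1 := by exact_mod_cast h1
    linarith
  have htriv : ∀ (r : ℕ) (χ : DirichletCharacter ℂ r) (A : Finset ℕ), ‖∑ m ∈ A, χ (m : ZMod r)‖ ≤ A.card := by
    intro r χ A
    refine (norm_sum_le _ _).trans ?_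
    refine (sum_le_sum fun m _ => χ.norm_le_one _).trans ?_
    simp
  have hsub : (Icc 1 Y).filter Nat.Prime ⊆ (Icc 1 ⌊w⌋₊).filter Nat.Prime := by
    apply filter_subset_filter
    apply Icc_subset_Icc_right
    exact Nat.le_floor (hYy.trans hw')
  have key : ∀ r ∈ (sieveR P (xi L ^ 2)).filter (fun r : ℕ => ¬ L ^ 120 < (r:ℝ)), ∀ χ ∈ prims r,
      ‖∑ m ∈ S, χ (m : ZMod r)‖ * ‖∑ n ∈ cset L w, χ (n : ZMod r)‖ ≤
      g + if (⟨r, χ⟩ : Σ r, DirichletCharacter ℂ r) = ⟨r1, χ1⟩ then (S.card * (cset L w).card : ℝ) else 0 := by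
    intro r hr χ hχ
    obtain ⟨hr, hrL⟩ := mem_filter.1 hr
    obtain ⟨⟨hr1, -⟩, -, -⟩ := mem_sieveR.1 hr
    split_ifs with he
    · have : 0 ≤ g := by positivity
      refine le_trans (mul_le_mul (htriv r χ S) (htriv r χ _) (norm_nonneg _) (by positivity)) ?_
      linarith
    · have hh := hgood r χ hr1 (not_lt.1 hrL) hχ he
      have e1 := hh w (by linarith) hwl
      have e2 := hh Y hYL.2 hYL.1
      rw [Nat.floor_natCast] at e2
      have e3 : ‖∑ n ∈ cset L w, χ (n : ZMod r)‖ ≤ 2 * (C2 * w / L ^ 247) := by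
        rw [cset, ← hy, ← hY, sum_sdiff_eq_sub hsub]
        refine (norm_sub_le _ _).trans ?_
        have : C2 * Y / L ^ 247 ≤ C2 * w / L ^ 247 := by gcongr; linarith
        linarith
      calc _ ≤ (2 * u) * (2 * (C2 * w / L ^ 247)) :=
            mul_le_mul ((htriv r χ S).trans hScard) e3 (norm_nonneg _) (by linarith)
        _ = 4 * C2 * (u * w) / L ^ 247 := by ring
        _ ≤ 4 * C2 * (8 * exp L) / L ^ 247 := by gcongr
        _ = _ := by rw [hg]; ring
  set s := (sieveR P (xi L ^ 2)).filter (fun r : ℕ => ¬ L ^ 120 < (r:ℝ)) with hs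
  have h9 : ∀ r ∈ s, (9:ℝ) ^ r.primeFactors.card ≤ C1 * r := by
    intro r hr
    have := hw r (mem_sieveR.1 (mem_filter.1 hr).1).2.1
    exact (le_self_pow₀ (one_le_pow₀ (by norm_num)) (by norm_num)).trans this
  have hcards : ((s.card : ℕ):ℝ) ≤ L ^ 120 := by
    have h1 : s ⊆ Ioc 0 ⌊L ^ 120⌋₊ := by
      intro r hr
      obtain ⟨hr, hrL⟩ := mem_filter.1 hr
      have := (mem_sieveR.1 hr).1.1
      exact mem_Ioc.2 ⟨by omega, Nat.le_floor (not_lt.1 hrL)⟩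
    have h2 := card_le_card h1
    rw [Nat.card_Ioc, Nat.sub_zero] at h2
    exact (Nat.cast_le.2 h2).trans (Nat.floor_le (by positivity))
  have hprims : ∀ r ∈ s, ((prims r).card : ℝ) ≤ r := by
    intro r hr
    have hr0 : NeZero r := ⟨by have := (mem_sieveR.1 (mem_filter.1 hr).1).1.1; omega⟩
    have h1 : (prims r).card ≤ Fintype.card (DirichletCharacter ℂ r) := card_le_univ _
    rw [← Nat.card_eq_fintype_card, DirichletCharacter.card_eq_totient_of_hasEnoughRootsOfUnity] at h1
    exact_mod_cast h1.trans (Nat.totient_le r)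
  calc _ ≤ ∑ r ∈ s, (9:ℝ) ^ r.primeFactors.card / r * ∑ χ ∈ prims r,
        (g + if (⟨r, χ⟩ : Σ r, DirichletCharacter ℂ r) = ⟨r1, χ1⟩ then (S.card * (cset L w).card : ℝ) else 0) := by
        apply sum_le_sum; intro r hr
        apply mul_le_mul_of_nonneg_left _ (by positivity)
        exact sum_le_sum (key r hr)
    _ = ∑ r ∈ s, (9:ℝ) ^ r.primeFactors.card / r * ((prims r).card * g) + ∑ t ∈ s.sigma prims,
        if t = ⟨r1, χ1⟩ then (9:ℝ) ^ t.1.primeFactors.card / t.1 * (S.card * (cset L w).card : ℝ) else 0 := by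
        rw [sum_sigma, ← sum_add_distrib]
        apply sum_congr rfl; intro r _
        rw [sum_add_distrib, mul_add, sum_const, nsmul_eq_mul, mul_sum]
        simp only [mul_ite, mul_zero]
    _ ≤ ∑ r ∈ s, C1 * L ^ 120 * g + C1 * ε * (S.card * (cset L w).card) := by
        apply add_le_add
        · apply sum_le_sum; intro r hr
          have hr0 : (0:ℝ) < r := by
            have := (mem_sieveR.1 (mem_filter.1 hr).1).1.1
            exact_mod_cast (by omega : 0 < r)
          calc (9:ℝ) ^ r.primeFactors.card / r * ((prims r).card * g)
              ≤ (C1 * r) / r * (r * g) := by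
                have := h9 r hr; have := hprims r hr
                gcongr
            _ = C1 * r * g := by field_simp
            _ ≤ _ := by
                have := not_lt.1 (mem_filter.1 hr).2
                gcongr
        · rw [sum_ite_eq']
          split_ifs with hm
          · have hr := (mem_sigma.1 hm).1
            have hr' := mem_sieveR.1 (mem_filter.1 hr).1
            gcongr
            have hr0 : (0:ℝ) < r1 := by exact_mod_cast lt_trans one_pos hr'.1.1
            rw [div_le_iff₀ hr0]
            apply le_of_pow_le_pow_left₀ (n := 16) (by norm_num) (by positivity)
            have hε : 1 ≤ ε ^ 16 * (r1:ℝ) ^ 12 := by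
              calc (1:ℝ) = (ε ^ 6 * L) ^ 3 := by rw [h6, one_pow]
                _ = ε ^ 2 * (ε ^ 16 * L ^ 3) := by ring
                _ ≤ 1 * (ε ^ 16 * ((r1:ℝ) ^ 4) ^ 3) := by gcongr; exact pow_le_one₀ h0.le f1
                _ = _ := by ring
            calc ((9:ℝ) ^ r1.primeFactors.card) ^ 16 = (((9:ℝ) ^ r1.primeFactors.card) ^ 4) ^ 4
                  := by ring
              _ ≤ (C1 * r1) ^ 4 := by gcongr; exact hw r1 hr'.2.1
              _ ≤ (C1 * r1) ^ 4 * (C1 ^ 12 * (ε ^ 16 * (r1:ℝ) ^ 12)) :=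
                  le_mul_of_one_le_right (by positivity)
                    (one_le_mul_of_one_le_of_one_le (one_le_pow₀ hC1) hε)
              _ = _ := by ring
          · positivity
    _ ≤ _ := by
        rw [sum_const, nsmul_eq_mul]
        have h1 : (s.card:ℝ) * (C1 * L ^ 120 * g) ≤ L ^ 120 * (C1 * L ^ 120 * g) := by gcongr
        have h2 : L ^ 120 * (C1 * L ^ 120 * g) = C1 * (32 * C2) * (exp L / L ^ 7) := by rw [hg]; field_simp
        have h3 : C1 ≤ C1 * (32 * C2) := le_mul_of_one_le_right (by linarith) (by linarith)
        have h4 : C1 * ε * (S.card * (cset L w).card) ≤ C1 * (32 * C2) * ε * (S.card * (cset L w).card) := by gcongr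
        linarith

lemma mem_cset {L w : ℝ} {p : ℕ} : p ∈ cset L w ↔ p.Prime ∧ exp (1 / 3 * L) ≤ p ∧ (p:ℝ) ≤ w := by
  rw [cset, Finset.mem_sdiff, mem_filter, mem_filter, mem_Icc, mem_Icc]
  have hc : 0 < ⌈exp (1 / 3 * L)⌉₊ := Nat.ceil_pos.2 (exp_pos _)
  constructor
  · rintro ⟨⟨⟨h1, h2⟩, h3⟩, h4⟩
    refine ⟨h3, ?_, (Nat.le_floor_iff' (by omega)).1 h2⟩
    by_contra h
    exact h4 ⟨⟨h1, by have := Nat.lt_ceil.2 (not_le.1 h); omega⟩, h3⟩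
  · rintro ⟨h1, h2, h3⟩
    refine ⟨⟨⟨h1.one_le, Nat.le_floor h3⟩, h1⟩, ?_⟩
    rintro ⟨⟨-, h⟩, -⟩
    have := Nat.ceil_le.2 h2; omega

lemma cset_card {L w w' : ℝ} (h : w ≤ w') : ((cset L w).card : ℝ) ≤ Nat.primeCounting ⌊w'⌋₊ := by
  rw [Nat.primeCounting, Nat.primeCounting', Nat.count_eq_card_filter_range]
  norm_cast
  apply card_le_card
  intro p hp
  obtain ⟨h1, -, h3⟩ := mem_cset.1 hp
  exact mem_filter.2 ⟨mem_range.2 (Nat.lt_succ_of_le (Nat.le_floor (h3.trans h))), h1⟩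

/-- the sieve bound for one cell -/
lemma cell_bound : ∃ C : ℝ, 1 ≤ C ∧ ∀ᶠ L : ℝ in atTop, ∀ ε : ℝ, 0 < ε → ε ^ 6 * L = 1 →
    ∀ (P : Finset ℕ) (A B : ℕ) (Q : Finset (ℕ × ℕ)) (u w : ℝ), (∀ p ∈ P, p.Prime ∧ 3 ≤ p) →
    (∀ p ∈ P, ¬ p ∣ A) → (∀ p ∈ P, ¬ p ∣ B) → Set.InjOn (fun v : ℕ × ℕ => v.1 * v.2) Q →
    (∀ v ∈ Q, exp (1 / 3 * L) ≤ ((v.1 * v.2 : ℕ) : ℝ) ∧ ((v.1 * v.2 : ℕ) : ℝ) ≤ u) →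
    u * w ≤ 8 * exp L → (∀ v ∈ Q, ∀ c ∈ cset L w, ∀ p ∈ P, ¬ p ∣ v.1 * v.2 * c) →
    (((Q ×ˢ cset L w).filter fun t => ∀ p ∈ P, ¬ p ∣ A * (t.1.1 * t.1.2 * t.2) + B).card : ℝ) ≤
      1 / sieveG P (xi L) * ((1 + C * ε) * (Q.card * (cset L w).card)) + C * (exp L / L ^ 7) := by
  obtain ⟨C1, hC1, hlarge⟩ := E_large
  obtain ⟨C2, hC2, hsmall⟩ := E_small
  obtain ⟨C3, hC3, hxi⟩ := xi_log
  refine ⟨C1 + C2, by linarith, ?_⟩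
  filter_upwards [hlarge, hsmall, hxi, eventually_ge_atTop 1] with L hl hs ⟨x1, _, _⟩ hL
    ε h0 h6 P A B Q u w hP hA hB hinj hQ huw hn
  have hL0 : 0 < L := by linarith
  have hG := sieveG_ge_one P hP (xi L) (by omega)
  set G := sieveG P (xi L) with hGdef
  set y := exp (1 / 3 * L) with hy
  rcases (Q ×ˢ cset L w).eq_empty_or_nonempty with he | ⟨⟨v, c⟩, hvc⟩
  · rw [he, filter_empty, card_empty, Nat.cast_zero]
    positivity
  obtain ⟨hv, hc⟩ := mem_product.1 hvc
  have hu : y ≤ u := (hQ v hv).1.trans (hQ v hv).2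
  have hw : y ≤ w := (mem_cset.1 hc).2.1.trans (mem_cset.1 hc).2.2
  set S := Q.image (fun v : ℕ × ℕ => v.1 * v.2) with hS
  have hScard : S.card = Q.card := card_image_of_injOn hinj
  have hSr : S ⊆ range (⌊u⌋₊ + 1) := by
    intro m hm
    obtain ⟨v, hv, rfl⟩ := mem_image.1 hm
    exact mem_range.2 (Nat.lt_succ_of_le (Nat.le_floor (hQ v hv).2))
  have hTr : cset L w ⊆ range (⌊w⌋₊ + 1) := fun m hm =>
    mem_range.2 (Nat.lt_succ_of_le (Nat.le_floor (mem_cset.1 hm).2.2))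
  have hfac : ∀ (r : ℕ) (χ : DirichletCharacter ℂ r),
      ∑ t ∈ Q ×ˢ cset L w, χ ((t.1.1 * t.1.2 * t.2 : ℕ) : ZMod r) =
      (∑ m ∈ S, χ (m : ZMod r)) * ∑ n ∈ cset L w, χ (n : ZMod r) := by
    intro r χ
    rw [hS, sum_image hinj, sum_mul_sum, sum_product]
    simp only [Nat.cast_mul, map_mul]
  have hsieve := sieve_bound (Q ×ˢ cset L w) (fun t => t.1.1 * t.1.2 * t.2) P hP A B hA hB
    (fun t ht => hn t.1 (mem_product.1 ht).1 t.2 (mem_product.1 ht).2) (xi L) (by omega)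
  refine hsieve.trans ?_
  have h1 := hs ε h0 h6 P S u w hu hw huw hSr
  have h2 : ∑ r ∈ (sieveR P (xi L ^ 2)).filter (fun r : ℕ => L ^ 120 < (r:ℝ)), (9:ℝ) ^ r.primeFactors.card / r *
      ∑ χ ∈ prims r, ‖∑ m ∈ S, χ (m : ZMod r)‖ * ‖∑ n ∈ cset L w, χ (n : ZMod r)‖ ≤ C1 * (exp L / L ^ 7) := by
    rcases le_total u w with h | h
    · exact hl P S (cset L w) u w h hu huw hSr hTr
    · have := hl P (cset L w) S w u h hw (by rwa [mul_comm]) hTr hSr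
      simp_rw [mul_comm ‖∑ m ∈ S, _‖]
      exact this
  have h3 := add_le_add h2 h1
  rw [sum_filter_add_sum_filter_not] at h3
  have h4 : ∑ r ∈ sieveR P (xi L ^ 2), ((9:ℝ) ^ r.primeFactors.card / (r * sieveG P (xi L))) *
      ∑ χ ∈ prims r, ‖∑ t ∈ Q ×ˢ cset L w, χ ((t.1.1 * t.1.2 * t.2 : ℕ) : ZMod r)‖ =
      1 / G * ∑ r ∈ sieveR P (xi L ^ 2), (9:ℝ) ^ r.primeFactors.card / r *
      ∑ χ ∈ prims r, ‖∑ m ∈ S, χ (m : ZMod r)‖ * ‖∑ n ∈ cset L w, χ (n : ZMod r)‖ := by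
    rw [mul_sum]
    refine sum_congr rfl fun r _ => ?_
    simp_rw [hfac, norm_mul]
    rw [← hGdef, ← mul_assoc, one_div_mul_eq_div, div_div]
  rw [h4, card_product, hScard] at *
  have hGi : 1 / G ≤ 1 := by rw [div_le_one (by linarith)]; exact hG
  have hG0 : 0 ≤ 1 / G := by positivity
  have hE : 0 ≤ (C1 + C2) * (exp L / L ^ 7) := by positivity
  have hq : 0 ≤ C1 * ε * ((Q.card:ℝ) * (cset L w).card) := by positivity
  calc _ ≤ ((Q.card * (cset L w).card : ℕ):ℝ) / G + 1 / G * ((C1 + C2) * ε * (Q.card * (cset L w).card) +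
        (C1 + C2) * (exp L / L ^ 7)) := by
        gcongr
        linarith
    _ = 1 / G * ((1 + (C1 + C2) * ε) * (Q.card * (cset L w).card)) + 1 / G * ((C1 + C2) * (exp L / L ^ 7)) := by
        push_cast; ring
    _ ≤ _ := add_le_add le_rfl (mul_le_of_le_one_left hE hGi)

set_option maxHeartbeats 1000000 in
lemma final (b : ℕ) (hb : 0 < b) (δ : ℝ) (hδ0 : 0 < δ) (hδ1 : δ < 1 / 3) :
    ∃ C : ℝ, 1 ≤ C ∧ ∀ᶠ L : ℝ in atTop, ∀ ε : ℝ, 0 < ε → ε ^ 6 * L = 1 → ∀ k : ℕ,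
      (SB b k (exp L) (exp (1 / 3 * L)) (exp (δ * L)) : ℝ) ≤
      (4 * δ * exp eulerMascheroniConstant *
        (∫ β in δ..(1 / 3 : ℝ), log (2 - 3 * β) / (β * (1 - β))) + C * ε) *
        exp L * V b (exp (δ * L)) / L := by
  obtain ⟨C1, hC1, hcell⟩ := cell_bound
  obtain ⟨C2, hC2, hGl⟩ := G_lower b hb δ hδ0 hδ1
  obtain ⟨C3, hC3, X, hX, hms⟩ := main_sum δ hδ0 hδ1
  obtain ⟨C4, -, hxi⟩ := xi_log
  set I := ∫ β in δ..(1 / 3 : ℝ), log (2 - 3 * β) / (β * (1 - β)) with hI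
  have hI0 : 0 ≤ I := by
    apply intervalIntegral.integral_nonneg hδ1.le
    intro β hβ
    exact div_nonneg (log_nonneg (by linarith [hβ.2])) (mul_nonneg (by linarith [hβ.1]) (by linarith [hβ.2]))
  set κ := 4 * δ * exp eulerMascheroniConstant with hκ
  have hκ0 : 0 < κ := by positivity
  set a := C1 + C2 + C1 * C2 with ha
  have ha0 : 0 < a := by positivity
  refine ⟨κ * (a * I + C3 + a * C3) + 4 * C1 * C2, ?_, ?_⟩
  · have : 1 ≤ C1 * C2 := one_le_mul_of_one_le_of_one_le hC1 hC2
    have : 0 ≤ κ * (a * I + C3 + a * C3) := by positivity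
    linarith
  filter_upwards [hcell, hGl, eventually_ge_atTop X, hxi] with L hcell ⟨hV, hGl⟩ hXL ⟨x1, _, _⟩ ε h0 h6 k
  classical
  have hL : 1 ≤ L := by linarith
  have hL0 : 0 < L := by linarith
  obtain ⟨f1, f2, -, f4⟩ := eps_facts hL h0 h6
  set y := exp (1 / 3 * L) with hy
  set z := exp (δ * L) with hz
  set x := exp L with hx
  have hy0 : 0 < y := exp_pos _
  have hx0 : 0 < x := exp_pos _
  have hV0 := V_pos b z
  obtain ⟨n0, hn0⟩ : ∃ n0, n0 = ⌊x⌋₊ + 1 := ⟨_, rfl⟩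
  set s := (range n0).filter (fun p : ℕ => p.Prime ∧ z ≤ p ∧ (p:ℝ) < y) with hs
  set t := fun p : ℕ => (range n0).filter (fun q : ℕ => q.Prime ∧ y ≤ q ∧ log p + 2 * log q ≤ L) with ht
  set PQ := (s ×ˢ range n0).filter (fun v : ℕ × ℕ => v.2 ∈ t v.1) with hPQ
  have memPQ : ∀ v, v ∈ PQ ↔ v.1 ∈ s ∧ v.2 ∈ t v.1 := by
    intro v
    simp only [hPQ, ht, mem_filter, mem_product]; tauto
  set bin := fun p : ℕ => ⌊log p / ε⌋₊ with hbin
  have binle : ∀ p : ℕ, bin p * ε ≤ log p ∧ log p < (bin p + 1) * ε := by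
    intro p
    have h := log_natCast_nonneg p
    rw [← le_div_iff₀ h0, ← div_lt_iff₀ h0]
    exact ⟨Nat.floor_le (by positivity), Nat.lt_floor_add_one _⟩
  obtain ⟨m, hm⟩ : ∃ m, m = ⌊L / ε⌋₊ + 1 := ⟨_, rfl⟩
  set J := range m ×ˢ range m with hJ
  set bn := fun v : ℕ × ℕ => (bin v.1, bin v.2) with hbn
  set Q := fun j : ℕ × ℕ => PQ.filter (fun v => bn v = j) with hQ
  set w := fun j : ℕ × ℕ => exp (L - (j.1 + j.2) * ε) with hw
  set P := fun i : ℕ => PP b y \ s.filter (fun p => bin p = i) with hP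
  set T := fun j : ℕ × ℕ => (Q j ×ˢ cset L (w j)).filter
    (fun t => ∀ p ∈ P j.1, ¬ p ∣ 2 ^ k * (t.1.1 * t.1.2 * t.2) + b) with hT
  have logb : ∀ p : ℕ, p < n0 → 0 < p → log p ≤ L := by
    intro p hp hp0
    rw [log_le_iff_le_exp (by exact_mod_cast hp0)]
    exact (Nat.le_floor_iff hx0.le).1 (by omega)
  have binm : ∀ p : ℕ, p < n0 → 0 < p → bin p ∈ range m := by
    intro p hp hp0
    have : bin p ≤ ⌊L / ε⌋₊ := Nat.floor_le_floor (by have := logb p hp hp0; gcongr)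
    exact mem_range.2 (by omega)
  have bnJ : ∀ v ∈ PQ, bn v ∈ J := by
    intro v hv
    obtain ⟨h1, h2⟩ := (memPQ v).1 hv
    obtain ⟨h1, h3, -⟩ := mem_filter.1 h1
    obtain ⟨h2, h4, -⟩ := mem_filter.1 h2
    exact mem_product.2 ⟨binm _ (mem_range.1 h1) h3.pos, binm _ (mem_range.1 h2) h4.pos⟩
  -- covering by cells
  have hcover : (SB b k x y z : ℝ) ≤ ∑ j ∈ J, ((T j).card : ℝ) := by
    have h1 : SB b k x y z ≤ ∑ j ∈ J, (T j).card := by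
      refine le_trans ?_ card_biUnion_le
      refine le_trans ?_ (card_image_le (f := fun t : (ℕ × ℕ) × ℕ => (t.1.1, t.1.2, t.2)))
      rw [← Set.ncard_coe_finset, SB]
      apply Set.ncard_le_ncard _ (finite_toSet _)
      rintro ⟨p, q, c⟩ ⟨hp, hq, hc, hzp, hpy, hyq, hqc, hN, hdiv⟩
      dsimp only at hp hq hc hzp hpy hyq hqc hN hdiv
      have hp' : (0:ℝ) < p := by exact_mod_cast hp.pos
      have hq' : (0:ℝ) < q := by exact_mod_cast hq.pos
      have hc' : (0:ℝ) < c := by exact_mod_cast hc.pos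
      have hlog : log p + log q + log c ≤ L := by
        rw [← log_mul hp'.ne' hq'.ne', ← log_mul (by positivity) hc'.ne', log_le_iff_le_exp (by positivity)]
        exact_mod_cast hN
      have hqc' : log q ≤ log c := log_le_log hq' (by exact_mod_cast hqc)
      have hlt : ∀ d : ℕ, d ∣ p * q * c → d < n0 := by
        intro d hd
        have h1 : d ≤ p * q * c := Nat.le_of_dvd (by have := hp.pos; have := hq.pos; have := hc.pos; positivity) hd
        have h2 : p * q * c ≤ ⌊x⌋₊ := Nat.le_floor hN
        omega
      have hv : (p, q) ∈ PQ := (memPQ _).2 ⟨mem_filter.2 ⟨mem_range.2 (hlt p ⟨q * c, by ring⟩), hp, hzp, hpy⟩,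
        mem_filter.2 ⟨mem_range.2 (hlt q ⟨p * c, by ring⟩), hq, hyq, by dsimp only; linarith⟩⟩
      refine mem_coe.2 (mem_image.2 ⟨((p, q), c), mem_biUnion.2 ⟨bn (p, q), bnJ _ hv, ?_⟩, rfl⟩)
      refine mem_filter.2 ⟨mem_product.2 ⟨mem_filter.2 ⟨hv, rfl⟩, mem_cset.2 ⟨hc, ?_, ?_⟩⟩, ?_⟩
      · exact hyq.trans (by exact_mod_cast hqc)
      · rw [← log_le_iff_le_exp hc']
        have := (binle p).1; have := (binle q).1
        simp only [hbn]; linarith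
      · intro d hd
        obtain ⟨h1, h2, h3, h4⟩ := mem_PP.1 (Finset.mem_sdiff.1 hd).1
        exact hdiv d h2 h3 h1 h4
    exact_mod_cast h1
  -- one cell
  have hone : ∀ j ∈ J, ((T j).card : ℝ) ≤ κ * (1 + C2 * ε) * V b z * ((1 + C1 * ε) * ((Q j).card * (cset L (w j)).card)) +
      C1 * (x / L ^ 7) := by
    intro j _
    have hQj : ∀ v ∈ Q j, (v.1.Prime ∧ v.2.Prime ∧ v.1 ∈ s ∧ (v.1:ℝ) < y ∧ y ≤ v.2) ∧ bin v.1 = j.1 ∧ bin v.2 = j.2 := by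
      intro v hv
      obtain ⟨h1, h2⟩ := mem_filter.1 hv
      obtain ⟨h1, h3⟩ := (memPQ v).1 h1
      have h4 := (mem_filter.1 h1).2
      have h5 := (mem_filter.1 h3).2
      exact ⟨⟨h4.1, h5.1, h1, h4.2.2, h5.2.1⟩, congrArg Prod.fst h2, congrArg Prod.snd h2⟩
    have hPP : ∀ p ∈ P j.1, p ∈ PP b y := fun p hp => (Finset.mem_sdiff.1 hp).1
    have hP3 : ∀ p ∈ P j.1, p.Prime ∧ 3 ≤ p := fun p hp => PP_three (hPP p hp)
    have hc := hcell ε h0 h6 (P j.1) (2 ^ k) b (Q j) (exp ((j.1 + j.2 + 2) * ε)) (w j) hP3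
      (fun p hp h => by
        have h1 := (Nat.prime_dvd_prime_iff_eq (hP3 p hp).1 Nat.prime_two).1 ((hP3 p hp).1.dvd_of_dvd_pow h)
        have := (hP3 p hp).2; omega)
      (fun p hp => (mem_PP.1 (hPP p hp)).2.2.2)
      (by
        rintro ⟨p, q⟩ hv ⟨p', q'⟩ hv' he
        obtain ⟨⟨a1, a2, -, a3, a4⟩, -⟩ := hQj _ hv
        obtain ⟨⟨b1, b2, -, b3, b4⟩, -⟩ := hQj _ hv'
        dsimp only at *
        have hpp : p = p' := by
          rcases (Nat.Prime.dvd_mul a1).1 (he ▸ dvd_mul_right p q : p ∣ p' * q') with h | h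
          · exact (Nat.prime_dvd_prime_iff_eq a1 b1).1 h
          · rw [(Nat.prime_dvd_prime_iff_eq a1 b2).1 h] at a3; linarith
        subst hpp
        rw [Nat.eq_of_mul_eq_mul_left a1.pos he])
      (by
        intro v hv
        obtain ⟨⟨a1, a2, -, a3, a4⟩, a5, a6⟩ := hQj v hv
        have a7 : (1:ℝ) ≤ v.1 := by exact_mod_cast a1.one_le
        have a8 : (0:ℝ) < v.2 := hy0.trans_le a4
        push_cast
        refine ⟨by nlinarith, ?_⟩
        rw [← log_le_iff_le_exp (by positivity), log_mul (by positivity) (by positivity), ← a5, ← a6]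
        have := (binle v.1).2; have := (binle v.2).2
        linarith)
      (by
        rw [← exp_add]
        have h1 := exp_one_lt_d9
        have h2 : exp 2 ≤ 8 := by rw [show (2:ℝ) = 1 + 1 by norm_num, exp_add]; nlinarith [exp_pos 1]
        calc _ ≤ exp (2 + L) := exp_le_exp.2 (by linarith)
          _ = exp 2 * x := exp_add _ _
          _ ≤ _ := by gcongr)
      (by
        intro v hv c hc p hp hd
        obtain ⟨⟨a1, a2, a0, a3, a4⟩, a5, -⟩ := hQj v hv
        obtain ⟨c1, c2, -⟩ := mem_cset.1 hc
        have hpy := (mem_PP.1 (hPP p hp)).1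
        have hp' := (hP3 p hp).1
        rcases (Nat.Prime.dvd_mul hp').1 hd with hd | hd
        · rcases (Nat.Prime.dvd_mul hp').1 hd with hd | hd
          · rw [(Nat.prime_dvd_prime_iff_eq hp' a1).1 hd] at hp
            exact (Finset.mem_sdiff.1 hp).2 (mem_filter.2 ⟨a0, a5⟩)
          · rw [(Nat.prime_dvd_prime_iff_eq hp' a2).1 hd] at hpy; linarith
        · rw [(Nat.prime_dvd_prime_iff_eq hp' c1).1 hd] at hpy; linarith)
    refine hc.trans ?_
    have hg := hGl ε h0 h6 j.1 (s.filter (fun p => bin p = j.1)) (by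
      intro p hp
      obtain ⟨h1, h2⟩ := mem_filter.1 hp
      obtain ⟨-, h3, h4, -⟩ := mem_filter.1 h1
      rw [← h2]
      exact ⟨h3, h4, binle p⟩)
    have hG := sieveG_ge_one (P j.1) hP3 (xi L) (by omega)
    have : 1 / sieveG (P j.1) (xi L) ≤ κ * (1 + C2 * ε) * V b z := by
      rw [div_le_iff₀ (by linarith)]
      refine hg.trans (le_of_eq ?_)
      simp only [hP]; ring
    exact add_le_add (mul_le_mul_of_nonneg_right this
      (mul_nonneg (by positivity) (mul_nonneg (Nat.cast_nonneg _) (Nat.cast_nonneg _)))) le_rfl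
  have hsum : ∑ j ∈ J, ((Q j).card * (cset L (w j)).card : ℝ) ≤ (I + C3 * ε) * x / L := by
    refine le_trans ?_ (hms L ε hXL f2 f1 s t ?_ ?_)
    · rw [← sum_finset_product PQ s t memPQ (f := fun v : ℕ × ℕ =>
          (Nat.primeCounting ⌊exp (L + 2 * ε) / (v.1 * v.2)⌋₊ : ℝ)), ← sum_fiberwise_of_maps_to bnJ]
      apply sum_le_sum
      intro j _
      rw [← nsmul_eq_mul, ← sum_const]
      apply sum_le_sum
      intro v hv
      apply cset_card
      obtain ⟨h1, h2⟩ := mem_filter.1 hv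
      obtain ⟨h1, h3⟩ := (memPQ v).1 h1
      have h4 : (0:ℝ) < v.1 := by exact_mod_cast (mem_filter.1 h1).2.1.pos
      have h5 : (0:ℝ) < v.2 := by exact_mod_cast (mem_filter.1 h3).2.1.pos
      rw [le_div_iff₀ (by positivity), ← h2]
      nth_rewrite 1 [← exp_log h4]
      nth_rewrite 1 [← exp_log h5]
      rw [← exp_add, ← exp_add]
      apply exp_le_exp.2
      have := (binle v.1).2; have := (binle v.2).2
      simp only [hbn]; linarith
    · intro p hp
      have := (mem_filter.1 hp).2
      exact ⟨this.1, this.2.1, this.2.2.le⟩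
    · intro p hp q hq
      have := (mem_filter.1 hq).2
      exact ⟨this.1, this.2.1, by linarith [this.2.2]⟩
  have hcardJ : (J.card : ℝ) ≤ 4 * L ^ 3 := by
    have h1 : (m:ℝ) ≤ 2 * (L / ε) := by
      have h2 : (⌊L / ε⌋₊ : ℝ) ≤ L / ε := Nat.floor_le (by positivity)
      have h3 : 1 ≤ L / ε := by rw [le_div_iff₀ h0]; linarith
      rw [hm]; push_cast; linarith
    rw [hJ, card_product, card_range]; push_cast
    calc (m:ℝ) * m ≤ (2 * (L / ε)) * (2 * (L / ε)) := by gcongr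
      _ = 4 * L ^ 2 * (1 / ε ^ 2) := by ring
      _ ≤ 4 * L ^ 2 * L := by gcongr; rw [div_le_iff₀ (by positivity)]; linarith
      _ = _ := by ring
  have hκV : 0 ≤ κ * (1 + C2 * ε) * V b z := by positivity
  have hmain : (SB b k x y z : ℝ) ≤ κ * (1 + C2 * ε) * V b z * ((1 + C1 * ε) * ((I + C3 * ε) * x / L)) +
      4 * L ^ 3 * (C1 * (x / L ^ 7)) := by
    refine hcover.trans ((sum_le_sum hone).trans ?_)
    rw [sum_add_distrib, ← mul_sum, ← mul_sum, sum_const, nsmul_eq_mul]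
    gcongr
  have hA : (1 + C2 * ε) * (1 + C1 * ε) ≤ 1 + a * ε := by
    have : C1 * C2 * (ε * ε) ≤ C1 * C2 * (ε * 1) := by gcongr
    rw [ha]; linarith
  have hB : (1 + a * ε) * (I + C3 * ε) ≤ I + (a * I + C3 + a * C3) * ε := by
    have : a * C3 * (ε * ε) ≤ a * C3 * (ε * 1) := by gcongr
    linarith
  have hE : 4 * L ^ 3 * (C1 * (x / L ^ 7)) ≤ 4 * C1 * C2 * ε * (x * V b z / L) := by
    calc 4 * L ^ 3 * (C1 * (x / L ^ 7)) = 4 * C1 * x / L ^ 4 * 1 := by field_simp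
      _ ≤ 4 * C1 * x / L ^ 4 * (C2 * L ^ 2 * V b z) := by gcongr
      _ = 4 * C1 * C2 * (1 / L) * (x * V b z / L) := by field_simp
      _ ≤ _ := by gcongr
  calc _ ≤ _ := hmain
    _ ≤ κ * (((1 + C2 * ε) * (1 + C1 * ε)) * (I + C3 * ε)) * (x * V b z / L) + 4 * C1 * C2 * ε * (x * V b z / L) := by
        refine add_le_add (le_of_eq (by ring)) hE
    _ ≤ κ * (I + (a * I + C3 + a * C3) * ε) * (x * V b z / L) + 4 * C1 * C2 * ε * (x * V b z / L) := by
        gcongr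
        exact le_trans (by gcongr) hB
    _ = _ := by ring

end

end Chen

theorem stmt7 (b : ℕ) (hb : 0 < b) (hbodd : Odd b)
    (δ : ℝ) (hδ0 : 0 < δ) (hδ1 : δ < 1 / 3)
    (k : ℕ → ℕ)
    (Cδ : ℝ)
    (hCδ : Cδ = ∫ β in δ..(1 / 3 : ℝ), Real.log (2 - 3 * β) / (β * (1 - β))) :
    ∃ C : ℝ, 0 < C ∧ ∃ M₀ : ℝ, ∀ N : ℕ, M₀ ≤ (N : ℝ) / 2 ^ (k N) →
      (SB b (k N) ((N : ℝ) / 2 ^ (k N))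
          (((N : ℝ) / 2 ^ (k N)) ^ ((1 : ℝ) / 3))
          (((N : ℝ) / 2 ^ (k N)) ^ δ) : ℝ)
      ≤ (4 * δ * Real.exp Real.eulerMascheroniConstant * Cδ +
          C * Real.log ((N : ℝ) / 2 ^ (k N)) ^ (-(1 / 6 : ℝ))) *
        ((N : ℝ) / 2 ^ (k N)) * V b (((N : ℝ) / 2 ^ (k N)) ^ δ) /
          Real.log ((N : ℝ) / 2 ^ (k N)) := by
  obtain ⟨C, hC, h⟩ := Chen.final b hb δ hδ0 hδ1
  obtain ⟨L0, hL0⟩ := Filter.eventually_atTop.1 h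
  refine ⟨C, by linarith, Real.exp (max L0 1), fun N hN => ?_⟩
  generalize (N : ℝ) / 2 ^ (k N) = x at hN ⊢
  have hx : 0 < x := (Real.exp_pos _).trans_le hN
  have hL : max L0 1 ≤ Real.log x := (Real.le_log_iff_exp_le hx).2 hN
  have hL1 : 0 < Real.log x := one_pos.trans_le ((le_max_right _ _).trans hL)
  have h6 : (Real.log x ^ (-(1 / 6 : ℝ))) ^ 6 * Real.log x = 1 := by
    rw [← Real.rpow_natCast, ← Real.rpow_mul hL1.le]
    norm_num
    rw [Real.rpow_neg_one, inv_mul_cancel₀ hL1.ne']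
  have key := hL0 (Real.log x) ((le_max_left _ _).trans hL) _ (Real.rpow_pos_of_pos hL1 _) h6 (k N)
  rw [Real.exp_log hx, ← hCδ, mul_comm (1 / 3), mul_comm δ (Real.log x), ← Real.rpow_def_of_pos hx,
    ← Real.rpow_def_of_pos hx] at key
  exact key
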